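/- Fix β > 1/2 with β ∉ {3/2, 5/2, 7/2, …}, and let λ_N, C, A_r be as in the context. Then lim_{N→∞} (2π/λ_N) / R_N = 1, where R_N := (1/4) π^{−1/4} C^{1/4} A_0^{−1/2} e^{sec(πβ)} N^{−1/2 + 1/(4β)} · exp( (2 N^{1−1/(2β)}/√(πC)) ∑_{r=0}^{⌊β−1/2⌋} (−1)^r (A_r/C^r) N^{−r/β} ). -/

import Mathlib

open MeasureTheory Real Filter Topology Polynomial

/-- `C(β) = 4 (Γ(β)²/Γ(2β))^{1/β}`. -/
noncomputable def Ccoef (β : ℝ) : ℝ :=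
  4 * (Real.Gamma β ^ 2 / Real.Gamma (2 * β)) ^ (1 / β)

/-- `a_r = Γ(r+1/2)/((r+1/2) Γ(r+1))`. -/
noncomputable def aCoef (r : ℕ) : ℝ :=
  Real.Gamma ((r : ℝ) + 1/2) / (((r : ℝ) + 1/2) * Real.Gamma ((r : ℝ) + 1))

/-- `A_r = a_r + (Γ(1/2−β)/2) ∑_{s=0}^r (Γ(s−1/2)/Γ(s+1)) (1−β)_{r−s} / Γ(3/2−β+r−s)`. -/
noncomputable def ACoef (β : ℝ) (r : ℕ) : ℝ :=
  aCoef r + (Real.Gamma (1/2 - β) / 2) *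
    ∑ s ∈ Finset.range (r + 1),
      (Real.Gamma ((s : ℝ) - 1/2) / Real.Gamma ((s : ℝ) + 1)) *
        (ascPochhammer ℝ (r - s)).eval (1 - β) /
        Real.Gamma (3/2 - β + ((r - s : ℕ) : ℝ))

section
open Set (Ioo Ico Ioi Ioc Icc Iio Ici Iic uIcc uIoc)
local notation:max "jj" => Complex.I
local notation:max "qe" => Complex.exp
local notation:max "cis" x:max => Complex.exp (x*Complex.I)
local notation:max "cin" x:max => Complex.exp (-(x*Complex.I))
local notation:max "oo" => (0:ℝ)
local notation:max "rg" => Finset.range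
local notation:max "ql" => (by linarith)
local notation:max "qp" => (by positivity)
local notation:max "qn" => (by norm_num)
variable {a b x B β s v r z y y0 t c θ M τ A C ϑ ε m D σ Z ax δ η G κ u x' ω ω' X h Λ k γ q ρ l : ℝ}
local notation:max "qf" => (by fun_prop)
local notation:max "xc" x:max => ((x : ℝ) : ℂ)
local notation:max "Tt" f:max x:max => Tendsto f atTop (nhds x)
local notation:max "xm" x:max => (2*x-1)
local notation:max "xk" x:max => (2*x)
local notation:max "xh" x:max => (x/2)
local notation:max "xx" => (1/2)
local notation:75 x:76 "²" => x^2
local notation:max "qq" => mul_le_mul_of_nonneg_left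
local notation:max "qz" => measurableSet_Ioo
local notation:max "qj" => integral_Ioc_eq_integral_Ioo
local notation:max "qx" => ae_restrict_mem
local notation:max "qw" => intervalIntegral.integral_of_le
local notation:max "qv" => integral_const_mul
local notation:max "qu" => Complex.norm_real
local notation:max "qk" => norm_mul
local notation:max "qy" => norm_eq_abs
local notation:max "qg" => Eventually.of_forall
local notation:max "qb" => mul_le_mul_of_nonneg_right
local notation:max "qd" => norm_of_nonneg
local notation:max "qm" => intervalIntegrable_iff_integrableOn_Ioo_of_le
local notation:max "qr" => eventually_gt_atTop
local notation:max "qt" => abs_of_pos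
local notation:max "qs" => norm_ne_zero_iff
local notation:max "qh" => measurableSet_Ioi
local notation:max "qc" => div_le_iff₀
local notation:max "qi" => intervalIntegral.integral_add_adjacent_intervals
local notation:max "qo" => smul_eq_mul
local notation:max "zq" => abs_le
local notation:max "zj" => intervalIntegral.integral_const_mul
local notation:max "zx" => pi_pos.le
local notation:max "zw" => Complex.re_le_norm
local notation:max "zv" => log_le_log
local notation:max "zu" => le_rfl
local notation:max "zk" => norm_nonneg
local notation:max "zy" => Finset.sum_congr
local notation:max "zp" => pi_pos
local notation:max "zg" => Complex.exp_ofReal_mul_I_re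
local notation:max "zb" => mul_one
local notation:max "zd" => sq_nonneg
local notation:max "zf" => mul_le_of_le_one_right
local notation:max "zn" => exp_add
local notation:max "zm" => measurableSet_Ioc
local notation:max "zl" => lt_of_lt_of_le
local notation:max "zr" => abs_nonneg
local notation:max "zt" => le_div_iff₀
local notation:max "zs" => Complex.ofReal_re
local notation:max "zh" => Complex.exp_add
local notation:max "zc" => Complex.exp_ne_zero
local notation:max "ze" => sub_zero
local notation:max "za" => setIntegral_congr_fun
local notation:max "zi" => one_le_mul_of_one_le_of_one_le
local notation:max "zo" => mul_nonneg
local notation:max "xq" => lt_of_le_of_lt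
local notation:max "xz" => exp_pos
local notation:max "xj" => mul_pow
local notation:max "xw" => tendsto_const_nhds.div_atTop
local notation:max "xv" => setIntegral_indicator
local notation:max "xu" => nhdsWithin_le_nhds
local notation:max "xy" => intervalIntegral.integral_mono_on_of_le_Ioo
local notation:max "xp" => zero_le_one
local notation:max "xg" => sub_ne_zero
local notation:max "xd" => sqrt_eq_rpow
local notation:max "xf" => mul_le_mul
local notation:max "xn" => exp_log
local notation:max "xl" => div_le_one
local notation:max "xr" => intervalIntegral.integral_add
local notation:max "xt" => intervalIntegrable_iff_integrableOn_Ioc_of_le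
local notation:max "xs" => Set.mem_ofPred_eq
local notation:max "xe" => Complex.exp_nat_mul
local notation:max "xa" => tendsto_const_nhds.congr'
local notation:max "xi" => norm_pow
local notation:max "xo" => mul_zero
local notation:max "wq" => mul_ne_zero
local notation:max "wz" => Gamma_add_one
local notation:max "wj" => one_mul
local notation:max "wx" => mul_assoc
local notation:max "ww" => tendsto_add_atTop_iff_nat
local notation:max "wv" => setIntegral_mono_on
local notation:max "wu" => mul_div_assoc
local notation:max "wk" => monotone_nat_of_le_succ
local notation:max "wy" => intervalIntegral.integral_interval_sub_left
local notation:max "wp" => exp_le_exp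
local notation:max "wg" => div_le_div_iff₀
local notation:max "wd" => div_eq_mul_inv
local notation:max "wf" => Finset.mem_range
local notation:max "wn" => Finset.sum_add_distrib
local notation:max "wm" => Complex.sq_norm
local notation:max "wl" => Complex.I_sq
local notation:max "wr" => norm_div
local notation:max "ws" => log_mul
local notation:max "wh" => le_trans
local notation:max "we" => integral_sub
local notation:max "wo" => integral_add
local notation:max "vq" => Complex.norm_exp_ofReal_mul_I
local notation:max "vz" => pi_gt_three
local notation:max "vj" => norm_add_le
local notation:max "vx" => lt_of_le_of_ne
local notation:max "vw" => le_or_gt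
local notation:max "vv" => gt_mem_nhds
local notation:max "vu" => add_zero
local notation:max "vk" => Set.Ioo_subset_Ioo_right
local notation:max "vy" => Nat.cast_zero
local notation:max "vg" => Finset.mul_sum
local notation:max "vb" => zero_add
local notation:max "vd" => rpow_natCast
local notation:max "vf" => rpow_mul
local notation:max "vm" => neg_div
local notation:max "vl" => log_le_sub_one_of_pos
local notation:max "vr" => Complex.slitPlane_arg_ne_pi
local notation:max "vh" => Complex.add_re
local notation:max "vc" => pow_ne_zero
local notation:max "ve" => norm_sub_le
local notation:max "va" => mul_left_cancel₀
local notation:max "vi" => le_of_eq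
local notation:max "vo" => intervalIntegral.integral_sub
local notation:max "uq" => intervalIntegral.integral_congr
local notation:max "uz" => exp_nat_mul
local notation:max "uj" => div_pos
local notation:max "ux" => div_nonneg
local notation:max "uw" => div_lt_one
local notation:max "uv" => ae_restrict_of_ae
local notation:max "uu" => Complex.re_ofReal_mul
local notation:max "uk" => intervalIntegral.intervalIntegrable_rpow'
local notation:max "uy" => intervalIntegral.integral_mul_const
local notation:max "ug" => intervalIntegral.integral_mono_on
local notation:max "ub" => integrable_exp_neg_mul_sq
local notation:max "ud" => Complex.GammaSeq_tendsto_Gamma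
local notation:max "uf" => mul_comm
local notation:max "un" => integrable_inv_one_add_sq.const_mul
local notation:max "ul" => Measure.ae_ne
local notation:max "ur" => Complex.sub_re
local notation:max "ut" => Complex.ofReal_cos
local notation:max "us" => Complex.exp_conj
local notation:max "uh" => Complex.add_im
theorem Ft (β : ℝ) (r : ℕ) (hne : ∀ n : ℕ, β ≠ (n : ℝ) + xx) (m : ℕ) (hm : m ≤ r) :
    ∑ s ∈ rg (m + 1),
      (Gamma ((s : ℝ) - xx) / Gamma ((s : ℝ) + 1)) *
        (ascPochhammer ℝ (r - s)).eval (1 - β) /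
        Gamma (3/2 - β + ((r - s : ℕ) : ℝ)) =
      4 / (2*β - 2*r - 1) * (Gamma ((m:ℝ)+xx) / Gamma ((m:ℝ)+1)) *
        (ascPochhammer ℝ (r - m)).eval (1 - β) / Gamma (xx - β + ((r - m : ℕ) : ℝ)) := by
  have hg : ∀ k : ℕ, Gamma (xx - β + k) ≠ 0 := by
    intro k
    apply Gamma_ne_zero
    intro n h
    apply hne (k + n)
    push_cast; linarith
  have hz : ∀ k : ℕ, (xx - β + k : ℝ) ≠ 0 := by
    intro k h
    apply hne k; linarith
  have hrec : ∀ k : ℕ, Gamma (3/2 - β + k) = (xx - β + k) * Gamma (xx - β + k) := by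
    intro k
    rw [← wz (hz k)]; congr 1; ring
  have hr : (2*β - 2*r - 1 : ℝ) ≠ 0 := by
    intro h; apply hne r; linarith
  induction m with
  | zero =>
    have aa : Gamma (oo + xx) = (oo - xx) * Gamma (oo - xx) := by
      rw [← wz qn]; norm_num
    simp only [vb, Finset.sum_range_one, vy, Nat.sub_zero, hrec]
    rw [vb] at aa
    rw [aa, show (2*β - 2*r - 1 : ℝ) = -2*(xx - β + r) by ring]
    have ba := hg r
    have bi := hz r
    generalize Gamma (xx - β + r) = g at *
    generalize (xx - β + r : ℝ) = x at *
    generalize Gamma (0 - xx) = bx at *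
    field_simp
    ring
  | succ m ih =>
    rw [Finset.sum_range_succ, ih (by omega)]
    obtain ⟨k, hk⟩ : ∃ k, r = m + 1 + k := ⟨r - (m+1), by omega⟩
    have aj : r - m = k + 1 := by omega
    have ak : r - (m+1) = k := by omega
    rw [aj, ak, hrec, ascPochhammer_succ_eval]
    have aa : Gamma (((m+1:ℕ):ℝ) + xx) = ((m:ℝ) + xx) * Gamma ((m:ℝ) + xx) := by
      rw [← wz qp]; congr 1; push_cast; ring
    have ad : Gamma (((m+1:ℕ):ℝ) - xx) = Gamma ((m:ℝ) + xx) := by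
      congr 1; push_cast; ring
    have ag : Gamma (((m+1:ℕ):ℝ) + 1) = ((m:ℝ)+1) * Gamma ((m:ℝ)+1) := by
      rw [← wz qp]; congr 1; push_cast; ring
    have ar : Gamma (xx - β + ((k+1:ℕ):ℝ)) = (xx - β + k) * Gamma (xx - β + k) := by
      rw [← wz (hz k)]; congr 1; push_cast; ring
    rw [aa, ad, ag, ar]
    have := hg k
    have := hz k
    have li : ((m:ℝ)+1) ≠ 0 := qp
    have hgm : Gamma ((m:ℝ)+1) ≠ 0 := (Gamma_pos_of_pos qp).ne'
    have hr' : (2*β - 2*((m:ℝ)+1+k) - 1 : ℝ) ≠ 0 := by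
      rw [hk] at hr; push_cast at hr; exact hr
    subst hk
    push_cast
    rw [show (2*β - 2*((m:ℝ)+1+k) - 1 : ℝ) = -2*((xx - β + k) + m + 1) by ring] at hr' ⊢
    rw [show (1 - β + k : ℝ) = (xx - β + k) + xx by ring]
    have ba := hg k
    have bi := hz k
    generalize Gamma (xx - β + k) = g at *
    generalize (xx - β + k : ℝ) = x at *
    generalize Gamma ((m:ℝ) + xx) = bx at *
    generalize Gamma ((m:ℝ) + 1) = de at *
    have lj : x + m + 1 ≠ 0 := fun h => hr' (by rw [h]; ring)
    field_simp
    ring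
theorem Dw (β : ℝ) (r : ℕ) (hne : ∀ n : ℕ, β ≠ (n : ℝ) + xx) :
    ACoef β r = 2*β/(2*β - 2*r - 1) * aCoef r := by
  have hr : (2*β - 2*r - 1 : ℝ) ≠ 0 := by
    intro h; apply hne r; linarith
  have hg : Gamma (xx - β) ≠ 0 := by
    apply Gamma_ne_zero
    intro n h
    apply hne n; linarith
  rw [ACoef, Ft β r hne r zu, aCoef]
  have hgm : Gamma ((r:ℝ)+1) ≠ 0 := (Gamma_pos_of_pos qp).ne'
  have ad : ((r:ℝ)+xx) ≠ 0 := qp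
  simp only [Nat.sub_self, ascPochhammer_zero, eval_one, vy, vu]
  have e : (2*r+1:ℝ) ≠ 0 := qp
  generalize Gamma (xx - β) = g at *
  generalize Gamma ((r:ℝ) + xx) = bx at *
  generalize Gamma ((r:ℝ) + 1) = de at *
  obtain ⟨d, hd⟩ : ∃ d, d = 2*β - 2*r - 1 := ⟨_, rfl⟩
  rw [← hd] at hr ⊢
  rw [show 2 * β = d + 2*r + 1 by linarith]
  field_simp
  ring
theorem Dx (ha : 0 < a) (hb : 0 < b) :
    IntegrableOn (fun x : ℝ => x^(a-1) * (1-x)^(b-1)) (Ioo 0 1) ∧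
    ∫ x in Ioo oo 1, x^(a-1) * (1-x)^(b-1) = Gamma a * Gamma b / Gamma (a+b) := by
  have h := ProbabilityTheory.beta_eq_betaIntegralReal a b ha hb
  have hi := Complex.betaIntegral_convergent (u := a) (v := b) (by simpa) (by simpa)
  rw [qm xp] at hi
  have he : ∀ x ∈ Ioo oo 1, ((x:ℂ) ^ ((a:ℂ) - 1) * (1 - (x:ℂ)) ^ ((b:ℂ) - 1)) =
     xc (x^(a-1) * (1-x)^(b-1)) := by
    intro x hx
    push_cast
    rw [Complex.ofReal_cpow hx.1.le, Complex.ofReal_cpow (by linarith [hx.2])]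
    push_cast; rfl
  rw [integrableOn_congr_fun he qz] at hi
  have fx := hi.re
  simp only [RCLike.re_eq_complex_re, zs] at fx
  refine ⟨fx, ?_⟩
  rw [← ProbabilityTheory.beta.eq_1, h, Complex.betaIntegral, qw xp,
    ← qj, qj, qj,
    za qz he, integral_complex_ofReal, zs]
theorem Bx {f f' : ℝ → ℝ} {g h : ℝ → ℝ} {s t : Set ℝ} (hs : MeasurableSet s)
    (hst : f '' s = t) (hf : ∀ x ∈ s, HasDerivAt f (f' x) x) (hinj : Set.InjOn f s)
    (hpos : ∀ x ∈ s, 0 ≤ f' x) (hh : ∀ x ∈ s, f' x * g (f x) = h x) (hi : IntegrableOn h s) :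
    IntegrableOn g t ∧ ∫ x in t, g x = ∫ x in s, h x := by
  have e : ∀ x ∈ s, |f' x| • g (f x) = h x := by
    intro x hx; rw [abs_of_nonneg (hpos x hx), qo, hh x hx]
  rw [← hst]
  constructor
  · rw [integrableOn_image_iff_integrableOn_abs_deriv_smul hs
      (fun x hx => (hf x hx).hasDerivWithinAt) hinj, integrableOn_congr_fun e hs]
    exact hi
  · rw [integral_image_eq_integral_abs_deriv_smul hs (fun x hx => (hf x hx).hasDerivWithinAt) hinj,
      za hs e]
theorem Fu (ha : 0 < a) :
    IntegrableOn (fun r : ℝ => r^(a-1) * (1-r²)^(-xx:ℝ)) (Ioo 0 1) ∧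
    ∫ r in Ioo oo 1, r^(a-1) * (1-r²)^(-xx:ℝ) = xx * (Gamma xh a * √π / Gamma (a/2+xx)) := by
  obtain ⟨aa, ad⟩ := Dx (a := a/2) (b := xx) qp qn
  have bz := aa.const_mul xx
  have := Bx (f := fun x => √x) (f' := fun x => 1/(2*√x))
    (g := fun r : ℝ => r^(a-1) * (1-r²)^(-xx:ℝ)) (t := Ioo 0 1)
    (h := fun x => xx * (x^(a/2-1) * (1-x)^((xx:ℝ)-1)))
    (s := Ioo 0 1) qz ?_ ?_ ?_ ?_ ?_ bz
  · refine ⟨this.1, ?_⟩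
    rw [this.2, qv, ad, Gamma_one_half_eq]
  · ext y
    constructor
    · rintro ⟨x, hx, rfl⟩
      exact ⟨sqrt_pos.2 hx.1, by rw [sqrt_lt' one_pos]; simpa using hx.2⟩
    · intro hy
      refine ⟨y², ⟨by have := hy.1; positivity, by nlinarith [hy.1, hy.2]⟩, sqrt_sq hy.1.le⟩
  · intro x hx
    exact hasDerivAt_sqrt hx.1.ne'
  · intro x hx y hy h
    exact (sqrt_inj hx.1.le hy.1.le).1 h
  · intro x hx; positivity
  · intro x hx
    have ek := hx.1
    rw [sq_sqrt ek.le, xd, ← vf ek.le,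
      show a/2-1 = xx*(a-1) + (-xx:ℝ) by ring, rpow_add ek, rpow_neg ek.le]
    norm_num
    field_simp
theorem Fv (ha : 0 < a) (dg : a < 3) :
    IntegrableOn (fun r : ℝ => r^(a-1) * (1+r²)^(-(3/2):ℝ)) (Ioi 0) ∧
    ∫ r in Ioi oo, r^(a-1) * (1+r²)^(-(3/2):ℝ) =
      xx * (Gamma xh a * Gamma ((3-a)/2) / Gamma (3/2)) := by
  obtain ⟨aa, ad⟩ := Dx (a := a/2) (b := (3-a)/2) qp ql
  have bz := aa.const_mul xx
  have hlog : ∀ x ∈ Ioo oo 1, 0 < 1 - x := fun x hx => by linarith [hx.2]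
  have := Bx (f := fun x => exp ((log x - log (1-x))/2))
    (f' := fun x => exp ((log x - log (1-x))/2) * ((1/x - (-1)/(1-x))/2))
    (g := fun r : ℝ => r^(a-1) * (1+r²)^(-(3/2):ℝ)) (t := Ioi 0)
    (h := fun x => xx * (x^(a/2-1) * (1-x)^((3-a)/2-1)))
    (s := Ioo 0 1) qz ?_ ?_ ?_ ?_ ?_ bz
  · refine ⟨this.1, ?_⟩
    rw [this.2, qv, ad, show a/2 + (3-a)/2 = 3/2 by ring]
  · ext y
    constructor
    · rintro ⟨x, hx, rfl⟩
      exact xz _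
    · intro (hy : 0 < y)
      have e : 1 - y²/(1+y²) = 1/(1+y²) := by field_simp; ring
      refine ⟨y²/(1+y²), ⟨qp, ?_⟩, ?_⟩
      · rw [uw qp]; linarith
      · simp only [e]
        rw [← log_div qp qp]
        rw [show y²/(1+y²)/(1/(1+y²)) = y² by field_simp, log_pow]
        rw [show ((2:ℕ):ℝ) * log y / 2 = log y by push_cast; ring, xn hy]
  · intro x hx
    have ag : HasDerivAt (fun x : ℝ => 1 - x) (-1) x := by
      simpa using (hasDerivAt_id x).const_sub 1
    have := (((hasDerivAt_log hx.1.ne').sub (ag.log (hlog x hx).ne')).div_const 2).exp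
    simpa using this
  · intro x hx y hy h
    simp only [exp_eq_exp] at h
    rw [← log_div hx.1.ne' (hlog x hx).ne', ← log_div hy.1.ne' (hlog y hy).ne'] at h
    have h' : log (x/(1-x)) = log (y/(1-y)) := ql
    have := log_injOn_pos (uj hx.1 (hlog x hx)) (uj hy.1 (hlog y hy)) h'
    have ba := hlog x hx
    have bi := hlog y hy
    rw [div_eq_div_iff ba.ne' bi.ne'] at this
    linarith
  · intro x hx
    have := hlog x hx
    have dh := hx.1
    have : 0 ≤ (1/x - (-1)/(1-x)) := by rw [vm, sub_neg_eq_add]; positivity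
    positivity
  · intro x hx
    have ba := hlog x hx
    have dh := hx.1
    have cr : 1 + exp ((log x - log (1-x))/2)² = exp (- log (1-x)) := by
      rw [← uz, exp_neg, xn ba,
        show ((2:ℕ):ℝ) * ((log x - log (1-x))/2) = log x - log (1-x) by push_cast; ring, exp_sub,
        xn ba, xn dh]
      field_simp; ring
    have aj : (1/x - (-1)/(1-x)) = exp (-log x - log (1-x)) := by
      rw [exp_sub, exp_neg, xn ba, xn dh]; field_simp; ring
    rw [cr, aj, ← exp_mul, ← exp_mul, rpow_def_of_pos dh, rpow_def_of_pos ba,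
      ← zn, ← zn, ← wu, ← zn, div_mul_eq_mul_div, ← zn,
      wd, uf, one_div]
    congr 2; ring
noncomputable def Aw (k : ℕ) : ℝ := (-1)^k * Gamma (k + xx) / (√π * Gamma (k+1))
theorem Bz : Aw 0 = 1 := by
  have : √π ≠ 0 := qp
  simp only [Aw, vy, vb, pow_zero, wj, Gamma_one, zb, Gamma_one_half_eq]
  field_simp
theorem Cv (k : ℕ) : Aw (k+1) * (k+1) = -(k+xx) * Aw k := by
  have aa : Gamma (((k+1:ℕ):ℝ) + xx) = (k+xx) * Gamma ((k:ℝ)+xx) := by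
    rw [← wz qp]; push_cast; ring_nf
  have ad : Gamma (((k+1:ℕ):ℝ) + 1) = (k+1) * Gamma ((k:ℝ)+1) := by
    rw [← wz qp]; push_cast; ring_nf
  have ag : Gamma ((k:ℝ)+1) ≠ 0 := (Gamma_pos_of_pos qp).ne'
  have : √π ≠ 0 := qp
  rw [Aw, Aw, aa, ad]
  have : (k:ℝ)+1 ≠ 0 := qp
  generalize Gamma ((k:ℝ)+xx) = g at *
  field_simp
  ring
theorem Dy (a : ℝ) (k : ℕ) : Ring.choose a (k+1) * (k+1) = (a - k) * Ring.choose a k := by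
  have aa := Ring.descPochhammer_eq_factorial_smul_choose a (k+1)
  have ad := Ring.descPochhammer_eq_factorial_smul_choose a k
  rw [descPochhammer_succ_right, smeval_mul, ad] at aa
  simp only [nsmul_eq_mul, Nat.factorial_succ, Nat.cast_mul] at aa
  have ag : (Polynomial.smeval (X - (k : ℤ[X])) a : ℝ) = a - k := by
    rw [Polynomial.smeval_sub, Polynomial.smeval_X, ← Polynomial.C_eq_natCast, Polynomial.smeval_C]
    simp
  rw [ag] at aa
  have : ((k.factorial : ℕ) : ℝ) ≠ 0 := qp
  push_cast at aa
  apply va this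
  linarith
theorem Fw (k : ℕ) : Ring.choose (-xx : ℝ) k = Aw k := by
  induction k with
  | zero => simp [Bz]
  | succ k ih =>
    have aa := Dy (-xx) k
    have ad := Cv k
    rw [ih] at aa
    have : (k:ℝ)+1 ≠ 0 := qp
    apply mul_right_cancel₀ this
    rw [aa, ad]; ring
theorem Fx (k : ℕ) : Ring.choose (xx : ℝ) k * (1 - 2*k) = Aw k := by
  induction k with
  | zero => simp [Bz]
  | succ k ih =>
    have aa := Dy xx k
    have ad := Cv k
    rw [← ih] at ad
    have : (k:ℝ)+1 ≠ 0 := qp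
    apply mul_right_cancel₀ this
    rw [ad]; push_cast; linear_combination (-(1+2*k:ℝ)) * aa
theorem Dz (a : ℝ) (n : ℕ) :
    (fun x : ℝ => (1+x)^a - ∑ k ∈ rg n, Ring.choose a k * x^k) =O[𝓝 0] fun x => x^n := by
  have := (one_add_rpow_hasFPowerSeriesAt_zero (a := a)).isBigO_sub_partialSum_pow n
  simp only [vb] at this
  refine (this.congr_left ?_).trans (Asymptotics.IsBigO.of_bound 1 ?_)
  · intro x
    simp only [FormalMultilinearSeries.partialSum]
    congr 1
    refine zy rfl fun k _ => ?_
    rw [binomialSeries_apply]; simp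
  · filter_upwards with x
    simp
theorem Ea (n : ℕ) :
    (fun x : ℝ => (√(1+x²))⁻¹ - ∑ k ∈ rg n, Aw k * x^(2*k)) =O[𝓝 0] fun x => x^(2*n) := by
  have h := Dz (-xx) n
  have ht : Tendsto (fun x : ℝ => x²) (𝓝 0) (𝓝 0) := by
    have := (continuous_pow 2).tendsto oo; simpa using this
  have := h.comp_tendsto ht
  refine this.congr ?_ ?_
  · intro x
    simp only [Function.comp, Fw, ← pow_mul]
    rw [rpow_neg qp, ← xd]
  · intro x; simp [← pow_mul]
theorem Fy (n : ℕ) :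
    (fun x : ℝ => arsinh x - ∑ k ∈ rg n, Aw k / (2*k+1) * x^(2*k+1))
      =O[𝓝 0] fun x => x^(2*n+1) := by
  obtain ⟨C, hC⟩ := (Ea n).bound
  rw [Metric.eventually_nhds_iff] at hC
  obtain ⟨ε, hε, hC⟩ := hC
  refine Asymptotics.IsBigO.of_bound C ?_
  rw [Metric.eventually_nhds_iff]
  refine ⟨ε, hε, fun x hx => ?_⟩
  have fy : 0 ≤ C ∨ x = 0 := by
    by_cases h : x = 0
    · exact Or.inr h
    · left
      have := (zk _).trans (hC hx)
      by_contra hc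
      push Not at hc
      have ad : 0 < ‖x^(2*n)‖ := norm_pos_iff.2 (vc _ h)
      nlinarith
  rcases fy with fy | rfl
  swap
  · simp
  let g : ℝ → ℝ := fun x => arsinh x - ∑ k ∈ rg n, Aw k / (2*k+1) * x^(2*k+1)
  have hd : ∀ t : ℝ, HasDerivAt g ((√(1+t²))⁻¹ - ∑ k ∈ rg n, Aw k * t^(2*k)) t := by
    intro t
    refine (hasDerivAt_arsinh t).sub ?_
    refine HasDerivAt.fun_sum fun k _ => ?_
    have := (hasDerivAt_pow (2*k+1) t).const_mul (Aw k / (2*k+1))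
    refine this.congr_deriv ?_
    have : (2*k+1:ℝ) ≠ 0 := qp
    push_cast
    field_simp
    try simp
  have := (convex_uIcc 0 x).norm_image_sub_le_of_norm_hasDerivWithin_le (f := g)
    (C := C * ‖x^(2*n)‖) (fun t _ => (hd t).hasDerivWithinAt) (fun t ht => ?_) Set.left_mem_uIcc
    Set.right_mem_uIcc
  · have bx : g 0 = 0 := by simp [g]
    rw [bx, ze, ze] at this
    refine this.trans (vi ?_)
    rw [pow_succ x, qk, wx]
  · have ht' : |t| ≤ |x| := by
      have := Set.abs_sub_left_of_mem_uIcc ht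
      simpa using this
    have aa : dist t 0 < ε := by
      rw [dist_zero_right] at hx ⊢; exact xq ht' hx
    refine (hC aa).trans ?_
    gcongr
    rw [xi, xi]
    gcongr
    exact ht'
theorem Cw {f : ℝ → ℝ} {n : ℕ} (hf : f =O[𝓝 0] fun x => x^n) (ha : a < n) :
    Tt (fun B : ℝ => B^a * f (1/B)) 0 := by
  have ah : Tt (fun B : ℝ => 1/B) 0 := by
    simpa using tendsto_inv_atTop_zero
  have aa := (Asymptotics.isBigO_refl (fun B : ℝ => B^a) atTop).mul (hf.comp_tendsto ah)
  refine aa.trans_tendsto ?_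
  have ad := tendsto_rpow_neg_atTop (y := n - a) ql
  refine ad.congr' ?_
  filter_upwards [qr 0] with B hB
  simp only [Function.comp]
  rw [one_div, inv_pow, ← vd, ← rpow_neg hB.le, ← rpow_add hB]
  congr 1; ring
noncomputable def Bg (a B : ℝ) : ℝ := ∫ r in oo..B, r^(a-1) * (√(1+r²))⁻¹
noncomputable def Az (a B : ℝ) : ℝ := ∫ r in oo..B, r^(a-1) * arsinh (1/r)
theorem Bu (hx : 0 ≤ x) : arsinh x ≤ x := by
  rw [← sinh_le_sinh, sinh_arsinh]; exact self_le_sinh_iff.2 hx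
theorem Bh (a B : ℝ) (ha : 1 < a) :
    IntervalIntegrable (fun r : ℝ => r^(a-1) * (√(1+r²))⁻¹) volume 0 B := by
  apply Continuous.intervalIntegrable
  refine (continuous_id.rpow_const (fun _ => Or.inr ql)).mul (Continuous.inv₀ qf ?_)
  intro r; positivity
theorem Eb (a B : ℝ) (ha : 1 < a) (hB : 0 < B) :
    IntervalIntegrable (fun r : ℝ => r^(a-1) * arsinh (1/r)) volume 0 B := by
  have aa : IntervalIntegrable (fun r : ℝ => r^(a-2)) volume 0 B :=
    uk ql
  refine aa.mono_fun' ?_ ?_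
  · apply Measurable.aestronglyMeasurable
    exact (measurable_id.pow_const _).mul (continuous_arsinh.measurable.comp (measurable_const.div measurable_id))
  · rw [Set.uIoc_of_le hB.le]
    filter_upwards [self_mem_ae_restrict zm] with r hr
    have bv := hr.1
    have ad : 0 ≤ arsinh (1/r) := arsinh_nonneg_iff.2 qp
    rw [qk, qd ad, qd qp]
    calc r^(a-1) * arsinh (1/r) ≤ r^(a-1) * (1/r) := by
          gcongr; exact Bu qp
      _ = r^(a-2) := by
          rw [show a - 1 = (a-2)+1 by ring, rpow_add bv, rpow_one]; field_simp
theorem Fz (a B : ℝ) (ha : 1 < a) (hB : 0 < B) :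
    B^a * √(1+B²) = a * Bg a B + (a+1) * Bg (a+2) B := by
  have h := intervalIntegral.integral_eq_sub_of_hasDerivAt_of_le (f := fun r : ℝ => r^a * √(1+r²))
    (f' := fun r => a * (r^(a-1) * (√(1+r²))⁻¹) + (a+1) * (r^(a+2-1) * (√(1+r²))⁻¹)) hB.le ?_ ?_ ?_
  · rw [xr ((Bh a B ha).const_mul _) ((Bh (a+2) B ql).const_mul _),
      zj, zj] at h
    rw [Bg, Bg, h, zero_rpow ql]; ring
  · exact ((continuous_id.rpow_const (fun _ => Or.inr ql)).mul qf).continuousOn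
  · intro r hr
    have bv := hr.1
    have aa := hasDerivAt_rpow_const (x := r) (p := a) (Or.inl bv.ne')
    have ad : HasDerivAt (fun r : ℝ => √(1+r²)) (2*r/(2*√(1+r²))) r := by
      apply HasDerivAt.sqrt _ qp
      simpa using (hasDerivAt_pow 2 r).const_add 1
    refine (aa.mul ad).congr_deriv ?_
    have ag : √(1+r²) ≠ 0 := qp
    have ar : √(1+r²)² = 1+r² := sq_sqrt qp
    rw [show a + 2 - 1 = (a-1) + 2 by ring, rpow_add bv (a-1), show r^a = r^((a-1)+1) by ring_nf,
      rpow_add bv, rpow_one, rpow_two]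
    field_simp
    rw [ar]; ring
  · exact ((Bh a B ha).const_mul _).add ((Bh (a+2) B ql).const_mul _)
theorem Ga (a B : ℝ) (ha : 1 < a) (hB : 0 < B) :
    B^a * (√(1+B²))⁻¹ = (a-1) * Bg a B + ∫ r in oo..B, r^(a-1) * (1+r²)^(-(3/2):ℝ) := by
  have hi : IntervalIntegrable (fun r : ℝ => r^(a-1) * (1+r²)^(-(3/2):ℝ)) volume 0 B := by
    apply Continuous.intervalIntegrable
    refine (continuous_id.rpow_const (fun _ => Or.inr ql)).mul ?_
    refine Continuous.rpow_const qf (fun r => Or.inl qp)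
  have h := intervalIntegral.integral_eq_sub_of_hasDerivAt_of_le (f := fun r : ℝ => r^a * (√(1+r²))⁻¹)
    (f' := fun r => (a-1) * (r^(a-1) * (√(1+r²))⁻¹) + (r^(a-1) * (1+r²)^(-(3/2):ℝ))) hB.le ?_ ?_ ?_
  · rw [xr ((Bh a B ha).const_mul _) hi,
      zj] at h
    rw [Bg, h, zero_rpow ql]; ring
  · refine ((continuous_id.rpow_const (fun _ => Or.inr ql)).mul (Continuous.inv₀ qf ?_)).continuousOn
    intro r; positivity
  · intro r hr
    have bv := hr.1
    have aa := hasDerivAt_rpow_const (x := r) (p := a) (Or.inl bv.ne')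
    have ad : HasDerivAt (fun r : ℝ => √(1+r²)) (2*r/(2*√(1+r²))) r := by
      apply HasDerivAt.sqrt _ qp
      simpa using (hasDerivAt_pow 2 r).const_add 1
    refine (aa.mul (ad.inv qp)).congr_deriv ?_
    have ag : √(1+r²) ≠ 0 := qp
    have ar : √(1+r²)² = 1+r² := sq_sqrt qp
    have ba : (1+r²)^(-(3/2):ℝ) = (√(1+r²))⁻¹ * (1+r²)⁻¹ := by
      rw [show (-(3/2):ℝ) = -xx + -1 by ring, rpow_add qp,
        rpow_neg qp, rpow_neg_one, xd]
    rw [ba, show r^a = r^((a-1)+1) by ring_nf,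
      rpow_add bv, rpow_one, ar]
    simp only [Pi.inv_apply]
    field_simp
    ring
  · exact ((Bh a B ha).const_mul _).add hi
theorem Gb (a B : ℝ) (ha : 1 < a) (hB : 0 < B) :
    a * Az a B = B^a * arsinh (1/B) + Bg a B := by
  have h := intervalIntegral.integral_eq_sub_of_hasDerivAt_of_le (f := fun r : ℝ => r^a * arsinh (1/r))
    (f' := fun r => a * (r^(a-1) * arsinh (1/r)) - (r^(a-1) * (√(1+r²))⁻¹)) hB.le ?_ ?_ ?_
  · rw [vo ((Eb a B ha hB).const_mul _) (Bh a B ha),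
      zj] at h
    rw [Az, Bg]
    simp only [zero_rpow (show a ≠ 0 by linarith), zero_mul, ze] at h
    linarith
  · intro r hr
    rcases eq_or_lt_of_le hr.1 with ah | ah
    · subst ah
      refine ContinuousAt.continuousWithinAt ?_
      have : Tendsto (fun r : ℝ => |r|^(a-1)) (𝓝 0) (𝓝 0) := by
        have := (continuous_abs.rpow_const (p := a-1) (fun _ => Or.inr ql)).tendsto oo
        simpa [zero_rpow (show a - 1 ≠ 0 by linarith)] using this
      rw [ContinuousAt, zero_rpow ql, zero_mul]
      refine squeeze_zero_norm (fun r => ?_) this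
      by_cases hr : r = 0
      · simp [hr, zero_rpow (show a - 1 ≠ 0 by linarith)]
      have hp : 0 < |r| := abs_pos.2 hr
      rw [qk]
      have aj : ‖r^a‖ ≤ |r|^a := abs_rpow_le_abs_rpow r a
      have ak : ‖arsinh (1/r)‖ ≤ 1/|r| := by
        rw [← abs_one, ← abs_div, abs_one]
        rcases abs_cases (1/r) with ⟨h, h'⟩ | ⟨h, h'⟩
        · rw [h, qd (arsinh_nonneg_iff.2 h')]; exact Bu h'
        · rw [h, ← norm_neg, ← arsinh_neg, qd (arsinh_nonneg_iff.2 ql)]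
          exact Bu ql
      calc ‖r^a‖ * ‖arsinh (1/r)‖ ≤ |r|^a * (1/|r|) := by gcongr
        _ = |r|^(a-1) := by rw [rpow_sub hp, rpow_one]; ring
    · refine ContinuousAt.continuousWithinAt ?_
      refine ContinuousAt.mul (continuousAt_id.rpow_const (Or.inl ah.ne')) ?_
      exact (continuousAt_const.div continuousAt_id ah.ne').arsinh
  · intro r hr
    have bv := hr.1
    have aa := hasDerivAt_rpow_const (x := r) (p := a) (Or.inl bv.ne')
    have ad : HasDerivAt (fun r : ℝ => 1/r) (-(r²)⁻¹) r := by
      simpa using hasDerivAt_inv bv.ne'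
    refine (aa.mul ad.arsinh).congr_deriv ?_
    have ag : √(1+r²) ≠ 0 := qp
    have ar : √(1+(1/r)²) = √(1+r²)/r := by
      rw [show 1 + (1/r)² = (1+r²)/r² by field_simp; ring, sqrt_div qp, sqrt_sq bv.le]
    rw [ar, show r^a = r^((a-1)+1) by ring_nf, rpow_add bv, rpow_one]
    simp only [qo]
    field_simp
    ring
  · exact ((Eb a B ha hB).const_mul _).sub (Bh a B ha)
theorem Gc (n : ℕ) :
    (fun x : ℝ => √(1+x²) - ∑ k ∈ rg n, Ring.choose (xx:ℝ) k * x^(2*k)) =O[𝓝 0] fun x => x^(2*n) := by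
  have h := Dz xx n
  have ht : Tendsto (fun x : ℝ => x²) (𝓝 0) (𝓝 0) := by
    have := (continuous_pow 2).tendsto oo; simpa using this
  have := h.comp_tendsto ht
  refine this.congr ?_ ?_
  · intro x
    simp only [Function.comp, ← pow_mul]
    rw [← xd]
  · intro x; simp [← pow_mul]
theorem Ec (hB : 0 < B) : √(1+B²) = B * √(1+(1/B)²) := by
  rw [show 1 + B² = B² * (1 + (1/B)²) by field_simp; ring, sqrt_mul qp, sqrt_sq hB.le]
theorem Ed (hB : 0 < B) (a : ℝ) (m : ℕ) : B^a * (1/B)^m = B^(a-m) := by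
  rw [rpow_sub hB, vd, one_div, inv_pow]; rfl
theorem Gd (R : ℕ) : ∀ a : ℝ, 2*R+1 < a → a < 2*R+3 →
    Tendsto (fun B : ℝ => Bg a B - ∑ k ∈ rg (R+1), Aw k * B^(a-2*k-1) / (a-2*k-1)) atTop
      (𝓝 (Gamma xh a * Gamma ((1-a)/2) / (2*√π))) := by
  induction R with
  | zero =>
    intro a ha dg
    simp only [vy, xo, vb] at ha dg
    obtain ⟨hi, hv⟩ := Fv (a := a) ql dg
    have aa := intervalIntegral_tendsto_integral_Ioi oo hi tendsto_id
    have ad := Cw (a := a - 1) (Ea 1) (by push_cast; linarith)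
    have ag := (ad.sub aa).div_const (a-1)
    rw [hv] at ag
    have hc : (0 - xx * (Gamma xh a * Gamma ((3 - a) / 2) / Gamma (3 / 2))) / (a - 1) =
        Gamma xh a * Gamma ((1-a)/2) / (2*√π) := by
      have aj : Gamma ((3-a)/2) = ((1-a)/2) * Gamma ((1-a)/2) := by
        rw [← wz ql]; congr 1; ring
      have ak : Gamma (3/2) = xx * √π := by
        rw [show (3/2:ℝ) = xx+1 by norm_num, wz qn, Gamma_one_half_eq]
      have : a - 1 ≠ 0 := ql
      have : √π ≠ 0 := qp
      rw [aj, ak]; field_simp; ring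
    rw [hc] at ag
    refine ag.congr' ?_
    filter_upwards [qr 0] with B hB
    have ar := Ga a B ha hB
    have ba : a - 1 ≠ 0 := ql
    have bi : B^a * (√(1+B²))⁻¹ = B^(a-1) * (√(1+(1/B)²))⁻¹ := by
      rw [Ec hB, rpow_sub hB, rpow_one, mul_inv]; field_simp
    rw [bi] at ar
    simp only [Finset.range_one, Finset.sum_singleton, Bz, xo, pow_zero, id, vb, vy, ze, zb, wj]
    rw [div_eq_iff ba, sub_mul, div_mul_cancel₀ _ ba, mul_sub]
    linarith
  | succ R ih =>
    intro a' ha dg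
    obtain ⟨a, rfl⟩ : ∃ a, a' = a + 2 := ⟨a' - 2, by ring⟩
    push_cast at ha dg
    have ez : 1 < a := by have : oo ≤ R := qp; linarith
    have aa := ih a ql ql
    have ad := Cw (a := a+1) (Gc (R+2)) (by push_cast; linarith)
    have ag := ((ad.sub (aa.const_mul a))).div_const (a+1)
    have hc : (0 - a * (Gamma xh a * Gamma ((1 - a) / 2) / (2 * √π))) / (a + 1) =
        Gamma ((a+2)/2) * Gamma ((1-(a+2))/2) / (2*√π) := by
      have aj : Gamma ((a+2)/2) = xh a * Gamma xh a := by
        rw [← wz ql]; congr 1; ring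
      have ak : Gamma ((1-a)/2) = ((1-(a+2))/2) * Gamma ((1-(a+2))/2) := by
        rw [← wz ql]; congr 1; ring
      have : a + 1 ≠ 0 := ql
      have : √π ≠ 0 := qp
      rw [aj, ak]; field_simp; ring
    rw [hc] at ag
    refine ag.congr' ?_
    filter_upwards [qr 0] with B hB
    have ar := Fz a B ez hB
    have ba : a + 1 ≠ 0 := ql
    have bi : B^a * √(1+B²) = B^(a+1) * √(1+(1/B)²) := by
      rw [Ec hB, rpow_add hB, rpow_one]; ring
    rw [bi] at ar
    rw [mul_sub, mul_sub, ar, div_eq_iff ba, sub_mul]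
    have key : B^(a+1) * ∑ k ∈ rg (R+2), Ring.choose (xx:ℝ) k * (1/B)^(2*k) =
       a * ∑ k ∈ rg (R+1), Aw k * B^(a-2*k-1) / (a-2*k-1) +
       (∑ k ∈ rg (R+1+1), Aw k * B^(a+2-2*k-1) / (a+2-2*k-1)) * (a+1) := by
      rw [Finset.sum_range_succ' (n := R+1), Finset.sum_range_succ' (n := R+1)]
      simp only [vy, xo, pow_zero, Bz, Ring.choose_zero_right, ze, zb]
      rw [add_mul, mul_add, vg, vg, Finset.sum_mul, ← add_assoc, ← wn]
      congr 1
      · refine zy rfl fun k hk => ?_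
        have hk' : (k:ℝ) ≤ R := by
          have := (wf).1 hk; exact_mod_cast Nat.lt_succ_iff.1 this
        have dr : a - 2*k - 1 ≠ 0 := ql
        have bn := Fx (k+1)
        have cl := Cv k
        have eB : B^(a+1) * (1/B)^(2*(k+1)) = B^(a-2*k-1) := by
          rw [Ed hB]; congr 1; push_cast; ring
        push_cast at bn ⊢
        rw [show a + 2 - 2*((k:ℝ)+1) - 1 = a - 2*k - 1 by ring, ← wx, uf (B^(a+1)), wx, eB]
        have bs : (k:ℝ)+1 ≠ 0 := qp
        have co : (1 - 2*((k:ℝ)+1)) ≠ 0 := by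
          have : oo ≤ k := qp
          linarith
        have iu : Aw (k+1) = -(k+xx) * Aw k / (k+1) := by rw [← cl]; field_simp
        have ix : Ring.choose (xx:ℝ) (k+1) = Aw (k+1) / (1 - 2*((k:ℝ)+1)) := by rw [← bn]; field_simp
        have iy : (1 - 2*((k:ℝ)+1)) = -2 * (k+xx) := by ring
        have iz : (k:ℝ) + xx ≠ 0 := qp
        rw [ix, iu, iy]
        obtain ⟨d, hd⟩ : ∃ d, d = a - 2*k - 1 := ⟨_, rfl⟩
        rw [← hd] at dr ⊢
        have hA : a = d + 2 * (k+xx) := ql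
        have fz : (k:ℝ) + 1 = (k+xx) + xx := by ring
        rw [fz] at bs
        rw [hA, fz]
        clear * - bs iz dr
        generalize (k:ℝ) + xx = y at *
        generalize B^d = P at *
        obtain ⟨q, hq⟩ : ∃ q, q = y + xx := ⟨_, rfl⟩
        rw [← hq] at bs ⊢
        field_simp
        rw [hq]
        ring
      · rw [show a + 2 - 1 = a + 1 by ring]; field_simp
    rw [key]; ring
theorem Ge (R : ℕ) (a : ℝ) (ha : 2*R+1 < a) (dg : a < 2*R+3) :
    Tendsto (fun B : ℝ => Az a B - ∑ k ∈ rg (R+1), Aw k * B^(a-2*k-1) / ((2*k+1)*(a-2*k-1))) atTop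
      (𝓝 (Gamma xh a * Gamma ((1-a)/2) / (2*√π) / a)) := by
  have ez : 1 < a := by have : oo ≤ R := qp; linarith
  have aa := Gd R a ha dg
  have ad := Cw (a := a) (Fy (R+1)) (by push_cast; linarith)
  have ag := (ad.add aa).div_const a
  rw [vb] at ag
  refine ag.congr' ?_
  filter_upwards [qr 0] with B hB
  have ar := Gb a B ez hB
  rw [div_eq_iff ql, sub_mul, uf (Az a B), ar, mul_sub, vg, Finset.sum_mul]
  have : ∀ x y z u w : ℝ, z + u = w → x - z + (y - u) = x + y - w := by intros; linarith
  apply this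
  rw [← wn]
  refine zy rfl fun k hk => ?_
  have hk' : (k:ℝ) ≤ R := by
    have := (wf).1 hk; exact_mod_cast Nat.lt_succ_iff.1 this
  have dr : a - 2*k - 1 ≠ 0 := ql
  have ea : (2*k+1:ℝ) ≠ 0 := qp
  have eB : B^a * (1/B)^(2*k+1) = B^(a-2*k-1) := by
    rw [Ed hB]; congr 1; push_cast; ring
  rw [← wx, uf (B^a), wx, eB]
  obtain ⟨d, hd⟩ : ∃ d, d = a - 2*k - 1 := ⟨_, rfl⟩
  rw [← hd] at dr ⊢
  rw [show a = d + 2*k + 1 by linarith]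
  field_simp
  ring
noncomputable def Af (β : ℝ) : ℝ := 2*β*Gamma (β+xx) / (√π * Gamma β)
noncomputable def Ak (β : ℝ) (N : ℕ) : ℝ := √(Ccoef β) * (N:ℝ)^(1/xk β)
noncomputable def Ad (β B : ℝ) : ℝ := Af β * B^xm β / xm β
theorem Ca (hβ : xx < β) : 0 < Ccoef β := by
  have aa : 0 < Gamma β := Gamma_pos_of_pos ql
  have ad : 0 < Gamma xk β := Gamma_pos_of_pos ql
  rw [Ccoef]; positivity
theorem Bo (hβ : xx < β) : 0 < Af β := by
  have aa : 0 < Gamma β := Gamma_pos_of_pos ql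
  have ad : 0 < Gamma (β+xx) := Gamma_pos_of_pos ql
  have ag : 0 < β := ql
  rw [Af]; positivity
theorem Ef (hβ : xx < β) : Af β * Ccoef β ^ β = 4*β := by
  have aa : 0 < Gamma β := Gamma_pos_of_pos ql
  have ad : 0 < Gamma xk β := Gamma_pos_of_pos ql
  have ag := Gamma_mul_Gamma_add_half β
  have ah : β ≠ 0 := ql
  have ar : Ccoef β ^ β = 4^β * (Gamma β² / Gamma xk β) := by
    rw [Ccoef, mul_rpow qn qp, ← vf qp, one_div,
      inv_mul_cancel₀ ah, rpow_one]
  have ba : (2:ℝ)^(1-2*β) * 4^β = 2 := by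
    rw [show (4:ℝ) = 2^(2:ℝ) by norm_num, ← vf qn, ← rpow_add qn]
    simp
  rw [ar, Af]
  have : √π ≠ 0 := qp
  have bi : Gamma β * Gamma (β+xx) * 4^β = Gamma xk β * √π * 2 := by
    rw [ag]; linear_combination (Gamma xk β * √π) * ba
  generalize Gamma (β+xx) = g at *
  field_simp
  linear_combination 2*bi
theorem Bv (hβ : xx < β) {N : ℕ} (hN : 0 < N) : 0 < Ak β N := by
  have := Ca hβ
  have : oo < N := by exact_mod_cast hN
  rw [Ak]; positivity
theorem Eg (hβ : xx < β) {N : ℕ} (hN : 0 < N) (s : ℝ) :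
    Ak β N ^ s = Ccoef β ^ xh s * (N:ℝ)^(s/xk β) := by
  have aa := Ca hβ
  have ad : oo < N := by exact_mod_cast hN
  rw [Ak, mul_rpow qp qp, xd, ← vf aa.le,
    ← vf ad.le]
  congr 2 <;> ring
theorem Cx (hβ : xx < β) {N : ℕ} (hN : 0 < N) : Af β * Ak β N ^ xk β = 4*β*N := by
  have ah : β ≠ 0 := ql
  rw [Eg hβ hN, show 2*β/2 = β by ring, show 2*β/xk β = 1 by field_simp, rpow_one, ← wx, Ef hβ]
theorem Ck (hβ : xx < β) : Tendsto (Ak β) atTop atTop := by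
  have aa := Ca hβ
  have ad : 0 < β := ql
  exact ((tendsto_rpow_atTop qp).comp tendsto_natCast_atTop_atTop).const_mul_atTop qp
theorem Eh (hβ : xx < β) (hne : ∀ n : ℕ, β ≠ n + xx) {N : ℕ} (hN : 0 < N) (r : ℕ) :
    2 * Af β * (Aw r * Ak β N ^ (2*β-2*r-1) / ((2*r+1)*(2*β-2*r-1))) =
    (2 * (N : ℝ) ^ (1 - 1 / xk β) / sqrt (π * Ccoef β)) *
      ((-1 : ℝ) ^ r * (ACoef β r / Ccoef β ^ r) * (N : ℝ) ^ (-(r : ℝ) / β)) := by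
  have aa := Ca hβ
  have ad : oo < N := by exact_mod_cast hN
  have ah : β ≠ 0 := ql
  have hd : 2*β-2*r-1 ≠ 0 := fun h => hne r ql
  have hG : Gamma ((r:ℝ)+1) ≠ 0 := (Gamma_pos_of_pos qp).ne'
  have aj : Ak β N ^ (2*β-2*r-1) = Ccoef β ^ β / Ccoef β ^ r / √(Ccoef β) * ((N : ℝ) ^ (1 - 1 / xk β) * (N : ℝ) ^ (-(r : ℝ) / β)) := by
    rw [Eg hβ hN, ← vd, xd, ← rpow_sub aa, ← rpow_sub aa, ← rpow_add ad]
    congr 2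
    · ring
    · field_simp; ring
  have ak := Ef hβ
  rw [aj, Dw β r hne, sqrt_mul zx, Aw, aCoef]
  have be : Af β = 4*β / Ccoef β ^ β := by rw [← ak]; field_simp
  rw [be]
  have : √π ≠ 0 := qp
  have : (2*(r:ℝ)+1) ≠ 0 := qp
  have : ((r:ℝ)+xx) = (2*(r:ℝ)+1)/2 := by ring
  rw [show Gamma ((r:ℝ)+xx) / (((r:ℝ)+xx) * Gamma ((r:ℝ)+1)) = 2 * Gamma ((r:ℝ)+xx) / ((2*r+1) * Gamma ((r:ℝ)+1)) by
    rw [this]; generalize Gamma ((2*(r:ℝ)+1)/2) = g; field_simp]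
  generalize Gamma ((r:ℝ)+xx) = g
  generalize (N : ℝ) ^ (1 - 1 / xk β) = lk
  generalize (N : ℝ) ^ (-(r : ℝ) / β) = ll
  field_simp
  ring
theorem Gf (hβ : xx < β) :
    2 * Af β * (Gamma (2*β/2) * Gamma ((1-2*β)/2) / (2*√π) / xk β) = 1 / cos (π*β) := by
  have aa : Gamma β ≠ 0 := (Gamma_pos_of_pos ql).ne'
  have ah : β ≠ 0 := ql
  have h := Gamma_mul_Gamma_one_sub (β+xx)
  rw [show π*(β+xx) = π*β + π/2 by ring, sin_add_pi_div_two, show 1-(β+xx) = (1-2*β)/2 by ring] at h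
  have : √π ≠ 0 := qp
  have ag : √π² = π := sq_sqrt zx
  rw [show 2*β/2 = β by ring, Af]
  have : 1/cos (π*β) = Gamma (β+xx) * Gamma ((1-2*β)/2) / √π² := by rw [h, ag]; field_simp
  rw [this]
  generalize Gamma (β+xx) = de
  generalize Gamma ((1-2*β)/2) = el
  field_simp
theorem Gg (hβ : xx < β) (hne : ∀ n : ℕ, β ≠ n + xx) {N : ℕ} (hN : 0 < N) :
    1 / (4 * √(π * Ad β (Ak β N))) = (1/4) * π ^ (-(1/4) : ℝ) * Ccoef β ^ ((1/4) : ℝ) *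
          ACoef β 0 ^ (-xx : ℝ) * (N : ℝ) ^ (-xx + 1 / (4 * β)) := by
  have aa := Ca hβ
  have ad : oo < N := by exact_mod_cast hN
  have ah : 0 < β := ql
  have ht := Eh hβ hne hN 0
  have hA : 0 < ACoef β 0 := by
    have e := Dw β 0 hne
    have : 0 < 2*β-1 := ql
    have : 0 < aCoef 0 := by
      have := Gamma_pos_of_pos (s := oo+xx) qn
      have := Gamma_pos_of_pos (s := oo+1) qn
      rw [aCoef]; push_cast; positivity
    rw [e]; simp only [vy, xo, ze]; positivity
  simp only [Bz, vy, xo, ze, vb, wj, pow_zero, div_one, neg_zero, zero_div,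
    rpow_zero, zb] at ht
  have hL : Ad β (Ak β N) = π^(-xx:ℝ) * Ccoef β^(-xx:ℝ) * ACoef β 0 * (N : ℝ) ^ (1 - 1 / xk β) := by
    rw [Ad, wu]
    have : √(π * Ccoef β) = π^(xx:ℝ) * Ccoef β^(xx:ℝ) := by rw [sqrt_mul zx, xd, xd]
    rw [this] at ht
    rw [rpow_neg zx, rpow_neg aa.le]
    have : π^(xx:ℝ) ≠ 0 := qp
    have : Ccoef β^(xx:ℝ) ≠ 0 := qp
    rw [wx] at ht
    have := va (two_ne_zero) (ht.trans (by ring : _ = 2 * ((N : ℝ) ^ (1 - 1 / xk β) / (π^(xx:ℝ) * Ccoef β^(xx:ℝ)) * ACoef β 0)))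
    rw [this]; field_simp
  rw [hL, one_div, mul_inv, xd, ← rpow_neg qp]
  have : π * (π^(-xx:ℝ) * Ccoef β^(-xx:ℝ) * ACoef β 0 * (N : ℝ) ^ (1 - 1 / xk β)) =
     π^(xx:ℝ) * Ccoef β^(-xx:ℝ) * ACoef β 0 * (N : ℝ) ^ (1 - 1 / xk β) := by
    have : π^(xx:ℝ) = π * π^(-xx:ℝ) := by
      rw [← rpow_one_add' zx qn]; norm_num
    rw [this]; ring
  rw [this, mul_rpow qp qp, mul_rpow qp qp,
    mul_rpow qp qp, ← vf zx, ← vf aa.le, ← vf ad.le,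
    show (1 - 1/xk β) * (-xx) = -xx + 1/(4*β) by field_simp; ring]
  norm_num
  ring
theorem Gh (hβ : xx < β) (hne : ∀ n : ℕ, β ≠ n + xx) :
    Tt (fun N : ℕ => (exp (2 * (Af β * Az xk β (Ak β N))) / (4 * √(π * Ad β (Ak β N)))) /
       ((1/4) * π ^ (-(1/4) : ℝ) * Ccoef β ^ ((1/4) : ℝ) *
          ACoef β 0 ^ (-xx : ℝ) * exp (1 / cos (π * β)) *
          (N : ℝ) ^ (-xx + 1 / (4 * β)) *
          exp ((2 * (N : ℝ) ^ (1 - 1 / xk β) / sqrt (π * Ccoef β)) *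
            ∑ r ∈ rg (Nat.floor (β - xx) + 1),
              (-1 : ℝ) ^ r * (ACoef β r / Ccoef β ^ r) * (N : ℝ) ^ (-(r : ℝ) / β)))) 1 := by
  set R := Nat.floor (β - xx) with hR
  have di : (R:ℝ) ≤ β - xx := Nat.floor_le ql
  have fc : β - xx < R + 1 := Nat.lt_floor_add_one _
  have ga := hne R
  have lm : (R:ℝ) < β - xx := vx di (fun h => ga ql)
  have hl := ((Ge R xk β ql ql).comp (Ck hβ)).const_mul (2*Af β)
  rw [Gf hβ] at hl
  have gb := (continuous_exp.tendsto _).comp (hl.sub_const (1 / cos (π*β)))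
  rw [sub_self, exp_zero] at gb
  refine gb.congr' ?_
  filter_upwards [qr 0] with N hN
  have hp := Gg hβ hne hN
  have hpos : 0 < Ad β (Ak β N) := by
    have := Bo hβ; have := Bv hβ hN; have : 0 < 2*β-1 := ql
    rw [Ad]; positivity
  have aj : (1/4) * π ^ (-(1/4) : ℝ) * Ccoef β ^ ((1/4) : ℝ) *
          ACoef β 0 ^ (-xx : ℝ) * exp (1 / cos (π * β)) * (N : ℝ) ^ (-xx + 1 / (4 * β)) =
          1 / (4 * √(π * Ad β (Ak β N))) * exp (1 / cos (π * β)) := by rw [hp]; ring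
  rw [aj, vg]
  simp_rw [← Eh hβ hne hN]
  rw [← vg, wd (exp _), ← one_div, uf (exp _), wx, mul_div_mul_left _ _ qp,
    ← zn, ← exp_sub]
  simp only [Function.comp]
  congr 1; ring
noncomputable def Ar (w : ℂ) (φ : ℝ) : ℝ :=
  log ‖cis φ - w‖ + log ‖cin φ - w‖
theorem Cy {w : ℂ} (hw : ‖w‖ ≤ 1) :
    IntervalIntegrable (Ar w) volume 0 π ∧ ∫ φ in oo..π, Ar w φ = 0 := by
  have aa := circleIntegrable_log_norm_sub_const (a := w) (c := 0) 1
  have ad := circleAverage_log_norm_sub_const_eq_posLog (a := w)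
  rw [posLog_eq_zero_iff _ |>.2 (by rwa [abs_norm]), circleAverage_def] at ad
  have eb : ∫ θ in oo..2*π, log ‖circleMap 0 1 θ - w‖ = 0 := by
    have := zp
    simpa [this.ne'] using ad
  rw [circleIntegrable_def] at aa
  have aj : (fun θ => log ‖circleMap 0 1 θ - w‖) = fun θ : ℝ => log ‖cis θ - w‖ := by
    funext θ; simp [circleMap]
  rw [aj] at aa eb
  have pp := zp
  have aq : IntervalIntegrable (fun θ : ℝ => log ‖cis θ - w‖) volume 0 π :=
    aa.mono_set (by rw [Set.uIcc_of_le pp.le, Set.uIcc_of_le ql]; exact Set.Icc_subset_Icc_right ql)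
  have av : IntervalIntegrable (fun θ : ℝ => log ‖cis θ - w‖) volume π (2*π) :=
    aa.mono_set (by rw [Set.uIcc_of_le ql, Set.uIcc_of_le ql]; exact Set.Icc_subset_Icc_left ql)
  have ak : (fun θ : ℝ => log ‖cin θ - w‖) =
      fun θ : ℝ => (fun θ : ℝ => log ‖cis θ - w‖) (2*π - θ) := by
    funext θ
    simp only
    congr 3
    rw [Complex.exp_eq_exp_iff_exists_int]
    exact ⟨-1, by push_cast; ring⟩
  have bj : IntervalIntegrable (fun θ : ℝ => log ‖cin θ - w‖) volume 0 π := by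
    rw [ak]
    have := (av.comp_sub_left (2*π)).symm
    simpa [show 2*π - π = π by ring] using this
  refine ⟨aq.add bj, ?_⟩
  unfold Ar
  rw [xr aq bj, ak, intervalIntegral.integral_comp_sub_left
    (fun θ : ℝ => log ‖cis θ - w‖), show 2*π - π = π by ring, ze,
    qi aq av, eb]
theorem Cb {w : ℂ} (hw : w ≠ 0) (φ : ℝ) (hs : sin xh φ ≠ 0) :
    1 + (1-w)²/(4*w*xc (sin xh φ)²) =
      (cis φ - w) * (cin φ - w) / (4*w*xc (sin xh φ)²) := by
  have aa : xc (sin xh φ) ≠ 0 := by exact_mod_cast hs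
  have ad : (4:ℂ) * (sin xh φ : ℝ)² = 2 - (cis φ + cin φ) := by
    have e : 2 * Complex.cos φ = cis φ + cin φ := by
      rw [Complex.cos]; ring_nf
    rw [← e]
    have : sin xh φ² = xx - cos φ/2 := by rw [sin_sq_eq_half_sub]; ring_nf
    rw [← Complex.ofReal_pow, this]; push_cast; ring
  have ag : cis φ * cin φ = 1 := by rw [← zh]; simp
  have ar : 4*w*xc (sin xh φ)² ≠ 0 := by simp only [ne_eq, mul_eq_zero, pow_eq_zero_iff, OfNat.ofNat_ne_zero, not_false_eq_true, hw, aa, or_self]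
  rw [eq_div_iff ar, add_mul, wj, div_mul_cancel₀ _ ar]
  linear_combination w * ad - ag
theorem Gi (w : ℂ) : {φ ∈ Ioo 0 π | cis φ = w ∨ cin φ = w}.Subsingleton := by
  have key : ∀ φ : ℝ, (cis φ = w ∨ cin φ = w) → cos φ = w.re := by
    rintro φ (h | h)
    · rw [← h, zg]
    · rw [← h, ← neg_mul, ← Complex.ofReal_neg, zg, cos_neg]
  intro a ha b hb
  exact injOn_cos ⟨ha.1.1.le, ha.1.2.le⟩ ⟨hb.1.1.le, hb.1.2.le⟩ ((key a ha.2).trans (key b hb.2).symm)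
theorem Ei (w : ℂ) : ∀ᵐ φ : ℝ ∂(volume.restrict (Ioo 0 π)),
    cis φ ≠ w ∧ cin φ ≠ w := by
  rw [ae_restrict_iff' qz]
  have := (Gi w).measure_zero volume
  filter_upwards [compl_mem_ae_iff.2 this] with φ h hφ
  by_contra hc
  apply h
  refine ⟨hφ, ?_⟩
  tauto
theorem Ej {w : ℂ} (hw : w ≠ 0) : ∀ᵐ φ : ℝ ∂(volume.restrict (Ioo 0 π)),
    log ‖1 + (1-w)²/(4*w*xc (sin xh φ)²)‖ = Ar w φ - Ar 1 φ - log ‖w‖ := by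
  filter_upwards [Ei w, qx qz] with φ h hφ
  have hs : 0 < sin xh φ := sin_pos_of_pos_of_lt_pi (by linarith [hφ.1]) (by linarith [hφ.1, hφ.2])
  have bf : ‖cis φ - w‖ ≠ 0 := (qs).2 ((xg).2 h.1)
  have bk : ‖cin φ - w‖ ≠ 0 := (qs).2 ((xg).2 h.2)
  have aw : ‖w‖ ≠ 0 := (qs).2 hw
  have cf := Cb (w := 1) one_ne_zero φ hs.ne'
  have hsc : xc (sin xh φ) ≠ 0 := by exact_mod_cast hs.ne'
  simp only [sub_self, ne_eq, OfNat.ofNat_ne_zero, not_false_eq_true, zero_pow, zero_div, vu] at cf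
  have ar : 4*1*xc (sin xh φ)² ≠ 0 := by simp only [ne_eq, mul_eq_zero, pow_eq_zero_iff, OfNat.ofNat_ne_zero, not_false_eq_true, hsc, one_ne_zero, or_self]
  rw [eq_div_iff ar, wj] at cf
  have dj : ‖(4 * 1 * xc (sin xh φ)²)‖ = _ * _ := (congrArg norm cf).trans (qk _ _)
  have cy : ‖(4 * 1 * xc (sin xh φ)²)‖ ≠ 0 := (qs).2 ar
  rw [dj] at cy
  have bg := left_ne_zero_of_mul cy
  have bo := right_ne_zero_of_mul cy
  rw [Cb hw φ hs.ne', wr, qk, show (4*w*xc (sin xh φ)²) = w * (4 * 1 * xc (sin xh φ)²) by ring,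
    qk, dj, log_div qp qp, ws bf bk, ws aw qp, ws bg bo]
  unfold Ar; ring
theorem Cz {w : ℂ} (hw : w ≠ 0) (fd : ‖w‖ ≤ 1) :
    IntegrableOn (fun φ : ℝ => log ‖1 + (1-w)²/(4*w*xc (sin xh φ)²)‖) (Ioo 0 π) ∧
    ∫ φ in Ioo 0 π, log ‖1 + (1-w)²/(4*w*xc (sin xh φ)²)‖ = -π * log ‖w‖ := by
  have pp := zp
  obtain ⟨aq, aj⟩ := Cy fd
  obtain ⟨av, ak⟩ := Cy (w := 1) (by simp)
  rw [qw pp.le, qj] at aj ak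
  rw [qm pp.le] at aq av
  have bj : IntegrableOn (fun _ : ℝ => log ‖w‖) (Ioo 0 π) := by simp
  constructor
  · exact ((aq.sub av).sub bj).congr (by filter_upwards [Ej hw] with φ h using h.symm)
  · have ja : IntegrableOn (fun φ => Ar w φ - Ar 1 φ) (Ioo 0 π) := aq.sub av
    rw [integral_congr_ae (Ej hw), we ja bj, we aq av, aj, ak]
    simp [pp.le]
noncomputable def Ac (s y : ℝ) : ℝ := log |1 + s / y²|
theorem Ek (w : ℝ) (hw : w ≠ 0) (fd : |w| ≤ 1) (hs : (1-w)²/(4*w) = s) :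
    IntegrableOn (fun φ : ℝ => Ac s (sin xh φ)) (Ioo 0 π) ∧
    ∫ φ in Ioo 0 π, Ac s (sin xh φ) = -π * log |w| := by
  have h := Cz (w := w) (by exact_mod_cast hw) (by simpa using fd)
  have e : ∀ φ : ℝ, log ‖1 + (1-(w:ℂ))²/(4*w*xc (sin xh φ)²)‖ = Ac s (sin xh φ) := by
    intro φ
    rw [Ac, ← hs, ← qy, ← qu]
    congr 2
    push_cast
    rw [div_div]
  simp_rw [e] at h
  simpa using h
theorem El (hv : 0 < v) :
    IntegrableOn (fun φ : ℝ => Ac (v²) (sin xh φ)) (Ioo 0 π) ∧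
    ∫ φ in Ioo 0 π, Ac (v²) (sin xh φ) = 2*π * arsinh v := by
  have ah : 0 < arsinh v := arsinh_pos_iff.2 hv
  have h := Ek (s := v²) (exp (-(2*arsinh v))) (xz _).ne' (by
    rw [qt (xz _), exp_le_one_iff]; linarith) (by
    have e := sinh_arsinh v
    rw [sinh_eq] at e
    rw [show -(2*arsinh v) = -arsinh v + -arsinh v by ring, zn]
    have ak : exp (arsinh v) * exp (-arsinh v) = 1 := by rw [← zn]; simp
    have be : exp (-arsinh v) ≠ 0 := (xz _).ne'
    have bq : exp (arsinh v) = (exp (-arsinh v))⁻¹ := eq_inv_of_mul_eq_one_left ak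
    rw [bq] at e; rw [← congrArg (fun t => t²) e]; field_simp; ring)
  refine ⟨h.1, h.2.trans ?_⟩
  rw [qt (xz _), log_exp]; ring
theorem Gj (hv : 1 ≤ v) :
    IntegrableOn (fun φ : ℝ => Ac (-v²) (sin xh φ)) (Ioo 0 π) ∧
    ∫ φ in Ioo 0 π, Ac (-v²) (sin xh φ) = 2*π * arcosh v := by
  have ah : 0 ≤ arcosh v := arcosh_nonneg hv
  have h := Ek (s := -v²) (-exp (-(2*arcosh v))) (neg_ne_zero.2 (xz _).ne') (by
    rw [abs_neg, qt (xz _), exp_le_one_iff]; linarith) (by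
    have e := cosh_arcosh hv
    rw [cosh_eq] at e
    rw [show -(2*arcosh v) = -arcosh v + -arcosh v by ring, zn]
    have ak : exp (arcosh v) * exp (-arcosh v) = 1 := by rw [← zn]; simp
    have be : exp (-arcosh v) ≠ 0 := (xz _).ne'
    have bq : exp (arcosh v) = (exp (-arcosh v))⁻¹ := eq_inv_of_mul_eq_one_left ak
    rw [bq] at e; rw [← congrArg (fun t => -t²) e]; field_simp; ring)
  refine ⟨h.1, h.2.trans ?_⟩
  rw [abs_neg, qt (xz _), log_exp]; ring
theorem Gk (hv : |v| ≤ 1) :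
    IntegrableOn (fun φ : ℝ => Ac (-v²) (sin xh φ)) (Ioo 0 π) ∧
    ∫ φ in Ioo 0 π, Ac (-v²) (sin xh φ) = 0 := by
  have hn : ‖qe (xc (2 * arcsin v) * jj)‖ = 1 := vq _
  have h := Cz (w := qe (xc (2 * arcsin v) * jj)) (zc _) hn.le
  set w := qe (xc (2 * arcsin v) * jj) with hw
  have cr : (1-w)²/(4*w) = xc (-v²) := by
    have aa : w ≠ 0 := zc _
    rw [div_eq_iff (by simp [aa])]
    have aj : w = qe (arcsin v * jj) * qe (arcsin v * jj) := by
      rw [hw, ← zh]; congr 1; push_cast; ring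
    have ak : (v:ℂ) = Complex.sin (arcsin v) := by
      rw [← Complex.ofReal_sin, sin_arcsin (by linarith [(zq).1 hv]) (by linarith [(zq).1 hv])]
    push_cast
    have be : qe (-arcsin v * jj) * qe (arcsin v * jj) = 1 := by
      rw [← zh]; simp
    rw [ak, Complex.sin, aj]
    generalize qe (-arcsin v * jj) = q at *
    have bq : q = (qe (arcsin v * jj))⁻¹ := eq_inv_of_mul_eq_one_left be
    rw [bq]
    have := zc (arcsin v * jj)
    generalize qe (arcsin v * jj) = p at *
    field_simp
    rw [wl]; ring
  have e : ∀ φ : ℝ, log ‖1 + (1-(w:ℂ))²/(4*w*xc (sin xh φ)²)‖ = Ac (-v²) (sin xh φ) := by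
    intro φ
    rw [Ac, ← div_div, cr, ← qy, ← qu]
    congr 2
    push_cast
    rfl
  simp_rw [e, hn] at h
  simpa using h
noncomputable def Ae (β B y : ℝ) : ℝ := Af β / π * ∫ r in Ioo y B, r^xm β * (r²-y²)^(-xx:ℝ)
theorem Em (hr : 0 < r) {k : ℝ → ℝ} (hi : IntegrableOn (fun φ => k (r * sin xh φ)) (Ioo 0 π)) :
    IntegrableOn (fun y => (r²-y²)^(-xx:ℝ) * k y) (Ioo 0 r) ∧
    ∫ y in Ioo 0 r, (r²-y²)^(-xx:ℝ) * k y = ∫ φ in Ioo 0 π, xx * k (r * sin xh φ) := by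
  refine Bx (f := fun φ => r * sin xh φ) (f' := fun φ => r * (cos xh φ * xx)) qz ?_ ?_ ?_ ?_ ?_ (hi.const_mul _)
  · ext y
    constructor
    · rintro ⟨φ, hφ, rfl⟩
      have aa : 0 < sin xh φ := sin_pos_of_pos_of_lt_pi (by linarith [hφ.1]) (by linarith [hφ.1, hφ.2])
      have ad : sin xh φ < 1 := by
        rw [← sin_pi_div_two]
        exact sin_lt_sin_of_lt_of_le_pi_div_two (by linarith [hφ.1, zp]) zu (by linarith [hφ.2])
      exact ⟨qp, by simp only; nlinarith⟩
    · intro hy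
      have aa : 0 < y/r := by have := hy.1; positivity
      have ad : y/r < 1 := by rw [uw hr]; exact hy.2
      refine ⟨2*arcsin (y/r), ⟨by have := arcsin_pos.2 aa; linarith, by have := arcsin_lt_pi_div_two.2 ad; linarith⟩, ?_⟩
      simp only
      rw [show 2*arcsin (y/r)/2 = arcsin (y/r) by ring, sin_arcsin ql ad.le]; field_simp
  · intro φ _
    have := ((hasDerivAt_id φ).div_const 2).sin.const_mul r
    simpa using this
  · intro a ha b hb h
    have h' := va hr.ne' h
    have := injOn_sin ⟨by linarith [ha.1, zp], by linarith [ha.2]⟩ ⟨by linarith [hb.1, zp], by linarith [hb.2]⟩ h'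
    linarith
  · intro φ hφ
    have : 0 ≤ cos xh φ := cos_nonneg_of_neg_pi_div_two_le_of_le (by linarith [hφ.1, zp]) (by linarith [hφ.2])
    positivity
  · intro φ hφ
    have aa : 0 < cos xh φ := cos_pos_of_mem_Ioo ⟨by linarith [hφ.1, zp], by linarith [hφ.2]⟩
    have ad : r² - (r * sin xh φ)² = (r * cos xh φ)² := by rw [xj, xj, cos_sq']; ring
    rw [ad, ← vd, ← vf qp]
    norm_num
    rw [rpow_neg_one]; field_simp
theorem Da {k : ℝ → ℝ} (hk : Measurable k)
    (aa : ∀ r ∈ Ioo 0 B, IntegrableOn (fun φ => k (r * sin xh φ)) (Ioo 0 π))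
    (ad : IntegrableOn (fun r => r^xm β * ∫ φ in Ioo 0 π, |k (r * sin xh φ)|) (Ioo 0 B)) :
    IntegrableOn (fun y => Ae β B y * k y) (Ioo 0 B) ∧
    ∫ y in Ioo 0 B, Ae β B y * k y =
      Af β / (2*π) * ∫ r in Ioo 0 B, r^xm β * ∫ φ in Ioo 0 π, k (r * sin xh φ) := by
  set μ := volume.restrict (Ioo oo B)
  set F : ℝ × ℝ → ℝ := Set.indicator {p | p.2 < p.1} (fun p => p.1^xm β * ((p.1²-p.2²)^(-xx:ℝ) * k p.2)) with hF
  have hm : Measurable F := by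
    refine Measurable.indicator ?_ (measurableSet_lt measurable_snd measurable_fst)
    exact (measurable_fst.pow_const _).mul ((((measurable_fst.pow_const 2).sub (measurable_snd.pow_const 2)).pow_const _).mul (hk.comp measurable_snd))
  have dk : ∀ r ∈ Ioo 0 B, (fun y => F (r,y)) =ᵐ[μ] (Ioo 0 r).indicator (fun y => r^xm β * ((r²-y²)^(-xx:ℝ) * k y)) := by
    intro r hr
    filter_upwards [qx qz] with y hy
    simp only [hF, Set.indicator, xs, Set.mem_Ioo, hy.1, true_and]
  have fe : ∀ r ∈ Ioo 0 B, Ioo 0 B ∩ Ioo 0 r = Ioo 0 r := fun r hr =>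
    Set.inter_eq_right.2 (vk hr.2.le)
  have S := fun r hr => Em (r := r) (Set.mem_Ioo.1 hr).1 (aa r hr)
  have jb : ∀ r ∈ Ioo 0 B, Integrable (fun y => F (r,y)) μ := by
    intro r hr
    rw [integrable_congr (dk r hr), integrable_indicator_iff qz]
    change Integrable _ ((volume.restrict _).restrict _)
    rw [Measure.restrict_restrict qz, Set.inter_comm, fe r hr]
    exact (S r hr).1.const_mul _
  have jc : ∀ r ∈ Ioo 0 B, ∫ y, F (r,y) ∂μ = r^xm β * (xx * ∫ φ in Ioo 0 π, k (r * sin xh φ)) := by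
    intro r hr
    rw [integral_congr_ae (dk r hr), integral_indicator qz, Measure.restrict_restrict qz, Set.inter_comm,
      fe r hr, qv, (S r hr).2, qv]
  have jd : ∀ r ∈ Ioo 0 B, ∫ y, ‖F (r,y)‖ ∂μ = r^xm β * (xx * ∫ φ in Ioo 0 π, |k (r * sin xh φ)|) := by
    intro r hr
    have := Em (r := r) (k := fun y => |k y|) hr.1 (aa r hr).abs
    have e : ∫ y, ‖F (r,y)‖ ∂μ = ∫ y, (Ioo 0 r).indicator (fun y => r^xm β * ((r²-y²)^(-xx:ℝ) * |k y|)) y ∂μ := ?_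
    · rw [e, integral_indicator qz, Measure.restrict_restrict qz, Set.inter_comm,
        fe r hr, qv, this.2, qv]
    refine integral_congr_ae ?_
    filter_upwards [dk r hr] with y hy
    rw [hy]
    by_cases h : y ∈ Ioo 0 r
    · simp only [Set.indicator_of_mem h, qy, abs_mul]
      rw [abs_of_nonneg (rpow_nonneg hr.1.le _), abs_of_nonneg (rpow_nonneg (by nlinarith [h.1, h.2]) _)]
    · simp [Set.indicator_of_notMem h]
  have hI : Integrable F (μ.prod μ) := by
    rw [integrable_prod_iff hm.aestronglyMeasurable]
    constructor
    · filter_upwards [qx qz] with r hr using jb r hr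
    · refine (ad.const_mul xx).congr ?_
      filter_upwards [qx qz] with r hr
      rw [jd r hr]; ring
  have gc : ∀ᵐ y ∂μ, Ae β B y * k y = Af β / π * ∫ r, F (r,y) ∂μ := by
    filter_upwards [qx qz] with y hy
    rw [Ae, wx]
    congr 1
    rw [← integral_mul_const]
    have e : Ioo y B = Ioo y B ∩ Ioo 0 B := (Set.inter_eq_left.2 (Set.Ioo_subset_Ioo_left hy.1.le)).symm
    rw [e, ← Measure.restrict_restrict qz, ← integral_indicator qz]
    refine integral_congr_ae ?_
    filter_upwards [qx qz] with r hr
    simp only [hF, Set.indicator, xs, Set.mem_Ioo, hr.2, and_true, wx]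
  constructor
  · exact (hI.integral_prod_right.const_mul _).congr (by filter_upwards [gc] with y hy using hy.symm)
  · rw [integral_congr_ae gc, qv, ← integral_prod_symm _ hI, integral_prod _ hI]
    rw [integral_congr_ae (g := fun r => xx * (r^xm β * ∫ φ in Ioo 0 π, k (r * sin xh φ))), qv]
    · have := (zp).ne'
      field_simp
    · filter_upwards [qx qz] with r hr
      rw [jc r hr]; ring
theorem Db (hβ : xx < β) (v : ℝ) (f : ℝ → ℝ) (hm : AEStronglyMeasurable f (volume.restrict (Ioo 0 B)))
    (hf : ∀ r ∈ Ioo 0 B, |f r| ≤ v / r) : IntegrableOn (fun r => r^xm β * f r) (Ioo 0 B) := by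
  rcases vw B 0 with hB | hB
  · rw [Set.Ioo_eq_empty ql]; exact integrableOn_empty
  have aa : IntervalIntegrable (fun r : ℝ => r^(2*β-2)) volume 0 B :=
    uk ql
  rw [qm hB.le] at aa
  refine Integrable.mono' (aa.const_mul v) ?_ ?_
  · exact (measurable_id.pow_const _).aestronglyMeasurable.mul hm
  · filter_upwards [qx qz] with r hr
    have au := hr.1
    rw [qk, qy, qy, abs_of_nonneg qp]
    calc r^xm β * |f r| ≤ r^xm β * (v/r) := by gcongr; exact hf r hr
      _ = v * r^(2*β-2) := by
        rw [show 2*β-1 = (2*β-2)+1 by ring, rpow_add_one au.ne']; field_simp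
theorem Cl (s : ℝ) (hr : 0 < r) (x : ℝ) : Ac s (r*x) = Ac (s/r²) x := by
  rw [Ac, Ac, xj, div_div]
theorem Dc (s : ℝ) : Measurable (Ac s) := by
  unfold Ac
  exact measurable_log.comp ((measurable_const.add (measurable_const.div (measurable_id.pow_const 2))).norm)
theorem Bp (hs : 0 ≤ s) (y : ℝ) : 0 ≤ Ac s y := by
  apply log_nonneg
  have : 0 ≤ s / y² := qp
  rw [abs_of_nonneg ql]; linarith
theorem Gl (hs : 0 ≤ s) (y : ℝ) : |Ac (-s) y| ≤ 2 * Ac s y - Ac (-s) y := by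
  have ah : 0 ≤ s / y² := qp
  have aa : Ac (-s) y ≤ Ac s y := by
    by_cases h : 1 - s/y² = 0
    · rw [Ac, vm, ← sub_eq_add_neg, h]; simpa using Bp hs y
    · refine zv ?_ ?_
      · rw [vm, ← sub_eq_add_neg]; positivity
      · rw [vm, abs_of_nonneg (a := 1 + s/y²) ql]
        exact (zq).2 ⟨ql, ql⟩
  have ad := Bp hs y
  exact (zq).2 ⟨ql, ql⟩
theorem Bd (hβ : xx < β) (hB : 0 < B) :
    IntegrableOn (Ae β B) (Ioo 0 B) ∧ ∫ y in Ioo 0 B, Ae β B y = Af β * B^xk β / (4*β) := by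
  have hi : IntervalIntegrable (fun r : ℝ => r^xm β) volume 0 B :=
    uk ql
  have he : ∫ r in oo..B, r^xm β = B^xk β/xk β := by
    rw [integral_rpow (Or.inl ql), show 2*β-1+1 = 2*β by ring, zero_rpow ql]; ring
  rw [qm hB.le] at hi
  rw [qw hB.le, qj] at he
  have h := Da (β := β) (B := B) (k := fun _ => 1) measurable_const (by intro r _; simp) (by
    simpa [zx, IntegrableOn] using hi.mul_const π)
  simp only [zb] at h
  refine ⟨h.1, h.2.trans ?_⟩
  have : 0 < β := ql
  have := zp
  simp only [integral_const, qo, zb, Measure.real, Measure.restrict_apply_univ, volume_Ioo, ze,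
    ENNReal.toReal_ofReal zx]
  rw [integral_mul_const, he]; field_simp; norm_num
theorem Cc (hβ : xx < β) (hv : 0 < v) :
    IntegrableOn (fun y => Ae β B y * Ac (v²) y) (Ioo 0 B) ∧
    ∫ y in Ioo 0 B, Ae β B y * Ac (v²) y = Af β * ∫ r in Ioo 0 B, r^xm β * arsinh (v/r) := by
  have bt : ∀ r ∈ Ioo 0 B, _ := fun r hr => El (v := v/r) (uj hv (Set.mem_Ioo.1 hr).1)
  have h := Da (β := β) (B := B) (Dc (v²)) (by
    intro r hr
    simp_rw [Cl _ hr.1, ← div_pow]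
    exact (bt r hr).1) (by
    refine (((Db (B := B) hβ v (fun r => arsinh (v/r)) ?_ ?_)).const_mul (2*π)).congr ?_
    · exact (continuous_arsinh.measurable.comp (measurable_const.div measurable_id)).aestronglyMeasurable
    · intro r hr
      have : 0 < v/r := uj hv hr.1
      rw [abs_of_nonneg (arsinh_nonneg_iff.2 this.le)]; exact Bu this.le
    · filter_upwards [qx qz] with r hr
      simp_rw [Cl _ hr.1, ← div_pow, abs_of_nonneg (Bp (zd _) _)]
      rw [(bt r hr).2]; ring)
  refine ⟨h.1, h.2.trans ?_⟩
  have : ∫ r in Ioo 0 B, r^xm β * ∫ φ in Ioo 0 π, Ac (v²) (r * sin xh φ) =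
      ∫ r in Ioo 0 B, (2*π) * (r^xm β * arsinh (v/r)) := by
    refine za qz ?_
    intro r hr
    simp_rw [Cl _ hr.1, ← div_pow]
    rw [(bt r hr).2]; ring
  rw [this, qv]
  have := zp
  field_simp
theorem En (hβ : xx < β) (hB : 0 < B) :
    ∫ y in Ioo 0 B, Ae β B y * Ac 1 y = Af β * Az xk β B := by
  have := (Cc (B := B) hβ one_pos).2
  rw [one_pow] at this
  rw [this, Az, qw hB.le, qj]
theorem Eo (hz : 1 ≤ z) : |arcosh z| ≤ z := by
  rw [abs_of_nonneg (arcosh_nonneg hz)]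
  refine wh ?_ (Bu ql)
  rw [arcosh, arsinh]
  have : √(z²-1) ≤ √(1+z²) := sqrt_le_sqrt ql
  gcongr
theorem Ep (hβ : xx < β) :
    IntegrableOn (fun r => r^xm β * arcosh (y/r)) (Ioo 0 y) := by
  refine Db hβ y _ ?_ ?_
  · refine Measurable.aestronglyMeasurable ?_
    unfold arcosh
    fun_prop
  · intro r hr
    exact Eo ((one_le_div hr.1).2 hr.2.le)
theorem Gm (hβ : xx < β) : Af β * ∫ r in Ioo oo 1, r^xm β * arcosh (1/r) = xx := by
  have hb := Fu (a := 2*β) ql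
  have hi := Ep (y := 1) hβ
  have ah : 0 < β := ql
  have je : Tendsto (fun r : ℝ => r^xk β * arcosh (1/r)) (𝓝[>] 0) (𝓝 0) := by
    have hz : Tendsto (fun r : ℝ => r^xm β) (𝓝[>] 0) (𝓝 0) := by
      have := (continuousAt_rpow_const 0 xm β (Or.inr ql)).tendsto
      rw [zero_rpow ql] at this
      exact this.mono_left xu
    refine squeeze_zero_norm' ?_ hz
    filter_upwards [Ioo_mem_nhdsGT one_pos] with r hr
    have := Eo (z := 1/r) ((one_le_div hr.1).2 hr.2.le)
    have au := hr.1
    rw [qk, qy, qy, abs_of_nonneg qp]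
    calc r^xk β * |arcosh (1/r)| ≤ r^xk β * (1/r) := by gcongr
      _ = _ := by rw [rpow_sub_one au.ne']; ring
  have h := intervalIntegral.integral_eq_sub_of_hasDerivAt_of_tendsto (a := 0) (b := 1) (f := fun r : ℝ => r^xk β * arcosh (1/r))
    (f' := fun r => xk β * (r^xm β * arcosh (1/r)) - r^xm β * (1-r²)^(-xx:ℝ)) (fa := 0) (fb := 0) one_pos ?_ ?_ je ?_
  · rw [qw xp, qj, we (hi.const_mul _) hb.1,
      qv, hb.2, show 2*β/2 = β by ring] at h
    have aa : Gamma β ≠ 0 := (Gamma_pos_of_pos ql).ne'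
    have ad : Gamma (β+xx) ≠ 0 := (Gamma_pos_of_pos ql).ne'
    have : √π ≠ 0 := qp
    rw [Af]
    generalize Gamma (β+xx) = g at *
    generalize ∫ r in Ioo oo 1, r^xm β * arcosh (1/r) = I at *
    have : 2*β*I = xx*(Gamma β * √π/g) := ql
    calc 2*β*g/(√π * Gamma β)*I = g/(√π * Gamma β) * (2*β*I) := by ring
      _ = _ := by rw [this]; field_simp
  · intro r hr
    have au : 0 < r := hr.1
    have di : 1 < 1/r := (one_lt_div au).2 hr.2
    have dr := (hasDerivAt_arcosh di).comp r ((hasDerivAt_inv au.ne').congr_of_eventuallyEq (f₁ := fun r => 1/r) (by simp))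
    have ea := (hasDerivAt_rpow_const (x := r) (p := 2*β) (Or.inl au.ne')).mul dr
    refine ea.congr_deriv ?_
    have e : √((1/r)²-1) = √(1-r²) / r := by
      rw [show (1/r)² - 1 = (1-r²)/r² by field_simp, sqrt_div' _ qp, sqrt_sq au.le]
    have : 0 < 1 - r² := by nlinarith [hr.2]
    have ao : √(1-r²) ≠ 0 := qp
    simp only [Function.comp]
    rw [e, rpow_neg this.le, ← xd, rpow_sub_one au.ne']
    field_simp
    ring
  · rw [qm xp]
    exact (hi.const_mul _).sub hb.1
  · have hc : ContinuousWithinAt (fun r : ℝ => r^xk β * arcosh (1/r)) (Ioc 0 1) 1 := by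
      refine ContinuousWithinAt.mul ((continuousAt_rpow_const 1 _ (Or.inl one_ne_zero)).continuousWithinAt) ?_
      have de : ContinuousWithinAt arcosh (Ici 1) ((fun r : ℝ => 1/r) 1) := continuousOn_arcosh _ (by simp)
      have el : ContinuousWithinAt (fun r : ℝ => 1/r) (Ioc 0 1) 1 :=
        (continuousAt_const.div continuousAt_id one_ne_zero).continuousWithinAt
      exact de.comp el (fun r hr => (one_le_div hr.1).2 hr.2)
    have := hc.tendsto
    simp only [div_one, arcosh_zero, xo] at this
    refine this.mono_left (nhdsWithin_le_of_mem ?_)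
    exact mem_of_superset (Ioo_mem_nhdsLT one_pos) Set.Ioo_subset_Ioc_self
theorem Er (hβ : xx < β) (hy : 0 < y) :
    Af β * ∫ r in Ioo oo y, r^xm β * arcosh (y/r) = y^xk β/2 := by
  have h := intervalIntegral.integral_comp_mul_left (a := 0) (b := 1) (fun r => r^xm β * arcosh (y/r)) hy.ne'
  rw [xo, zb, qw hy.le, qw xp,
    qj, qj] at h
  have e : ∫ x in Ioo oo 1, (y*x)^xm β * arcosh (y/(y*x)) = y^xm β * ∫ r in Ioo oo 1, r^xm β * arcosh (1/r) := by
    rw [← qv]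
    refine za qz ?_
    intro x hx
    simp only
    rw [mul_rpow hy.le hx.1.le, show y/(y*x) = 1/x by have := hx.1; field_simp]; ring
  rw [e, qo, rpow_sub_one hy.ne'] at h
  have aa := Gm hβ
  generalize ∫ r in Ioo oo 1, r^xm β * arcosh (1/r) = I at *
  generalize ∫ r in Ioo oo y, r^xm β * arcosh (y/r) = J at *
  have : J = y^xk β * I := by field_simp at h; linarith
  rw [this]; linear_combination y^xk β * aa
theorem Es (hβ : xx < β) (hy : 0 < y0) :
    IntegrableOn (fun y => Ae β B y * Ac (-y0²) y) (Ioo 0 B) ∧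
    ∫ y in Ioo 0 B, Ae β B y * Ac (-y0²) y ≤ y0^xk β/2 ∧
    (y0 ≤ B → ∫ y in Ioo 0 B, Ae β B y * Ac (-y0²) y = y0^xk β/2) := by
  set κ : ℝ → ℝ := fun r => if r < y0 then 2*π*arcosh (y0/r) else 0 with hκ
  have bt : ∀ r ∈ Ioo 0 B, IntegrableOn (fun φ : ℝ => Ac (-(y0/r)²) (sin xh φ)) (Ioo 0 π) ∧
      ∫ φ in Ioo 0 π, Ac (-(y0/r)²) (sin xh φ) = κ r := by
    intro r hr
    have au := hr.1
    by_cases h : r < y0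
    · rw [hκ]; simp only [h, if_true]
      exact Gj ((one_le_div hr.1).2 h.le)
    · rw [hκ]; simp only [h, if_false]
      refine Gk ?_
      rw [abs_of_nonneg qp, xl hr.1]; linarith
  have gd : ∀ r ∈ Ioo 0 B, _ := fun r hr => El (v := y0/r) (uj hy (Set.mem_Ioo.1 hr).1)
  have sc : ∀ r ∈ Ioo 0 B, ∀ x, Ac (-y0²) (r*x) = Ac (-(y0/r)²) x := by
    intro r hr x
    rw [Cl _ hr.1, vm, ← div_pow]
  have h := Da (β := β) (B := B) (Dc (-y0²)) (by
    intro r hr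
    simp_rw [sc r hr]
    exact (bt r hr).1) (by
    refine Db (B := B) hβ (4*π*y0) (fun r => ∫ φ in Ioo 0 π, |Ac (-y0²) (r * sin xh φ)|) ?_ ?_
    · have : StronglyMeasurable (fun p : ℝ × ℝ => |Ac (-y0²) (p.1 * sin (p.2/2))|) := by
        refine Measurable.stronglyMeasurable ?_
        exact ((Dc (-y0²)).comp (measurable_fst.mul (measurable_sin.comp (measurable_snd.div_const 2)))).norm
      exact (this.integral_prod_right (ν := volume.restrict (Ioo 0 π))).aestronglyMeasurable
    · intro r hr
      have au := hr.1
      rw [abs_of_nonneg (integral_nonneg fun _ => zr _)]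
      simp_rw [sc r hr]
      have aq := (gd r hr).1.const_mul 2
      have kn : 0 ≤ κ r := by
        by_cases h : r < y0
        · simp only [hκ, h, if_true]
          have := arcosh_nonneg ((one_le_div hr.1).2 h.le)
          have := zp
          positivity
        · simp [hκ, h]
      calc _ ≤ ∫ φ in Ioo 0 π, (2 * Ac ((y0/r)²) (sin xh φ) - Ac (-(y0/r)²) (sin xh φ)) :=
            integral_mono (bt r hr).1.abs (aq.sub (bt r hr).1) (fun φ => Gl (zd _) _)
        _ = 2*(2*π*arsinh (y0/r)) - κ r := by rw [we aq (bt r hr).1, qv, (gd r hr).2, (bt r hr).2]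
        _ ≤ 4*π*(y0/r) := by
            have := Bu (x := y0/r) qp
            have := qq this zx
            linarith
        _ = _ := by ring)
  have key : ∫ y in Ioo 0 B, Ae β B y * Ac (-y0²) y = Af β * ∫ r in Ioo 0 (min B y0), r^xm β * arcosh (y0/r) := by
    rw [h.2]
    have : ∫ r in Ioo 0 B, r^xm β * ∫ φ in Ioo 0 π, Ac (-y0²) (r * sin xh φ) =
        ∫ r in Ioo 0 B, (2*π) * (Iio y0).indicator (fun r => r^xm β * arcosh (y0/r)) r := by
      refine za qz ?_
      intro r hr
      simp_rw [sc r hr]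
      rw [(bt r hr).2, hκ]
      by_cases h : r < y0
      · simp [h]; ring
      · simp [h]
    rw [this, qv, xv measurableSet_Iio, Set.Ioo_inter_Iio]
    have := zp
    field_simp
  refine ⟨h.1, ?_, ?_⟩
  · rw [key, ← Er hβ hy]
    refine qq ?_ (Bo hβ).le
    refine setIntegral_mono_set (Ep hβ) ?_ (LE.le.eventuallyLE (vk (min_le_right _ _)))
    filter_upwards [qx qz] with r hr
    have := arcosh_nonneg ((one_le_div hr.1).2 hr.2.le)
    have := hr.1
    simp only [Pi.zero_apply]
    positivity
  · intro hB
    rw [key, min_eq_right hB, Er hβ hy]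
noncomputable def Ax (β t s : ℝ) : ℝ := (t²+s²)^(β-1)
noncomputable def Bw (β t : ℝ) : ℝ := ∫ s in Ioo oo 1, Ax β t s
noncomputable def Dd (β t : ℝ) : ℝ := ∫ s in Ioo oo 1, Set.indicator {s | 1 ≤ t²+s²} (Ax β t) s
noncomputable def Aq (β t : ℝ) : ℝ := ∫ s in Ioo oo 1, Set.indicator {s | t²+s² < 1} (Ax β t) s
noncomputable def Bi (β s : ℝ) : ℝ := s^(2*β-2) + 2^(β-1)
theorem Cd (hβ : xx < β) : IntegrableOn (Bi β) (Ioo 0 1) := by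
  have aa : IntervalIntegrable (fun r : ℝ => r^(2*β-2)) volume 0 1 :=
    uk ql
  rw [qm xp] at aa
  exact aa.add (by simp)
theorem Be (β t s : ℝ) : 0 ≤ Ax β t s := rpow_nonneg qp _
theorem Ce (ht : t ∈ Icc 0 1) (hs : s ∈ Ioo 0 1) : Ax β t s ≤ Bi β s := by
  obtain ⟨al, bp⟩ := ht
  obtain ⟨ao, bn⟩ := hs
  unfold Ax Bi
  have e : s^(2*β-2) = (s²)^(β-1) := by rw [← vd, ← vf ao.le]; congr 1; push_cast; ring
  have ds : 0 ≤ s^(2*β-2) := qp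
  have cu : oo ≤ 2^(β-1) := qp
  rcases le_total β 1 with h | h
  · have := rpow_le_rpow_of_nonpos (x := s²) (y := t²+s²) (z := β-1) qp (by nlinarith) ql
    rw [e]; linarith
  · have := rpow_le_rpow (x := t²+s²) (y := 2) (z := β-1) qp (by nlinarith) ql
    linarith
theorem Cm (β t : ℝ) : Measurable (Ax β t) := by unfold Ax; fun_prop
theorem Bj (hβ : xx < β) (ht : t ∈ Icc 0 1) {S : Set ℝ} (hS : MeasurableSet S) :
    IntegrableOn (S.indicator (Ax β t)) (Ioo 0 1) := by
  refine Integrable.mono' (Cd hβ) ((Cm β t).indicator hS).aestronglyMeasurable ?_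
  filter_upwards [qx qz] with s hs
  rw [qy, abs_of_nonneg (Set.indicator_nonneg (fun _ _ => Be _ _ _) _)]
  exact (Set.indicator_le_self' (fun _ _ => Be _ _ _) _).trans (Ce ht hs)
theorem Cn (hβ : xx < β) (ht : t ∈ Icc 0 1) : IntegrableOn (Ax β t) (Ioo 0 1) := by
  simpa using Bj hβ ht MeasurableSet.univ
theorem Bq (t : ℝ) : MeasurableSet {s : ℝ | t²+s² < 1} := measurableSet_lt qf qf
theorem De (t : ℝ) : MeasurableSet {s : ℝ | 1 ≤ t²+s²} := measurableSet_le qf qf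
theorem Gn (hβ : xx < β) (ht : t ∈ Icc 0 1) : Aq β t = Bw β t - Dd β t := by
  rw [Aq, Bw, Dd, ← we (Cn hβ ht) (Bj hβ ht (De t))]
  congr 1; funext s
  by_cases h : t²+s² < 1
  · simp [Set.indicator, h, not_le.2 h]
  · simp [Set.indicator, h, not_lt.1 h]
theorem Go (hβ : xx < β) (ht : t ∈ Icc 0 1) : Aq β t ≤ ∫ s in Ioo oo 1, Bi β s := by
  refine wv (Bj hβ ht (Bq t)) (Cd hβ) qz ?_
  intro s hs
  exact (Set.indicator_le_self' (fun _ _ => Be _ _ _) _).trans (Ce ht hs)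
theorem Et (hβ : xx < β) : Aq β 0 = 1/xm β := by
  have he : ∫ r in oo..1, r^(2*β-2) = 1/xm β := by
    rw [integral_rpow (Or.inl ql), show 2*β-2+1 = 2*β-1 by ring, zero_rpow ql]; simp
  rw [qw xp, qj] at he
  rw [← he, Aq]
  refine za qz ?_
  intro s hs
  have : s² < 1 := by nlinarith [hs.1, hs.2]
  simp only [Set.indicator, xs, Ax, ne_eq, OfNat.ofNat_ne_zero, not_false_eq_true, zero_pow, vb, this, if_true]
  rw [← vd, ← vf hs.1.le]; congr 1; push_cast; ring
theorem Jv (hβ : xx < β) (ht : t ∈ Ico 0 1) : 0 < Aq β t := by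
  have ht' : t ∈ Icc oo 1 := ⟨ht.1, ht.2.le⟩
  have jf : t² < 1 := by nlinarith [ht.1, ht.2]
  rw [Aq, setIntegral_pos_iff_support_of_nonneg_ae
    (ae_of_all _ fun s => Set.indicator_nonneg (fun _ _ => Be _ _ _) _) (Bj hβ ht' (Bq t))]
  have hsq : 0 < √(1-t²) := sqrt_pos.2 ql
  have hss : √(1-t²) ≤ 1 := by rw [sqrt_le_iff]; exact ⟨qn, by nlinarith [ht.1]⟩
  refine zl ?_ (measure_mono (s := Ioo 0 (√(1-t²))) ?_)
  · simp [hsq]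
  · intro s hs
    have aa : t²+s² < 1 := by
      have := sq_sqrt (show 0 ≤ 1-t² by linarith)
      nlinarith [hs.1, hs.2]
    refine ⟨?_, hs.1, hs.2.trans_le hss⟩
    have := hs.1
    have : 0 < Ax β t s := rpow_pos_of_pos qp _
    simp [Set.indicator, aa, this.ne']
theorem Df (hβ : xx < β) : Tendsto (Aq β) (𝓝[≥] 0) (𝓝 (Aq β 0)) ∧ Tendsto (Bw β) (𝓝[≥] 0) (𝓝 (Bw β 0)) := by
  have hev : ∀ᶠ t : ℝ in 𝓝[≥] 0, t ∈ Icc 0 1 := Icc_mem_nhdsGE one_pos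
  have hc : ∀ s ∈ Ioo oo 1, Tendsto (fun t => Ax β t s) (𝓝[≥] 0) (𝓝 (Ax β 0 s)) := by
    intro s hs
    have : ContinuousAt (fun t : ℝ => Ax β t s) 0 := by
      unfold Ax
      refine ContinuousAt.rpow_const qf (Or.inl ?_)
      have := hs.1
      positivity
    exact this.tendsto.mono_left xu
  constructor
  · refine tendsto_integral_filter_of_dominated_convergence (Bi β) ?_ ?_ (Cd hβ) ?_
    · exact qg fun t => ((Cm β t).indicator (Bq t)).aestronglyMeasurable
    · filter_upwards [hev] with t ht
      filter_upwards [qx qz] with s hs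
      rw [qy, abs_of_nonneg (Set.indicator_nonneg (fun _ _ => Be _ _ _) _)]
      exact (Set.indicator_le_self' (fun _ _ => Be _ _ _) _).trans (Ce ht hs)
    · filter_upwards [qx qz] with s hs
      have aa : oo²+s² < 1 := by nlinarith [hs.1, hs.2]
      rw [Set.indicator_of_mem (by exact aa)]
      refine (hc s hs).congr' ?_
      have : ∀ᶠ t : ℝ in 𝓝 0, t²+s² < 1 := by
        have : ContinuousAt (fun t : ℝ => t²+s²) 0 := qf
        exact this.eventually_lt_const aa
      filter_upwards [xu this] with t ht
      rw [Set.indicator_of_mem (by exact ht)]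
  · refine tendsto_integral_filter_of_dominated_convergence (Bi β) ?_ ?_ (Cd hβ) ?_
    · exact qg fun t => (Cm β t).aestronglyMeasurable
    · filter_upwards [hev] with t ht
      filter_upwards [qx qz] with s hs
      rw [qy, abs_of_nonneg (Be _ _ _)]
      exact Ce ht hs
    · filter_upwards [qx qz] with s hs using hc s hs
theorem Gp (hβ : xx < β) : ∃ W : ℝ → ℝ, MonotoneOn W (Icc 0 1) ∧ Tendsto W (𝓝[≥] 0) (𝓝 (W 0)) ∧
    ∀ a ∈ Icc oo 1, ∀ b ∈ Icc oo 1, a ≤ b → |Aq β a - Aq β b| ≤ W b - W a := by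
  obtain ⟨bp, bh⟩ := Df hβ
  rcases le_total β 1 with h | h
  · have an : AntitoneOn (Aq β) (Icc 0 1) := by
      intro a ha b hb hab
      refine wv (Bj hβ hb (Bq b)) (Bj hβ ha (Bq a)) qz ?_
      intro s hs
      have gf : a² ≤ b² := by nlinarith [ha.1]
      by_cases aa : b²+s² < 1
      · have ad : a²+s² < 1 := ql
        simp only [Set.indicator, xs, aa, ad, if_true]
        have := hs.1
        exact rpow_le_rpow_of_nonpos qp ql ql
      · simp only [Set.indicator, xs, aa, if_false]
        split_ifs
        · exact Be _ _ _
        · exact zu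
    refine ⟨fun t => - Aq β t, an.neg, bp.neg, ?_⟩
    intro a ha b hb hab
    have := an ha hb hab
    rw [abs_of_nonneg ql]; linarith
  · have ax : ∀ a ∈ Icc oo 1, ∀ b ∈ Icc oo 1, a ≤ b → ∀ s, Ax β a s ≤ Ax β b s := by
      intro a ha b hb hab s
      have gf : a² ≤ b² := by nlinarith [ha.1]
      exact rpow_le_rpow qp ql ql
    have m1 : MonotoneOn (Bw β) (Icc 0 1) := fun a ha b hb hab =>
      setIntegral_mono (Cn hβ ha) (Cn hβ hb) (ax a ha b hb hab)
    have dt : MonotoneOn (Dd β) (Icc 0 1) := by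
      intro a ha b hb hab
      refine setIntegral_mono (Bj hβ ha (De a)) (Bj hβ hb (De b)) ?_
      intro s
      have gf : a² ≤ b² := by nlinarith [ha.1]
      by_cases aa : 1 ≤ a²+s²
      · have ad : 1 ≤ b²+s² := ql
        simp only [Set.indicator, xs, aa, ad, if_true]
        exact ax a ha b hb hab s
      · simp only [Set.indicator, xs, aa, if_false]
        split_ifs
        · exact Be _ _ _
        · exact zu
    have sp := fun t ht => Gn (t := t) hβ ht
    refine ⟨fun t => 2 * Bw β t - Aq β t, ?_, (bh.const_mul 2).sub bp, ?_⟩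
    · intro a ha b hb hab
      have := m1 ha hb hab
      have := dt ha hb hab
      simp only
      rw [sp a ha, sp b hb]; linarith
    · intro a ha b hb hab
      have := m1 ha hb hab
      have := dt ha hb hab
      simp only
      rw [sp a ha, sp b hb]; exact (zq).2 ⟨ql, ql⟩
theorem Gq (hβ : xx < β) (hB : 0 < B) (hy : y ∈ Ico 0 B) :
    Ae β B y = Af β / π * B^xm β * Aq β (y/B) := by
  set t := y/B with ht
  have hyt : y = B*t := by rw [ht]; field_simp
  have al : 0 ≤ t := ux hy.1 hB.le
  have bp : t < 1 := (uw hB).2 hy.2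
  have jf : t² < 1 := by nlinarith
  have hss : √(1-t²) ≤ 1 := by rw [sqrt_le_iff]; exact ⟨qn, by nlinarith⟩
  have hset : Ioo 0 1 ∩ {s : ℝ | t²+s² < 1} = Ioo 0 (√(1-t²)) := by
    ext s
    simp only [Set.mem_inter_iff, Set.mem_Ioo, xs]
    constructor
    · rintro ⟨⟨aa, ad⟩, ag⟩
      exact ⟨aa, lt_sqrt_of_sq_lt ql⟩
    · rintro ⟨aa, ad⟩
      have := (lt_sqrt aa.le).1 ad
      exact ⟨⟨aa, ad.trans_le hss⟩, ql⟩
  have hi := (Cn hβ (t := t) ⟨al, bp.le⟩).mono_set (vk hss)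
  have h := Bx (f := fun s => B * √(t²+s²)) (f' := fun s => B * (s / √(t²+s²)))
    (g := fun r => r^xm β * (r²-y²)^(-xx:ℝ)) (h := fun s => B^xm β * Ax β t s) (s := Ioo 0 (√(1-t²)))
    (t := Ioo y B) qz ?_ ?_ ?_ ?_ ?_ (hi.const_mul _)
  · rw [Ae, h.2, qv, Aq, xv (Bq t), hset]; ring
  · ext r
    constructor
    · rintro ⟨s, hs, rfl⟩
      have ao := hs.1
      have bn := (lt_sqrt ao.le).1 hs.2
      constructor
      · rw [hyt]; refine mul_lt_mul_of_pos_left (lt_sqrt_of_sq_lt (by nlinarith)) hB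
      · have : √(t²+s²) < 1 := by rw [sqrt_lt' one_pos]; linarith
        simp only; nlinarith
    · rintro ⟨aa, ad⟩
      have di : t < r/B := by rw [lt_div_iff₀ hB]; linarith
      have fc : r/B < 1 := (uw hB).2 ad
      have ga : t² < (r/B)² := by nlinarith
      refine ⟨√((r/B)²-t²), ⟨sqrt_pos.2 ql, sqrt_lt_sqrt ql (by nlinarith)⟩, ?_⟩
      simp only
      rw [sq_sqrt ql, show t² + ((r/B)²-t²) = (r/B)² by ring, sqrt_sq ql]
      field_simp
  · intro s hs
    have ao := hs.1
    have : HasDerivAt (fun s : ℝ => t²+s²) (2*s) s := by simpa using (hasDerivAt_pow 2 s).const_add (t²)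
    refine ((this.sqrt qp).const_mul B).congr_deriv ?_
    have : √(t²+s²) ≠ 0 := qp
    field_simp
  · intro a ha b hb hab
    have aa := va hB.ne' hab
    rw [sqrt_inj qp qp] at aa
    have := ha.1; have := hb.1
    nlinarith
  · intro s hs
    have ao := hs.1
    positivity
  · intro s hs
    have ao := hs.1
    have p : 0 < √(t²+s²) := qp
    have aj : (B*√(t²+s²))² - y² = (B*s)² := by rw [xj, sq_sqrt qp, hyt]; ring
    have ak : ((B*s)²)^(-xx:ℝ) = (B*s)⁻¹ := by
      rw [← vd, ← vf qp]; norm_num; rw [rpow_neg_one]; field_simp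
    have be : Ax β t s = √(t²+s²)^xm β / √(t²+s²) := by
      rw [← rpow_sub_one p.ne', xd, ← vf qp, Ax]; congr 1; ring
    rw [aj, ak, be, mul_rpow hB.le p.le]
    field_simp
theorem Eu {A : ℕ → ℝ → ℂ} {am : ℝ → ℂ} {e : ℕ → ℝ → ℂ} {g : ℝ → ℝ} {h : ℕ → ℝ}
    (hA : ∀ t > 0, Tt (fun i => A i t) (am t))
    (hAm : ∀ i, Measurable (A i)) (hAg : ∀ᶠ i in atTop, ∀ t > 0, ‖A i t‖ ≤ g t)
    (hg : IntegrableOn g (Ioi 0)) (hga : AntitoneOn g (Ioi 0))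
    (gg : ContinuousOn am (Ioi 0)) (hem : ∀ i, Measurable (e i)) (he : ∀ i t, ‖e i t‖ ≤ 1)
    (hh : ∀ i, 0 < h i) (cz : Tt h 0)
    (hs : ∀ t > 0, Tt (fun i => e i t + e i (t + h i)) 0) :
    Tt (fun i => ∫ t in Ioi 0, A i t * e i t) 0 := by
  have en : ∀ t > 0, ‖am t‖ ≤ g t := fun t ht =>
    le_of_tendsto (hA t ht).norm (hAg.mono fun i hi => hi t ht)
  have ff : AEStronglyMeasurable am (volume.restrict (Ioi 0)) :=
    gg.aestronglyMeasurable qh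
  have fg : IntegrableOn am (Ioi 0) := by
    refine Integrable.mono' hg ff ?_
    filter_upwards [qx qh] with t ht using en t ht
  have dl : ∀ i, IntegrableOn (fun t => am t * e i t) (Ioi 0) := fun i =>
    fg.mul_bdd (c := 1) (hem i).aestronglyMeasurable (.of_forall (he i))
  have aa : Tt (fun i => ∫ t in Ioi 0, (A i t - am t) * e i t) 0 := by
    have := tendsto_integral_filter_of_dominated_convergence (μ := volume.restrict (Ioi oo))
      (F := fun i t => (A i t - am t) * e i t) (f := fun _ => (0:ℂ)) (l := atTop) (fun t => 2 * g t)
      (.of_forall fun i => ((hAm i).aestronglyMeasurable.sub ff).mul (hem i).aestronglyMeasurable) ?_ (hg.const_mul 2) ?_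
    · simpa using this
    · filter_upwards [hAg] with i hi
      filter_upwards [qx qh] with t ht
      rw [qk]
      calc _ ≤ (‖A i t‖ + ‖am t‖) * 1 := xf (ve _ _) (he i t) (zk _) qp
        _ ≤ 2 * g t := by linarith [hi t ht, en t ht]
    · filter_upwards [qx qh] with t ht
      refine squeeze_zero_norm (a := fun i => ‖A i t - am t‖) (fun i => ?_) ?_
      · rw [qk]; exact zf (zk _) (he i t)
      · have := ((hA t ht).sub_const (am t)).norm; simpa using this
  have hsh : ∀ i, IntegrableOn (fun t => am (t + h i) * e i (t + h i)) (Ioi 0) ∧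
      ∫ t in Ioi 0, am (t + h i) * e i (t + h i) = ∫ t in Ioi (h i), am t * e i t := by
    intro i
    have hp := (measurePreserving_add_right volume (h i))
    have hE := (MeasurableEquiv.addRight (h i)).measurableEmbedding
    have hpre : (fun t => t + h i) ⁻¹' (Ioi (h i)) = Ioi 0 := by ext; simp
    constructor
    · have := (hp.integrableOn_comp_preimage hE (f := fun t => am t * e i t) (s := Ioi (h i))).2
        ((dl i).mono_set (Set.Ioi_subset_Ioi (hh i).le))
      rwa [hpre] at this
    · rw [← hpre]; exact hp.setIntegral_preimage_emb hE (fun t => am t * e i t) _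
  have ad : Tt (fun i => ∫ t in Ioi 0, (am t * e i t + am (t + h i) * e i (t + h i))) 0 := by
    have := tendsto_integral_filter_of_dominated_convergence (μ := volume.restrict (Ioi oo))
      (F := fun i t => am t * e i t + am (t + h i) * e i (t + h i)) (f := fun _ => (0:ℂ)) (l := atTop) (fun t => 2 * g t)
      (.of_forall fun i => ((dl i).add (hsh i).1).aestronglyMeasurable) ?_ (hg.const_mul 2) ?_
    · simpa using this
    · refine .of_forall fun i => ?_
      filter_upwards [qx qh] with t ht
      have ht' : 0 < t := ht
      have p := hh i
      have q : g (t + h i) ≤ g t := hga ht (show 0 < t + h i by linarith) ql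
      refine (vj _ _).trans ?_
      rw [qk, qk]
      have bf := zf (zk (am t)) (he i t)
      have bk := zf (zk (am (t+h i))) (he i (t+h i))
      linarith [en t ht, en (t + h i) ql]
    · filter_upwards [qx qh] with t ht
      have ht' : 0 < t := ht
      have az : Tt (fun i => am (t + h i)) (am t) := by
        have : Tt (fun i => t + h i) t := by simpa using cz.const_add t
        exact ((gg.continuousAt (Ioi_mem_nhds ht')).tendsto).comp this
      have ay : Tt (fun i => am t * (e i t + e i (t + h i))) 0 := by
        simpa using (hs t ht).const_mul (am t)
      have ca : Tt (fun i => (am (t + h i) - am t) * e i (t + h i)) 0 := by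
        refine squeeze_zero_norm (a := fun i => ‖am (t + h i) - am t‖) (fun i => ?_) ?_
        · rw [qk]; exact zf (zk _) (he i _)
        · have := (az.sub_const (am t)).norm; simpa using this
      have := ay.add ca
      rw [vu] at this
      exact this.congr fun i => by ring
  have ag : Tt (fun i => ∫ t in Ioc 0 (h i), am t * e i t) 0 := by
    have hz : Tt (fun i => ∫ t in Ioc 0 (h i), ‖am t‖) 0 := by
      have hc : Tt (fun i => ∫ t in Ioi oo, Set.indicator (Ioc 0 (h i)) (fun t => ‖am t‖) t) (∫ t in Ioi oo, oo) := by
        refine tendsto_integral_filter_of_dominated_convergence (fun t => ‖am t‖) (.of_forall fun i => ff.norm.indicator zm) (.of_forall fun i => .of_forall fun t => ?_) fg.norm ?_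
        · rw [Set.indicator_apply]; split_ifs <;> simp
        · filter_upwards [qx qh] with t ht
          refine xa ?_
          filter_upwards [cz.eventually_lt_const ht] with i hi
          rw [Set.indicator_of_notMem]; simp; intro _; exact hi
      simp only [integral_zero] at hc
      refine hc.congr fun i => ?_
      rw [xv zm, Set.inter_eq_right.2 Set.Ioc_subset_Ioi_self]
    refine squeeze_zero_norm (fun i => ?_) hz
    refine norm_integral_le_of_norm_le ((fg.mono_set Set.Ioc_subset_Ioi_self).norm) (.of_forall fun t => ?_)
    rw [qk]; exact zf (zk _) (he i _)
  have ar : Tt (fun i => ∫ t in Ioi 0, am t * e i t) 0 := by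
    have := (ad.add ag).const_mul xx
    simp only [vu, xo] at this
    refine this.congr fun i => ?_
    rw [wo (dl i) (hsh i).1, (hsh i).2]
    have hu : Ioi oo = Ioc 0 (h i) ∪ Ioi (h i) := (Set.Ioc_union_Ioi_eq_Ioi (hh i).le).symm
    have := setIntegral_union (f := fun t => am t * e i t) (μ := volume) (Set.Ioc_disjoint_Ioi zu) qh
      ((dl i).mono_set (by rw [hu]; exact Set.subset_union_left)) ((dl i).mono_set (by rw [hu]; exact Set.subset_union_right))
    rw [← hu] at this
    rw [this]; ring
  have := aa.add ar
  rw [vu] at this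
  refine Tendsto.congr' ?_ this
  filter_upwards [hAg] with i hi
  have : IntegrableOn (fun t => A i t * e i t) (Ioi 0) := by
    refine Integrable.mul_bdd (c := 1) (Integrable.mono' hg (hAm i).aestronglyMeasurable ?_) (hem i).aestronglyMeasurable (.of_forall (he i))
    filter_upwards [qx qh] with t ht using hi t ht
  rw [← wo _ (dl i)]
  · congr 1; ext t; ring
  · have := this.sub (dl i); refine this.congr (.of_forall fun t => ?_); simp; ring
noncomputable def Ah (z : ℂ) (y : ℝ) : ℝ := log ‖1 + z / (y:ℂ)²‖
theorem Br (s y : ℝ) : Ah (s:ℂ) y = Ac s y := by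
  unfold Ah Ac
  rw [← qy, ← qu]; push_cast; rfl
theorem Dg (z : ℂ) : Measurable (Ah z) := by unfold Ah; fun_prop
theorem Gr (κ : ℂ) (hκ : 0 ≤ κ.re) :
    IntegrableOn (fun φ : ℝ => log ‖1 + κ²/xc (tan xh φ)²‖) (Ioo 0 π) ∧
    ∫ φ in Ioo 0 π, log ‖1 + κ²/xc (tan xh φ)²‖ = 2 * π * log ‖1 + κ‖ := by
  have pp := zp
  have hsc : ∀ φ ∈ Ioo 0 π, 0 < sin xh φ ∧ 0 < cos xh φ := fun φ h =>
    ⟨sin_pos_of_pos_of_lt_pi (by linarith [h.1]) (by linarith [h.1, h.2]), cos_pos_of_mem_Ioo ⟨by linarith [h.1], by linarith [h.2]⟩⟩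
  have dm : 1 + κ ≠ 0 := fun h => by have := congrArg Complex.re h; simp at this; linarith
  have key : ∀ φ ∈ Ioo 0 π, 1 + κ²/xc (tan xh φ)² = (1-κ²) + κ²/xc (sin xh φ)² := by
    intro φ h
    obtain ⟨s, c⟩ := hsc φ h
    have s' : xc (sin xh φ) ≠ 0 := by exact_mod_cast s.ne'
    have c' : xc (cos xh φ) ≠ 0 := by exact_mod_cast c.ne'
    rw [tan_eq_sin_div_cos]
    have := congrArg (fun x : ℝ => (x:ℂ)) (sin_sq_add_cos_sq xh φ)
    simp only [Complex.ofReal_add, Complex.ofReal_pow, Complex.ofReal_one] at this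
    rw [Complex.ofReal_div]
    field_simp
    linear_combination κ² * this
  by_cases aa : κ = 1
  · subst aa
    obtain ⟨av, ak⟩ := Cy (w := 1) (by simp)
    rw [qw pp.le, qj] at ak
    rw [qm pp.le] at av
    have bj : IntegrableOn (fun _ : ℝ => 2 * log 2) (Ioo 0 π) := integrableOn_const (by simp)
    have e : Set.EqOn (fun φ : ℝ => log ‖1 + (1:ℂ)²/xc (tan xh φ)²‖) (fun φ => 2 * log 2 - Ar 1 φ) (Ioo 0 π) := by
      intro φ h
      obtain ⟨s, c⟩ := hsc φ h
      have := Cb (w := 1) one_ne_zero φ s.ne'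
      simp only
      rw [key φ h]
      have s' : xc (sin xh φ) ≠ 0 := by exact_mod_cast s.ne'
      simp only [sub_self, ne_eq, OfNat.ofNat_ne_zero, not_false_eq_true, zero_pow, zero_div, vu, zb] at this
      have fh : 4 * xc (sin xh φ)² ≠ 0 := wq qn (vc _ s')
      have ad : (cis φ - 1) * (cin φ - 1) = 4 * xc (sin xh φ)² := by
        rw [eq_comm, div_eq_one_iff_eq fh] at this; exact this
      have bm : cis φ - 1 ≠ 0 := fun h => by rw [h] at ad; exact fh (by rw [← ad]; ring)
      have cq : cin φ - 1 ≠ 0 := fun h => by rw [h] at ad; exact fh (by rw [← ad]; ring)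
      rw [Ar, ← ws ((qs).2 bm) ((qs).2 cq), ← qk, ad]
      simp only [qk, xi, qu, qy, qt s, wr, norm_one, one_pow, sub_self, vb]
      rw [ws (by simp) qp]
      norm_num
      rw [show (4:ℝ) = 2² by norm_num, log_pow]; push_cast; ring
    constructor
    · exact (bj.sub av).congr_fun e.symm qz
    · rw [za qz e, we bj av, ak]
      simp [pp.le]; norm_num; ring
  have du : 1 - κ ≠ 0 := (xg).2 (Ne.symm aa)
  obtain ⟨aq, aj⟩ := Cz (w := (1-κ)/(1+κ)) (div_ne_zero du dm) (by
    rw [wr, xl (norm_pos_iff.2 dm), ← sq_le_sq₀ (zk _) (zk _), ← Complex.normSq_eq_norm_sq, ← Complex.normSq_eq_norm_sq]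
    simp only [Complex.normSq_apply, ur, vh, Complex.sub_im, uh, Complex.one_re, Complex.one_im]
    nlinarith)
  have bj : IntegrableOn (fun _ : ℝ => log ‖1-κ²‖) (Ioo 0 π) := by simp
  have hf : 1 - κ² = (1-κ)*(1+κ) := by ring
  have e : (fun φ : ℝ => log ‖1 + κ²/xc (tan xh φ)²‖) =ᵐ[volume.restrict (Ioo 0 π)] (fun φ => log ‖1-κ²‖ + log ‖1 + (1-(1-κ)/(1+κ))²/(4*((1-κ)/(1+κ))*xc (sin xh φ)²)‖) := by
    filter_upwards [qx qz, Ei ((1-κ)/(1+κ))] with φ h hx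
    obtain ⟨s, c⟩ := hsc φ h
    have s' : xc (sin xh φ) ≠ 0 := by exact_mod_cast s.ne'
    have hfac := Cb (w := (1-κ)/(1+κ)) (div_ne_zero du dm) φ s.ne'
    rw [key φ h, ← ws, ← qk]
    · congr 2; rw [hf]; field_simp; ring
    · rw [hf]; exact (qs).2 (wq du dm)
    · rw [qs, hfac]
      exact div_ne_zero (wq ((xg).2 hx.1) ((xg).2 hx.2)) (wq (wq qn (div_ne_zero du dm)) (vc _ s'))
  constructor
  · exact (Integrable.add bj aq).congr e.symm
  · rw [integral_congr_ae e, wo bj aq, aj, hf, qk, wr, ws (by simpa using du) (by simpa using dm), log_div (by simpa using du) (by simpa using dm)]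
    simp [pp.le]; ring
theorem Cf {v : ℂ} (hv : 0 ≤ v.re) (hc : 0 < c) :
    IntegrableOn (fun y : ℝ => Ah (v²) y * (c/(c²+y²))) (Ioi 0) ∧
    ∫ y in Ioi 0, Ah (v²) y * (c/(c²+y²)) = π * log ‖1 + v/c‖ := by
  have pp := zp
  obtain ⟨i, e⟩ := Gr (v/c) (by rw [Complex.div_ofReal_re]; positivity)
  have hsc : ∀ φ ∈ Ioo 0 π, 0 < cos xh φ := fun φ h => cos_pos_of_mem_Ioo ⟨by linarith [h.1], by linarith [h.2]⟩
  have := Bx (f := fun φ => c * tan xh φ) (f' := fun φ => c * (1/cos xh φ² * xx))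
    (g := fun y => Ah (v²) y * (c/(c²+y²))) (h := fun φ => xx * log ‖1 + (v/c)²/xc (tan xh φ)²‖)
    (s := Ioo 0 π) (t := Ioi 0) qz ?_ ?_ ?_ ?_ ?_ (i.const_mul _)
  · refine ⟨this.1, ?_⟩
    rw [this.2, qv, e]; ring
  · ext y
    simp only [Set.mem_image, Set.mem_Ioi]
    constructor
    · rintro ⟨φ, h, rfl⟩
      exact mul_pos hc (tan_pos_of_pos_of_lt_pi_div_two (by linarith [h.1]) (by linarith [h.2]))
    · intro hy
      refine ⟨2 * arctan (y/c), ⟨by have := arctan_pos.2 (uj hy hc); linarith, by have := arctan_lt_pi_div_two (y/c); linarith⟩, ?_⟩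
      rw [mul_div_cancel_left₀ _ (by norm_num : (2:ℝ) ≠ 0), tan_arctan]; field_simp
  · intro φ h
    exact ((hasDerivAt_tan (hsc φ h).ne').comp φ ((hasDerivAt_id φ).div_const 2)).const_mul c
  · intro a ha b hb hab
    have := injOn_tan ⟨by linarith [ha.1, zp], by linarith [ha.2]⟩ ⟨by linarith [hb.1, zp], by linarith [hb.2]⟩ (va hc.ne' hab)
    linarith
  · intro φ h; have := hsc φ h; positivity
  · intro φ h
    have ah := hsc φ h
    have aj : v² / xc (c * tan xh φ)² = (v/c)²/xc (tan xh φ)² := by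
      rw [Complex.ofReal_mul, xj, div_pow, div_div]
    have ak : c * (1/cos xh φ² * xx) * (c/(c²+(c*tan xh φ)²)) = xx := by
      rw [tan_eq_sin_div_cos]
      have := sin_sq_add_cos_sq xh φ
      have ag : c²+(c*(sin xh φ/cos xh φ))² = c²/cos xh φ² := by
        field_simp; linarith
      rw [ag]; field_simp
    simp only [Ah]
    rw [aj]; linear_combination (log ‖1 + (v/c)²/xc (tan xh φ)²‖) * ak
theorem Dh {ζ : ℂ} (h : ‖ζ‖ ≤ xx) : |log ‖1+ζ‖| ≤ 2 * ‖ζ‖ := by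
  have aa : 1 - ‖ζ‖ ≤ ‖1+ζ‖ := by have := ve (1+ζ) ζ; rw [add_sub_cancel_right, norm_one] at this; linarith
  have ad : ‖1+ζ‖ ≤ 1 + ‖ζ‖ := by have := vj (1:ℂ) ζ; rwa [norm_one] at this
  have ah := zk ζ
  have p : 0 < ‖1+ζ‖ := ql
  rw [zq]
  constructor
  · have := one_sub_inv_le_log_of_pos p
    have ag : ‖1+ζ‖⁻¹ ≤ 1 + 2*‖ζ‖ := by
      rw [inv_le_iff_one_le_mul₀ p]; nlinarith
    linarith
  · have := vl p; linarith
theorem Di {v : ℂ} (hv : 0 ≤ v.re) :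
    IntegrableOn (Ah (v²)) (Ioi 0) ∧ ∫ y in Ioi 0, Ah (v²) y = π * v.re := by
  set R := 1 + 2 * ‖v‖ with hR
  have dv := zk v
  have hi : IntegrableOn (Ah (v²)) (Ioi 0) := by
    have aq := (Cf hv one_pos).1.norm.const_mul (1+R²)
    have av : IntegrableOn (fun y : ℝ => 4*‖v‖² * (1+y²)⁻¹) (Ioi 0) := (un _).integrableOn
    refine Integrable.mono' (aq.add av) (Dg _).aestronglyMeasurable ?_
    filter_upwards [qx qh] with y hy
    have hy' : oo < y := hy
    have q : 0 ≤ |Ah (v²) y| := zr _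
    simp only [Pi.add_apply, qk, wr, qy, abs_one, one_pow]
    rw [qt (by positivity : oo < 1 + y²)]
    rcases vw y R with h | h
    · have : |Ah (v²) y| ≤ (1+R²) * (|Ah (v²) y| * (1/(1+y²))) := by
        rw [mul_one_div, mul_div_assoc', zt qp, uf]
        exact qb (by nlinarith) q
      have : 0 ≤ 4*‖v‖² * (1+y²)⁻¹ := qp
      linarith
    · have eo : 1 ≤ y := ql
      have hz : ‖v²/(y:ℂ)²‖ = ‖v‖²/y² := by simp
      have hs : ‖v²/(y:ℂ)²‖ ≤ xx := by
        rw [hz, qc qp]; nlinarith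
      have aa := Dh hs
      have ad : 2 * (‖v‖²/y²) ≤ 4*‖v‖² * (1+y²)⁻¹ := by
        rw [← wd, mul_div_assoc', wg qp qp]
        nlinarith [zd ‖v‖, zo (zd ‖v‖) (by nlinarith : 0 ≤ y²-1)]
      rw [hz] at aa
      have : 0 ≤ (1+R²) * (|Ah (v²) y| * (1/(1+y²))) := qp
      unfold Ah at *
      linarith
  refine ⟨hi, ?_⟩
  have bp : Tt (fun n : ℕ => ∫ y in Ioi 0, (n:ℝ) * (Ah (v²) y * (n/((n:ℝ)²+y²)))) (∫ y in Ioi 0, Ah (v²) y) := by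
    refine tendsto_integral_of_dominated_convergence (fun y => ‖Ah (v²) y‖) (fun n => ?_) hi.norm (fun n => .of_forall fun y => ?_) (.of_forall fun y => ?_)
    · exact (((Dg _).mul qf).const_mul _).aestronglyMeasurable
    · rw [show (n:ℝ) * (Ah (v²) y * (n/((n:ℝ)²+y²))) = Ah (v²) y * (n²/((n:ℝ)²+y²)) by ring, qk]
      refine zf (zk _) ?_
      rw [qd qp]
      exact div_le_one_of_le₀ (by nlinarith) qp
    · have : Tt (fun n : ℕ => (n:ℝ)²/((n:ℝ)²+y²)) 1 := by
        have aa : Tt (fun n : ℕ => 1 - y² / ((n:ℝ)²+y²)) (1-0) := by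
          refine tendsto_const_nhds.sub (xw ?_)
          exact tendsto_atTop_add_const_right _ _ ((tendsto_pow_atTop two_ne_zero).comp tendsto_natCast_atTop_atTop)
        rw [ze] at aa
        refine aa.congr' ?_
        filter_upwards [qr 0] with n hn
        have : oo < n := by exact_mod_cast hn
        field_simp; ring
      have := this.const_mul (Ah (v²) y)
      rw [zb] at this
      exact this.congr fun n => by ring
  have bh : Tt (fun n : ℕ => π * log ‖(1 + v/n)^n‖) (π * log ‖qe v‖) :=
    ((Complex.tendsto_one_add_div_pow_exp v).norm.log (by simp)).const_mul π
  rw [Complex.norm_exp, log_exp] at bh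
  refine tendsto_nhds_unique bp (bh.congr' ?_)
  filter_upwards [qr 0] with n hn
  have hn' : oo < n := by exact_mod_cast hn
  rw [qv, (Cf hv hn').2, xi, log_pow]; push_cast; ring
theorem Cg (hβ : xx < β) (B y : ℝ) : 0 ≤ Ae β B y ∨ y < 0 := by
  rcases lt_or_ge y 0 with h | h
  · exact Or.inr h
  left
  unfold Ae
  refine zo (ux (Bo ql).le zx) (setIntegral_nonneg qz fun r hr => ?_)
  have := hr.1
  exact zo (rpow_nonneg ql _) (rpow_nonneg (by nlinarith) _)
noncomputable def Aj (B y : ℝ) : ℝ := 2 * arcsin (y/B)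
noncomputable def Bb (B : ℝ) (η : ℂ) (y : ℝ) : ℂ :=
  Complex.log (1 - qe (Aj B y * jj) * η) + Complex.log (1 - qe (-(Aj B y * jj)) * η)
noncomputable def Bk (ρ : ℝ → ℝ) (B : ℝ) (η : ℂ) : ℂ := ∫ y in Ioo 0 B, (ρ y : ℂ) * Bb B η y
theorem Ev (B : ℝ) : Measurable (Aj B) := by unfold Aj; fun_prop
theorem Ai (t : ℝ) : ‖cis t‖ = 1 ∧ ‖cin t‖ = 1 := by
  refine ⟨vq t, ?_⟩
  rw [← neg_mul, ← Complex.ofReal_neg]; exact vq _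
theorem Dj {a η : ℂ} (ha : ‖a‖ = 1) : 1 - ‖η‖ ≤ (1 - a*η).re := by
  have := (zw (a*η)); rw [qk, ha, wj] at this
  simp only [ur, Complex.one_re]; linarith
theorem Dk {a η : ℂ} (ha : ‖a‖ = 1) (h : ‖η‖ < 1) : 1 - a*η ∈ Complex.slitPlane :=
  Complex.mem_slitPlane_iff.2 (Or.inl (by linarith [Dj (η := η) ha]))
theorem Dl (B : ℝ) (η : ℂ) : Measurable (Bb B η) := by
  have := Ev B
  unfold Bb; fun_prop
theorem Co (B : ℝ) (η : ℂ) (y : ℝ) : (Bb B η y).re = Ar η (Aj B y) := by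
  unfold Bb Ar
  have h : ∀ x : ℂ, 1 - qe x * η = qe x * (qe (-x) - η) := fun x => by
    rw [mul_sub, ← zh]; simp
  rw [vh, Complex.log_re, Complex.log_re, h, h (-_), qk, qk, (Ai _).1, (Ai _).2, wj, wj, neg_neg, add_comm]
theorem Gs {η : ℂ} (hr : r < 1) (h : ‖η‖ ≤ r) (y : ℝ) : ‖Bb B η y‖ ≤ 2 * (log 2 - log (1-r) + π) := by
  have key : ∀ a : ℂ, ‖a‖ = 1 → ‖Complex.log (1 - a*η)‖ ≤ log 2 - log (1-r) + π := by
    intro a ha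
    have au : 0 ≤ r := (zk _).trans h
    have aa : 1 - r ≤ ‖1 - a*η‖ := by
      have := Dj (η := η) ha; have := zw (1-a*η); linarith
    have ad : ‖1 - a*η‖ ≤ 2 := by
      refine (ve _ _).trans ?_
      rw [qk, ha]; simp; linarith
    have p : 0 < 1 - r := ql
    have bu := zv p aa
    have bw := zv ql ad
    have da : log (1-r) ≤ 0 := log_nonpos p.le ql
    have jg : 0 ≤ log 2 := log_nonneg qn
    rw [← Complex.re_add_im (Complex.log _)]
    refine (vj _ _).trans ?_
    rw [qk, Complex.norm_I, zb, qu, qu, Complex.log_re, Complex.log_im]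
    refine add_le_add ?_ (Complex.abs_arg_le_pi _)
    rw [qy, zq]; constructor <;> linarith
  refine (vj _ _).trans ?_
  linarith [key _ (Ai (Aj B y)).1, key _ (Ai (Aj B y)).2]
theorem Ew {ρ : ℝ → ℝ} (hi : IntegrableOn ρ (Ioo 0 B)) {η : ℂ} (h : ‖η‖ < 1) :
    IntegrableOn (fun y => (ρ y : ℂ) * Bb B η y) (Ioo 0 B) :=
  (Integrable.ofReal hi).mul_bdd (Dl B η).aestronglyMeasurable (.of_forall fun y => Gs h zu y)
theorem Gt {ρ : ℝ → ℝ} (hi : IntegrableOn ρ (Ioo 0 B)) :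
    DifferentiableOn ℂ (Bk ρ B) (Metric.ball 0 1) := by
  intro af ah
  rw [mem_ball_zero_iff] at ah
  obtain ⟨r, aa, ad⟩ := exists_between ah
  have hs : Metric.ball (0:ℂ) r ∈ 𝓝 af := Metric.isOpen_ball.mem_nhds (by simpa using aa)
  refine DifferentiableAt.differentiableWithinAt ?_
  set F' : ℂ → ℝ → ℂ := fun η y => (ρ y:ℂ) * (-(qe (Aj B y * jj)) / (1 - qe (Aj B y * jj) * η) + -(qe (-(Aj B y * jj))) / (1 - qe (-(Aj B y * jj)) * η)) with hF'
  have hm : ∀ η, AEStronglyMeasurable (F' η) (volume.restrict (Ioo 0 B)) := by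
    intro η
    have := Ev B
    refine (Integrable.ofReal hi).aestronglyMeasurable.mul (Measurable.aestronglyMeasurable ?_)
    fun_prop
  refine (hasDerivAt_integral_of_dominated_loc_of_deriv_le (μ := volume.restrict (Ioo 0 B)) (F := fun η y => (ρ y : ℂ) * Bb B η y) (F' := F') (bound := fun y => |ρ y| * (2/(1-r))) hs ?_ (Ew hi ah) (hm _) ?_ (hi.abs.mul_const _) ?_).2.differentiableAt
  · refine .of_forall fun η => (Integrable.ofReal hi).aestronglyMeasurable.mul (Dl B η).aestronglyMeasurable
  · refine .of_forall fun y η hη => ?_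
    rw [mem_ball_zero_iff] at hη
    have key : ∀ a : ℂ, ‖a‖ = 1 → ‖-a/(1-a*η)‖ ≤ 1/(1-r) := by
      intro a ha
      have := Dj (η := η) ha; have := zw (1-a*η)
      rw [wr, norm_neg, ha]
      exact one_div_le_one_div_of_le ql ql
    rw [hF', qk, qu, qy]
    refine qq ((vj _ _).trans ?_) (zr _)
    have := key _ (Ai (Aj B y)).1; have := key _ (Ai (Aj B y)).2
    have : 2/(1-r) = 1/(1-r)+1/(1-r) := by ring
    linarith
  · refine .of_forall fun y η hη => ?_
    rw [mem_ball_zero_iff] at hη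
    have key : ∀ a : ℂ, ‖a‖ = 1 → HasDerivAt (fun η => Complex.log (1-a*η)) (-a/(1-a*η)) η := by
      intro a ha
      refine HasDerivAt.clog ?_ (Dk ha (hη.trans ad))
      simpa using ((hasDerivAt_id η).const_mul a).const_sub 1
    exact ((key _ (Ai (Aj B y)).1).add (key _ (Ai (Aj B y)).2)).const_mul _
theorem Gu {ρ : ℝ → ℝ} {η : ℂ} (h : ‖η‖ < 1) :
    Bk ρ B ((starRingEnd ℂ) η) = (starRingEnd ℂ) (Bk ρ B η) := by
  unfold Bk
  rw [← integral_conj]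
  congr 1; ext y
  have az : (starRingEnd ℂ) (qe (Aj B y * jj)) = qe (-(Aj B y * jj)) := by
    rw [← us]; simp
  have ay : (starRingEnd ℂ) (qe (-(Aj B y * jj))) = qe (Aj B y * jj) := by
    rw [← az, Complex.conj_conj]
  unfold Bb
  rw [map_mul, map_add, Complex.conj_ofReal, ← Complex.log_conj, ← Complex.log_conj, map_sub, map_sub, map_mul, map_mul, az, ay, map_one, add_comm (Complex.log _)]
  · exact vr (Dk (Ai _).2 h)
  · exact vr (Dk (Ai _).1 h)
theorem Ex (hy : y ∈ Ioo 0 B) : Aj B y ∈ Ioo 0 π ∧ sin (Aj B y / 2) = y/B := by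
  have hB : 0 < B := hy.1.trans hy.2
  have aa : y/B < 1 := (uw hB).2 hy.2
  have ah : 0 < y/B := uj hy.1 hB
  unfold Aj
  refine ⟨⟨by have := arcsin_pos.2 ah; linarith, by have := arcsin_lt_pi_div_two.2 aa; linarith⟩, ?_⟩
  rw [mul_div_cancel_left₀ _ (by norm_num : (2:ℝ) ≠ 0), sin_arcsin ql aa.le]
theorem Ey (hy : y ∈ Ioo 0 B) {η : ℂ} (ah : η ≠ 0) (aa : qe (Aj B y * jj) ≠ η)
    (ad : qe (-(Aj B y * jj)) ≠ η) :
    Ah (B²*(1-η)²/(4*η)) y = Ar η (Aj B y) - log ‖η‖ - log (4*y²/B²) := by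
  have hB : 0 < B := hy.1.trans hy.2
  obtain ⟨m, e⟩ := Ex hy
  have y0 := hy.1
  have f := Cb ah (Aj B y) (by rw [e]; positivity)
  rw [e] at f
  have hB' : (B:ℂ) ≠ 0 := by exact_mod_cast hB.ne'
  have hy' : (y:ℂ) ≠ 0 := by exact_mod_cast y0.ne'
  unfold Ah Ar
  rw [show (B:ℂ)²*(1-η)²/(4*η)/(y:ℂ)² = (1-η)²/(4*η*xc (y/B)²) by push_cast; field_simp, f, wr, qk, log_div, ws, qk, ws, qk, ws]
  · simp only [xi, qu, qy, sq_abs]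
    rw [log_div, ws, div_pow, log_div] <;> first | positivity | skip
    norm_num; ring
  · simp
  · simpa using ah
  · exact (qs).2 (wq qn ah)
  · exact (qs).2 (vc _ (by exact_mod_cast (by positivity : y/B ≠ 0)))
  · exact (qs).2 ((xg).2 aa)
  · exact (qs).2 ((xg).2 ad)
  · rw [← qk]; exact (qs).2 (wq ((xg).2 aa) ((xg).2 ad))
  · exact (qs).2 (wq (wq qn ah) (vc _ (by exact_mod_cast (by positivity : y/B ≠ 0))))
theorem Dm (hs : s ∈ Ioo 0 (2*π)) : Complex.arg (1 - cis s) = (s-π)/2 := by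
  have h : 1 - cis s = xc (2 * sin xh s) * (Complex.cos ((s-π)/2 : ℝ) + Complex.sin ((s-π)/2 : ℝ) * jj) := by
    rw [Complex.exp_mul_I]
    have aj : cos ((s-π)/2) = sin xh s := by rw [show (s-π)/2 = -(π/2 - s/2) by ring, cos_neg, cos_pi_div_two_sub]
    have ak : sin ((s-π)/2) = -cos xh s := by rw [show (s-π)/2 = -(π/2 - s/2) by ring, sin_neg, sin_pi_div_two_sub]
    have be : cos s = 1 - 2*sin xh s² := by have := cos_sq' xh s; have ad := cos_two_mul xh s; rw [show 2*xh s = s by ring] at ad; linarith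
    have bq : sin s = 2*sin xh s*cos xh s := by rw [← sin_two_mul]; ring_nf
    rw [← ut, ← Complex.ofReal_sin, ← ut, ← Complex.ofReal_sin, aj, ak, be, bq]
    push_cast; ring
  rw [h, Complex.arg_mul_cos_add_sin_mul_I]
  · have := sin_pos_of_pos_of_lt_pi (x := s/2) (by linarith [hs.1]) (by linarith [hs.2]); positivity
  · constructor <;> linarith [hs.1, hs.2, zp]
theorem Gv (hs : s ∈ Ioo (-(2*π)) 0) : Complex.arg (1 - cis s) = (s+π)/2 := by
  have := Dm (s := s+2*π) ⟨by linarith [hs.1], by linarith [hs.2]⟩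
  rw [show xc (s+2*π) * jj = s * jj + 2*π*jj by push_cast; ring, Complex.exp_periodic] at this
  rw [this]; ring
theorem Ch (hθ : θ ∈ Ioo 0 π) (hy : y ∈ Ioo 0 B) (hne : y ≠ B * sin xh θ) :
    qe (Aj B y * jj) ≠ cis θ ∧ qe (-(Aj B y * jj)) ≠ cis θ ∧
    Bb B (cis θ) y = xc (Ac (-(B*sin xh θ)²) y + log (4*y²/B²)) +
      xc (if y < B * sin xh θ then θ - π else θ) * jj := by
  have hB : 0 < B := hy.1.trans hy.2
  obtain ⟨m, e⟩ := Ex hy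
  set τ := Aj B y with hτ
  have hy' : y = B * sin xh τ := by rw [e]; field_simp
  have hsin : ∀ a ∈ Ioo 0 π, ∀ b ∈ Ioo 0 π, a < b → sin xh a < sin xh b := fun a ha b hb hab =>
    sin_lt_sin_of_lt_of_le_pi_div_two (by linarith [ha.1, zp]) (by linarith [hb.2]) ql
  have hτθ : τ ≠ θ := fun h => hne (by rw [hy', h])
  have hiff : y < B * sin xh θ ↔ τ < θ := by
    rw [hy', mul_lt_mul_iff_right₀ hB]
    constructor
    · intro h; by_contra hc
      rcases eq_or_lt_of_le (not_lt.1 hc) with aa | aa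
      · exact hτθ aa.symm
      · exact (hsin _ hθ _ m aa).not_gt h
    · exact hsin _ m _ hθ
  have bm : cis τ ≠ cis θ := by
    intro h
    have aa := congrArg Complex.re h
    rw [zg, zg] at aa
    exact hτθ (injOn_cos ⟨m.1.le, m.2.le⟩ ⟨hθ.1.le, hθ.2.le⟩ aa)
  have cq : cin τ ≠ cis θ := by
    intro h
    have aa := congrArg Complex.im h
    rw [← neg_mul, ← Complex.ofReal_neg, Complex.exp_ofReal_mul_I_im, Complex.exp_ofReal_mul_I_im, sin_neg] at aa
    have := sin_pos_of_pos_of_lt_pi m.1 m.2; have := sin_pos_of_pos_of_lt_pi hθ.1 hθ.2; linarith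
  refine ⟨bm, cq, Complex.ext ?_ ?_⟩
  · have hs := Ey hy (zc (θ*jj)) bm cq
    rw [Co, vh, zs, uu, Complex.I_re, xo, vu, ← Br]
    have be : (B:ℂ)²*(1-cis θ)²/(4*cis θ) = xc (-(B*sin xh θ)²) := by
      have bq : cis θ = qe (θ/2*jj)² := by rw [← xe]; congr 1; push_cast; ring
      have n := zc ((θ/2:ℂ)*jj)
      push_cast
      rw [bq, Complex.sin, show -((θ:ℂ)/2)*jj = -(θ/2*jj) by ring, Complex.exp_neg]
      field_simp
      ring_nf; simp only [wl]; ring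
    rw [be, (Ai θ).1, log_one] at hs
    rw [hs]; ring
  · rw [uh, Complex.ofReal_im, Complex.im_ofReal_mul, Complex.I_im, zb, vb, Bb, uh, Complex.log_im, Complex.log_im,
      ← zh, ← zh, ← hτ, show (τ:ℂ)*jj + θ*jj = xc (τ+θ)*jj by push_cast; ring,
      show -((τ:ℂ)*jj) + θ*jj = xc (θ-τ)*jj by push_cast; ring, Dm ⟨by linarith [m.1, hθ.1], by linarith [m.2, hθ.2]⟩]
    split_ifs with h
    · rw [hiff] at h
      rw [Dm ⟨ql, by linarith [hθ.2, m.1, zp]⟩]; ring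
    · rw [hiff] at h
      rw [Gv ⟨by linarith [hθ.1, m.2, zp], by linarith [vx (not_lt.1 h) hτθ.symm]⟩]; ring
theorem Gw {f : ℂ → ℂ} {F : ℝ → ℂ} (hf : DifferentiableOn ℂ f (Metric.ball 0 1))
    (hc : ∀ η, ‖η‖ < 1 → f ((starRingEnd ℂ) η) = (starRingEnd ℂ) (f η))
    (hb : ∀ r ∈ Ioo oo 1, ∀ θ ∈ Ioo 0 π, ‖f (r * cis θ)‖ ≤ M)
    (hl : ∀ θ ∈ Ioo 0 π, Tendsto (fun r : ℝ => f (r * cis θ)) (𝓝[<] 1) (𝓝 (F θ)))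
    {af : ℂ} (ah : ‖af‖ < 1) :
    2 * π * f af = ∫ θ in Ioo 0 π, (cis θ * F θ / (cis θ - af)
      + (starRingEnd ℂ) (cis θ * F θ) / (cin θ - af)) := by
  set G : ℝ → ℝ → ℂ := fun r θ => r * cis θ * f (r * cis θ) / (r * cis θ - af) with hG
  set H : ℝ → ℝ → ℂ := fun r θ => (starRingEnd ℂ) (r * cis θ * f (r * cis θ)) / (r * cin θ - af) with hH
  obtain ⟨au, aa, ad⟩ := exists_between ah
  have bm : ∀ r θ : ℝ, 0 ≤ r → ‖(r:ℂ) * cis θ‖ = r := fun r θ hr => by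
    rw [qk, (Ai θ).1, zb, qu, qd hr]
  have cq : ∀ r θ : ℝ, 0 ≤ r → ‖(r:ℂ) * cin θ‖ = r := fun r θ hr => by
    rw [qk, (Ai θ).2, zb, qu, qd hr]
  have ec : ∀ z : ℂ, au ≤ ‖z‖ → au - ‖af‖ ≤ ‖z - af‖ := fun z hz => by
    have := norm_sub_norm_le z af; linarith
  have dne : ∀ z : ℂ, au ≤ ‖z‖ → z - af ≠ 0 := fun z hz h => by
    have := ec z hz; rw [h, norm_zero] at this; linarith
  have ed : 0 ≤ au := (zk _).trans aa.le
  have hfc : ∀ r ∈ Icc au 1, r < 1 → Continuous fun θ : ℝ => f (r * cis θ) := fun r hr ee =>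
    hf.continuousOn.comp_continuous qf fun θ => by
      rw [mem_ball_zero_iff, bm r θ (ed.trans hr.1)]; exact ee
  have hGc : ∀ r ∈ Icc au 1, r < 1 → Continuous (G r) := fun r hr ee => by
    have := hfc r hr ee
    refine Continuous.div (Continuous.mul qf this) qf fun θ => dne _ ?_
    rw [bm r θ (ed.trans hr.1)]; exact hr.1
  have hHc : ∀ r ∈ Icc au 1, r < 1 → Continuous (H r) := fun r hr ee => by
    have := hfc r hr ee
    refine Continuous.div (Complex.continuous_conj.comp (Continuous.mul qf this)) qf fun θ => dne _ ?_
    rw [cq r θ (ed.trans hr.1)]; exact hr.1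
  have key : ∀ r ∈ Ioo au 1, ∫ θ in Ioo 0 π, (G r θ + H r θ) = 2 * π * f af := by
    intro r hr
    have rp : 0 < r := ed.trans_lt hr.1
    have c := DiffContOnCl.circleIntegral_sub_inv_smul (c := 0) (R := r) (f := f) (w := af)
      (DifferentiableOn.diffContOnCl (hf.mono (by
        rw [closure_ball 0 rp.ne']; exact Metric.closedBall_subset_ball hr.2))) (by simpa using aa.trans hr.1)
    have ay : ∫ θ in oo..2*π, G r θ = 2 * π * f af := by
      have : (2 * π * jj : ℂ) * f af = jj * ∫ θ in oo..2*π, G r θ := by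
        rw [← qo, ← c, circleIntegral, ← zj]
        congr 1; ext θ
        simp only [deriv_circleMap, circleMap, hG, qo, vb]
        ring
      have := va Complex.I_ne_zero (this.symm.trans (by ring : _ = jj * (2 * π * f af)))
      exact this
    have ii : ∀ a b, IntervalIntegrable (G r) volume a b := fun a b =>
      (hGc r ⟨hr.1.le, hr.2.le⟩ hr.2).intervalIntegrable a b
    rw [← ay, ← qi (ii 0 π) (ii π (2*π))]
    have ca : ∫ θ in π..2*π, G r θ = ∫ θ in oo..π, H r θ := by
      have := intervalIntegral.integral_comp_sub_left (G r) (a := 0) (b := π) (2*π)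
      rw [ze, show 2*π-π = π by ring] at this
      rw [← this]
      congr 1; ext θ
      have aj : qe (xc (2*π-θ) * jj) = cin θ := by
        rw [← Complex.exp_periodic (-(θ * jj))]; congr 1; push_cast; ring
      have ak : (starRingEnd ℂ) (cis θ) = cin θ := by
        rw [← us]; simp
      simp only [hG, hH]
      rw [aj, map_mul, ← hc _ (by rw [bm r θ rp.le]; exact hr.2), map_mul, ak, Complex.conj_ofReal]
    rw [ca, ← xr (ii 0 π) ((hHc r ⟨hr.1.le, hr.2.le⟩ hr.2).intervalIntegrable 0 π),
      qw zx, qj]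
  have ev : ∀ᶠ r in 𝓝[<] (1:ℝ), r ∈ Ioo au 1 := Ioo_mem_nhdsLT ad
  refine tendsto_nhds_unique (f := fun r => ∫ θ in Ioo 0 π, (G r θ + H r θ)) (l := 𝓝[<] (1:ℝ))
    (xa (ev.mono fun r hr => (key r hr).symm)) ?_
  refine tendsto_integral_filter_of_dominated_convergence (fun _ => M/(au-‖af‖) + M/(au-‖af‖)) ?_ ?_ ?_ ?_
  · filter_upwards [ev] with r hr
    exact ((hGc r ⟨hr.1.le, hr.2.le⟩ hr.2).add (hHc r ⟨hr.1.le, hr.2.le⟩ hr.2)).aestronglyMeasurable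
  · filter_upwards [ev] with r hr
    filter_upwards [qx qz] with θ hθ
    have rp : 0 < r := ed.trans_lt hr.1
    have hM := hb r ⟨rp, hr.2⟩ θ hθ
    have : ‖(r:ℂ) * cis θ * f (r * cis θ)‖ ≤ M := by
      rw [qk, bm r θ rp.le]
      exact (mul_le_of_le_one_left (zk _) hr.2.le).trans hM
    refine (vj _ _).trans (add_le_add ?_ ?_)
    · simp only [hG]
      rw [wr]
      exact div_le_div₀ ((zk _).trans this) this ql (ec _ (by rw [bm r θ rp.le]; exact hr.1.le))
    · simp only [hH]
      rw [wr, RCLike.norm_conj]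
      exact div_le_div₀ ((zk _).trans this) this ql (ec _ (by rw [cq r θ rp.le]; exact hr.1.le))
  · exact (integrable_const _)
  · filter_upwards [qx qz] with θ hθ
    have al : Tendsto (fun r : ℝ => (r:ℂ)) (𝓝[<] 1) (𝓝 1) := by
      have : ContinuousAt (fun r : ℝ => (r:ℂ)) 1 := qf
      simpa using this.tendsto.mono_left xu
    have bp := al.mul_const (cis θ)
    have bh := al.mul_const (cin θ)
    rw [wj] at bp bh
    have ef := bp.mul (hl θ hθ)
    exact (ef.div (bp.sub_const af) (dne _ (by rw [(Ai θ).1]; exact ad.le))).add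
      (((Complex.continuous_conj.tendsto _).comp ef).div (bh.sub_const af) (dne _ (by rw [(Ai θ).2]; exact ad.le)))
theorem Dn {E : Type*} [NormedAddCommGroup E] {f g : ℝ → E} {μ : Measure ℝ} (hf : Integrable f μ) (hg : Integrable g μ) :
    Integrable (fun x => f x - g x) μ := hf.sub hg
theorem Ez (hβ : xx < β) (hB : 0 < B) :
    IntegrableOn (fun y => Ae β B y * log (4*y²/B²)) (Ioo 0 B) := by
  have h := ((Bd hβ hB).1.const_mul (log 4)).add (Cc (B := B) hβ hB).1
  refine h.mono' ((Bd hβ hB).1.aestronglyMeasurable.mul (measurable_log.comp qf).aestronglyMeasurable) ?_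
  filter_upwards [qx qz] with y hy
  have y0 := hy.1
  have au := (Cg hβ B y).resolve_right ql
  have aj : log (4*y²/B²) = log 4 - log (B²/y²) := by
    rw [← log_div qn qp]; congr 1; field_simp
  have ak : log (B²/y²) ≤ Ac (B²) y := by
    unfold Ac
    apply zv qp
    rw [abs_of_nonneg qp]; linarith
  have be : 0 ≤ log (B²/y²) := log_nonneg (by rw [zt qp]; nlinarith [hy.2])
  have bq : 0 ≤ log 4 := log_nonneg qn
  rw [qk, qd au, aj, qy]
  simp only [Pi.add_apply]
  rw [uf (log 4), ← mul_add]
  exact qq ((zq).2 ⟨ql, ql⟩) au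
noncomputable def Ay (β B : ℝ) (η : ℂ) : ℂ :=
  qe (xc (∫ y in Ioo 0 B, Ae β B y * log (4*y²/B²)) - Bk (Ae β B) B η)
theorem Gx (hβ : xx < β) (hB : 0 < B) : DifferentiableOn ℂ (Ay β B) (Metric.ball 0 1) :=
  ((differentiableOn_const _).sub (Gt (Bd hβ hB).1)).cexp
theorem Gy {η : ℂ} (h : ‖η‖ < 1) : Ay β B ((starRingEnd ℂ) η) = (starRingEnd ℂ) (Ay β B η) := by
  unfold Ay
  rw [Gu h, ← us, map_sub, Complex.conj_ofReal]
theorem Fa (hβ : xx < β) (hB : 0 < B) {η : ℂ} (h : ‖η‖ < 1) :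
    (Bk (Ae β B) B η).re = ∫ y in Ioo 0 B, Ae β B y * Ar η (Aj B y) ∧
    IntegrableOn (fun y => Ae β B y * Ar η (Aj B y)) (Ioo 0 B) := by
  have e : ∀ y, Ae β B y * Ar η (Aj B y) = RCLike.re ((Ae β B y : ℂ) * Bb B η y) := fun y => by
    rw [← Co]; simp
  have hi := Ew (Bd hβ hB).1 h
  simp_rw [e]
  exact ⟨(integral_re hi).symm, hi.re⟩
theorem Gz {N : ℕ} (hβ : xx < β) (hB : 0 < B) (hN : Af β * B^xk β = 4*β*N) {η : ℂ} (h : ‖η‖ < 1) (ah : η ≠ 0) :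
    ‖η‖^N * ‖Ay β B η‖ = exp (-∫ y in Ioo 0 B, Ae β B y * Ah (B²*(1-η)²/(4*η)) y) := by
  obtain ⟨aa, ad⟩ := Fa hβ hB h
  obtain ⟨ag, ar⟩ := Bd hβ hB
  have hne : ∀ t : ℝ, cis t ≠ η ∧ cin t ≠ η := fun t =>
    ⟨fun e => by rw [← e, (Ai t).1] at h; linarith, fun e => by rw [← e, (Ai t).2] at h; linarith⟩
  have e : ∫ y in Ioo 0 B, Ae β B y * Ah (B²*(1-η)²/(4*η)) y =
      ∫ y in Ioo 0 B, (Ae β B y * Ar η (Aj B y) - log ‖η‖ * Ae β B y - Ae β B y * log (4*y²/B²)) := by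
    refine za qz fun y hy => ?_
    rw [Ey hy ah (hne _).1 (hne _).2]; ring
  rw [e, we (Dn ad (ag.const_mul _)) (Ez hβ hB), we ad (ag.const_mul _), qv, ar, hN, Ay, Complex.norm_exp,
    ur, zs, aa]
  have : ‖η‖^N = exp (N * log ‖η‖) := by
    rw [uz, xn qp]
  rw [this, ← zn]
  congr 1
  have : 4*β*N/(4*β) = N := by field_simp
  rw [this]; ring
theorem Fb (hr : r ∈ Ioo oo 1) (aa : cis τ ≠ cis θ)
    (ad : cin τ ≠ cis θ) :
    Ar (cis θ) τ - 2*log 2 ≤ Ar (r * cis θ) τ ∧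
    Ar (r * cis θ) τ ≤ 2*log 2 := by
  have key : ∀ a : ℂ, ‖a‖ = 1 → a ≠ cis θ →
      log ‖a - cis θ‖ - log 2 ≤ log ‖a - r * cis θ‖ ∧ log ‖a - r * cis θ‖ ≤ log 2 := by
    intro a ha hne
    have bm := (Ai θ).1
    set w := cis θ
    have aj : ‖(r:ℂ) * w‖ = r := by rw [qk, bm, qu, qd hr.1.le, zb]
    have bu : 1 - r ≤ ‖a - r*w‖ := by
      have := norm_sub_norm_le a (r*w); rw [ha, aj] at this; exact this
    have bw : ‖a - w‖ ≤ 2 * ‖a - r*w‖ := by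
      have e : a - w = (a - r*w) - xc (1-r)*w := by push_cast; ring
      have := ve (a - r*w) (xc (1-r)*w)
      rw [← e, qk, bm, qu, qd (by linarith [hr.2])] at this
      linarith
    have p : 0 < ‖a - w‖ := norm_pos_iff.2 ((xg).2 hne)
    have da : ‖a - r*w‖ ≤ 2 := by
      have := ve a (r*w); rw [ha, aj] at this; linarith [hr.2]
    have cu : 0 < ‖a - r*w‖ := ql
    refine ⟨?_, zv cu da⟩
    rw [sub_le_iff_le_add, ← ws cu.ne' two_ne_zero]
    exact zv p ql
  have bs := key _ (Ai τ).1 aa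
  have co := key _ (Ai τ).2 ad
  unfold Ar
  constructor <;> linarith [bs.1, bs.2, co.1, co.2]
theorem Fd {N : ℕ} (hβ : xx < β) (hB : 0 < B) (hN : Af β * B^xk β = 4*β*N) (hθ : θ ∈ Ioo 0 π) :
    (∀ r ∈ Ioo oo 1, ‖Ay β B (r * cis θ)‖ ≤ exp (2*log 2*N)) ∧
    Tendsto (fun r : ℝ => Ay β B (r * cis θ)) (𝓝[<] 1)
      (𝓝 (qe ((-((B*sin xh θ)^xk β/2) : ℝ) + ((π * ∫ y in Ioo 0 (B*sin xh θ), Ae β B y) - N*θ : ℝ) * jj))) := by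
  obtain ⟨ag, ar⟩ := Bd hβ hB
  set Y := B*sin xh θ with hY
  have hs : 0 < sin xh θ := sin_pos_of_pos_of_lt_pi (by linarith [hθ.1]) (by linarith [hθ.2, hθ.1])
  have Y0 : 0 < Y := mul_pos hB hs
  have YB : Y ≤ B := zf hB.le (sin_le_one _)
  obtain ⟨aq, -, av⟩ := Es (B := B) hβ Y0
  have av := av YB
  have bj := Ez hβ hB
  have hNN : ∫ y in Ioo 0 B, Ae β B y = N := by rw [ar, hN]; field_simp
  set w := cis θ with hw
  have nr : ∀ r ∈ Ioo oo 1, ‖(r:ℂ)*w‖ < 1 := fun r hr => by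
    rw [qk, (Ai θ).1, qu, qd hr.1.le, zb]; exact hr.2
  have ep : ∀ᵐ y ∂(volume.restrict (Ioo 0 B)), y ∈ Ioo 0 B ∧ y ≠ Y := by
    filter_upwards [qx qz, uv (ul volume Y)] with y aa ad
    exact ⟨aa, ad⟩
  have gh : ∀ y ∈ Ioo 0 B, y ≠ Y → Ar w (Aj B y) = Ac (-Y²) y + log (4*y²/B²) := fun y hy hne => by
    rw [← Co, (Ch hθ hy hne).2.2, vh, zs, uu, Complex.I_re, xo, vu]
  constructor
  · intro r hr
    obtain ⟨aa, ad⟩ := Fa hβ hB (nr r hr)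
    rw [Ay, Complex.norm_exp, wp, ur, zs, aa]
    have : ∫ y in Ioo 0 B, (Ae β B y * Ac (-Y²) y + Ae β B y * log (4*y²/B²) - 2*log 2 * Ae β B y) ≤
        ∫ y in Ioo 0 B, Ae β B y * Ar (r*w) (Aj B y) := by
      refine integral_mono_ae ((aq.add bj).sub (ag.const_mul _)) ad ?_
      filter_upwards [ep] with y hy
      obtain ⟨bg, bo, -⟩ := Ch hθ hy.1 hy.2
      have := (Fb hr bg bo).1
      rw [← hw, gh y hy.1 hy.2] at this
      have au := (Cg hβ B y).resolve_right (by linarith [hy.1.1])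
      nlinarith
    rw [we (Integrable.fun_add aq bj) (ag.const_mul _), wo aq bj, qv, hNN, av] at this
    have : 0 ≤ Y^xk β/2 := qp
    linarith
  · unfold Ay
    refine (Complex.continuous_exp.tendsto _).comp ?_
    have T : Tendsto (fun r : ℝ => Bk (Ae β B) B (r*w)) (𝓝[<] 1) (𝓝 (∫ y in Ioo 0 B, (Ae β B y : ℂ) * Bb B w y)) := by
      unfold Bk
      refine tendsto_integral_filter_of_dominated_convergence (fun y => |Ae β B y * Ac (-Y²) y| + |Ae β B y * log (4*y²/B²)| + (2*log 2 + 2*π) * |Ae β B y|) ?_ ?_ ?_ ?_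
      · exact .of_forall fun r => (Complex.measurable_ofReal.comp_aemeasurable ag.aestronglyMeasurable.aemeasurable).aestronglyMeasurable.mul (Dl B _).aestronglyMeasurable
      · filter_upwards [Ioo_mem_nhdsLT (zero_lt_one (α := ℝ))] with r hr
        filter_upwards [ep] with y hy
        obtain ⟨bg, bo, -⟩ := Ch hθ hy.1 hy.2
        have := Fb hr bg bo
        rw [← hw, gh y hy.1 hy.2] at this
        rw [qk, qu, qy, abs_mul, abs_mul, uf (2*log 2+2*π), ← mul_add, ← mul_add]
        refine qq ?_ (zr _)
        refine (Complex.norm_le_abs_re_add_abs_im _).trans ?_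
        have bw := log_nonneg (one_le_two (α := ℝ))
        have ln : |(Bb B (r*w) y).im| ≤ 2*π := by
          unfold Bb
          rw [uh, Complex.log_im, Complex.log_im]
          refine (abs_add_le _ _).trans ?_
          linarith [Complex.abs_arg_le_pi (1 - qe (Aj B y * jj) * (r*w)), Complex.abs_arg_le_pi (1 - qe (-(Aj B y * jj)) * (r*w))]
        rw [Co]
        have lo : |Ar (r*w) (Aj B y)| ≤ |Ac (-Y²) y| + |log (4*y²/B²)| + 2*log 2 := by
          have := neg_abs_le (Ac (-Y²) y)
          have := neg_abs_le (log (4*y²/B²))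
          have := zr (Ac (-Y²) y)
          have := zr (log (4*y²/B²))
          exact (zq).2 ⟨ql, ql⟩
        linarith
      · exact (aq.norm.add bj.norm).add (ag.norm.const_mul _)
      · filter_upwards [ep] with y hy
        obtain ⟨bg, bo, -⟩ := Ch hθ hy.1 hy.2
        refine Tendsto.const_mul _ ?_
        unfold Bb
        have al : Tendsto (fun r : ℝ => (r:ℂ)*w) (𝓝[<] 1) (𝓝 w) := by
          have : ContinuousAt (fun r : ℝ => (r:ℂ)*w) 1 := qf
          simpa using this.tendsto.mono_left xu
        have sl : ∀ a : ℂ, ‖a‖ = 1 → a ≠ 1 → 1 - a ∈ Complex.slitPlane := by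
          intro a ha aa
          refine Complex.mem_slitPlane_iff.2 (Or.inl ?_)
          have ad := zw a
          rcases ad.lt_or_eq with h | h
          · simp; linarith
          · exfalso; apply aa
            have := wm a; rw [Complex.normSq_apply, ← h] at this
            have ba : a.im = 0 := by nlinarith
            exact Complex.ext (by rw [h, ha]; rfl) (by rw [ba]; rfl)
        have q : ∀ a : ℂ, ‖a‖ = 1 → (∀ b : ℂ, a * b = 1 → b ≠ w) → Tendsto (fun r : ℝ => Complex.log (1 - a*(r*w))) (𝓝[<] 1) (𝓝 (Complex.log (1 - a*w))) := by
          intro a ha hb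
          refine (continuousAt_clog (sl _ ?_ ?_)).tendsto.comp (tendsto_const_nhds.sub (al.const_mul a))
          · rw [qk, ha, (Ai θ).1, wj]
          · exact fun h => hb w h rfl
        refine (q _ (Ai _).1 fun b hb => ?_).add (q _ (Ai _).2 fun b hb => ?_)
        · intro h; apply bo; rw [← hw, ← h, Complex.exp_neg, eq_comm]; exact eq_inv_of_mul_eq_one_right hb
        · intro h; apply bg; rw [← hw, ← h]
          rw [Complex.exp_neg] at hb
          field_simp at hb; exact hb.symm
    have E : ∫ y in Ioo 0 B, (Ae β B y : ℂ) * Bb B w y =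
        xc (Y^xk β/2 + ∫ y in Ioo 0 B, Ae β B y * log (4*y²/B²)) + xc (N*θ - π * ∫ y in Ioo 0 Y, Ae β B y) * jj := by
      have j : ∀ᵐ y ∂(volume.restrict (Ioo 0 B)), (Ae β B y : ℂ) * Bb B w y = xc (Ae β B y * Ac (-Y²) y + Ae β B y * log (4*y²/B²)) +
          xc (θ * Ae β B y - π * (Ioo 0 Y).indicator (Ae β B) y) * jj := by
        filter_upwards [ep] with y hy
        rw [(Ch hθ hy.1 hy.2).2.2, Set.indicator_apply]
        by_cases h : y < Y
        · rw [if_pos h, if_pos ⟨hy.1.1, h⟩]; push_cast; ring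
        · rw [if_neg h, if_neg fun q => h q.2]; push_cast; ring
      have bs : Integrable ((Ioo 0 Y).indicator (Ae β B)) (volume.restrict (Ioo 0 B)) := ag.indicator qz
      have co := Dn (ag.const_mul θ) (bs.const_mul π)
      rw [integral_congr_ae j, wo (Integrable.fun_add aq bj).ofReal (co.ofReal.mul_const _), integral_mul_const, integral_complex_ofReal, integral_complex_ofReal,
        wo aq bj, av]
      have : ∫ y in Ioo 0 B, (θ * Ae β B y - π * (Ioo 0 Y).indicator (Ae β B) y) = N*θ - π * ∫ y in Ioo 0 Y, Ae β B y := by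
        rw [we (ag.const_mul θ) (bs.const_mul π), qv, qv, hNN, xv qz,
          Set.inter_eq_self_of_subset_right (vk YB)]
        ring
      rw [this]
    rw [E] at T
    convert tendsto_const_nhds.sub T using 2
    push_cast; ring
noncomputable def An (c : ℕ → ℝ) (N : ℕ) (z : ℂ) : ℂ := ∑ k ∈ rg (N+1), (c k : ℂ) * z^k
noncomputable def As (c : ℕ → ℝ) (N : ℕ) (x : ℝ) : ℝ := ∑ k ∈ rg (N+1), c k * x^k
noncomputable def Au (β B Y : ℝ) : ℝ := ∫ y in Ioo 0 Y, Ae β B y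
noncomputable def Ao (β B : ℝ) (af : ℂ) (θ : ℝ) : ℂ :=
  qe ((2*π*Au β B (B*sin xh θ) : ℝ) * jj) * (-2*jj*cis θ^3) /
    ((cis θ - af) * (cis θ - (starRingEnd ℂ) af))
theorem Hc (c : ℕ → ℝ) (N : ℕ) (x : ℝ) : An c N x = (As c N x : ℂ) := by
  unfold An As; push_cast; rfl
theorem Hd (hx : 0 ≤ x) (hA : 0 ≤ A) (hC : 0 ≤ C) (h : ∀ t : ℝ, 0 < t → 2*x ≤ t*A + C/t) : x² ≤ A*C := by
  have : discrim A (-(2*x)) C ≤ 0 := discrim_le_zero fun t => by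
    rcases vw t 0 with ah | ah
    · nlinarith [zo hx (neg_nonneg.2 ah), zo hA (mul_self_nonneg t)]
    · have := qb (h t ah) ah.le
      have e : (t*A + C/t)*t = A*(t*t)+C := by field_simp
      rw [e] at this; linarith
  unfold discrim at this; nlinarith
theorem Cp (t : ℝ) : 1 - cis t² = -2*jj*(sin t:ℝ)*cis t := by
  have e : cis t * qe (-t*jj) = 1 := by rw [← zh]; simp
  rw [Complex.ofReal_sin, Complex.sin]
  have av := Complex.I_mul_I
  linear_combination (-1)*e + (cis t) * (qe (-t*jj)-cis t) * av
theorem Fe {af : ℂ} (ah : ‖af‖ < 1) :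
    ∫ θ in Ioo 0 π, (1/‖cis θ - af‖² + 1/‖cin θ - af‖²) = 2*π/(1-‖af‖²) := by
  have dne : ∀ z : ℂ, ‖z‖ = 1 → z - af ≠ 0 := fun z hz h => by
    rw [sub_eq_zero.1 h] at hz; linarith
  have cne : ∀ z : ℂ, ‖z‖ ≤ 1 → 1 - (starRingEnd ℂ) af * z ≠ 0 := fun z hz h => by
    have := congrArg norm (sub_eq_zero.1 h)
    rw [norm_one, qk, RCLike.norm_conj] at this
    nlinarith [zk af, zk z]
  have c := DiffContOnCl.circleIntegral_sub_inv_smul (c := 0) (R := 1) (f := fun z => (1 - (starRingEnd ℂ) af * z)⁻¹) (w := af)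
    (DifferentiableOn.diffContOnCl (by
      rw [closure_ball 0 one_ne_zero]
      intro z hz
      have := cne z (by simpa using hz)
      exact (DifferentiableAt.fun_inv (𝕜 := ℂ) (h := fun z => 1 - (starRingEnd ℂ) af * z) qf this).differentiableWithinAt)) (by simpa using ah)
  set G : ℝ → ℝ := fun θ => 1/‖cis θ - af‖² with hG
  have ns : ∀ z : ℂ, (‖z‖:ℂ)² = z * (starRingEnd ℂ) z := fun z => (Complex.mul_conj' z).symm
  have cj : ∀ θ : ℝ, (starRingEnd ℂ) (cis θ) = (cis θ)⁻¹ := fun θ => by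
    rw [← us, ← Complex.exp_neg]; simp
  have ay : xc (∫ θ in oo..2*π, G θ) = (2*π/(1-‖af‖²) : ℝ) := by
    apply va Complex.I_ne_zero
    have e : jj * xc (2*π/(1-‖af‖²)) = (2*π*jj) • (1 - (starRingEnd ℂ) af * af)⁻¹ := by
      push_cast; rw [ns, qo, uf af]; ring
    rw [e, ← c, circleIntegral, ← intervalIntegral.integral_ofReal, ← zj]
    congr 1; ext θ
    have eg := zc (θ*jj)
    have d := dne _ (Ai θ).1
    have ea := cne _ (Ai θ).1.le
    simp only [deriv_circleMap, circleMap, hG, qo, vb, Complex.ofReal_one, wj]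
    push_cast
    rw [ns, map_sub, cj]
    have jh : (cis θ)⁻¹ - (starRingEnd ℂ) af = (1 - (starRingEnd ℂ) af * cis θ) * (cis θ)⁻¹ := by
      field_simp
    rw [jh]; field_simp
  have ay := Complex.ofReal_injective ay
  have hGc : Continuous G := by
    refine Continuous.div continuous_const qf fun θ => ?_
    exact vc _ ((qs).2 (dne _ (Ai θ).1))
  have hHc : Continuous fun θ : ℝ => 1/‖cin θ - af‖² := by
    refine Continuous.div continuous_const qf fun θ => ?_
    exact vc _ ((qs).2 (dne _ (Ai θ).2))
  rw [← ay, ← qj, ← qw zx,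
    ← qi (hGc.intervalIntegrable 0 π) (hGc.intervalIntegrable π (2*π)),
    xr (hGc.intervalIntegrable 0 π) (hHc.intervalIntegrable 0 π)]
  congr 1
  have := intervalIntegral.integral_comp_sub_left G (a := 0) (b := π) (2*π)
  rw [ze, show 2*π-π = π by ring] at this
  rw [← this]
  congr 1; ext θ
  have aj : qe (xc (2*π-θ) * jj) = cin θ := by
    rw [← Complex.exp_periodic (-(θ * jj))]; congr 1; push_cast; ring
  simp only [hG]; rw [aj]
theorem Hf (hB : 0 < B) {P : ℝ → ℝ} (hP : Continuous P)
    (hi : IntegrableOn (fun x => P x² * exp (-(x^β))) (Ioi 0)) :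
    IntegrableOn (fun θ => (P ((B*sin xh θ)²) * exp (-((B*sin xh θ)^xk β/2)))² * (B²/2*sin θ)) (Ioo 0 π) ∧
    ∫ θ in Ioo 0 π, (P ((B*sin xh θ)²) * exp (-((B*sin xh θ)^xk β/2)))² * (B²/2*sin θ) ≤ ∫ x in Ioi 0, P x² * exp (-(x^β)) := by
  have hinj : Set.InjOn (fun θ => (B*sin xh θ)²) (Ioo 0 π) := by
    intro a ha b hb h
    have sa := sin_pos_of_pos_of_lt_pi (by linarith [ha.1] : 0 < a/2) (by linarith [ha.2, ha.1])
    have sb := sin_pos_of_pos_of_lt_pi (by linarith [hb.1] : 0 < b/2) (by linarith [hb.2, hb.1])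
    have := (sq_eq_sq₀ qp qp).1 h
    have := va hB.ne' this
    have := injOn_sin ⟨by linarith [ha.1, zp], by linarith [ha.2]⟩ ⟨by linarith [hb.1, zp], by linarith [hb.2]⟩ this
    linarith
  have hd : ∀ θ ∈ Ioo 0 π, HasDerivWithinAt (fun θ => (B*sin xh θ)²) (B²/2*sin θ) (Ioo 0 π) θ := fun θ _ => by
    have aa : HasDerivAt (fun θ : ℝ => θ/2) xx θ := (hasDerivAt_id θ).div_const 2
    have := ((aa.sin.const_mul B).pow 2)
    refine (this.congr_deriv ?_).hasDerivWithinAt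
    rw [show sin θ = sin (2*xh θ) by congr 1; ring, sin_two_mul]; push_cast; ring
  have hsub : (fun θ => (B*sin xh θ)²) '' (Ioo 0 π) ⊆ Ioi 0 := by
    rintro _ ⟨θ, hθ, rfl⟩
    have sa := sin_pos_of_pos_of_lt_pi (by linarith [hθ.1] : 0 < θ/2) (by linarith [hθ.2, hθ.1])
    exact Set.mem_Ioi.2 qp
  have e : Set.EqOn (fun θ => |B²/2*sin θ| • (P ((B*sin xh θ)²)² * exp (-(((B*sin xh θ)²)^β))))
      (fun θ => (P ((B*sin xh θ)²) * exp (-((B*sin xh θ)^xk β/2)))² * (B²/2*sin θ)) (Ioo 0 π) := fun θ hθ => by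
    have sa := sin_pos_of_pos_of_lt_pi (by linarith [hθ.1] : 0 < θ/2) (by linarith [hθ.2, hθ.1])
    have cl := sin_pos_of_pos_of_lt_pi hθ.1 hθ.2
    simp only
    rw [qt qp, xj (P _), ← uz, ← vd (B*sin xh θ) 2, ← vf qp, qo]
    push_cast
    rw [show (2:ℝ) * -((B*sin xh θ)^xk β/2) = -((B*sin xh θ)^xk β) by ring]; ring
  have j := (integrableOn_image_iff_integrableOn_abs_deriv_smul qz hd hinj (fun x => P x² * exp (-(x^β)))).1 (hi.mono_set hsub)
  have k := integral_image_eq_integral_abs_deriv_smul qz hd hinj (fun x => P x² * exp (-(x^β)))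
  refine ⟨(integrableOn_congr_fun e qz).1 j, ?_⟩
  rw [← za qz e, ← k]
  exact setIntegral_mono_set hi (.of_forall fun x => qp) hsub.eventuallyLE
theorem Dp (hβ : xx < β) (hB : 0 < B) : Measurable (fun θ => Au β B (B*sin xh θ)) := by
  have ah : ∀ y, ¬ B ≤ y ∨ Ae β B y = 0 := fun y => by
    by_cases h : B ≤ y
    · right; unfold Ae; rw [Set.Ioo_eq_empty ql]; simp
    · left; exact h
  have : Monotone (Au β B) := by
    intro a b hab
    have hi : IntegrableOn (Ae β B) (Ioi 0) := by
      have : IntegrableOn (Ae β B) (Ici B) :=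
        (integrableOn_zero).congr_fun (fun y hy => ((ah y).resolve_left (not_not.2 hy)).symm) measurableSet_Ici
      refine ((Bd hβ hB).1.union this).mono_set fun y hy => ?_
      rcases lt_or_ge y B with h | h
      · exact Or.inl ⟨hy, h⟩
      · exact Or.inr h
    refine setIntegral_mono_set (hi.mono_set fun y hy => hy.1) ?_ (vk hab).eventuallyLE
    filter_upwards [qx qz] with y hy
    exact (Cg hβ B y).resolve_right (by linarith [hy.1])
  exact this.measurable.comp qf
theorem Ff {af : ℂ} (θ : ℝ) :
    ‖Ao β B af θ‖ = 2/(‖cis θ - af‖ * ‖cin θ - af‖) := by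
  have e : ‖cis θ - (starRingEnd ℂ) af‖ = ‖cin θ - af‖ := by
    rw [← RCLike.norm_conj, map_sub, Complex.conj_conj, ← us]; simp
  unfold Ao
  rw [wr, qk, qk (_ - _), e, (Ai _).1, qk, qk, xi, (Ai _).1]; simp
theorem Fg (hβ : xx < β) (hB : 0 < B) {af : ℂ} (ah : ‖af‖ < 1) :
    IntegrableOn (Ao β B af) (Ioo 0 π) ∧ ‖∫ θ in Ioo 0 π, Ao β B af θ‖ ≤ 2*π/(1-‖af‖²) ∧
    IntegrableOn (fun θ : ℝ => 1/‖cis θ - af‖² + 1/‖cin θ - af‖²) (Ioo 0 π) := by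
  have dne : ∀ z : ℂ, ‖z‖ = 1 → ‖z - af‖² ≠ 0 := fun z hz h => by
    have := norm_eq_zero.1 (pow_eq_zero_iff two_ne_zero |>.1 h)
    rw [sub_eq_zero.1 this] at hz; linarith
  have hc : Continuous fun θ : ℝ => 1/‖cis θ - af‖² + 1/‖cin θ - af‖² :=
    (Continuous.div continuous_const qf fun θ => dne _ (Ai θ).1).add
      (Continuous.div continuous_const qf fun θ => dne _ (Ai θ).2)
  have hci : IntegrableOn (fun θ : ℝ => 1/‖cis θ - af‖² + 1/‖cin θ - af‖²) (Ioo 0 π) :=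
    (hc.integrableOn_Icc).mono_set Set.Ioo_subset_Icc_self
  have b : ∀ θ, ‖Ao β B af θ‖ ≤ 1/‖cis θ - af‖² + 1/‖cin θ - af‖² := fun θ => by
    rw [Ff]
    have := two_mul_le_add_sq (‖cis θ - af‖)⁻¹ (‖cin θ - af‖)⁻¹
    calc _ = 2 * (‖cis θ - af‖)⁻¹ * (‖cin θ - af‖)⁻¹ := by
          rw [wd, mul_inv]; ring
      _ ≤ _ := this
      _ = _ := by rw [inv_pow, inv_pow]; ring
  have hm : Measurable (Ao β B af) := by
    have := Dp hβ hB
    unfold Ao; fun_prop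
  have hX : IntegrableOn (Ao β B af) (Ioo 0 π) := hci.mono' hm.aestronglyMeasurable (.of_forall b)
  refine ⟨hX, ?_, hci⟩
  rw [← Fe ah]
  exact norm_integral_le_of_norm_le hci (.of_forall b)
theorem Hg {N : ℕ} (hβ : xx < β) (hB : 0 < B) (hN : Af β * B^xk β = 4*β*N) (c : ℕ → ℝ)
    (hi : IntegrableOn (fun x => As c N x² * exp (-(x^β))) (Ioi 0)) {af : ℂ} (ah : ‖af‖ < 1) (hη : af ≠ 0) :
    4*π² * ‖An c N (-(B²*(1-af)²/(4*af)))‖² * ‖1-af²‖ ≤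
    exp (2 * ∫ y in Ioo 0 B, Ae β B y * Ah (B²*(1-af)²/(4*af)) y) * (∫ x in Ioi 0, As c N x² * exp (-(x^β))) *
      (2/B² * (4*π/(1-‖af‖²) + 2 * (∫ θ in Ioo 0 π, Ao β B af θ).re)) := by
  set q : ℂ → ℂ := fun η => ∑ k ∈ rg (N+1), (c k : ℂ) * (-(B²/4*(1-η)²))^k * η^(N-k) with hq
  set a : ℂ → ℂ := fun η => (1-η²)^(((2:ℕ):ℂ)⁻¹) with ha
  have bk : ∀ η, a η² = 1-η² := fun η => Complex.cpow_nat_inv_pow _ two_ne_zero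
  have hqp : ∀ η, η ≠ 0 → q η = η^N * An c N (-(B²*(1-η)²/(4*η))) := fun η h => by
    simp only [hq, An, vg]
    refine zy rfl fun k hk => ?_
    have hk : k ≤ N := by simpa [Nat.lt_succ_iff] using hk
    rw [show η^N = η^(N-k)*η^k by rw [← pow_add, Nat.sub_add_cancel hk], show -((B:ℂ)²/4*(1-η)²) = -(B²*(1-η)²/(4*η)) * η by field_simp, xj]
    ring
  have sl : ∀ η : ℂ, ‖η‖ < 1 → 1 - η² ∈ Complex.slitPlane := fun η h => by
    have : ‖η²‖ < 1 := by rw [xi]; exact pow_lt_one₀ (zk _) h two_ne_zero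
    have := zw (η²)
    exact Complex.mem_slitPlane_iff.2 (Or.inl (by simp only [ur, Complex.one_re]; linarith))
  set g : ℝ → ℝ := fun θ => As c N ((B*sin xh θ)²) * exp (-((B*sin xh θ)^xk β/2)) with hg
  set Th : ℝ → ℝ := fun θ => Au β B (B*sin xh θ) with hTh
  set F : ℝ → ℂ := fun θ => g θ * qe ((π*Th θ:ℝ)*jj) * a (cis θ) with hF
  have hqc : Continuous q := by simp only [hq]; fun_prop
  have jk : DifferentiableOn ℂ (fun η => q η * Ay β B η * a η) (Metric.ball 0 1) := by
    refine (DifferentiableOn.mul (by simp only [hq]; fun_prop) (Gx hβ hB)).mul fun η h => ?_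
    exact (DifferentiableAt.cpow (f := fun η => 1-η²) (g := fun _ => ((2:ℕ):ℂ)⁻¹) qf qf (sl η (by simpa using h))).differentiableWithinAt
  have jl : ∀ η, q ((starRingEnd ℂ) η) = (starRingEnd ℂ) (q η) := fun η => by
    simp only [hq, map_sum, map_mul, map_pow, map_neg, map_sub, map_one, Complex.conj_ofReal, map_div₀, map_ofNat]
  have jm : ∀ η, ‖η‖ < 1 → q ((starRingEnd ℂ) η) * Ay β B ((starRingEnd ℂ) η) * a ((starRingEnd ℂ) η) = (starRingEnd ℂ) (q η * Ay β B η * a η) := fun η h => by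
    rw [map_mul, map_mul, Gy h, jl]
    congr 1
    have := Complex.cpow_conj (1-η²) ((2:ℕ):ℂ)⁻¹ (vr (sl η h))
    simp only [ha]
    rw [show (1:ℂ) - (starRingEnd ℂ) η² = (starRingEnd ℂ) (1-η²) by simp, show ((2:ℕ):ℂ)⁻¹ = (starRingEnd ℂ) ((2:ℕ):ℂ)⁻¹ by rw [map_inv₀, Complex.conj_natCast], Complex.cpow_conj _ _ (by
      rw [Complex.arg_conj, if_neg (vr (sl η h))]; have := Complex.neg_pi_lt_arg (1-η²); linarith), Complex.conj_conj, map_inv₀, Complex.conj_natCast]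
  obtain ⟨Mq, hMq⟩ := (isCompact_closedBall (0:ℂ) 1).exists_bound_of_continuousOn hqc.continuousOn
  have nr : ∀ r ∈ Ioo oo 1, ∀ θ : ℝ, ‖(r:ℂ)*cis θ‖ < 1 := fun r hr θ => by
    rw [qk, (Ai θ).1, qu, qd hr.1.le, zb]; exact hr.2
  have hab : ∀ η : ℂ, ‖η‖ < 1 → ‖a η‖ ≤ 2 := fun η h => by
    have aa : ‖a η‖² ≤ 2 := by
      rw [← xi, bk]; refine (ve _ _).trans ?_
      rw [norm_one, xi]; nlinarith [zk η]
    nlinarith [zk (a η)]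
  have jn : ∀ r ∈ Ioo oo 1, ∀ θ ∈ Ioo 0 π, ‖q (r*cis θ) * Ay β B (r*cis θ) * a (r*cis θ)‖ ≤ Mq * exp (2*log 2*N) * 2 := by
    intro r hr θ hθ
    have n := nr r hr θ
    rw [qk, qk]
    have m1 := hMq _ (mem_closedBall_zero_iff.2 n.le)
    exact xf (xf m1 ((Fd hβ hB hN hθ).1 r hr) (zk _) ((zk _).trans m1)) (hab _ n) (zk _)
      (zo ((zk _).trans m1) (xz _).le)
  have hsq : ∀ θ : ℝ, (1 - cis θ)² = -4*(sin xh θ:ℝ)²*cis θ := fun θ => by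
    have e : cis θ = qe ((θ/2:ℝ)*jj)² := by
      rw [← xe]; congr 1; push_cast; ring
    rw [e, Cp, xj, xj, xj, wl]; ring
  have jo : ∀ θ ∈ Ioo 0 π, Tendsto (fun r : ℝ => q (r*cis θ) * Ay β B (r*cis θ) * a (r*cis θ)) (𝓝[<] 1) (𝓝 (F θ)) := by
    intro θ hθ
    have al : Tendsto (fun r : ℝ => (r:ℂ)*cis θ) (𝓝[<] 1) (𝓝 (cis θ)) := by
      have : ContinuousAt (fun r : ℝ => (r:ℂ)*cis θ) 1 := qf
      simpa using this.tendsto.mono_left xu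
    have ao := sin_pos_of_pos_of_lt_pi hθ.1 hθ.2
    have ac : ContinuousAt a (cis θ) := by
      refine ContinuousAt.cpow qf qf ?_
      rw [Cp]
      refine Complex.mem_slitPlane_iff.2 (Or.inl ?_)
      rw [Complex.exp_mul_I, ← ut, ← Complex.ofReal_sin]
      simp only [Complex.mul_re, Complex.mul_im, vh, uh, Complex.neg_re, Complex.neg_im, zs, Complex.ofReal_im, Complex.I_re, Complex.I_im, Complex.re_ofNat, Complex.im_ofNat]
      nlinarith
    have := (((hqc.tendsto _).comp al).mul (Fd hβ hB hN hθ).2).mul (ac.tendsto.comp al)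
    have E : ∀ z, z = F θ → Tendsto (fun r : ℝ => q (r*cis θ) * Ay β B (r*cis θ) * a (r*cis θ)) (𝓝[<] 1) (𝓝 z) → Tendsto (fun r : ℝ => q (r*cis θ) * Ay β B (r*cis θ) * a (r*cis θ)) (𝓝[<] 1) (𝓝 (F θ)) := fun z h => h ▸ id
    refine E _ ?_ this
    simp only [hF, hg, hTh, Au]
    congr 1
    have eg := zc (θ*jj)
    rw [hqp _ eg, hsq, show -((B:ℂ)²*(-4*(sin xh θ:ℝ)²*cis θ)/(4*cis θ)) = xc ((B*sin xh θ)²) by push_cast; field_simp,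
      Hc, ← xe, zh]
    push_cast
    rw [sub_mul, Complex.exp_sub, show (N:ℂ)*(θ*jj) = N*θ*jj by ring]
    have := zc (N*θ*jj)
    field_simp
  have key := Gw jk jm jn jo ah
  set K : ℝ → ℂ := fun θ => cis θ * (qe ((π*Th θ:ℝ)*jj) * a (cis θ)) / (cis θ - af)
    + (starRingEnd ℂ) (cis θ * (qe ((π*Th θ:ℝ)*jj) * a (cis θ))) / (cin θ - af) with hK
  have jp : 2*π*(q af * Ay β B af * a af) = ∫ θ in Ioo 0 π, (g θ:ℂ) * K θ := by
    rw [key]; congr 1; ext θ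
    simp only [hF, hK, map_mul, Complex.conj_ofReal]; ring
  have gi : ∀ θ ∈ Ioo 0 π, ‖K θ‖² = sin θ * (2*(1/‖cis θ - af‖² + 1/‖cin θ - af‖²) + 2*(Ao β B af θ).re) := by
    intro θ hθ
    have ao := sin_pos_of_pos_of_lt_pi hθ.1 hθ.2
    have na : ‖a (cis θ)‖² = 2 * sin θ := by
      rw [← xi, bk, Cp, qk, qk, (Ai θ).1, qu, qd ao.le]; simp
    set u := cis θ * (qe ((π*Th θ:ℝ)*jj) * a (cis θ)) with hu
    have nu : ‖u‖² = 2*sin θ := by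
      rw [hu, qk, qk, (Ai _).1, (Ai _).1, wj, wj, na]
    have bm : ‖u / (cis θ - af)‖² = sin θ * (2*(1/‖cis θ - af‖²)) := by
      rw [wr, div_pow, nu]; ring
    have cq : ‖(starRingEnd ℂ) u / (cin θ - af)‖² = sin θ * (2*(1/‖cin θ - af‖²)) := by
      rw [wr, RCLike.norm_conj, div_pow, nu]; ring
    have eh : u / (cis θ - af) * (starRingEnd ℂ) ((starRingEnd ℂ) u / (cin θ - af)) = (sin θ:ℝ) * Ao β B af θ := by
      have ak : (starRingEnd ℂ) (cin θ) = cis θ := by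
        rw [← us]; simp
      have be : u² = (sin θ:ℝ) * (qe ((2*π*Au β B (B*sin xh θ) : ℝ) * jj) * (-2*jj*cis θ^3)) := by
        rw [hu, xj, xj, bk, Cp, ← xe (xc (π*Th θ)*jj)]
        rw [show ((2:ℕ):ℂ)*(xc (π*Th θ)*jj) = ((2*π*Au β B (B*sin xh θ) : ℝ) * jj) by simp only [hTh]; push_cast; ring]
        ring
      rw [map_div₀, Complex.conj_conj, map_sub, ak, div_mul_div_comm, ← sq, be, Ao]; ring
    simp only [hK]
    rw [wm, Complex.normSq_add, ← wm, ← wm, bm, cq, eh, uu]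
    ring
  obtain ⟨fi, lr, gj⟩ := Fg hβ hB ah
  have hP : Continuous (As c N) := by unfold As; fun_prop
  obtain ⟨de, el⟩ := Hf hB hP hi
  set L := 2/B² * (4*π/(1-‖af‖²) + 2 * (∫ θ in Ioo 0 π, Ao β B af θ).re) with hL
  have gk : IntegrableOn (fun θ : ℝ => 2/B²*(2*(1/‖cis θ - af‖² + 1/‖cin θ - af‖²) + 2*(Ao β B af θ).re)) (Ioo 0 π) :=
    ((gj.const_mul 2).add (fi.re.const_mul 2)).const_mul _
  have gm : ∫ θ in Ioo 0 π, 2/B²*(2*(1/‖cis θ - af‖² + 1/‖cin θ - af‖²) + 2*(Ao β B af θ).re) = L := by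
    have := integral_re fi
    have jq : Integrable (fun θ => (Ao β B af θ).re) (volume.restrict (Ioo 0 π)) := fi.re
    rw [qv, wo (gj.const_mul 2) (jq.const_mul 2), qv, qv, Fe ah]
    simp only [RCLike.re_to_complex] at this
    rw [this, hL]; ring
  have jr : 0 ≤ L := by
    rw [← gm]
    refine setIntegral_nonneg qz fun θ hθ => ?_
    have ao := sin_pos_of_pos_of_lt_pi hθ.1 hθ.2
    have := zd ‖K θ‖; rw [gi θ hθ] at this
    exact zo qp (nonneg_of_mul_nonneg_right this ao)
  set fj := ∫ x in Ioi 0, As c N x² * exp (-(x^β)) with hnr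
  have js : 0 ≤ fj := setIntegral_nonneg qh fun x _ => qp
  have cs : ‖2*π*(q af * Ay β B af * a af)‖² ≤ fj * L := by
    refine Hd (zk _) js jr fun t ht => ?_
    have bg : ‖∫ θ in Ioo 0 π, (g θ:ℂ) * K θ‖ ≤ ∫ θ in Ioo 0 π, (t/2 * (g θ² * (B²/2*sin θ)) +
        1/(2*t) * (2/B²*(2*(1/‖cis θ - af‖² + 1/‖cin θ - af‖²) + 2*(Ao β B af θ).re))) := by
      refine norm_integral_le_of_norm_le ((de.const_mul _).add (gk.const_mul _)) ?_
      filter_upwards [qx qz] with θ hθ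
      have ao := sin_pos_of_pos_of_lt_pi hθ.1 hθ.2
      have := gi θ hθ
      set R := 2*(1/‖cis θ - af‖² + 1/‖cin θ - af‖²) + 2*(Ao β B af θ).re
      have eR : R = ‖K θ‖² / sin θ := by rw [this]; field_simp
      rw [qk, qu, qy, eR, ← sq_abs (g θ)]
      have p : 0 < t*(B²/2)*sin θ := qp
      have : t/2 * (|g θ|² * (B²/2*sin θ)) + 1/(2*t)*(2/B²*(‖K θ‖²/sin θ)) - |g θ| * ‖K θ‖ = (t*(B²/2)*sin θ * |g θ| - ‖K θ‖)²/(2*(t*(B²/2)*sin θ)) := by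
        field_simp; ring
      have : 0 ≤ (t*(B²/2)*sin θ * |g θ| - ‖K θ‖)²/(2*(t*(B²/2)*sin θ)) := qp
      linarith
    rw [wo (de.const_mul _) (gk.const_mul _), qv, qv, gm] at bg
    rw [jp]
    have := qq el (by positivity : 0 ≤ t/2)
    calc _ ≤ 2 * (t/2*fj + 1/(2*t)*L) := ql
      _ = _ := by field_simp
  have nd := Gz hβ hB hN ah hη
  rw [qk (2*π:ℂ), qk _ (a af), qk _ (Ay β B af), hqp _ hη, qk (af^N), xj, xj _ ‖a af‖, ← xi (a af), bk] at cs
  have aj : ‖af^N‖ * ‖An c N (-(B²*(1-af)²/(4*af)))‖ * ‖Ay β B af‖ = ‖An c N (-(B²*(1-af)²/(4*af)))‖ * exp (-∫ y in Ioo 0 B, Ae β B y * Ah (B²*(1-af)²/(4*af)) y) := by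
    rw [← nd, xi]; ring
  have ak : ‖(2*π:ℂ)‖² = 4*π² := by
    rw [qk, qu, qd zx]; simp; ring
  rw [aj, ak, xj, ← uz] at cs
  set I := ∫ y in Ioo 0 B, Ae β B y * Ah (B²*(1-af)²/(4*af)) y
  have be : exp (2*I) * exp ((2:ℕ) * -I) = 1 := by rw [← zn]; simp
  have := qq cs (xz (2*I)).le
  calc _ = 4*π² * ‖An c N (-(B²*(1-af)²/(4*af)))‖² * ‖1-af²‖ * (exp (2*I) * exp ((2:ℕ) * -I)) := by rw [be, zb]
    _ = exp (2*I) * (4*π² * (‖An c N (-(B²*(1-af)²/(4*af)))‖² * exp ((2:ℕ) * -I) * ‖1-af²‖)) := by ring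
    _ ≤ _ := this
    _ = _ := by ring
noncomputable def Cq (β B : ℝ) (v : ℂ) : ℝ := ∫ y in Ioo 0 B, Ae β B y * Ah (v²) y
noncomputable def Bc (ξ : ℂ) : ℝ := 4*ξ.re/(‖ξ‖^3*(1+‖ξ‖²)*‖1+ξ²‖)
noncomputable def Ba (β B : ℝ) (ξ : ℂ) : ℝ := (1-‖ξ²‖²)/(2*π)*(∫ θ in Ioo 0 π, Ao β B (ξ²) θ).re
theorem Hh (a : ℂ) : ∃ S : ℂ, S² = a ∧ 0 ≤ S.re := by
  obtain ⟨S, hS⟩ := IsAlgClosed.exists_pow_nat_eq a two_pos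
  rcases le_total 0 S.re with h | h
  · exact ⟨S, hS, h⟩
  · exact ⟨-S, by rw [neg_sq, hS], by simpa using h⟩
theorem Hi {w : ℂ} (hw : ‖w‖ ≤ 1/8) : ∃ ξ : ℂ, ξ² + 2*w*ξ = 1 ∧ ‖ξ-1‖ ≤ 2*‖w‖ := by
  obtain ⟨S, hS, ah⟩ := Hh (1+w²)
  refine ⟨S-w, by linear_combination hS, ?_⟩
  have aa : 1 ≤ ‖S+1‖ := by
    have := zw (S+1); simp at this; linarith
  have ad : ‖S-1‖*‖S+1‖ = ‖w‖² := by rw [← qk, ← xi]; congr 1; linear_combination hS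
  have ag : ‖S-1‖ ≤ ‖w‖² := by nlinarith [zk (S-1)]
  have : ‖S-w-1‖ ≤ ‖S-1‖+‖w‖ := by rw [show S-w-1 = (S-1)-w by ring]; exact ve _ _
  nlinarith [zk w]
theorem Dq {ξ : ℂ} (h : ‖ξ-1‖ ≤ 1/4) : 3/4 ≤ ‖ξ‖ ∧ ‖ξ‖ ≤ 5/4 ∧ 3/4 ≤ ξ.re ∧ 1 ≤ ‖1+ξ²‖ ∧ Bc ξ ≤ 12 := by
  have bf : 3/4 ≤ ξ.re := by
    have := ((zq).1 (Complex.abs_re_le_norm (ξ-1))).1; simp at this; linarith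
  have bk := zw ξ
  have dc : ‖ξ‖ ≤ 5/4 := by
    have := vj (ξ-1) 1; simp at this; linarith
  have cw : 1 ≤ ‖1+ξ²‖ := by
    have e : (2:ℂ) = (1+ξ²) - (ξ-1)*(ξ-1+2) := by ring
    have := ve (1+ξ²) ((ξ-1)*(ξ-1+2))
    rw [← e, qk] at this
    have t := vj (ξ-1) 2
    simp at this t
    nlinarith [zk (ξ-1), zk (ξ-1+2)]
  refine ⟨ql, dc, bf, cw, ?_⟩
  unfold Bc
  have p : (3/4:ℝ)^3 ≤ ‖ξ‖^3 := pow_le_pow_left₀ qn ql 3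
  have ds : (3/4:ℝ)^3*1*1 ≤ ‖ξ‖^3*(1+‖ξ‖²)*‖1+ξ²‖ :=
    xf (xf p (by nlinarith [zk ξ]) qn qp) cw qn qp
  rw [qc ql]
  linarith
theorem Hj {N : ℕ} (hβ : xx < β) (hB : 0 < B) (hN : Af β * B^xk β = 4*β*N) {v : ℂ} (hv : 0 < v.re) (hvB : ‖v‖ ≤ B/8) :
    ∃ ξ : ℂ, ξ² + 2*(v/B)*ξ = 1 ∧ ‖ξ-1‖ ≤ 2*‖v‖/B ∧ ‖ξ-1‖ ≤ 1/4 ∧ ‖ξ²‖ < 1 ∧ 1-‖ξ²‖² ≤ 20*‖v‖/B ∧ |Ba β B ξ| ≤ 1 ∧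
    ∀ c : ℕ → ℝ, IntegrableOn (fun x => As c N x² * exp (-(x^β))) (Ioi 0) →
      ‖An c N (-v²)‖² ≤ exp (2*Cq β B v)/(8*π*v.re*‖v‖) * Bc ξ * (1 + Ba β B ξ) * ∫ x in Ioi 0, As c N x² * exp (-(x^β)) := by
  have hB' : (B:ℂ) ≠ 0 := by exact_mod_cast hB.ne'
  have nw : ‖v/B‖ = ‖v‖/B := by rw [wr, qu, qd hB.le]
  obtain ⟨ξ, aa, ad⟩ := Hi (w := v/B) (by rw [nw, qc hB]; linarith)
  rw [nw] at ad
  have eb : ‖ξ-1‖ ≤ 1/4 := ad.trans (by have : ‖v‖/B ≤ 1/8 := (by rw [qc hB]; linarith); linarith)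
  obtain ⟨bf, bk, dc, cw, -⟩ := Dq eb
  have jt : ξ ≠ 0 := by rintro rfl; simp at bf; norm_num at bf
  have cr : ξ⁻¹ - ξ = 2*(v/B) := by field_simp; linear_combination (-B)*aa + (2*v*ξ)*(mul_inv_cancel₀ hB')
  have aj : ξ.re*(1-‖ξ‖²) = 2*(v.re/B)*‖ξ‖² := by
    have := congrArg Complex.re cr
    have e : (2*(v/B):ℂ).re = 2*(v.re/B) := by
      rw [show (2*(v/B):ℂ) = xc (2/B)*v by push_cast; ring, uu]; ring
    rw [ur, Complex.inv_re, e, ← wm] at this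
    rw [← this]; field_simp
  have ju : 0 < v.re/B := qp
  have bm : 0 < 1-‖ξ‖² := by
    by_contra h; push Not at h
    nlinarith [mul_pos ju (by positivity : 0 < ‖ξ‖²)]
  have ak : 1-‖ξ²‖² = (1-‖ξ‖²)*(1+‖ξ‖²) := by rw [xi]; ring
  have cq : 0 < 1-‖ξ²‖² := by rw [ak]; positivity
  have eh : ‖ξ²‖ < 1 := by rw [xi]; linarith
  have hcr : |Ba β B ξ| ≤ 1 := by
    have := (Fg (β := β) hβ hB eh).2.1
    unfold Ba
    rw [abs_mul, qt qp]
    have := (Complex.abs_re_le_norm (∫ θ in Ioo 0 π, Ao β B (ξ²) θ)).trans this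
    calc _ ≤ (1-‖ξ²‖²)/(2*π) * (2*π/(1-‖ξ²‖²)) := qq this qp
      _ = 1 := by field_simp
  have vp : 0 < ‖v‖ := hv.trans_le (zw v)
  refine ⟨ξ, aa, by rw [wu]; exact ad, eb, eh, ?_, hcr, fun c hi => ?_⟩
  · rw [ak]
    have dd : 1-‖ξ‖² ≤ 4*(‖v‖/B) := by
      have : v.re/B ≤ ‖v‖/B := div_le_div_of_nonneg_right (zw v) hB.le
      have : ‖ξ‖² < 1 := ql
      nlinarith
    have : ‖ξ‖² ≤ 1 := ql
    have : 0 ≤ ‖v‖/B := qp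
    rw [wu]; nlinarith
  have u := Hg hβ hB hN c hi eh (vc 2 jt)
  have be : (B:ℂ)²*(1-ξ²)²/(4*ξ²) = v² := by
    rw [show (1:ℂ)-ξ² = 2*(v/B)*ξ by linear_combination (-1)*aa]; field_simp; ring
  rw [be] at u
  set I := ∫ x in Ioi 0, As c N x² * exp (-(x^β)) with hI
  have bq : ‖1-(ξ²)²‖ = 2*(‖v‖/B)*‖ξ‖*‖1+ξ²‖ := by
    rw [show 1-(ξ²)² = 2*(v/B)*ξ*(1+ξ²) by linear_combination (-(1+ξ²))*aa, qk, qk, qk, nw]; simp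
  have jv : 2/B²*(4*π/(1-‖ξ²‖²) + 2*(∫ θ in Ioo 0 π, Ao β B (ξ²) θ).re) = 8*π/B²/(1-‖ξ²‖²)*(1+Ba β B ξ) := by
    unfold Ba; field_simp; ring
  rw [jv, bq] at u
  have jw : 1-‖ξ²‖² = 2*(v.re/B)*‖ξ‖²/ξ.re*(1+‖ξ‖²) := by
    rw [ak]; congr 1; rw [eq_div_iff ql, ← aj]; ring
  rw [jw] at u
  unfold Cq Bc
  set P := ∫ y in Ioo 0 B, Ae β B y * Ah (v²) y
  have ξp : 0 < ‖ξ‖ := ql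
  have rp : 0 < ξ.re := ql
  have kp : 0 < ‖1+ξ²‖ := ql
  have D : 0 < 4*π²*(2*(‖v‖/B)*‖ξ‖*‖1+ξ²‖) := qp
  have : ‖An c N (-v²)‖² ≤ exp (2*P)*I*(8*π/B²/(2*(v.re/B)*‖ξ‖²/ξ.re*(1+‖ξ‖²))*(1+Ba β B ξ))/(4*π²*(2*(‖v‖/B)*‖ξ‖*‖1+ξ²‖)) := by
    rw [zt D]; linarith
  refine this.trans (vi ?_)
  field_simp; ring
theorem Hk (hβ : xx < β) (hB : 0 < B) {v : ℂ} (hv : 0 < v.re) :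
    IntegrableOn (fun y => Ae β B y * Ah (v²) y) (Ioo 0 B) := by
  have vp : 0 < ‖v‖ := hv.trans_le (zw v)
  have h := ((Bd hβ hB).1.const_mul |2*log (v.re/B)|).add (Cc (B := B) hβ vp).1
  refine h.mono' ((Bd hβ hB).1.aestronglyMeasurable.mul (Dg _).aestronglyMeasurable) ?_
  filter_upwards [qx qz] with y hy
  have y0 := hy.1
  have au := (Cg hβ B y).resolve_right ql
  have yc : (y:ℂ) ≠ 0 := by exact_mod_cast y0.ne'
  have f : ∀ a : ℂ, |a.im| ≤ ‖a‖ := Complex.abs_im_le_norm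
  have aj : ‖1+v²/(y:ℂ)²‖ = ‖y+jj*v‖*‖y-jj*v‖/y² := by
    rw [← qk, show (y+jj*v)*(y-jj*v) = (1+v²/(y:ℂ)²)*y² by field_simp; linear_combination (-v²)*wl, qk, xi, qu, qd y0.le]
    field_simp
  have bu : (v.re/B)² ≤ ‖1+v²/(y:ℂ)²‖ := by
    have bg := f (y+jj*v); have bo := f (y-jj*v)
    simp [qt hv] at bg bo
    rw [aj, div_pow]
    apply div_le_div₀ qp _ qp (by nlinarith [hy.2])
    nlinarith
  have bw : ‖1+v²/(y:ℂ)²‖ ≤ 1+‖v‖²/y² := by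
    refine (vj _ _).trans ?_
    rw [wr, xi, xi, qu, qd y0.le, norm_one]
  have p : 0 < (v.re/B)² := qp
  have m1 := zv p bu
  have dt := zv (p.trans_le bu) bw
  rw [log_pow] at m1; push_cast at m1
  have e : log (1+‖v‖²/y²) = Ac (‖v‖²) y := by unfold Ac; rw [abs_of_nonneg qp]
  rw [e] at dt
  have := Bp (zd ‖v‖) y
  rw [qk, qd au, qy]
  simp only [Pi.add_apply]
  rw [uf |_|, ← mul_add]
  refine qq ((zq).2 ⟨?_, ?_⟩) au
  · have := neg_abs_le (2*log (v.re/B)); unfold Ah; linarith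
  · have := zr (2*log (v.re/B)); unfold Ah; linarith
open Set
noncomputable def Am (y : ℝ) : ℝ := y²/(1+y²)²
noncomputable def Ci (β : ℝ) : ℝ := ∫ s in Ioo oo 1, Bi β s
theorem Bf (hβ : xx < β) : Tendsto (Ad β) atTop atTop :=
  ((tendsto_rpow_atTop (by linarith : 0 < 2*β-1)).const_mul_atTop (Bo hβ)).atTop_div_const ql
theorem Av (hβ : xx < β) (hB : 0 < B) : 0 < Ad β B :=
  uj (mul_pos (Bo hβ) (rpow_pos_of_pos hB _)) ql
theorem Cr (hβ : xx < β) (hB : 0 < B) (hy : y ∈ Ico 0 B) :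
    Ae β B y = Ad β B * (xm β/π) * Aq β (y/B) := by
  have : 2*β-1 ≠ 0 := ql
  rw [Gq hβ hB hy, Ad]; field_simp
theorem Bs (hβ : xx < β) (hB : 0 < B) (hy : y ∈ Ico 0 B) :
    0 ≤ Ae β B y ∧ Ae β B y ≤ Ad β B * (xm β/π) * Ci β := by
  have aa := (Cg hβ B y).resolve_right (by linarith [hy.1])
  have := Av hβ hB
  have ad := Go hβ (t := y/B) ⟨ux hy.1 hB.le, (xl hB).2 hy.2.le⟩
  refine ⟨aa, ?_⟩
  rw [Cr hβ hB hy]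
  exact qq ad (zo this.le (ux ql zx))
theorem Hl (hβ : xx < β) {y : ℝ → ℝ} (h : ∀ᶠ B in atTop, 0 ≤ y B) (hl : Tt (fun B => y B/B) 0) :
    Tt (fun B => Ae β B (y B) / Ad β B) (1/π) := by
  have hb : 2*β-1 ≠ 0 := ql
  have t : Tendsto (fun B => y B/B) atTop (𝓝[≥] 0) := tendsto_nhdsWithin_iff.2 ⟨hl, by
    filter_upwards [h, qr 0] with B h h' using ux h h'.le⟩
  have := ((Df hβ).1.comp t).const_mul (xm β/π)
  rw [Et hβ] at this
  refine (this.congr' ?_).trans (by rw [show xm β/π*(1/xm β) = 1/π by field_simp])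
  filter_upwards [h, qr 0, hl.eventually (vv one_pos)] with B h h' aa
  have := Av hβ h'
  rw [Cr hβ h' ⟨h, by rwa [uw h'] at aa⟩]
  simp only [Function.comp]; field_simp
theorem Fh (hβ : xx < β) {g : ℝ → ℝ} (hg : IntegrableOn g (Ioi 0)) :
    Tt (fun B => (∫ y in Ioo 0 B, Ae β B y * g y) / Ad β B) (1/π * ∫ y in Ioi 0, g y) := by
  have key : ∀ᶠ B in atTop, ∫ y in Ioi 0, (Ioo 0 B).indicator (fun y => Ae β B y / Ad β B * g y) y
      = (∫ y in Ioo 0 B, Ae β B y * g y) / Ad β B := by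
    refine qg fun B => ?_
    rw [xv qz, inter_eq_right.2 (fun y hy => hy.1), ← integral_div]
    congr 1; ext y; ring
  rw [← qv]
  refine Tendsto.congr' key (tendsto_integral_filter_of_dominated_convergence (fun y => (xm β/π)*Ci β*|g y|) ?_ ?_ (hg.abs.const_mul _) ?_)
  · filter_upwards [qr 0] with B hB
    refine AEStronglyMeasurable.indicator ?_ qz
    have e : AEStronglyMeasurable (Ae β B) ((volume.restrict (Ioi 0))) := by
      rw [show Ioi oo = Ioo 0 B ∪ Ici B by ext y; simp; exact ⟨fun h => by by_cases y < B <;> grind, by grind⟩, aestronglyMeasurable_union_iff]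
      refine ⟨(Bd hβ hB).1.aestronglyMeasurable, ?_⟩
      refine (aestronglyMeasurable_const (b := oo)).congr ?_
      filter_upwards [qx measurableSet_Ici] with y hy
      rw [Ae, Ioo_eq_empty (by simpa using hy)]; simp
    exact (e.mul_const (Ad β B)⁻¹).mul hg.aestronglyMeasurable
  · filter_upwards [qr 0] with B hB
    refine qg fun y => ?_
    have hL := Av hβ hB
    rw [norm_indicator_eq_indicator_norm]
    refine indicator_le' (g := fun y => (xm β/π)*Ci β*|g y|) (fun y hy => ?_) (fun y hy => ?_) y
    · have h := Bs hβ hB ⟨hy.1.le, hy.2⟩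
      rw [qk, wr, qd h.1, qd hL.le, qy]
      refine qb ?_ (zr _)
      rw [qc hL]; linarith [h.2]
    · have h := Bs hβ hB ⟨zu, hB⟩
      have : 0 ≤ Ad β B * (xm β/π*Ci β) := by linarith [h.1, h.2]
      exact zo (nonneg_of_mul_nonneg_right this hL) (zr _)
  · filter_upwards [qx qh] with y hy
    have := (Hl hβ (y := fun _ => y) (qg fun _ => le_of_lt hy) (xw tendsto_id)).mul_const (g y)
    refine this.congr' ?_
    filter_upwards [qr y] with B hB
    rw [indicator_of_mem (show y ∈ Ioo 0 B from ⟨hy, hB⟩)]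
theorem Cs : IntegrableOn Am (Ioi 0) ∧ ∫ y in Ioi 0, Am y = π/4 := by
  have d : ∀ x ∈ Ici oo, HasDerivAt (fun y => (arctan y - y/(1+y²))/2) (Am x) x := fun x _ => by
    have h : 1+x² ≠ 0 := qp
    refine (((hasDerivAt_arctan x).sub ((hasDerivAt_id' x).div ((hasDerivAt_pow 2 x).const_add 1) h)).div_const 2).congr_deriv ?_
    unfold Am; field_simp; ring
  have n : ∀ x ∈ Ioi oo, 0 ≤ Am x := fun x _ => by unfold Am; positivity
  have l : Tt (fun y : ℝ => (arctan y - y/(1+y²))/2) ((π/2 - 0)/2) := by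
    refine ((tendsto_nhds_of_tendsto_nhdsWithin tendsto_arctan_atTop).sub ?_).div_const 2
    refine squeeze_zero' (g := fun y => 1/y) ?_ ?_ (by simpa using tendsto_inv_atTop_zero)
    · filter_upwards [qr 0] with y hy using by positivity
    · filter_upwards [qr 0] with y hy
      rw [wg qp hy]; nlinarith
  refine ⟨integrableOn_Ioi_deriv_of_nonneg' d n l, ?_⟩
  rw [integral_Ioi_of_hasDerivAt_of_nonneg' d n l]; simp; ring
theorem Bl (y : ℝ) : 0 ≤ Am y ∧ Am y ≤ 1/4 := by
  unfold Am
  refine ⟨qp, ?_⟩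
  rw [wg qp qn]; nlinarith [zd (1-y²)]
theorem Fi (hy : 0 < y) : ‖1 + cis ϑ²/(y:ℂ)²‖² = (1+1/y²)²*(1-4*sin ϑ²*Am y) := by
  rw [← xe, show ((2:ℕ):ℂ)*(ϑ*jj) = xc (2*ϑ)*jj by push_cast; ring, wm, Complex.normSq_apply,
    show 1 + qe (xc (2*ϑ)*jj)/(y:ℂ)² = (1+1/y²*cos (2*ϑ):ℝ) + (1/y²*sin (2*ϑ):ℝ)*jj by
      rw [Complex.exp_mul_I]; push_cast; ring]
  simp only [vh, uh, zs, Complex.ofReal_im, Complex.mul_re, Complex.mul_im, Complex.I_re, Complex.I_im]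
  have := sin_sq_add_cos_sq ϑ
  have e : cos ϑ² = 1 - sin ϑ² := ql
  simp only [sin_two_mul, cos_two_mul, Am]
  field_simp
  ring_nf
  rw [show cos ϑ^4 = (cos ϑ²)² by ring, e]; ring
theorem Hm (hβ : xx < β) (hB : 0 < B) (h : 0 < cos ϑ) :
    Cq β B (cis ϑ) ≤ Af β*Az xk β B - 2*sin ϑ²*∫ y in Ioo 0 B, Ae β B y * Am y := by
  have aq := (Cc (B := B) hβ one_pos).1
  rw [one_pow] at aq
  have av : IntegrableOn (fun y => Ae β B y * Am y) (Ioo 0 B) := by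
    refine (Bd hβ hB).1.mono' ((Bd hβ hB).1.aestronglyMeasurable.mul (Measurable.aestronglyMeasurable (by unfold Am; fun_prop))) ?_
    filter_upwards [qx qz] with y hy
    have h := Bs hβ hB ⟨hy.1.le, hy.2⟩
    rw [qk, qd h.1, qd (Bl y).1]
    nlinarith [(Bl y).2]
  rw [← En hβ hB, ← qv, ← we aq (av.const_mul _)]
  refine wv (Hk hβ hB (by rw [zg]; exact h)) (aq.sub (av.const_mul _)) qz fun y hy => ?_
  have r := Bs hβ hB ⟨hy.1.le, hy.2⟩
  have bn : 0 < 1-4*sin ϑ²*Am y := by nlinarith [Bl y, sin_sq_add_cos_sq ϑ, zd (sin ϑ)]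
  have e := Fi (ϑ := ϑ) hy.1
  have : Ah (cis ϑ²) y ≤ Ac 1 y - 2*sin ϑ²*Am y := by
    have l := congrArg log e
    have y0 := hy.1
    have q : 0 < 1+1/y² := qp
    rw [ws qp bn.ne', log_pow, log_pow] at l
    have := vl bn
    rw [Ah, Ac, qt q]; push_cast at l; linarith
  calc _ ≤ Ae β B y*(Ac 1 y - 2*sin ϑ²*Am y) := qq this r.1
    _ = _ := by ring
theorem Fj (hβ : xx < β) (hε : 0 < ε) :
    ∀ᶠ B in atTop, ∀ y ∈ Icc 0 (√B), |Ae β B y - Ad β B/π| ≤ ε*Ad β B := by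
  have hb : 2*β-1 > 0 := ql
  have h := Metric.tendsto_nhdsWithin_nhds.1 (Df hβ).1 (ε/(xm β/π)) qp
  obtain ⟨δ, jx, h⟩ := h
  filter_upwards [qr 1, (tendsto_sqrt_atTop.eventually_gt_atTop (1/δ))] with B hB ad y hy
  have ai : 0 < B := ql
  have ao : 0 < √B := sqrt_pos.2 ai
  have e : √B*√B = B := mul_self_sqrt ai.le
  have bn : 1 < √B := by rw [lt_sqrt] <;> linarith
  have hL := Av hβ ai
  have yB : y < B := by nlinarith [hy.2]
  have k := @h (y/B) (ux hy.1 ai.le) (by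
    rw [dist_zero_right, qd (ux hy.1 ai.le), div_lt_iff₀ ai]
    rw [div_lt_iff₀ jx] at ad; nlinarith [hy.2])
  rw [Et hβ, dist_eq_norm, qy] at k
  rw [Cr hβ ai ⟨hy.1, yB⟩, show Ad β B * (xm β/π)*Aq β (y/B) - Ad β B/π = Ad β B*(xm β/π)*(Aq β (y/B) - 1/xm β) by
    field_simp, abs_mul, qt qp]
  calc _ ≤ Ad β B*(xm β/π)*(ε/(xm β/π)) := by gcongr
    _ = _ := by field_simp
theorem Hn (hβ : xx < β) (hB : 0 < B) (ah : 0 ≤ a) (hab : a ≤ b) (hb : b ≤ B) 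
    (hm : ∀ y ∈ Ioo a b, m ≤ Ae β B y ∧ Ae β B y ≤ M) : m*(b-a) ≤ Au β B b - Au β B a ∧ Au β B b - Au β B a ≤ M*(b-a) := by
  have i := (Bd hβ hB).1
  have e : Au β B b - Au β B a = ∫ y in Ioc a b, Ae β B y := by
    have i' : IntegrableOn (Ae β B) (Ioc 0 B) := (integrableOn_Ioc_iff_integrableOn_Ioo (by simp)).2 i
    rw [Au, Au, ← qj, ← qj, ← Ioc_union_Ioc_eq_Ioc ah hab, setIntegral_union (Ioc_disjoint_Ioc_of_le zu) zm (i'.mono_set (Ioc_subset_Ioc_right (hab.trans hb))) (i'.mono_set (Ioc_subset_Ioc ah hb))]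
    ring
  have j := i.mono_set (Ioo_subset_Ioo ah hb)
  have c : ∀ c : ℝ, c*(b-a) = ∫ y in Ioo a b, c := fun c => by simp [hab]; ring
  rw [e, qj, c m, c M]
  have k : ∀ c : ℝ, IntegrableOn (fun _ : ℝ => c) (Ioo a b) := fun c => integrableOn_const (by simp)
  exact ⟨wv (k m) j qz fun y hy => (hm y hy).1, wv j (k M) qz fun y hy => (hm y hy).2⟩
theorem Fk (hβ : xx < β) {Bn a b : ℕ → ℝ} (hB : Tendsto Bn atTop atTop) (ah : ∀ᶠ i in atTop, 0 ≤ a i ∧ a i ≤ b i ∧ b i ≤ √(Bn i))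
    (h : Tt (fun i => Ad β (Bn i)*(b i - a i)) xh π) :
    Tt (fun i => Au β (Bn i) (b i) - Au β (Bn i) (a i)) xx := by
  rw [Metric.tendsto_nhds]
  intro ε hε
  have t := Metric.tendsto_nhds.1 (h.div_const π) (ε/4) qp
  have bh := h.eventually (vv (show π/2 < 2 by linarith [pi_lt_four]))
  filter_upwards [ah, hB.eventually (Fj hβ (show 0 < ε/4 by positivity)), hB.eventually_gt_atTop 1, t, bh] with i ⟨aa, ad, ag⟩ ar ba bi dh
  have sB : √(Bn i) ≤ Bn i := by rw [sqrt_le_left] <;> nlinarith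
  have hL := Av hβ (show 0 < Bn i by linarith)
  have k := Hn (B := Bn i) (m := Ad β (Bn i)/π - ε/4*Ad β (Bn i)) (M := Ad β (Bn i)/π + ε/4*Ad β (Bn i)) hβ ql aa ad ql fun y hy => by
    have := (zq).1 (ar y ⟨by linarith [hy.1], by linarith [hy.2]⟩)
    exact ⟨by linarith [this.1], by linarith [this.2]⟩
  rw [dist_eq_norm, qy, abs_lt] at bi ⊢
  have e : π/2/π = xx := by field_simp
  rw [e, mul_div_right_comm] at bi
  exact ⟨by nlinarith [k.1, bi.1], by nlinarith [k.2, bi.2]⟩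
theorem Fl {a b : ℕ → ℝ} (h : Tt (fun i => b i - a i) xx) :
    Tt (fun i => qe ((2*π*a i:ℝ)*jj) + qe ((2*π*b i:ℝ)*jj)) 0 := by
  rw [tendsto_zero_iff_norm_tendsto_zero]
  have c : Continuous fun x : ℝ => ‖1 + qe ((2*π*x:ℝ)*jj)‖ := qf
  have := (c.tendsto xx).comp h
  rw [show ‖1 + qe ((2*π*xx:ℝ)*jj)‖ = 0 by rw [show 2*π*xx = π by ring, Complex.exp_pi_mul_I]; simp] at this
  refine this.congr fun i => ?_
  simp only [Function.comp]
  rw [show qe ((2*π*a i:ℝ)*jj) + qe ((2*π*b i:ℝ)*jj) = qe ((2*π*a i:ℝ)*jj)*(1 + qe ((2*π*(b i - a i):ℝ)*jj)) by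
    rw [mul_add, ← zh]; congr 1; ring_nf; congr 1; push_cast; ring, qk, (Ai _).1, wj]
theorem Fm : IntegrableOn (fun t : ℝ => 8/(1+t²)) (Ioi 0) ∧ AntitoneOn (fun t : ℝ => 8/(1+t²)) (Ioi 0) := by
  refine ⟨((un 8).integrableOn).congr_fun (fun t _ => by simp [wd]) qh, fun a ha b hb h => ?_⟩
  have : oo < a := ha
  simp only; gcongr
theorem Ho (hβ : xx < β) {Bn : ℕ → ℝ} {v ξ : ℕ → ℂ} (hB : Tendsto Bn atTop atTop) (bl : ∀ i, 0 < Bn i) (hv : Tt v 1)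
    (h : ∀ᶠ i in atTop, ξ i² + 2*(v i/Bn i)*ξ i = 1 ∧ ‖ξ i-1‖ ≤ 2*‖v i‖/Bn i ∧ ‖ξ i-1‖ ≤ 1/4 ∧ ‖ξ i²‖ < 1 ∧ 1-‖ξ i²‖² ≤ 20*‖v i‖/Bn i) :
    Tt ξ 1 ∧ Tt (fun i => Ba β (Bn i) (ξ i)) 0 := by
  have vn : Tt (fun i => ‖v i‖) 1 := by simpa using hv.norm
  have jy : ∀ᶠ i in atTop, ‖v i‖ < 2 := vn.eventually (vv qn)
  have gn : Tt ξ 1 := by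
    rw [tendsto_iff_norm_sub_tendsto_zero]
    refine squeeze_zero' (qg fun _ => zk _) (h.mono fun i h => h.2.1) ?_
    exact (vn.const_mul 2).div_atTop hB
  refine ⟨gn, ?_⟩
  have hr : ∀ᶠ i in atTop, xx < (v i²).re := by
    have := (Complex.continuous_re.tendsto _).comp (hv.pow 2)
    exact this.eventually (lt_mem_nhds (by simp; norm_num))
  set A : ℕ → ℝ → ℂ := fun i => (Iio (Bn i*π/2)).indicator fun t => (2/(Bn i:ℂ)²)*((-2*jj*qe ((2*t/Bn i:ℝ)*jj)^3)/((qe ((2*t/Bn i:ℝ)*jj)-ξ i²)*(qe ((2*t/Bn i:ℝ)*jj)-(starRingEnd ℂ) (ξ i²)))) with hA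
  set e : ℕ → ℝ → ℂ := fun i t => qe ((2*π*Au β (Bn i) (Bn i*sin (t/Bn i)):ℝ)*jj) with he
  have key : ∀ i, ∫ t in Ioi 0, A i t * e i t = (1/(Bn i:ℂ))*∫ θ in Ioo 0 π, Ao β (Bn i) (ξ i²) θ := fun i => by
    have b := bl i
    have bc : (Bn i:ℂ) ≠ 0 := by exact_mod_cast b.ne'
    have q : ∀ t, A i t * e i t = (Iio (Bn i*π/2)).indicator (fun t => (2/(Bn i:ℂ)²)*Ao β (Bn i) (ξ i²) (2/Bn i*t)) t := fun t => by
      simp only [hA, he]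
      by_cases ht : t ∈ Iio (Bn i*π/2)
      · rw [indicator_of_mem ht, indicator_of_mem ht, Ao, show 2/Bn i*t/2 = t/Bn i by ring, show 2/Bn i*t = 2*t/Bn i by ring]; ring
      · rw [indicator_of_notMem ht, indicator_of_notMem ht, zero_mul]
    simp_rw [q]
    rw [xv measurableSet_Iio, Ioi_inter_Iio, qv, ← qj, ← qw qp,
      intervalIntegral.integral_comp_mul_left (fun θ => Ao β (Bn i) (ξ i²) θ) qp, xo, show 2/Bn i*(Bn i*π/2) = π by field_simp,
      qw zx, qj, Complex.real_smul]
    push_cast; field_simp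
  have hlim := Eu (A := A) (am := fun t => 2*(-2*jj)/((2*t*jj+2)*(2*t*jj+2))) (e := e) (g := fun t => 8/(1+t²)) (h := fun i => π/2/Ad β (Bn i))
    (fun t ht => ?_) (fun i => ?_) ?_ Fm.1 Fm.2 ?_ (fun i => ?_) (fun i t => ?_) (fun i => ?_) ?_ (fun t ht => ?_)
  · simp_rw [key] at hlim
    rw [tendsto_zero_iff_norm_tendsto_zero] at hlim
    have := hlim.const_mul 40
    rw [xo] at this
    refine squeeze_zero_norm' ?_ this
    filter_upwards [h, jy] with i ⟨_, _, _, ar, ba⟩ bi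
    have b := bl i
    set X := ∫ θ in Ioo 0 π, Ao β (Bn i) (ξ i²) θ
    rw [Ba, qk, qk, wr (1:ℂ), norm_one, qu, qd b.le, qd (ux (by nlinarith [zk (ξ i²)]) qp)]
    calc (1-‖ξ i²‖²)/(2*π)*‖X.re‖ ≤ (40/Bn i)/1*‖X‖ := by
          gcongr
          · refine ba.trans ?_
            gcongr; linarith
          · linarith [vz]
          · exact Complex.abs_re_le_norm X
      _ = _ := by ring
  · have hd : Tt (fun i => (Bn i:ℂ)*(qe ((2*t/Bn i:ℝ)*jj) - 1)) (2*t*jj) := by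
      have d : HasDerivAt (fun h : ℝ => qe ((2*t*h:ℝ)*jj)) (2*t*jj) 0 := by
        have : HasDerivAt (fun h : ℝ => xc (2*t*h)*jj) (xc (2*t*1)*jj) 0 := (((hasDerivAt_id' oo).const_mul (2*t)).ofReal_comp).mul_const _
        simpa using this.cexp
      have := d.tendsto_slope_zero_right.comp (tendsto_inv_atTop_nhdsGT_zero.comp hB)
      refine this.congr fun i => ?_
      simp [Function.comp, wd]
    have aa : Tt (fun i => (Bn i:ℂ)*(1-ξ i²)) 2 := by
      have := (hv.const_mul 2).mul gn
      simp only [zb] at this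
      refine this.congr' (h.mono fun i h => ?_)
      have bc : (Bn i:ℂ) ≠ 0 := by exact_mod_cast (bl i).ne'
      have := h.1
      field_simp at this; linear_combination this
    have ad : Tt (fun i => (Bn i:ℂ)*(1-(starRingEnd ℂ) (ξ i²))) 2 := by
      have := (Complex.continuous_conj.tendsto _).comp aa
      refine (this.congr fun i => ?_).trans (by rw [Complex.conj_ofNat])
      simp
    have ag : Tt (fun i => qe ((2*t/Bn i:ℝ)*jj)) 1 := by
      have c : Continuous fun x : ℝ => qe ((x:ℝ)*jj) := qf
      have := (c.tendsto 0).comp ((tendsto_const_nhds (x := 2*t)).div_atTop hB)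
      simpa [Function.comp_def] using this
    have := ((ag.pow 3).const_mul (2*(-2*jj))).div ((hd.add aa).mul (hd.add ad)) (by
      intro hh
      have := congrArg Complex.re (mul_self_eq_zero.1 hh)
      simp at this)
    simp only [one_pow, zb] at this
    refine this.congr' ?_
    filter_upwards [hB.eventually_gt_atTop (t*2/π)] with i hi
    have bc : (Bn i:ℂ) ≠ 0 := by exact_mod_cast (bl i).ne'
    simp only [hA]
    rw [Pi.div_apply, indicator_of_mem (by rw [div_lt_iff₀ zp] at hi; simp; linarith), ← mul_add, ← mul_add, sub_add_sub_cancel, sub_add_sub_cancel, div_mul_div_comm]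
    congr 1 <;> ring
  · exact Measurable.indicator qf measurableSet_Iio
  · filter_upwards [h, hr] with i ⟨aa, _, ag, _, _⟩ ba t ht
    have b := bl i
    have bc : (Bn i:ℂ) ≠ 0 := by exact_mod_cast b.ne'
    simp only [hA]
    rw [norm_indicator_eq_indicator_norm]
    by_cases hc : t ∈ Iio (Bn i*π/2)
    swap
    · rw [indicator_of_notMem hc]; positivity
    rw [indicator_of_mem hc]
    rw [mem_Iio] at hc
    set θ := 2*t/Bn i with hθ
    have n := Ff (β := β) (B := Bn i) (af := ξ i²) θ
    rw [Ao, wu, qk, (Ai _).1, wj] at n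
    rw [qk, n, ← qk]
    set y := Bn i*sin (t/Bn i) with hy
    have bn : 2/π*(t/Bn i) ≤ sin (t/Bn i) := mul_le_sin (ux (le_of_lt ht) b.le) (by rw [qc b]; linarith)
    have eo : 2/π*t ≤ y := by
      rw [hy]; calc _ = Bn i*(2/π*(t/Bn i)) := by field_simp
        _ ≤ _ := by gcongr
    have go : t²/4 ≤ y² := by
      have : xx*t ≤ 2/π*t := qb (by rw [wg qn zp]; linarith [pi_lt_four]) (le_of_lt ht)
      nlinarith [show 0 < t from ht]
    have id : (cis θ-ξ i²)*(cin θ-ξ i²) = 4*ξ i²*(v i²+(y²:ℝ))/Bn i² := by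
      have az : cis θ*cin θ = 1 := by rw [← zh]; simp
      have ay : cis θ+cin θ = 2*(1-2*(sin (t/Bn i):ℝ)²) := by
        have : cos θ = 1-2*sin (t/Bn i)² := by
          rw [hθ, show 2*t/Bn i = 2*(t/Bn i) by ring, cos_two_mul, cos_sq']; ring
        have g := Complex.two_cos (θ:ℂ)
        rw [← neg_mul, ← g, ← ut, this]; push_cast; ring
      have ca : (1-ξ i²)² = 4*v i²*ξ i²/Bn i² := by
        rw [← aa]; field_simp; ring
      have bt : xc (y²) = Bn i²*(sin (t/Bn i):ℝ)² := by rw [hy]; push_cast; ring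
      rw [bt]
      have fk : 4*ξ i²*(v i²+Bn i²*(sin (t/Bn i):ℝ)²)/Bn i² = 4*v i²*ξ i²/Bn i² + 4*ξ i²*(sin (t/Bn i):ℝ)² := by field_simp
      rw [fk, ← ca]; linear_combination az - ξ i²*ay
    have hx := (Dq ag).1
    have re : xx+t²/4 ≤ ‖v i²+(y²:ℝ)‖ := by
      refine wh ?_ (zw _)
      rw [vh, zs]; linarith
    have tp : 0 < xx+t²/4 := qp
    rw [id, wr, wr, qk, qk, xi, xi, qu, qd b.le]
    have es : xx ≤ ‖ξ i‖² := by nlinarith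
    have pos : xx*(xx+t²/4) ≤ ‖ξ i‖²*‖v i²+(y²:ℝ)‖ := xf es re tp.le qp
    have pp : 0 < ‖v i²+(y²:ℝ)‖ := ql
    have px : 0 < ‖ξ i‖ := ql
    simp only [Complex.norm_ofNat]
    calc _ = 1/(‖ξ i‖²*‖v i²+(y²:ℝ)‖) := by field_simp; norm_num
      _ ≤ 1/(xx*(xx+t²/4)) := one_div_le_one_div_of_le qp pos
      _ ≤ _ := by rw [wg qp qp]; nlinarith
  · refine Continuous.continuousOn (continuous_const.div qf fun t hh => ?_)
    have := congrArg Complex.re (mul_self_eq_zero.1 hh)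
    simp at this
  · have := (Dp hβ (bl i)).comp (measurable_const_mul (2/Bn i))
    have q : (fun t => Au β (Bn i) (Bn i*sin (t/Bn i))) = (fun θ => Au β (Bn i) (Bn i*sin xh θ)) ∘ (fun t => 2/Bn i*t) := by
      ext t; simp only [Function.comp]; congr 3; ring
    rw [← q] at this
    simp only [he]; fun_prop
  · exact (Ai _).1.le
  · exact uj qp (Av hβ (bl i))
  · exact xw ((Bf hβ).comp hB)
  · apply Fl
    have cz : Tt (fun i => π/2/Ad β (Bn i)) 0 := xw ((Bf hβ).comp hB)
    have bd : ∀ i, π/2/Ad β (Bn i) < 1 → t+1 < Bn i → π/2/Ad β (Bn i)*cos ((t+1)/Bn i) ≤ Bn i*sin ((t+π/2/Ad β (Bn i))/Bn i) - Bn i*sin (t/Bn i) ∧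
        Bn i*sin ((t+π/2/Ad β (Bn i))/Bn i) - Bn i*sin (t/Bn i) ≤ π/2/Ad β (Bn i) := fun i aq av => by
      have b := bl i
      have hp : 0 < π/2/Ad β (Bn i) := uj qp (Av hβ b)
      set k := π/2/Ad β (Bn i)
      have al : 0 < t := ht
      obtain ⟨c, hc, hc'⟩ := exists_hasDerivAt_eq_slope (fun x => Bn i*sin (x/Bn i)) (fun x => cos (x/Bn i)) (show t < t+k by linarith) qf (fun x _ => by
        have := ((hasDerivAt_sin (x/Bn i)).comp x ((hasDerivAt_id' x).div_const _)).const_mul (Bn i)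
        refine this.congr_deriv ?_
        field_simp)
      have : Bn i*sin ((t+k)/Bn i) - Bn i*sin (t/Bn i) = k*cos (c/Bn i) := by
        rw [hc', add_sub_cancel_left, mul_div_cancel₀ _ hp.ne']
      rw [this]
      refine ⟨qq (cos_le_cos_of_nonneg_of_le_pi (ux (by linarith [hc.1]) b.le) ?_ ?_) hp.le, by nlinarith [cos_le_one (c/Bn i)]⟩
      · rw [qc b]; nlinarith [vz]
      · gcongr; linarith [hc.2]
    have ev : ∀ᶠ i in atTop, π/2/Ad β (Bn i) < 1 ∧ (t+1)² < Bn i := (cz.eventually (vv one_pos)).and (hB.eventually_gt_atTop _)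
    have al : 0 < t := ht
    refine Fk hβ hB ?_ ?_
    · filter_upwards [ev] with i ⟨aq, av⟩
      have b := bl i
      have bj : t+1 < Bn i := by nlinarith
      have q := bd i aq bj
      have hp : 0 < π/2/Ad β (Bn i) := uj qp (Av hβ b)
      have cp : 0 < cos ((t+1)/Bn i) := cos_pos_of_mem_Ioo ⟨by have : 0 < (t+1)/Bn i := qp; linarith [zp], by rw [div_lt_iff₀ b]; nlinarith [vz]⟩
      refine ⟨zo b.le (sin_nonneg_of_nonneg_of_le_pi qp (by rw [qc b]; nlinarith [vz])), by nlinarith, ?_⟩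
      have := sin_le (show 0 ≤ (t+π/2/Ad β (Bn i))/Bn i by positivity)
      calc _ ≤ Bn i*((t+π/2/Ad β (Bn i))/Bn i) := by gcongr
        _ = t+π/2/Ad β (Bn i) := by field_simp
        _ ≤ t+1 := ql
        _ ≤ _ := by apply le_sqrt_of_sq_le; linarith
    · have l : Tt (fun i => π/2*cos ((t+1)/Bn i)) xh π := by
        have := ((continuous_cos.tendsto 0).comp ((tendsto_const_nhds (x := t+1)).div_atTop hB)).const_mul xh π
        simpa using this
      have s : ∀ i, Ad β (Bn i)*(π/2/Ad β (Bn i)) = π/2 := fun i => by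
        have := Av hβ (bl i); field_simp
      refine tendsto_of_tendsto_of_tendsto_of_le_of_le' l tendsto_const_nhds ?_ ?_
      · filter_upwards [ev] with i ⟨aq, av⟩
        have q := qq (bd i aq (by nlinarith)).1 (Av hβ (bl i)).le
        rwa [← wx, s] at q
      · filter_upwards [ev] with i ⟨aq, av⟩
        have q := qq (bd i aq (by nlinarith)).2 (Av hβ (bl i)).le
        rwa [s] at q
theorem Fn (c : ℕ → ℝ) (N : ℕ) :
    ∫ ϑ in (-xh π)..xh π, ‖An c N (-cis ϑ²)‖² = π * ∑ k ∈ rg (N+1), c k² := by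
  have e : ∀ ϑ : ℝ, ‖An c N (-cis ϑ²)‖² = ∑ j ∈ rg (N+1), ∑ k ∈ rg (N+1), c j*c k*cos (((j:ℝ)-k)*(2*ϑ+π)) := fun ϑ => by
    have z : -cis ϑ² = qe ((2*ϑ+π:ℝ)*jj) := by
      push_cast; rw [add_mul, zh, Complex.exp_pi_mul_I, ← xe]; push_cast; ring_nf
    have p : An c N (-cis ϑ²) = (∑ k ∈ rg (N+1), c k*cos (k*(2*ϑ+π)):ℝ) + (∑ k ∈ rg (N+1), c k*sin (k*(2*ϑ+π)):ℝ)*jj := by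
      rw [z, An]; push_cast; rw [Finset.sum_mul, ← wn]
      refine zy rfl fun k _ => ?_
      rw [← xe, ← wx, Complex.exp_mul_I]; ring
    rw [p, wm, Complex.normSq_add_mul_I, sq, sq, Finset.sum_mul_sum, Finset.sum_mul_sum, ← wn]
    refine zy rfl fun j _ => ?_
    rw [← wn]
    refine zy rfl fun k _ => ?_
    rw [sub_mul, cos_sub]; ring
  have i : ∀ j k : ℕ, ∫ ϑ in (-xh π)..xh π, c j*c k*cos (((j:ℝ)-k)*(2*ϑ+π)) = if j = k then π*c j² else 0 := fun j k => by
    split_ifs with h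
    · subst h; simp; ring
    · have h' : ((j:ℝ)-k) ≠ 0 := (xg).2 (by exact_mod_cast h)
      rw [zj]
      have : ∀ ϑ, cos (((j:ℝ)-k)*(2*ϑ+π)) = cos ((((j:ℝ)-k)*2)*ϑ+((j:ℝ)-k)*π) := fun ϑ => by ring_nf
      simp_rw [this]
      rw [intervalIntegral.integral_comp_mul_add _ qp, integral_cos]
      rw [show ((j:ℝ)-k)*2*xh π+((j:ℝ)-k)*π = ((2*((j:ℤ)-k):ℤ):ℝ)*π by push_cast; ring, sin_int_mul_pi, show ((j:ℝ)-k)*2*(-xh π)+((j:ℝ)-k)*π = 0 by ring]; simp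
  simp_rw [e]
  rw [intervalIntegral.integral_finsetSum fun j _ => Continuous.intervalIntegrable qf _ _, vg]
  refine zy rfl fun j hj => ?_
  rw [intervalIntegral.integral_finsetSum fun k _ => Continuous.intervalIntegrable qf _ _]
  simp_rw [i]
  simp [(wf).1 hj]
theorem Hp (c : ℕ → ℝ) (N : ℕ) {z : ℂ} (hz : ‖z‖ = 1) : ‖An c N z‖² ≤ (N+1)*∑ k ∈ rg (N+1), c k² := by
  have aa : ‖An c N z‖ ≤ ∑ k ∈ rg (N+1), |c k| := (norm_sum_le _ _).trans (Finset.sum_le_sum fun k _ => by simp [hz])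
  have ad := sq_sum_le_card_mul_sum_sq (s := rg (N+1)) (f := fun k => |c k|)
  simp only [sq_abs, Finset.card_range] at ad
  push_cast at ad
  exact (pow_le_pow_left₀ (zk _) aa 2).trans ad
theorem Hq (hβ : xx < β) (c : ℕ → ℝ) (N : ℕ) : IntegrableOn (fun x => As c N x² * exp (-(x^β))) (Ioi 0) := by
  have e : ∀ x, As c N x² * exp (-(x^β)) = ∑ j ∈ rg (N+1), ∑ k ∈ rg (N+1), c j*c k*(x^(j+k)*exp (-(x^β))) := fun x => by
    rw [As, sq, Finset.sum_mul_sum, Finset.sum_mul]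
    refine zy rfl fun j _ => ?_
    rw [Finset.sum_mul]
    refine zy rfl fun k _ => by ring
  simp_rw [e]
  refine integrable_finsetSum _ fun j _ => integrable_finsetSum _ fun k _ => Integrable.const_mul ?_ _
  have := integrableOn_rpow_mul_exp_neg_rpow (p := β) (s := ((j+k:ℕ):ℝ)) (by have : oo ≤ ((j+k:ℕ):ℝ) := qp; linarith) ql
  refine this.congr_fun (fun x _ => by simp only [vd]) qh
theorem Hr (hβ : xx < β) (k : ℕ) : Tt (fun N : ℕ => ((N:ℝ)+1)^k*√(π*Ad β (Ak β N))*exp (-Ad β (Ak β N)/8)) 0 := by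
  have hb : 0 < 2*β-1 := ql
  have g := Bo hβ
  set q := 2*β/xm β
  have t := (((tendsto_rpow_mul_exp_neg_mul_atTop_nhds_zero (q*k+xx) (1/8) qn).comp ((Bf hβ).comp (Ck hβ)))).const_mul ((2*(Af β/(4*β)*(xm β/Af β)^q))^k*√π)
  rw [xo] at t
  refine squeeze_zero' (qg fun N => qp) ?_ t
  filter_upwards [qr 0] with N hN
  have ai := Bv hβ hN
  have br := Av hβ ai
  have bm : (1:ℝ) ≤ N := by exact_mod_cast hN
  have hN' := Cx hβ hN
  set B := Ak β N
  have aj : B^xk β = (xm β/Af β)^q*Ad β B^q := by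
    rw [← mul_rpow qp br.le, show xm β/Af β*Ad β B = B^xm β by rw [Ad]; field_simp, ← vf ai.le]
    congr 1; simp only [q]; field_simp
  have ak : (N:ℝ) = Af β/(4*β)*(xm β/Af β)^q*Ad β B^q := by
    rw [wx, ← aj, div_mul_eq_mul_div, hN']; field_simp
  have be : (N:ℝ)+1 ≤ 2*(Af β/(4*β)*(xm β/Af β)^q)*Ad β B^q := ql
  simp only [Function.comp]
  calc _ ≤ (2*(Af β/(4*β)*(xm β/Af β)^q)*Ad β B^q)^k*√(π*Ad β B)*exp (-Ad β B/8) := by gcongr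
    _ = _ := by
      rw [xj, ← rpow_mul_natCast br.le, sqrt_mul zx, xd (Ad β B), rpow_add br, show -(1/8)*Ad β B = -Ad β B/8 by ring]; ring
theorem Hs {F : ℝ → ℝ} (Fc : Continuous F) (gp : 2 ≤ M) (pw : ∀ ϑ ∈ Icc (-xh π) xh π, F ϑ ≤ (Ioc (-1) 1).indicator F ϑ + D + ((Ioc (-xh π) (-xh π+1/M²)).indicator (fun _ => M) ϑ + (Ioc (π/2-1/M²) xh π).indicator (fun _ => M) ϑ) ∨ ϑ = -1 ∨ ϑ = -xh π) :
    ∫ ϑ in (-xh π)..xh π, F ϑ ≤ (∫ ϑ in (-1:ℝ)..1, F ϑ) + π*D + (M*(1/M²) + M*(1/M²)) := by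
  have ii : ∀ a b : ℝ, IntegrableOn ((Ioc a b).indicator fun _ => M) (Ioc (-xh π) xh π) := fun a b => by
    have : IntegrableOn (fun _ : ℝ => M) (Ioc (-xh π) xh π) := integrableOn_const (by simp)
    exact this.indicator zm
  have iF : IntegrableOn ((Ioc (-1) 1).indicator F) (Ioc (-xh π) xh π) := by
    have : IntegrableOn F (Ioc (-xh π) xh π) := Fc.integrableOn_Ioc
    exact this.indicator zm
  have iD : IntegrableOn (fun _ : ℝ => D) (Ioc (-xh π) xh π) := integrableOn_const (by simp)
  have ls : 1/M² ≤ 1 := by rw [xl qp]; nlinarith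
  have gq := vz
  have Mi : 0 < 1/M² := qp
  rw [qw (by linarith [zp])]
  have key := integral_mono_ae (Fc.integrableOn_Ioc) ((iF.add iD).add ((ii (-xh π) (-xh π+1/M²)).add (ii (π/2-1/M²) xh π))) (show F ≤ᵐ[volume.restrict (Ioc (-xh π) xh π)] _ by
    filter_upwards [qx zm, uv (ul volume (-1:ℝ)), uv (ul volume (-xh π))] with ϑ hϑ bs co
    exact ((pw ϑ ⟨hϑ.1.le, hϑ.2⟩).resolve_right (by push Not; exact ⟨bs, co⟩)))
  rw [integral_add' (iF.add iD) ((ii _ _).add (ii _ _)), integral_add' iF iD, integral_add' (ii _ _) (ii _ _), xv zm, xv zm, xv zm,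
    inter_eq_right.2 (Ioc_subset_Ioc ql ql), inter_eq_right.2 (Ioc_subset_Ioc_right ql), inter_eq_right.2 (Ioc_subset_Ioc_left ql)] at key
  rw [qw qn]
  refine key.trans (vi ?_)
  rw [setIntegral_const, setIntegral_const, setIntegral_const]
  simp only [measureReal_def, volume_Ioc, qo]
  rw [ENNReal.toReal_ofReal ql, ENNReal.toReal_ofReal ql, ENNReal.toReal_ofReal ql]
  ring
theorem Ht (hβ : xx < β) (c : ℕ → ℕ → ℝ) (hc : ∀ N, ∑ k ∈ rg (N+1), c N k² = 1) (hε : 0 < ε) :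
    ∀ᶠ M : ℕ in atTop, 2*π - ε ≤ (1+ε)*(exp (2*(Af β*Az xk β (Ak β M)))/(4*√(π*Ad β (Ak β M))))*∫ x in Ioi 0, As (c M) M x²*exp (-(x^β)) := by
  have suff : ∀ᶠ N : ℕ in atTop, 2*π - ε ≤ (1+ε)*(exp (2*(Af β*Az xk β (Ak β (N+1))))/(4*√(π*Ad β (Ak β (N+1)))))*∫ x in Ioi 0, As (c (N+1)) (N+1) x²*exp (-(x^β)) := by
    set B : ℕ → ℝ := fun N => Ak β (N+1) with hB
    set L : ℕ → ℝ := fun N => Ad β (B N) with hL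
    set E : ℕ → ℝ := fun N => exp (2*(Af β*Az xk β (B N))) with hE
    set I : ℕ → ℝ := fun N => ∫ x in Ioi 0, As (c (N+1)) (N+1) x²*exp (-(x^β)) with hI
    set F : ℕ → ℝ → ℝ := fun N ϑ => ‖An (c (N+1)) (N+1) (-cis ϑ²)‖² with hF
    set R : ℕ → ℝ := fun N => ∫ y in Ioo 0 (B N), Ae β (B N) y*Am y with hR
    have ai : ∀ N, 0 < B N := fun N => Bv hβ (Nat.succ_pos N)
    have Bt : Tendsto B atTop atTop := (ww 1).2 (Ck hβ)
    have br : ∀ N, 0 < L N := fun N => Av hβ (ai N)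
    have Lt : Tendsto L atTop atTop := (Bf hβ).comp Bt
    have sL : ∀ N, √(L N)² = L N := fun N => sq_sqrt (br N).le
    have ao : ∀ N, 0 < √(L N) := fun N => sqrt_pos.2 (br N)
    have ch : ∀ N, 0 < E N := fun N => xz _
    have cx : ∀ N, 0 ≤ I N := fun N => setIntegral_nonneg qh fun x _ => qp
    have gr : ∀ N ϑ, 0 ≤ F N ϑ := fun N ϑ => qp
    have Fc : ∀ N, Continuous (F N) := fun N => by simp only [hF, An]; fun_prop
    have Rt : Tt (fun N => R N/L N) (1/4) := by
      have := (Fh hβ Cs.1).comp Bt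
      rwa [Cs.2, show 1/π*(π/4) = 1/4 by field_simp] at this
    have gs : ∀ᶠ N in atTop, L N/8 ≤ R N := (Rt.eventually (lt_mem_nhds (show (1/8:ℝ) < 1/4 by norm_num))).mono fun N h => by
      rw [lt_div_iff₀ (br N)] at h; linarith
    have U : ∀ N ϑ, ∃ ξ : ℂ, 8 ≤ B N → 0 < cos ϑ → (ξ² + 2*(cis ϑ/B N)*ξ = 1 ∧ ‖ξ-1‖ ≤ 2*‖cis ϑ‖/B N ∧ ‖ξ-1‖ ≤ 1/4 ∧ ‖ξ²‖ < 1 ∧ 1-‖ξ²‖² ≤ 20*‖cis ϑ‖/B N) ∧ |Ba β (B N) ξ| ≤ 1 ∧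
        F N ϑ ≤ exp (-4*sin ϑ²*R N)/(8*π*cos ϑ)*Bc ξ*(1+Ba β (B N) ξ)*(I N*E N) ∧ 0 ≤ Bc ξ ∧ Bc ξ ≤ 12 := fun N ϑ => by
      by_cases h : 8 ≤ B N ∧ 0 < cos ϑ
      swap
      · exact ⟨0, fun a b => absurd ⟨a, b⟩ h⟩
      have bm := (Ai ϑ).1
      have re : (cis ϑ).re = cos ϑ := zg ϑ
      obtain ⟨ξ, aa, ad, ag, ar, ba, bi, dh⟩ := Hj (N := N+1) (v := cis ϑ) hβ (ai N) (by exact_mod_cast Cx hβ (Nat.succ_pos N)) (by rw [re]; exact h.2) (by rw [bm]; linarith)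
      obtain ⟨bf, bk, dc, cw, dw⟩ := Dq ag
      have dx : 0 ≤ Bc ξ := by unfold Bc; positivity
      refine ⟨ξ, fun _ _ => ⟨⟨aa, ad, ag, ar, ba⟩, bi, ?_, dx, dw⟩⟩
      have := dh (c (N+1)) (Hq hβ _ _)
      rw [bm, re, zb] at this
      refine this.trans ?_
      have p := Hm hβ (ai N) h.2
      have p' : exp (2*Cq β (B N) (cis ϑ)) ≤ exp (-4*sin ϑ²*R N)*E N := by
        rw [hE, ← zn]; apply (wp).2; linarith
      have az : 0 ≤ 1+Ba β (B N) ξ := by linarith [((zq).1 bi).1]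
      have ay := h.2
      calc _ ≤ exp (-4*sin ϑ²*R N)*E N/(8*π*cos ϑ)*Bc ξ*(1+Ba β (B N) ξ)*I N := by gcongr
        _ = _ := by ring
    choose ξ hξ using U
    have Ub : ∀ N ϑ, 8 ≤ B N → 0 < cos ϑ → F N ϑ ≤ exp (-4*sin ϑ²*R N)*(1/cos ϑ)*(I N*E N) := fun N ϑ aa ad => by
      obtain ⟨-, ag, ar, ba, bi⟩ := hξ N ϑ aa ad
      refine ar.trans (qb ?_ (zo (cx N) (ch N).le))
      have az : 1+Ba β (B N) (ξ N ϑ) ≤ 2 := by linarith [((zq).1 ag).2]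
      have cd : 0 ≤ 1+Ba β (B N) (ξ N ϑ) := by linarith [((zq).1 ag).1]
      have k : Bc (ξ N ϑ)*(1+Ba β (B N) (ξ N ϑ)) ≤ 12*2 := xf bi az cd qn
      calc _ = exp (-4*sin ϑ²*R N)*(1/cos ϑ)*((Bc (ξ N ϑ)*(1+Ba β (B N) (ξ N ϑ)))/(8*π)) := by field_simp
        _ ≤ exp (-4*sin ϑ²*R N)*(1/cos ϑ)*1 := by
          gcongr
          rw [xl qp]; linarith [vz]
        _ = _ := zb _
    have sinb : ∀ ϑ, |ϑ| ≤ π/2 → ϑ²/4 ≤ sin ϑ² := fun ϑ h => by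
      rw [← sq_abs (sin ϑ), ← sq_abs ϑ]
      have := mul_abs_le_abs_sin h
      have : xx*|ϑ| ≤ |sin ϑ| := wh (qb (by rw [wg qn zp]; linarith [pi_lt_four]) (zr _)) this
      nlinarith [zr ϑ]
    have cosb : ∀ ϑ, |ϑ| ≤ 1 → xx ≤ cos ϑ := fun ϑ h => by
      have := one_sub_sq_div_two_le_cos (x := ϑ)
      have := (sq_le_one_iff_abs_le_one ϑ).2 h
      linarith
    set g : ℝ → ℝ := fun s => exp (-1*s²)/(8*π) with hg
    set J : ℕ → ℝ → ℝ := fun N => (Icc (-√(L N)) (√(L N))).indicator fun s => F N (s/√(L N))/(I N*E N) with hJ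
    have hs : ∀ N s, s ∈ Icc (-√(L N)) (√(L N)) → |s/√(L N)| ≤ 1 := fun N s h => by
      rw [abs_div, qt (ao N), xl (ao N)]; exact (zq).2 h
    have dom : ∀ᶠ N in atTop, ∀ s, J N s ≤ 2*exp (-(1/8)*s²) := by
      filter_upwards [Bt.eventually_ge_atTop 8, gs] with N aa ad s
      refine indicator_le' (g := fun s => 2*exp (-(1/8)*s²)) (fun s h => ?_) (fun s _ => qp) s
      have a := hs N s h
      have cb := cosb _ a
      refine div_le_of_le_mul₀ (zo (cx N) (ch N).le) qp ((Ub N _ aa ql).trans (qb ?_ (zo (cx N) (ch N).le)))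
      rw [uf 2]
      have b := sinb _ (a.trans (by linarith [vz]))
      rw [div_pow, sL] at b
      refine xf ((wp).2 ?_) ?_ (one_div_nonneg.2 ql) (xz _).le
      · have : s²/L N/4*(L N/8) ≤ sin (s/√(L N))²*R N := xf b ad (by have := br N; positivity) qp
        have e : s²/L N/4*(L N/8) = s²/32 := by have := (br N).ne'; field_simp; ring
        linarith
      · rw [qc ql]; linarith
    have H : Tt (fun N => ∫ s, max (J N s) (g s)) (∫ s, g s) := by
      refine tendsto_integral_filter_of_dominated_convergence (fun s => 2*exp (-(1/8)*s²)) ?_ ?_ ((ub qn).const_mul 2) ?_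
      · refine qg fun N => Measurable.aestronglyMeasurable ?_
        have := Fc N
        exact (Measurable.indicator qf measurableSet_Icc).max qf
      · filter_upwards [dom] with N h
        refine qg fun s => ?_
        have bx : 0 ≤ g s := by simp only [hg]; positivity
        rw [qd (le_max_of_le_right bx)]
        refine max_le (h s) ?_
        simp only [hg]
        calc _ ≤ exp (-1*s²) := div_le_self (xz _).le (by linarith [vz])
          _ ≤ exp (-(1/8)*s²) := (wp).2 (by nlinarith [zd s])
          _ ≤ _ := by linarith [xz (-(1/8)*s²)]
      · refine qg fun s => ?_
        have st : Tendsto (fun N => √(L N)) atTop atTop := tendsto_sqrt_atTop.comp Lt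
        have al : Tt (fun N => s/√(L N)) 0 := xw st
        have vt : Tt (fun N => qe ((s/√(L N):ℝ)*jj)) 1 := by
          have cc : Continuous fun x : ℝ => qe ((x:ℝ)*jj) := qf
          simpa [Function.comp_def] using (cc.tendsto 0).comp al
        have ct : Tt (fun N => cos (s/√(L N))) 1 := by simpa [Function.comp_def] using (continuous_cos.tendsto 0).comp al
        have cp : ∀ᶠ N in atTop, 0 < cos (s/√(L N)) := ct.eventually (lt_mem_nhds one_pos)
        obtain ⟨gv, es⟩ := Ho hβ Bt ai vt (ξ := fun N => ξ N (s/√(L N))) (by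
          filter_upwards [Bt.eventually_ge_atTop 8, cp] with N aa ad using (hξ N _ aa ad).1)
        have kt : Tt (fun N => Bc (ξ N (s/√(L N)))) 1 := by
          have : ContinuousAt Bc 1 := by unfold Bc; exact ContinuousAt.div qf qf (by rw [show (1:ℂ)+1²=2 by norm_num]; norm_num)
          have := this.tendsto.comp gv
          rwa [show Bc 1 = 1 by simp [Bc]; norm_num] at this
        have sn : Tt (fun N => sin (s/√(L N))²*L N) (s²) := by
          have d := (hasDerivAt_sin 0).tendsto_slope_zero_right
          rcases eq_or_ne s 0 with rfl | jz
          · simp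
          have d := (hasDerivAt_iff_tendsto_slope_zero.1 (hasDerivAt_sin 0)).comp (tendsto_nhdsWithin_iff.2 ⟨al, qg fun N => div_ne_zero jz (ao N).ne'⟩)
          have := (d.pow 2).const_mul (s²)
          simp only [cos_zero, one_pow, zb] at this
          refine this.congr fun N => ?_
          have := (ao N).ne'
          simp only [Function.comp, vb, sin_zero, ze, qo]
          field_simp; rw [sL]; try ring
        have ex : Tt (fun N => exp (-4*sin (s/√(L N))²*R N)) (exp (-1*s²)) := by
          refine (continuous_exp.tendsto _).comp ?_
          have := (sn.mul Rt).const_mul (-4)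
          refine (this.congr fun N => ?_).trans (by rw [show -4*(s²*(1/4)) = -1*s² by ring])
          have := (br N).ne'; field_simp
        have Kt := ((ex.div (ct.const_mul (8*π)) qp).mul kt).mul (es.const_add 1)
        simp only [zb, vu] at Kt
        have Kt' := Kt.max (tendsto_const_nhds (x := g s))
        rw [show exp (-1*s²)/(8*π) = g s from rfl, max_self] at Kt'
        refine tendsto_of_tendsto_of_tendsto_of_le_of_le' tendsto_const_nhds Kt' (qg fun N => le_max_right _ _) ?_
        filter_upwards [Bt.eventually_ge_atTop 8, cp] with N aa ad
        refine max_le_max ?_ zu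
        obtain ⟨-, ag, ar, ba, bi⟩ := hξ N _ aa ad
        have cd : 0 ≤ 1+Ba β (B N) (ξ N (s/√(L N))) := by linarith [((zq).1 ag).1]
        have gx : 0 ≤ exp (-4*sin (s/√(L N))²*R N)/(8*π*cos (s/√(L N)))*Bc (ξ N (s/√(L N)))*(1+Ba β (B N) (ξ N (s/√(L N)))) := qp
        refine indicator_apply_le' (fun _ => ?_) (fun _ => gx)
        exact div_le_of_le_mul₀ (zo (cx N) (ch N).le) gx ar
    rw [show ∫ s, g s = √π/(8*π) by rw [integral_div, integral_gaussian]; simp] at H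
    have ka : ∀ᶠ N in atTop, ∫ ϑ in (-1:ℝ)..1, F N ϑ ≤ (1+ε/2)*(√π/(8*π))/√(L N)*(I N*E N) := by
      filter_upwards [Bt.eventually_ge_atTop 8, dom, H.eventually (ge_mem_nhds (show √π/(8*π) < (1+ε/2)*(√π/(8*π)) by nlinarith [show 0 < √π/(8*π) by positivity]))] with N aa ad ag
      have ji : ∀ s, 0 ≤ J N s := fun s => indicator_nonneg (fun s _ => ux (gr _ _) (zo (cx N) (ch N).le)) s
      have mi : Integrable (fun s => max (J N s) (g s)) := by
        have := Fc N
        refine ((ub (show oo < 1/8 by norm_num)).const_mul 2).add ((ub (show oo < 1 by norm_num)).div_const (8*π)) |>.mono' (Measurable.aestronglyMeasurable ((Measurable.indicator qf measurableSet_Icc).max qf)) (qg fun s => ?_)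
        have bx : 0 ≤ g s := by simp only [hg]; positivity
        rw [qd (le_max_of_le_right bx)]
        refine max_le ((ad s).trans ?_) ?_
        · simp only [Pi.add_apply]; exact le_add_of_nonneg_right bx
        · simp only [Pi.add_apply]; exact le_add_of_nonneg_left qp
      have gy : ∫ s in (-√(L N))..√(L N), F N (s/√(L N))/(I N*E N) ≤ ∫ s, max (J N s) (g s) := by
        rw [qw (by linarith [ao N]), ← integral_Icc_eq_integral_Ioc, ← integral_indicator measurableSet_Icc]
        exact integral_mono_of_nonneg (qg ji) mi (qg fun s => le_max_left _ _)
      rw [intervalIntegral.integral_div, intervalIntegral.integral_comp_div _ (ao N).ne', vm, div_self (ao N).ne', qo] at gy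
      rcases (zo (cx N) (ch N).le).eq_or_lt with ah | ah
      · rw [← ah, xo]
        rw [qw qn]
        refine setIntegral_nonpos zm fun ϑ hϑ => ?_
        have := cosb ϑ ((zq).2 ⟨hϑ.1.le, hϑ.2⟩)
        have := Ub N ϑ aa ql
        rwa [← ah, xo] at this
      · have := gy.trans ag
        rw [qc ah] at this
        rw [div_mul_eq_mul_div, zt (ao N)]; linarith
    have pe := ((ww 1).2 (Hr hβ 2)).const_mul (16*π)
    rw [xo] at pe
    have bq : Tt (fun N : ℕ => (8:ℝ)*(1/((N+1:ℕ)+1))) 0 := by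
      have := ((ww 1).2 (tendsto_one_div_add_atTop_nhds_zero_nat (𝕜 := ℝ))).const_mul 8
      rw [xo] at this; exact this
    filter_upwards [ka, Bt.eventually_ge_atTop 8, gs, pe.eventually (ge_mem_nhds (half_pos hε)), bq.eventually (ge_mem_nhds hε)] with N aa ad ag ar ba
    set M : ℝ := ((N+1:ℕ):ℝ)+1 with hM
    have gp : 2 ≤ M := by rw [hM]; push_cast; have : oo ≤ N := qp; linarith
    set D : ℝ := 2*M²*exp (-L N/8)*(I N*E N) with hD
    have lu : 0 ≤ D := zo qp (zo (cx N) (ch N).le)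
    have P := Fn (c (N+1)) (N+1)
    rw [hc, zb] at P
    have pw : ∀ ϑ ∈ Icc (-xh π) xh π, F N ϑ ≤ (Ioc (-1) 1).indicator (F N) ϑ + D + ((Ioc (-xh π) (-xh π+1/M²)).indicator (fun _ => M) ϑ + (Ioc (π/2-1/M²) xh π).indicator (fun _ => M) ϑ) ∨ ϑ = -1 ∨ ϑ = -xh π := fun ϑ hϑ => by
      by_contra! hcon
      obtain ⟨hcon, lv, kb⟩ := hcon
      have aq : 0 ≤ (Ioc (-1) 1).indicator (F N) ϑ := indicator_nonneg (fun s _ => gr _ _) ϑ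
      have av : 0 ≤ (Ioc (-xh π) (-xh π+1/M²)).indicator (fun _ => M) ϑ := indicator_nonneg (fun s _ => ql) ϑ
      have bj : 0 ≤ (Ioc (π/2-1/M²) xh π).indicator (fun _ => M) ϑ := indicator_nonneg (fun s _ => ql) ϑ
      by_cases az : ϑ ∈ Ioc (-1:ℝ) 1
      · rw [indicator_of_mem az] at hcon; linarith
      have cM : F N ϑ ≤ M := by
        have := Hp (c (N+1)) (N+1) (z := -cis ϑ²) (by rw [norm_neg, xi, (Ai ϑ).1, one_pow])
        rwa [hc, zb] at this
      by_cases ay : ϑ ∈ Ioc (-xh π) (-xh π+1/M²)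
      · rw [indicator_of_mem ay] at hcon; linarith
      by_cases ca : ϑ ∈ Ioc (π/2-1/M²) xh π
      · rw [indicator_of_mem ca] at hcon; linarith
      have ab : |ϑ| ≤ π/2-1/M² := by
        refine (zq).2 ⟨?_, ?_⟩
        · by_contra! h; exact ay ⟨vx hϑ.1 (Ne.symm kb), ql⟩
        · by_contra! h; exact ca ⟨h, hϑ.2⟩
      have bf : 1 ≤ |ϑ| := by
        by_contra! h; rw [abs_lt] at h; exact az ⟨h.1, h.2.le⟩
      have Mi : 0 < 1/M² := qp
      have cb : xx*(1/M²) ≤ cos ϑ := by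
        rw [← cos_abs, ← sin_pi_div_two_sub]
        refine wh ?_ (mul_le_sin ql (by linarith [zr ϑ]))
        exact xf (by rw [wg qn zp]; linarith [pi_lt_four]) ql Mi.le qp
      have cd : 0 < cos ϑ := ql
      have := Ub N ϑ ad cd
      have sb := sinb ϑ ql
      have : F N ϑ ≤ D := by
        refine this.trans (qb ?_ (zo (cx N) (ch N).le))
        rw [uf]
        refine xf ?_ ((wp).2 ?_) (xz _).le qp
        · rw [qc cd]
          calc 1 = 2*M²*(xx*(1/M²)) := by field_simp
            _ ≤ _ := by gcongr
        · have : 1/4 ≤ sin ϑ² := by nlinarith [sq_abs ϑ]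
          nlinarith [br N]
      linarith
    have fin := Hs (Fc N) gp pw
    rw [P] at fin
    have dd : (1+ε/2)*(√π/(8*π))/√(L N)*(I N*E N) = (1+ε/2)*(E N/(4*√(π*L N)))*I N/2 := by
      rw [sqrt_mul zx]
      have sp : √π² = π := sq_sqrt zx
      have := ao N
      field_simp; rw [sp]
      try ring
    have kd : 2*π*D ≤ ε/2*(E N/(4*√(π*L N)))*I N := by
      have sp : 0 < √(π*L N) := sqrt_pos.2 (mul_pos zp (br N))
      have ke : 16*π*(M²*√(π*L N)*exp (-L N/8)) ≤ ε/2 := ar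
      have := qb ke (zo (cx N) (ch N).le)
      rw [show ε/2*(E N/(4*√(π*L N)))*I N = ε/2*(I N*E N)/(4*√(π*L N)) by ring, zt qp, hD]
      linarith
    have lw : 4*(M*(1/M²)) ≤ ε := by
      have : M*(1/M²) = 1/M := by field_simp
      rw [this]
      have : 0 < 1/M := qp
      have lx : 8*(1/M) ≤ ε := ba
      linarith
    rw [dd] at aa
    calc 2*π-ε ≤ (1+ε/2)*(E N/(4*√(π*L N)))*I N + ε/2*(E N/(4*√(π*L N)))*I N := ql
      _ = _ := by ring
  rw [eventually_atTop] at suff ⊢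
  obtain ⟨a, ha⟩ := suff
  refine ⟨a+1, fun b hb => ?_⟩
  have := ha (b-1) (by omega)
  rwa [show b-1+1 = b by omega] at this
theorem Fo {w : ℂ} (hw : Complex.cos (π*w) ≠ 0) :
    Tt (fun n : ℕ => ∏ j ∈ rg n, (1-w²/((j:ℂ)+xx)²)) (Complex.cos (π*w)) := by
  have g : ∀ z : ℂ, Complex.Gamma (xx+z)*Complex.Gamma (xx-z) = π/Complex.cos (π*z) := fun z => by
    have := Complex.Gamma_mul_Gamma_one_sub (xx+z)
    rw [show (1:ℂ)-(xx+z) = xx-z by ring, show (π:ℂ)*(xx+z) = π*z+π/2 by ring, Complex.sin_add_pi_div_two] at this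
    exact this
  have pc : (π:ℂ) ≠ 0 := by exact_mod_cast pi_ne_zero
  have gw := g w
  have bx := g 0
  rw [xo, Complex.cos_zero, div_one, vu, ze] at bx
  have t := ((ud xx).mul (ud xx)).div
    ((ud (xx+w)).mul (ud (xx-w))) (by rw [gw]; exact div_ne_zero pc hw)
  rw [gw, bx, div_div_eq_mul_div, mul_div_cancel_left₀ _ pc] at t
  rw [← ww 1]
  refine t.congr' ?_
  filter_upwards [qr 0] with n hn
  have dv : (n:ℂ) ≠ 0 := by exact_mod_cast hn.ne'
  have et : ((n.factorial:ℕ):ℂ) ≠ 0 := by exact_mod_cast n.factorial_ne_zero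
  have gz : ∀ j : ℕ, ((j:ℂ)+xx) ≠ 0 := fun j => by
    have : ((j:ℝ)+xx) ≠ 0 := qp
    exact_mod_cast (by simpa using Complex.ofReal_ne_zero.2 this : ((j:ℂ)+xx) ≠ 0)
  have p : ∏ j ∈ rg (n+1), (1-w²/((j:ℂ)+xx)²) = (∏ j ∈ rg (n+1), (xx+w+j))*(∏ j ∈ rg (n+1), (xx-w+j))/((∏ j ∈ rg (n+1), ((1:ℂ)/2+j))*(∏ j ∈ rg (n+1), ((1:ℂ)/2+j))) := by
    rw [← Finset.prod_mul_distrib, ← Finset.prod_mul_distrib, ← Finset.prod_div_distrib]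
    refine Finset.prod_congr rfl fun j _ => ?_
    have := gz j
    rw [show (1:ℂ)/2+j = j+xx by ring]
    rw [show xx+w+(j:ℂ) = j+xx+w by ring, show xx-w+(j:ℂ) = j+xx-w by ring]
    generalize (j:ℂ)+xx = a at *
    field_simp; ring
  rw [p]
  simp only [Complex.GammaSeq, Pi.mul_apply, Pi.div_apply]
  have e : (n:ℂ)^((1:ℂ)/2+w)*(n:ℂ)^((1:ℂ)/2-w) = (n:ℂ)^((1:ℂ)/2)*(n:ℂ)^((1:ℂ)/2) := by
    rw [← Complex.cpow_add _ _ dv, ← Complex.cpow_add _ _ dv]; ring_nf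
  have cr : (n:ℂ)^((1:ℂ)/2)*(n:ℂ)^((1:ℂ)/2) ≠ 0 := by
    rw [← Complex.cpow_add _ _ dv]; simp [dv];
  generalize (n:ℂ)^((1:ℂ)/2+w) = a at *
  generalize (n:ℂ)^((1:ℂ)/2-w) = b at *
  generalize (n:ℂ)^((1:ℂ)/2) = d at *
  generalize ((n.factorial:ℕ):ℂ) = f at *
  rw [div_mul_div_comm, div_mul_div_comm, div_div_div_eq, show a*f*(b*f) = (a*b)*(f*f) by ring, e, show d*f*(d*f) = d*d*(f*f) by ring, uf (d*d*(f*f))]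
  exact mul_div_mul_right _ _ (wq cr (wq et et))
theorem Dr {θ g V : ℝ → ℝ} {Y y : ℕ → ℝ} {n : ℕ} (Y0 : 0 ≤ Y 0) (hY : ∀ j, Y j ≤ y j ∧ y j ≤ Y (j+1)) (hp : ∀ j < n, 0 < y j)
    (aa : ∀ j < n, ∫ t in Y j..Y (j+1), θ t = 1) (ah : ∀ t ∈ Ioo (Y 0) (Y n), 0 ≤ θ t) (hV : MonotoneOn V (Icc (Y 0) (Y n)))
    (hg : ∀ a b, 0 < a → Y 0 ≤ a → a ≤ b → b ≤ Y n → |g a-g b| ≤ V b-V a) (hi : IntervalIntegrable θ volume (Y 0) (Y n)) (hgi : IntervalIntegrable (fun t => θ t*g t) volume (Y 0) (Y n)) :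
    |∑ j ∈ rg n, g (y j) - ∫ t in Y 0..Y n, θ t*g t| ≤ V (Y n) - V (Y 0) := by
  have mY : Monotone Y := wk fun j => (hY j).1.trans (hY j).2
  have sub : ∀ j < n, uIcc (Y j) (Y (j+1)) ⊆ uIcc (Y 0) (Y n) := fun j hj => by
    rw [uIcc_of_le (mY (Nat.le_succ j)), uIcc_of_le (mY (Nat.zero_le n))]; exact Icc_subset_Icc (mY (Nat.zero_le j)) (mY hj)
  rw [← intervalIntegral.sum_integral_adjacent_intervals fun j hj => hgi.mono_set (sub j hj), ← Finset.sum_sub_distrib, ← Finset.sum_range_sub (fun j => V (Y j)) n]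
  refine (Finset.abs_sum_le_sum_abs _ _).trans (Finset.sum_le_sum fun j hj => ?_)
  rw [wf] at hj
  have hi' := hi.mono_set (sub j hj)
  have l := mY (Nat.le_succ j)
  have e : g (y j) - ∫ t in Y j..Y (j+1), θ t*g t = ∫ t in Y j..Y (j+1), θ t*(g (y j)-g t) := by
    simp_rw [mul_sub]
    rw [vo (hi'.mul_const _) (hgi.mono_set (sub j hj)), uy, aa j hj, wj]
  have ak : V (Y (j+1)) - V (Y j) = ∫ t in Y j..Y (j+1), θ t*(V (Y (j+1))-V (Y j)) := by
    rw [uy, aa j hj, wj]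
  have ho := mY (Nat.zero_le j)
  have fl : Y (j+1) ≤ Y n := mY hj
  rw [e, ak, ← qy]
  refine intervalIntegral.norm_integral_le_of_norm_le l ?_ (hi'.mul_const _)
  filter_upwards [ul volume (Y (j+1))] with t ht' ht
  have tp : 0 < t := by linarith [ht.1]
  have a := ah t ⟨by linarith [ht.1], zl (vx ht.2 ht') fl⟩
  rw [qk, qd a, qy]
  refine qq ?_ a
  have bg : V (Y j) ≤ V t := hV ⟨ho, ql⟩ ⟨by linarith [ht.1], by linarith [ht.2]⟩ ht.1.le
  have bo : V (Y j) ≤ V (y j) := hV ⟨ho, ql⟩ ⟨by linarith [(hY j).1], by linarith [(hY j).2]⟩ (hY j).1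
  have fm : V t ≤ V (Y (j+1)) := hV ⟨by linarith [ht.1], by linarith [ht.2]⟩ ⟨ql, fl⟩ ht.2
  have eu : V (y j) ≤ V (Y (j+1)) := hV ⟨by linarith [(hY j).1], by linarith [(hY j).2]⟩ ⟨ql, fl⟩ (hY j).2
  rcases le_total t (y j) with h | h
  · have := hg t (y j) tp (by linarith [ht.1]) h (by linarith [(hY j).2])
    rw [abs_sub_comm]; linarith
  · have := hg (y j) t (hp j hj) (by linarith [(hY j).1]) h (by linarith [ht.2])
    linarith
theorem Hu {T : ℝ → ℝ} (hB : 0 ≤ B) (hc : ContinuousOn T (Icc 0 B)) (hm : MonotoneOn T (Icc 0 B)) (ah : T 0 = 0) :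
    ∃ Y : ℝ → ℝ, Y 0 = 0 ∧ (∀ u ∈ Icc 0 (T B), Y u ∈ Icc 0 B ∧ T (Y u) = u) ∧ ∀ u ∈ Icc 0 (T B), ∀ u' ∈ Icc 0 (T B), u < u' → Y u < Y u' := by
  have h : ∀ u, ∃ y, (u = 0 → y = 0) ∧ (u ∈ Icc 0 (T B) → y ∈ Icc 0 B ∧ T y = u) := fun u => by
    by_cases a : u = 0
    · exact ⟨0, fun _ => rfl, fun _ => ⟨⟨zu, hB⟩, by rw [a, ah]⟩⟩
    by_cases b : u ∈ Icc 0 (T B)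
    · obtain ⟨y, hy, e⟩ := intermediate_value_Icc hB hc (by rwa [ah])
      exact ⟨y, fun h => absurd h a, fun _ => ⟨hy, e⟩⟩
    · exact ⟨0, fun _ => rfl, fun h => absurd h b⟩
  choose Y a b using h
  refine ⟨Y, a 0 rfl, b, fun u hu u' hu' l => ?_⟩
  by_contra! c
  have := hm (b u' hu').1 (b u hu).1 c
  rw [(b u hu).2, (b u' hu').2] at this
  linarith
theorem Hv {w : ℂ} (hσ : (σ:ℂ) = -w²) (hw : Complex.cos (π*w) ≠ 0) {v : ℂ} (hv : 0 ≤ v.re) (hvw : v² = σ) {m : ℕ} (hm : 1 ≤ m) (hs : 2*|σ| ≤ (m:ℝ)²) :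
    |∑ j ∈ rg m, Ac σ (j+xx) - (∫ u in oo..m, Ac σ u) - (log ‖Complex.cos (π*w)‖ - π*v.re)| ≤ 2*|σ|/m² := by
  obtain ⟨fn, iv⟩ := Di hv
  have cr : Ah (v²) = Ac σ := by funext y; rw [hvw, Br]
  rw [cr] at fn iv
  have bp : Tt (fun n : ℕ => ∑ j ∈ rg n, Ac σ (j+xx)) (log ‖Complex.cos (π*w)‖) := by
    have t := ((Fo hw).norm).log ((qs).2 hw)
    refine t.congr' ?_
    have nz : ∀ j : ℕ, 1-w²/((j:ℂ)+xx)² ≠ 0 := fun j h => by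
      refine hw (tendsto_nhds_unique (Fo hw) ?_)
      refine xa ?_
      filter_upwards [qr j] with n hn
      exact (Finset.prod_eq_zero ((wf).2 hn) h).symm
    filter_upwards with n
    rw [norm_prod, log_prod fun j _ => (qs).2 (nz j)]
    refine zy rfl fun j _ => ?_
    rw [Ac, ← qy, ← qu]; push_cast; rw [hσ]; ring_nf
  have bh : Tt (fun n : ℕ => ∫ u in oo..n, Ac σ u) (π*v.re) := by
    rw [← iv]; exact intervalIntegral_tendsto_integral_Ioi _ fn tendsto_natCast_atTop_atTop
  have ef := (bp.sub bh).const_sub (∑ j ∈ rg m, Ac σ (j+xx) - ∫ u in oo..m, Ac σ u)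
  refine le_of_tendsto ef.abs ?_
  filter_upwards [eventually_ge_atTop m] with n hn
  obtain ⟨k, rfl⟩ := Nat.exists_eq_add_of_le hn
  have m1 : (1:ℝ) ≤ m := by exact_mod_cast hm
  have ii : ∀ a b : ℝ, 0 ≤ a → a ≤ b → IntervalIntegrable (Ac σ) volume a b := fun a b h l => by
    rw [xt l]; exact fn.mono_set fun x hx => xq h hx.1
  have pos : ∀ y : ℝ, m ≤ y → xx ≤ 1+σ/y² ∧ |σ/y²| ≤ xx := fun y hy => by
    have : |σ/y²| ≤ xx := by
      rw [abs_div, abs_of_nonneg (zd y), qc (by nlinarith)]; nlinarith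
    exact ⟨by linarith [neg_abs_le (σ/y²)], this⟩
  have mon : ∀ a b : ℝ, (m:ℝ) ≤ a → a ≤ b → (0 ≤ σ → Ac σ b ≤ Ac σ a) ∧ (σ ≤ 0 → Ac σ a ≤ Ac σ b) := fun a b ha hb => by
    have ds := pos a ha
    have cu := pos b (ha.trans hb)
    have q : a² ≤ b² := by nlinarith
    have qa : 0 < a² := by nlinarith
    simp only [Ac]
    refine ⟨fun h => ?_, fun h => ?_⟩
    · rw [qt (by linarith [ds.1]), qt (by linarith [cu.1])]
      exact zv (by linarith [cu.1]) (by gcongr)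
    · rw [qt (by linarith [ds.1]), qt (by linarith [cu.1])]
      refine zv (by linarith [ds.1]) ?_
      have : -σ/b² ≤ -σ/a² := div_le_div_of_nonneg_left ql qa q
      rw [vm, vm] at this; linarith
  have bd : ∀ y : ℝ, m ≤ y → |Ac σ y| ≤ 2*(|σ|/y²) := fun y hy => by
    have := Dh (ζ := xc (σ/y²)) (by rw [qu]; exact (pos y hy).2)
    rw [qu, qy, abs_div, abs_of_nonneg (zd y)] at this
    rw [Ac, ← qy (1+_), ← qu]; push_cast at this ⊢; exact this
  have sg : ∀ y : ℝ, m ≤ y → (0 ≤ σ → 0 ≤ Ac σ y) ∧ (σ ≤ 0 → Ac σ y ≤ 0) := fun y hy => by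
    have p := (pos y hy).1
    rw [Ac, qt ql]
    exact ⟨fun h => log_nonneg (by linarith [ux h (zd y)]), fun h => log_nonpos ql (by linarith [div_nonpos_of_nonpos_of_nonneg h (zd y)])⟩
  have km : (m:ℝ) ≤ m+k := by linarith [(Nat.cast_nonneg k : oo ≤ k)]
  obtain ⟨V, ia, kf⟩ : ∃ V : ℝ → ℝ, (∀ a b : ℝ, m ≤ a → a ≤ b → |Ac σ a-Ac σ b| ≤ V b-V a) ∧ V (m+k)-V m ≤ 2*(|σ|/m²) := by
    rcases le_total 0 σ with h | h
    · refine ⟨fun y => -Ac σ y, fun a b ha hb => ?_, ?_⟩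
      · rw [abs_of_nonneg (by linarith [(mon a b ha hb).1 h])]; linarith
      · have := bd m zu; linarith [le_abs_self (Ac σ m), (sg _ km).1 h]
    · refine ⟨fun y => Ac σ y, fun a b ha hb => ?_, ?_⟩
      · rw [abs_of_nonpos (by linarith [(mon a b ha hb).2 h])]; linarith
      · have := bd m zu; linarith [neg_abs_le (Ac σ m), (sg _ km).2 h]
  have c := Dr (θ := fun _ => 1) (g := Ac σ) (V := V) (Y := fun j => m+j) (y := fun j => m+j+xx) (n := k) (by simp) (fun j => by constructor <;> (push_cast; linarith)) (fun j _ => qp) (fun j _ => by simp) (fun _ _ => xp)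
    (fun a ha b hb l => by have := (zr _).trans (ia a b (by simpa using ha.1) l); linarith) (fun a b _ h l _ => ia a b (by simpa using h) l) (by simp) (by simp only [wj]; exact ii _ _ (by simp) (by simp))
  simp only [wj, vy, vu] at c
  have bn : ∑ j ∈ rg (m+k), Ac σ (j+xx) = ∑ j ∈ rg m, Ac σ (j+xx) + ∑ j ∈ rg k, Ac σ (m+j+xx) := by
    rw [Finset.sum_range_add]; simp
  have cl : ∫ u in oo..(m+k:ℕ), Ac σ u = (∫ u in oo..m, Ac σ u) + ∫ u in (m:ℝ)..(m+k), Ac σ u := by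
    push_cast; rw [qi (ii _ _ zu qp) (ii _ _ qp km)]
  rw [bn, cl, ← abs_neg]
  rw [wu]
  refine wh (vi (congrArg _ ?_)) (c.trans kf)
  ring
theorem Hw {T : ℝ → ℝ} (hB : 0 ≤ B) (hc : ContinuousOn T (Icc 0 B)) (hm : MonotoneOn T (Icc 0 B)) (ah : T 0 = 0) :
    ∃ Y y : ℕ → ℝ, Y 0 = 0 ∧ (∀ j, Y j ≤ y j ∧ y j ≤ Y (j+1)) ∧ (∀ j, Y j ∈ Icc 0 B) ∧ (∀ j : ℕ, (j:ℝ) ≤ T B → T (Y j) = j) ∧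
      ∀ j : ℕ, (j:ℝ)+xx ≤ T B → T (y j) = j+xx ∧ 0 < y j := by
  obtain ⟨F, et, cf, dj⟩ := Hu hB hc hm ah
  have tb : 0 ≤ T B := by rw [← ah]; exact hm ⟨zu, hB⟩ ⟨hB, zu⟩ hB
  have mem : ∀ u : ℝ, 0 ≤ u → min u (T B) ∈ Icc 0 (T B) := fun u h => ⟨le_min h tb, min_le_right _ _⟩
  have mon : ∀ a b : ℝ, 0 ≤ a → a ≤ b → F (min a (T B)) ≤ F (min b (T B)) := fun a b ha hb => by
    rcases (min_le_min_right (T B) hb).eq_or_lt with h | h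
    · rw [h]
    · exact (dj _ (mem a ha) _ (mem b (ha.trans hb)) h).le
  refine ⟨fun j => F (min j (T B)), fun j => F (min (j+xx) (T B)), by simp [tb, et], fun j => ⟨mon _ _ qp ql, mon _ _ qp (by push_cast; linarith)⟩,
    fun j => (cf _ (mem _ qp)).1, fun j hj => ?_, fun j hj => ?_⟩
  · have := (cf _ (mem j qp)).2; beta_reduce; rwa [min_eq_left hj] at this ⊢
  · have := (cf _ (mem (j+xx) qp))
    beta_reduce; rw [min_eq_left hj] at this ⊢
    refine ⟨this.2, vx this.1.1 fun h => ?_⟩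
    rw [← h, ah] at this
    have ad := this.2
    have : oo < j+xx := qp
    linarith
structure HtN (θ V : ℝ → ℝ) (m v : ℝ) : Prop where
  c : Continuous θ
  Vm : Monotone V
  Vb : ∀ t, |V t| ≤ v
  b : ∀ a b, a ≤ b → |θ a-θ b| ≤ V b-V a
  p : 0 < m
  mb : ∀ t, m ≤ θ t
  e : ∀ t, θ (-t) = θ t
theorem Ct {θ V : ℝ → ℝ} (H : HtN θ V m v) (p : ℝ) : ∃ A F : ℝ → ℝ, Monotone F ∧ (∀ y, |F y| ≤ v/m) ∧ (∀ y, ∫ t in p..y, θ t = (y-p)*A y) ∧ (∀ y, m ≤ A y) ∧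
    (∀ a b, a ≤ b → |log (A a)-log (A b)| ≤ F b-F a) ∧ Continuous A := by
  have hc := H.c
  have ax := H.p
  have Vi : ∀ y, IntervalIntegrable (fun t => V (p+(y-p)*t)) volume 0 1 := fun y => by
    have hm := H.Vm.measurable
    have hb : IntervalIntegrable (fun _ : ℝ => v) volume 0 1 := by simp
    exact hb.mono_fun' (hm.comp (by fun_prop : Measurable fun t : ℝ => p+(y-p)*t)).aestronglyMeasurable (qg fun t => H.Vb _)
  have θi : ∀ y, IntervalIntegrable (fun t => θ (p+(y-p)*t)) volume 0 1 := fun y => Continuous.intervalIntegrable qf _ _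
  have am : ∀ y, m ≤ ∫ t in oo..1, θ (p+(y-p)*t) := fun y => by
    have := ug xp (by simp : IntervalIntegrable (fun _ : ℝ => m) volume 0 1) (θi y) fun t _ => H.mb _
    simpa using this
  have key : ∀ a b, a ≤ b → |(∫ t in oo..1, θ (p+(a-p)*t)) - ∫ t in oo..1, θ (p+(b-p)*t)| ≤ (∫ t in oo..1, V (p+(b-p)*t)) - ∫ t in oo..1, V (p+(a-p)*t) := fun a b h => by
    rw [← vo (θi a) (θi b), ← vo (Vi b) (Vi a), ← qy]
    exact intervalIntegral.norm_integral_le_of_norm_le xp (qg fun t ht => H.b _ _ (by nlinarith [ht.1])) ((Vi b).sub (Vi a))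
  refine ⟨fun y => ∫ t in oo..1, θ (p+(y-p)*t), fun y => (∫ t in oo..1, V (p+(y-p)*t))/m, fun a b h => ?_, fun y => ?_, fun y => ?_, am, fun a b h => ?_, ?_⟩
  · exact div_le_div_of_nonneg_right (by linarith [(zr _).trans (key a b h)]) ax.le
  · rw [abs_div, qt ax, ← qy]
    have := intervalIntegral.norm_integral_le_of_norm_le_const (a := 0) (b := 1) (f := fun t => V (p+(y-p)*t)) fun t _ => H.Vb _
    exact div_le_div_of_nonneg_right (by simpa using this) ax.le
  · have := intervalIntegral.smul_integral_comp_add_mul (a := 0) (b := 1) θ (y-p) p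
    rw [qo] at this
    rw [this]; simp
  · rw [← sub_div, zt ax]
    refine wh ?_ (key a b h)
    have lg : ∀ x y : ℝ, m ≤ x → m ≤ y → (log x-log y)*m ≤ |x-y| := fun x y hx hy => by
      rw [← log_div ql ql]
      have y0 : 0 < y := ql
      have l := vl (show 0 < x/y by apply uj <;> linarith)
      have : x/y-1 = (x-y)/y := by field_simp
      rw [this] at l
      have bw : (x-y)/y ≤ |x-y|/m := div_le_div₀ (zr _) (le_abs_self _) ax hy
      rw [← zt ax]; linarith
    rcases abs_cases (log (∫ t in oo..1, θ (p+(a-p)*t)) - log (∫ t in oo..1, θ (p+(b-p)*t))) with h | h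
    · rw [h.1]; exact lg _ _ (am a) (am b)
    · rw [h.1, neg_sub, abs_sub_comm]; exact lg _ _ (am b) (am a)
  · exact intervalIntegral.continuous_parametric_intervalIntegral_of_continuous' qf _ _
theorem Hx {θ V : ℝ → ℝ} (H : HtN θ V m v) (hZ : 0 ≤ Z) {G : ℝ → ℝ} (hG : IntegrableOn G (Ioi 0)) :
    IntervalIntegrable (fun y => θ y*G (∫ t in oo..y, θ t)) volume 0 Z ∧ ∫ y in oo..Z, θ y*G (∫ t in oo..y, θ t) = ∫ u in oo..(∫ t in oo..Z, θ t), G u := by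
  have hc := H.c
  have ii : ∀ a b, IntervalIntegrable θ volume a b := fun a b => hc.intervalIntegrable a b
  set T : ℝ → ℝ := fun y => ∫ t in oo..y, θ t with hT
  have d : ∀ y, HasDerivAt T (θ y) y := fun y => intervalIntegral.integral_hasDerivAt_right (ii _ _) (hc.stronglyMeasurableAtFilter _ _) hc.continuousAt
  have sm : StrictMono T := strictMono_of_hasDerivAt_pos d fun y => zl H.p (H.mb y)
  have Tc : Continuous T := continuous_iff_continuousAt.2 fun y => (d y).continuousAt
  have ck : T 0 = 0 := by simp [hT]
  have TZ : 0 ≤ T Z := by rw [← ck]; exact sm.monotone hZ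
  have im : T '' Ioo 0 Z = Ioo 0 (T Z) := by
    refine Subset.antisymm ?_ ?_
    · rintro _ ⟨y, hy, rfl⟩; rw [← ck]; exact ⟨sm hy.1, sm hy.2⟩
    · have := intermediate_value_Ioo hZ Tc.continuousOn; rwa [ck] at this
  have ab : ∀ y, |θ y| = θ y := fun y => qt (zl H.p (H.mb y))
  have aj := integrableOn_image_iff_integrableOn_abs_deriv_smul (s := Ioo 0 Z) qz (fun y _ => (d y).hasDerivWithinAt) sm.injective.injOn G
  have ak := integral_image_eq_integral_abs_deriv_smul (s := Ioo 0 Z) qz (fun y _ => (d y).hasDerivWithinAt) sm.injective.injOn G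
  simp only [ab, qo, im] at aj ak
  constructor
  · rw [qm hZ]; exact aj.1 (hG.mono_set fun x hx => hx.1)
  · rw [qw hZ, qw TZ, qj, qj, ← ak]
theorem Hy {θ V : ℝ → ℝ} (H : HtN θ V ax v) {Y y : ℕ → ℝ} {m : ℕ} (Y0 : Y 0 = 0) (hY : ∀ j, Y j ≤ y j ∧ y j ≤ Y (j+1)) (hYm : ∀ j ≤ m, ∫ t in oo..Y j, θ t = j)
    (hy : ∀ j < m, (∫ t in oo..y j, θ t = j+xx) ∧ 0 < y j) {g Q W : ℝ → ℝ} (hσ : IntegrableOn (Ac σ) (Ioi 0))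
    (hg : ∀ t > 0, t ≠ y0 → g t = Ac σ (∫ s in oo..t, θ s) + Q t) (hn : ∀ j < m, y j ≠ y0) (hW : Monotone W) (hQ : ∀ a b, 0 < a → a ≤ b → |Q a-Q b| ≤ W b-W a) (hQm : ContinuousOn Q (Ioi 0)) :
    IntervalIntegrable (fun t => θ t*g t) volume 0 (Y m) ∧
    |∑ j ∈ rg m, g (y j) - (∫ t in oo..Y m, θ t*g t) - (∑ j ∈ rg m, Ac σ (j+xx) - ∫ u in oo..m, Ac σ u)| ≤ W (Y m)-W 0 := by
  have hc := H.c
  have ii : ∀ a b, IntervalIntegrable θ volume a b := fun a b => hc.intervalIntegrable a b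
  have mY : Monotone Y := wk fun j => (hY j).1.trans (hY j).2
  have ew : 0 ≤ Y m := by rw [← Y0]; exact mY (Nat.zero_le m)
  have Qi : IntervalIntegrable (fun t => θ t*Q t) volume 0 (Y m) := by
    rw [xt ew]
    have aa : IntegrableOn (fun t => θ t*(|Q (Y m)|+(W (Y m)-W 0))) (Ioc 0 (Y m)) := Continuous.integrableOn_Ioc qf
    refine Integrable.mono' aa ((hc.continuousOn.mul (hQm.mono fun x hx => hx.1)).aestronglyMeasurable zm) ?_
    filter_upwards [qx zm] with t ht
    have al : 0 ≤ θ t := H.p.le.trans (H.mb t)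
    rw [qk, qd al]
    refine qq ?_ al
    have := hQ t (Y m) ht.1 ht.2
    have w := hW ht.1.le
    have := abs_sub_abs_le_abs_sub (Q t) (Q (Y m))
    rw [qy]; linarith
  obtain ⟨bn, cl⟩ := Hx H ew hσ
  have eq : ∀ᵐ t, t ∈ Ioc 0 (Y m) → θ t*g t = θ t*Ac σ (∫ s in oo..t, θ s) + θ t*Q t := by
    filter_upwards [ul volume y0] with t h ht
    rw [hg t ht.1 h]; ring
  have c := Dr (θ := θ) (g := Q) (V := W) (n := m) Y0.ge hY (fun j h => (hy j h).2) (fun j h => by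
    have e := wy (ii 0 (Y (j+1))) (ii 0 (Y j))
    rw [hYm _ h, hYm _ h.le] at e; rw [← e]; push_cast; ring) (fun t _ => H.p.le.trans (H.mb t)) (hW.monotoneOn _) (fun a b h _ l _ => hQ a b h l) (ii _ _) (by rw [Y0]; exact Qi)
  rw [Y0] at c
  have aq : ∫ t in oo..Y m, θ t*g t = (∫ u in oo..m, Ac σ u) + ∫ t in oo..Y m, θ t*Q t := by
    rw [← hYm m zu, ← cl, ← xr bn Qi]
    refine intervalIntegral.integral_congr_ae ?_
    rw [uIoc_of_le ew]; exact eq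
  have av : ∑ j ∈ rg m, g (y j) = ∑ j ∈ rg m, Ac σ (j+xx) + ∑ j ∈ rg m, Q (y j) := by
    rw [← wn]
    refine zy rfl fun j hj => ?_
    rw [wf] at hj
    rw [hg _ (hy j hj).2 (hn j hj), (hy j hj).1]
  refine ⟨(bn.add Qi).congr_ae ?_, ?_⟩
  · rw [uIoc_of_le ew]
    filter_upwards [uv eq, qx zm] with t aa ad using (aa ad).symm
  · rw [aq, av]
    refine wh (vi (congrArg _ ?_)) c
    ring
theorem Hz (hβ : xx < β) : ContinuousOn (Aq β) (Icc 0 1) := by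
  intro al ah
  refine tendsto_integral_filter_of_dominated_convergence (Bi β) ?_ ?_ (Cd hβ) ?_
  · exact qg fun t => ((Cm β t).indicator (Bq t)).aestronglyMeasurable
  · filter_upwards [self_mem_nhdsWithin] with t ht
    filter_upwards [qx qz] with s hs
    rw [qy, abs_of_nonneg (indicator_nonneg (fun _ _ => Be _ _ _) _)]
    exact (indicator_le_self' (fun _ _ => Be _ _ _) _).trans (Ce ht hs)
  · filter_upwards [qx qz, uv (ul volume (√(1-al²)))] with s hs hne
    refine Tendsto.mono_left ?_ xu
    have hc : ContinuousAt (fun t : ℝ => Ax β t s) al := by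
      refine ContinuousAt.rpow_const qf (Or.inl ?_)
      have := hs.1; positivity
    have hd : ContinuousAt (fun t : ℝ => t²+s²) al := qf
    have hn : al²+s² ≠ 1 := fun h => hne (by rw [show 1-al² = s² by linarith, sqrt_sq hs.1.le])
    rcases hn.lt_or_gt with aa | aa
    · rw [indicator_of_mem (by exact aa)]
      refine hc.tendsto.congr' ?_
      filter_upwards [hd.eventually_lt_const aa] with t ht
      rw [indicator_of_mem (by exact ht)]
    · rw [indicator_of_notMem (by simpa using aa.le)]
      refine xa ?_
      filter_upwards [hd.eventually_const_lt aa] with t ht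
      rw [indicator_of_notMem (by simpa using ht.le)]
noncomputable def Ag (δ : ℝ) (K : ℕ) (y : ℝ) : ℝ := 1/π*(xx*(δ/(δ²+y²))+1/(1²+y²)+K*(δ⁻¹/((δ⁻¹)²+y²)))
noncomputable def Ap (δ : ℝ) (K : ℕ) (v : ℂ) : ℝ := xx*log ‖1+v/δ‖+log ‖1+v/(1:ℝ)‖+K*log ‖1+v/(δ⁻¹:ℝ)‖
theorem Ds (hδ : 0 < δ) (K : ℕ) {v : ℂ} (hv : 0 ≤ v.re) : IntegrableOn (fun y => Ag δ K y*Ah (v²) y) (Ioi 0) ∧ ∫ y in Ioi 0, Ag δ K y*Ah (v²) y = Ap δ K v := by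
  obtain ⟨bf, bk⟩ := Cf hv hδ
  obtain ⟨bg, bo⟩ := Cf hv one_pos
  obtain ⟨az, ay⟩ := Cf hv (inv_pos.2 hδ)
  have e : (fun y => Ag δ K y*Ah (v²) y) = fun y => 1/π*(xx*(Ah (v²) y * (δ/(δ²+y²)))+Ah (v²) y * (1/(1²+y²))+K*(Ah (v²) y * (δ⁻¹/((δ⁻¹)²+y²)))) := by
    funext y; unfold Ag; ring
  have aq := (bf.const_mul xx).fun_add bg
  have av := aq.fun_add (az.const_mul (K:ℝ))
  rw [e]
  refine ⟨av.const_mul _, ?_⟩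
  rw [qv, wo aq (az.const_mul (K:ℝ)), wo (bf.const_mul xx) bg, qv, qv, bk, bo, ay, Ap]
  field_simp
theorem Dt (hδ : 0 < δ) (K : ℕ) : Continuous (Ag δ K) := by
  unfold Ag
  have h : ∀ c y : ℝ, 0 < c → c²+y² ≠ 0 := fun c y h => qp
  have i : 0 < δ⁻¹ := inv_pos.2 hδ
  refine continuous_const.mul (((continuous_const.mul ?_).add ?_).add (continuous_const.mul ?_)) <;> refine continuous_const.div qf fun y => h _ _ (by first | exact hδ | exact one_pos | exact i)
theorem Du (hδ : 0 < δ) (K : ℕ) : AntitoneOn (Ag δ K) (Ici 0) := fun a ha b hb h => by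
  have : oo ≤ a := ha
  unfold Ag; gcongr
theorem Bm (hδ : 0 < δ) (K : ℕ) (y : ℝ) : 0 ≤ Ag δ K y := by unfold Ag; positivity
theorem Jw (hδ : 0 < δ) (K : ℕ) (hy : 0 < y) : Ag δ K y ≤ 1/π*(xx*δ+1+K*δ⁻¹)/y² := by
  have h : ∀ c : ℝ, 0 < c → c/(c²+y²) ≤ c/y² := fun c hc => by gcongr; nlinarith
  have aa := h δ hδ
  have ad := h 1 one_pos
  have ag := qq (h δ⁻¹ (inv_pos.2 hδ)) (Nat.cast_nonneg (α := ℝ) K)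
  have : 1/π*(xx*δ+1+K*δ⁻¹)/y² = 1/π*(xx*(δ/y²)+1/y²+K*(δ⁻¹/y²)) := by ring
  rw [this, Ag]
  exact qq ql qp
noncomputable def Al (β δ : ℝ) (K : ℕ) (B y : ℝ) : ℝ := Ae β B y - if y ≤ √B then Ag δ K y else 0
theorem Ja {θ U : ℝ → ℝ} (hZ : 0 ≤ Z) (hc : ContinuousOn θ (Icc 0 Z)) (hU : MonotoneOn U (Icc 0 Z)) (hb : ∀ a ∈ Icc 0 Z, ∀ b ∈ Icc 0 Z, a ≤ b → |θ a-θ b| ≤ U b-U a)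
    (hm : 0 < m) (hmb : ∀ t ∈ Icc 0 Z, m ≤ θ t) : ∃ V, HtN (fun t => θ (min |t| Z)) V m (U Z-U 0) := by
  have mem : ∀ t, min |t| Z ∈ Icc 0 Z := fun t => ⟨le_min (zr _) hZ, min_le_right _ _⟩
  have mem' : ∀ t, min (max t 0) Z ∈ Icc 0 Z := fun t => ⟨le_min (le_max_right _ _) hZ, min_le_right _ _⟩
  have fo : oo ∈ Icc 0 Z := ⟨zu, hZ⟩
  have zz : Z ∈ Icc 0 Z := ⟨hZ, zu⟩
  have mo : ∀ a b, a ≤ b → U (min (max a 0) Z) ≤ U (min (max b 0) Z) := fun a b h => hU (mem' a) (mem' b) (by gcongr)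
  have bd : ∀ t, U 0 ≤ U (min (max t 0) Z) ∧ U (min (max t 0) Z) ≤ U Z := fun t => ⟨hU fo (mem' t) (mem' t).1, hU (mem' t) zz (mem' t).2⟩
  have po : ∀ t, 0 ≤ t → min |t| Z = min (max t 0) Z ∧ min (max (-t) 0) Z = 0 := fun t h => by
    rw [abs_of_nonneg h, max_eq_left h, max_eq_right ql, min_eq_left hZ]; simp
  have ne : ∀ t, t ≤ 0 → min |t| Z = min (max (-t) 0) Z ∧ min (max t 0) Z = 0 := fun t h => by
    have := po (-t) ql; rwa [abs_neg, neg_neg] at this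
  refine ⟨fun t => U (min (max t 0) Z) - U (min (max (-t) 0) Z), hc.comp_continuous qf mem, fun a b h => ?_, fun t => ?_, fun a b h => ?_, hm, fun t => hmb _ (mem t), fun t => by simp⟩
  · have aa := mo a b h
    have ad := mo (-b) (-a) ql
    linarith
  · have aa := bd t
    have ad := bd (-t)
    rw [zq]; constructor <;> linarith
  · beta_reduce
    rcases le_total 0 a with ha | ha
    · rw [(po a ha).2, (po b (ha.trans h)).2, (po a ha).1, (po b (ha.trans h)).1]
      have := hb _ (mem' a) _ (mem' b) (by gcongr)
      linarith
    rcases le_total 0 b with hb' | hb'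
    · rw [(ne a ha).2, (po b hb').2, (ne a ha).1, (po b hb').1]
      have aa := hb _ fo _ (mem' b) (mem' b).1
      have ad := hb _ fo _ (mem' (-a)) (mem' (-a)).1
      have ag := abs_sub_le (θ (min (max (-a) 0) Z)) (θ 0) (θ (min (max b 0) Z))
      rw [abs_sub_comm _ (θ 0)] at ag
      linarith
    · rw [(ne a ha).2, (ne b hb').2, (ne a ha).1, (ne b hb').1]
      have := hb _ (mem' (-b)) _ (mem' (-a)) (by gcongr)
      rw [abs_sub_comm]; linarith
theorem Jb (hβ : xx < β) (hδ : 0 < δ) (K : ℕ) (hη : 0 < η) : ∀ᶠ B in atTop, (∃ V v, HtN (fun t => Al β δ K B (min |t| (√B))) V (Ad β B/(2*π)) v ∧ v/(Ad β B/(2*π)) ≤ η) ∧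
    ∀ t, Al β δ K B (min |t| (√B)) ≤ 2*Ad β B/π := by
  obtain ⟨W, kg, kh, ki⟩ := Gp hβ
  have cy : 0 < 2*β-1 := ql
  have hs : Tendsto (fun B : ℝ => √B/B) atTop (𝓝[≥] 0) := by
    refine tendsto_nhdsWithin_iff.2 ⟨?_, qg fun B => by
      rcases le_total 0 B with h | h
      · exact ux (sqrt_nonneg _) h
      · simp [sqrt_eq_zero_of_nonpos h]⟩
    have : Tt (fun B : ℝ => (√B)⁻¹) 0 := tendsto_inv_atTop_zero.comp tendsto_sqrt_atTop
    refine this.congr fun B => ?_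
    rw [sqrt_div_self', one_div]
  have w := kh.comp hs
  have w' := w.eventually (vv (show W 0 < W 0 + η/(4*xm β) from lt_add_of_pos_right _ qp))
  filter_upwards [w', Fj hβ (ε := 1/(4*π)) qp, (Bf hβ).eventually_ge_atTop (4*π*Ag δ K 0/η), (Bf hβ).eventually_ge_atTop (4*π*Ag δ K 0), qr 1] with B w hr bu bw hB
  have ai : 0 < B := ql
  have br := Av hβ ai
  have sB : √B < B := by rw [sqrt_lt' ai]; nlinarith
  have ao : 0 < √B := sqrt_pos.2 ai
  have mem : ∀ y ∈ Icc 0 (√B), y/B ∈ Icc oo 1 := fun y hy => ⟨ux hy.1 ai.le, (xl ai).2 (hy.2.trans sB.le)⟩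
  have eq : ∀ y ∈ Icc 0 (√B), Al β δ K B y = Ad β B * (xm β/π) * Aq β (y/B) - Ag δ K y := fun y hy => by
    rw [Al, if_pos hy.2, Cr hβ ai ⟨hy.1, hy.2.trans_lt sB⟩]
  have sb : ∀ y ∈ Icc 0 (√B), Ag δ K y ≤ Ag δ K 0 := fun y hy => Du hδ K (mem_Ici.2 zu) hy.1 hy.1
  set k := Ad β B * (xm β/π) with hk
  have dn : 0 ≤ k := qp
  have bnd : ∀ y ∈ Icc 0 (√B), Ad β B/(2*π) ≤ Al β δ K B y ∧ Al β δ K B y ≤ 2*Ad β B/π := fun y hy => by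
    rw [Al, if_pos hy.2]
    have aa := (zq).1 (hr y hy)
    have ad := sb y hy
    have ag := Bm hδ K y
    have aj : Ad β B/(2*π) = xx*(Ad β B/π) := by field_simp
    have ak : 1/(4*π)*Ad β B = 1/4*(Ad β B/π) := by field_simp
    have be : 2*Ad β B/π = 2*(Ad β B/π) := by ring
    have da : Ag δ K 0 ≤ 1/4*(Ad β B/π) := by
      rw [← wu, zt zp]; linarith
    have : 0 < Ad β B/π := qp
    rw [aj, be]; rw [ak] at aa
    constructor <;> linarith [aa.1, aa.2]
  have mem' : ∀ t, min |t| (√B) ∈ Icc 0 (√B) := fun t => ⟨le_min (zr _) ao.le, min_le_right _ _⟩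
  refine ⟨?_, fun t => (bnd _ (mem' t)).2⟩
  have ⟨V, hV⟩ : ∃ V, HtN (fun t => Al β δ K B (min |t| (√B))) V (Ad β B/(2*π)) ((k*W (√B/B) - Ag δ K (√B))-(k*W (0/B) - Ag δ K 0)) := by
    refine Ja (θ := Al β δ K B) (U := fun y => k*W (y/B) - Ag δ K y) (Z := √B) (m := Ad β B/(2*π)) ao.le ?_ (fun a ha b hb h => ?_) (fun a ha b hb h => ?_) qp fun t ht => (bnd t ht).1
    · refine ContinuousOn.congr (f := fun y => k*Aq β (y/B) - Ag δ K y) ?_ eq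
      exact (continuousOn_const.mul ((Hz hβ).comp qf mem)).sub (Dt hδ K).continuousOn
    · have aa := qq (kg (mem a ha) (mem b hb) (by gcongr)) dn
      have ad := Du hδ K ha.1 hb.1 h
      linarith
    · rw [eq a ha, eq b hb]
      have aa := qq (ki _ (mem a ha) _ (mem b hb) (by gcongr)) dn
      have ad := Du hδ K ha.1 hb.1 h
      have e : k*Aq β (a/B) - Ag δ K a - (k*Aq β (b/B) - Ag δ K b) = k*(Aq β (a/B)-Aq β (b/B)) - (Ag δ K a-Ag δ K b) := by ring
      rw [e]
      refine (abs_sub _ _).trans ?_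
      rw [abs_mul, abs_of_nonneg dn, abs_of_nonneg (sub_nonneg.2 ad)]
      linarith
  refine ⟨V, _, hV, ?_⟩
  rw [qc qp, zero_div]
  have aa : k*(W (√B/B)-W 0) ≤ η*(Ad β B/(4*π)) := by
    have : k*(W (√B/B)-W 0) ≤ k*(η/(4*xm β)) := qq (by simp only [Function.comp] at w; linarith) dn
    refine this.trans (vi ?_)
    rw [hk]; field_simp
  have ad : Ag δ K 0 ≤ η*(Ad β B/(4*π)) := by
    rw [qc hη] at bu
    rw [← wu, zt qp]; linarith
  have ag := Bm hδ K (√B)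
  have e : η*(Ad β B/(2*π)) = η*(Ad β B/(4*π))+η*(Ad β B/(4*π)) := by field_simp; ring
  rw [e]; linarith
structure HtS (θ θh : ℝ → ℝ) (B : ℝ) (Y y : ℕ → ℝ) (n m : ℕ) : Prop where
  i : IntervalIntegrable θ volume 0 B
  p : ∀ t ∈ Ioo 0 B, 0 ≤ θ t
  Y0 : Y 0 = 0
  Yy : ∀ j, Y j ≤ y j ∧ y j ≤ Y (j+1)
  YB : ∀ j, Y j ∈ Icc 0 B
  T : ∀ j ≤ n, ∫ t in oo..Y j, θ t = j
  t : ∀ j < n, (∫ t in oo..y j, θ t = j+xx) ∧ 0 < y j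
  N : ∫ t in oo..B, θ t ≤ n+1
  mn : m ≤ n
  m1 : 1 ≤ m
  h : ∀ t ∈ Icc 0 (Y m), θ t = θh t
theorem Dv {θ θh : ℝ → ℝ} {Y y : ℕ → ℝ} {n m k : ℕ} (S : HtS θ θh B Y y n m) (hk : k ≤ n) {g U : ℝ → ℝ} (hi : IntervalIntegrable (fun t => θ t*g t) volume 0 B) 
    (hU : MonotoneOn U (Icc (Y k) B)) (hg : ∀ a b, 0 < a → Y k ≤ a → a ≤ b → b ≤ B → |g a-g b| ≤ U b-U a) (hG : ∀ t ∈ Ioo (Y n) B, -G ≤ g t) :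
    ∑ j ∈ rg (n-k), g (y (k+j)) ≤ (∫ t in Y k..B, θ t*g t) + (U B-U (Y k)) + max G 0 ∧
    ((∀ t ∈ Ioo (Y n) B, g t ≤ G) → |∑ j ∈ rg (n-k), g (y (k+j)) - ∫ t in Y k..B, θ t*g t| ≤ (U B-U (Y k)) + max G 0) := by
  have mY : Monotone Y := wk fun j => (S.Yy j).1.trans (S.Yy j).2
  have sub : ∀ a ∈ Icc 0 B, ∀ b ∈ Icc 0 B, uIcc a b ⊆ uIcc 0 B := fun a ha b hb => by
    rw [uIcc_of_le (ha.1.trans ha.2)]; exact (uIcc_subset_Icc ha hb)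
  have ai : 0 ≤ B := (S.YB 0).1.trans (S.YB 0).2
  have mB : B ∈ Icc 0 B := ⟨ai, zu⟩
  have ax : oo ∈ Icc 0 B := ⟨zu, ai⟩
  have ii : ∀ a ∈ Icc 0 B, ∀ b ∈ Icc 0 B, IntervalIntegrable θ volume a b := fun a ha b hb => S.i.mono_set (sub a ha b hb)
  have ig : ∀ a ∈ Icc 0 B, ∀ b ∈ Icc 0 B, IntervalIntegrable (fun t => θ t*g t) volume a b := fun a ha b hb => hi.mono_set (sub a ha b hb)
  have c := Dr (θ := θ) (g := g) (V := U) (Y := fun j => Y (k+j)) (y := fun j => y (k+j)) (n := n-k) (S.YB _).1 (fun j => S.Yy _) (fun j h => (S.t _ (by omega)).2) (fun j h => by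
      have e := wy (ii 0 ax _ (S.YB (k+j+1))) (ii 0 ax _ (S.YB (k+j)))
      rw [S.T _ (by omega), S.T _ (by omega)] at e; show ∫ t in Y (k+j)..Y (k+j+1), θ t = 1
      rw [← e]; push_cast; ring) (fun t ht => S.p t ⟨xq (S.YB _).1 ht.1, ht.2.trans_le (S.YB _).2⟩) (hU.mono (Icc_subset_Icc_right (S.YB _).2))
      (fun a b h aa ad ag => hg a b h aa ad (ag.trans (S.YB _).2)) (ii _ (S.YB _) _ (S.YB _)) (ig _ (S.YB _) _ (S.YB _))
  simp only [vu, Nat.add_sub_cancel' hk] at c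
  have e := qi (ig _ (S.YB k) _ (S.YB n)) (ig _ (S.YB n) _ mB)
  have aj := wy (ii 0 ax B mB) (ii 0 ax _ (S.YB n))
  rw [S.T n zu] at aj
  have ak : ∫ t in Y n..B, θ t ≤ 1 := by rw [← aj]; linarith [S.N]
  have ei : U (Y n) ≤ U B := hU ⟨mY hk, (S.YB _).2⟩ ⟨(S.YB _).2, zu⟩ (S.YB _).2
  have bu : -(max G 0) ≤ ∫ t in Y n..B, θ t*g t := by
    have := xy (S.YB n).2 ((ii _ (S.YB n) _ mB).mul_const (-(max G 0))) (ig _ (S.YB n) _ mB) fun t ht =>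
      qq ((neg_le_neg (le_max_left G 0)).trans (hG t ht)) (S.p t ⟨xq (S.YB _).1 ht.1, ht.2⟩)
    rw [uy] at this
    nlinarith [le_max_right G 0]
  refine ⟨by linarith [((zq).1 c).2], fun kk => ?_⟩
  have bw : ∫ t in Y n..B, θ t*g t ≤ max G 0 := by
    have := xy (S.YB n).2 (ig _ (S.YB n) _ mB) ((ii _ (S.YB n) _ mB).mul_const (max G 0)) fun t ht =>
      qq ((kk t ht).trans (le_max_left G 0)) (S.p t ⟨xq (S.YB _).1 ht.1, ht.2⟩)
    rw [uy] at this
    nlinarith [le_max_right G 0]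
  rw [zq] at c ⊢
  constructor <;> linarith [c.1, c.2]
theorem Fp {θ θh V : ℝ → ℝ} {Y y : ℕ → ℝ} {n m : ℕ} (S : HtS θ θh B Y y n m) (H : HtN θh V ax v) {g Q W : ℝ → ℝ} {w z : ℂ} (hσ : (σ:ℂ) = -w²)
    (hw : Complex.cos (π*w) ≠ 0) (hz : 0 ≤ z.re) (hzw : z² = σ) (hs : 2*|σ| ≤ m²)
    (hg : ∀ t > 0, t ≠ y0 → g t = Ac σ (∫ s in oo..t, θh s) + Q t) (hn : ∀ j < m, y j ≠ y0) (hW : Monotone W) (hQ : ∀ a b, 0 < a → a ≤ b → |Q a-Q b| ≤ W b-W a) (hQm : ContinuousOn Q (Ioi 0))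
    (hi : IntervalIntegrable (fun t => θ t*g t) volume 0 B) (hκ : |κ| = 1) (hgm : ∀ a b, 0 < a → Y m ≤ a → a ≤ b → |g a-g b| ≤ κ*g b-κ*g a) (hG : ∀ t ≥ Y m, |g t| ≤ G) (hY : 0 < Y m) :
    |∑ j ∈ rg n, g (y j) - (∫ t in oo..B, θ t*g t) - (log ‖Complex.cos (π*w)‖ - π*z.re)| ≤ W (Y m)-W 0 + 2*|σ|/m² + 3*G := by
  have mY : Monotone Y := wk fun j => (S.Yy j).1.trans (S.Yy j).2
  have cg : ∀ a ∈ Icc 0 (Y m), ∫ t in oo..a, θh t = ∫ t in oo..a, θ t := fun a ha => uq fun t ht => by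
    rw [uIcc_of_le ha.1] at ht; exact (S.h t ⟨ht.1, ht.2.trans ha.2⟩).symm
  have hl : IntegrableOn (Ac σ) (Ioi 0) := by
    have := (Di hz).1; rw [hzw] at this
    exact this.congr_fun (fun y _ => Br σ y) qh
  have ymem : ∀ j < m, y j ∈ Icc 0 (Y m) := fun j hj => ⟨(S.YB j).1.trans (S.Yy j).1, (S.Yy j).2.trans (mY hj)⟩
  have hmn := S.mn
  obtain ⟨-, nr⟩ := Hy H S.Y0 S.Yy (m := m) (fun j hj => by rw [cg _ ⟨(S.YB j).1, mY hj⟩, S.T j (by omega)]) (fun j hj => by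
    rw [cg _ (ymem j hj)]; exact S.t j (by omega)) hl hg hn hW hQ hQm
  have md := Hv hσ hw hz hzw S.m1 hs
  have kl : 0 ≤ G := (zr _).trans (hG _ zu)
  have κ1 : ∀ t ≥ Y m, |κ*g t| ≤ G := fun t ht => by rw [abs_mul, hκ, wj]; exact hG t ht
  have fr := (Dv S hmn (g := g) (U := fun t => κ*g t) hi (G := G) (fun a ha b hb h => sub_nonneg.1 ((zr _).trans (hgm a b (hY.trans_le ha.1) ha.1 h)))
    (fun a b h aa ad _ => hgm a b h aa ad) fun t ht => ((zq).1 (hG t ((mY hmn).trans ht.1.le))).1).2 fun t ht => ((zq).1 (hG t ((mY hmn).trans ht.1.le))).2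
  rw [max_eq_left kl] at fr
  have bs := (zq).1 (κ1 _ zu)
  have co := (zq).1 (κ1 B (S.YB m).2)
  have aj : ∫ t in oo..Y m, θh t*g t = ∫ t in oo..Y m, θ t*g t := uq fun t ht => by
    rw [uIcc_of_le hY.le] at ht; beta_reduce; rw [S.h t ht]
  have ai : 0 ≤ B := (S.YB 0).1.trans (S.YB 0).2
  have ak := qi (hi.mono_set (c := 0) (d := Y m) (by rw [uIcc_of_le hY.le, uIcc_of_le ai]; exact Icc_subset_Icc_right (S.YB m).2))
    (hi.mono_set (c := Y m) (d := B) (by rw [uIcc_of_le (S.YB m).2, uIcc_of_le ai]; exact Icc_subset_Icc_left hY.le))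
  have be := Finset.sum_range_add (fun j => g (y j)) m (n-m)
  rw [Nat.add_sub_cancel' hmn] at be
  rw [aj] at nr
  rw [← ak, be]
  rw [zq] at *
  constructor <;> linarith [nr.1, nr.2, md.1, md.2, fr.1, fr.2]
theorem Fq (ht : 0 < t) (h : 2*|s| ≤ t²) : |Ac s t| ≤ 2*|s|/t² := by
  have := Dh (ζ := xc (s/t²)) (by rw [qu, qy, abs_div, qt (by positivity : 0 < t²), qc qp]; linarith)
  rw [← Complex.ofReal_one, ← Complex.ofReal_add, qu, qy, qu, qy, abs_div, qt (by positivity : 0 < t²)] at this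
  rw [Ac, wu]; exact this
theorem Jc {θ θh V : ℝ → ℝ} {Y y : ℕ → ℝ} {n m : ℕ} (S : HtS θ θh B Y y n m) (H : HtN θh V ax v) (ah : 0 < y0) (hy : 2*y0 ≤ Y m) (hn : ∀ j < m, y j ≠ y0)
    (hu : ∫ t in oo..y0, θh t = u) (hs : 2*u² ≤ m²) (hi : IntervalIntegrable (fun t => θ t*Ac (-y0²) t) volume 0 B) :
    cos (π*u) ≠ 0 ∧ |∑ j ∈ rg n, Ac (-y0²) (y j) - (∫ t in oo..B, θ t*Ac (-y0²) t) - log (|cos (π*u)|)| ≤ 8*(v/ax) + 2*u²/m² + 3*(2*y0²/(Y m)²) := by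
  obtain ⟨A, F, bf, bk, dc, cw, dw, dx⟩ := Ct H 0
  obtain ⟨A', F', bg, bo, fm, eu, ko, kr⟩ := Ct H y0
  obtain ⟨A'', F'', az, ay, ca, bt, fk, ks⟩ := Ct H (-y0)
  have ax := H.p
  have ii : ∀ a b, IntervalIntegrable θh volume a b := fun a b => H.c.intervalIntegrable a b
  have mY : Monotone Y := wk fun j => (S.Yy j).1.trans (S.Yy j).2
  have hY : 0 < Y m := ql
  have hmn := S.mn
  have hun : ∫ t in (-y0)..0, θh t = u := by
    rw [← hu]
    have := intervalIntegral.integral_comp_neg (a := 0) (b := y0) θh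
    rw [neg_zero] at this; rw [← this]; simp only [H.e]
  have aj : ∀ t, ∫ s in oo..t, θh s = u + (t-y0)*A' t := fun t => by
    rw [← fm, ← hu]; exact (qi (ii _ _) (ii _ _)).symm
  have ak : ∀ t, ∫ s in oo..t, θh s = (t+y0)*A'' t - u := fun t => by
    have := ca t
    rw [← qi (ii (-y0) 0) (ii 0 t), hun, sub_neg_eq_add] at this; linarith
  have hcos : Complex.cos (π*(u:ℂ)) ≠ 0 := by
    rw [Ne, Complex.cos_eq_zero_iff]; rintro ⟨k, hk⟩
    have hk' : u = k+xx := by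
      have : π*u = (2*k+1)*π/2 := by exact_mod_cast hk
      field_simp at this; linarith
    have ib : 0 ≤ u := by rw [← hu]; exact intervalIntegral.integral_nonneg ah.le fun t _ => ax.le.trans (H.mb t)
    have dn : 0 ≤ k := by
      have : (-1:ℝ) < k := ql
      have : -1 < k := by exact_mod_cast this
      omega
    lift k to ℕ using dn
    have um : u < m := by
      have : (1:ℝ) ≤ m := by exact_mod_cast S.m1
      nlinarith
    have km : k < m := by
      have : (k:ℝ) < m := by push_cast at hk'; linarith
      exact_mod_cast this
    have yk := (S.t k (by omega)).1
    have ym : y k ≤ Y m := (S.Yy k).2.trans (mY km)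
    have : ∫ t in oo..y k, θh t = u := by
      rw [hk', show ((k:ℤ):ℝ) = k by simp, ← yk]
      refine uq fun t ht => ?_
      rw [uIcc_of_le (S.t k (by omega)).2.le] at ht; exact (S.h t ⟨ht.1, ht.2.trans ym⟩).symm
    rw [aj] at this
    have := (mul_eq_zero.1 (by linarith : (y k-y0)*A' (y k) = 0)).resolve_right (ax.trans_le (eu _)).ne'
    exact hn k km ql
  have key := Fp S H (g := Ac (-y0²)) (Q := fun t => 2*log (A t)-log (A' t)-log (A'' t)) (W := fun t => 2*F t+F' t+F'' t) (σ := -u²) (y0 := y0) (G := 2*y0²/(Y m)²) (κ := 1) (w := u) (z := u*jj)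
    (by push_cast; ring) hcos (by simp) (by push_cast; rw [xj, wl]; ring) (by rwa [abs_neg, abs_of_nonneg (zd u)]) (fun t ht hne => ?_) hn (fun a b h => by
      have aa := bf h
      have ad := bg h
      have ag := az h
      linarith) (fun a b _ h => ?_) ?_ hi (by simp) (fun a b ha hYa h => ?_) (fun t ht => ?_) hY
  · have e : (u*jj : ℂ).re = 0 := by simp
    rw [e, xo, ze, abs_neg, abs_of_nonneg (zd u), ← Complex.ofReal_mul, ← ut, qu, qy] at key
    refine ⟨fun h => hcos (by rw [← Complex.ofReal_mul, ← ut, h, Complex.ofReal_zero]), key.trans ?_⟩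
    have dp := fun t => (zq).1 (bk t)
    have ic := fun t => (zq).1 (bo t)
    have ij := fun t => (zq).1 (ay t)
    linarith [(dp 0).1, (dp (Y m)).2, (ic 0).1, (ic (Y m)).2, (ij 0).1, (ij (Y m)).2]
  · have ds := ax.trans_le (cw t)
    have cu := ax.trans_le (eu t)
    have gq := ax.trans_le (bt t)
    have cf := dc t
    rw [ze] at cf
    have dj := aj t
    have il := ak t
    have q : 1+ -u²/(t*A t)² = (1+ -y0²/t²)*(A' t*A'' t/(A t)²) := by
      rw [cf] at dj il
      field_simp
      linear_combination (t*A t+u)*dj + (t-y0)*A' t*il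
    have dy : 1+ -y0²/t² ≠ 0 := by
      intro h
      have : (t-y0)*(t+y0) = 0 := by field_simp at h; linarith
      rcases mul_eq_zero.1 this with h | h
      · exact hne ql
      · linarith
    rw [cf, Ac, Ac, q, abs_mul, ws (abs_ne_zero.2 dy) qp, qt (by positivity : 0 < A' t*A'' t/(A t)²), log_div qp qp, ws cu.ne' gq.ne', log_pow]
    push_cast; ring
  · have aa := (zq).1 (dw a b h)
    have ad := (zq).1 (ko a b h)
    have ag := (zq).1 (fk a b h)
    rw [zq]; constructor <;> linarith [aa.1, aa.2, ad.1, ad.2, ag.1, ag.2]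
  · have bu := dx.log fun t => (ax.trans_le (cw t)).ne'
    have bw := kr.log fun t => (ax.trans_le (eu t)).ne'
    have da := ks.log fun t => (ax.trans_le (bt t)).ne'
    exact (((continuous_const.mul bu).sub bw).sub da).continuousOn
  · have : Ac (-y0²) a ≤ Ac (-y0²) b := by
      have q : y0²/a² < 1 := by rw [uw qp]; nlinarith
      have kd : y0²/b² ≤ y0²/a² := by gcongr
      rw [Ac, Ac, vm, vm, qt ql, qt ql]
      exact zv ql ql
    rw [abs_of_nonpos ql]; linarith
  · have al : 0 < t := zl hY ht
    have := Fq al (s := -y0²) (by rw [abs_neg, abs_of_nonneg (zd y0)]; nlinarith)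
    rw [abs_neg, abs_of_nonneg (zd y0)] at this
    refine this.trans ?_
    have : Y m ≤ t := ht
    gcongr
theorem Jd (h : 0 ≤ ω) (aa : ω ≤ 1) (h' : 0 ≤ ω') (bz : ω' ≤ 1) (hx : |x| ≤ X) (hX : X ≤ 1) :
    |log (1+ω*(exp x-1)) - log (1+ω'*(exp x'-1))| ≤ |x-x'| + 6*X*|ω-ω'| := by
  have pos : ∀ w z : ℝ, 0 ≤ w → w ≤ 1 → 0 < 1+w*(exp z-1) := fun w z h aa => by
    rcases h.eq_or_lt with rfl | h
    · norm_num
    · linarith [mul_pos h (xz z)]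
  have bn : ∀ w a b : ℝ, 0 ≤ w → w ≤ 1 → log (1+w*(exp a-1)) - log (1+w*(exp b-1)) ≤ |a-b| := fun w a b h aa => by
    rw [sub_le_iff_le_add, ← log_exp (|a-b|), ← ws (xz _).ne' (pos w b h aa).ne']
    refine zv (pos w a h aa) ?_
    have aj : exp a ≤ exp (|a-b|)*exp b := by rw [← zn]; exact (wp).2 (by linarith [le_abs_self (a-b)])
    have ak : 1 ≤ exp (|a-b|) := one_le_exp (zr _)
    nlinarith
  have be : |exp x-1| ≤ 2*X := (abs_exp_sub_one_le (hx.trans hX)).trans ql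
  have bq : 1/3 ≤ exp x := by
    have := (wp).2 (show -1 ≤ x by linarith [((zq).1 hx).1])
    have ag : exp 1 < 3 := exp_one_lt_d9.trans qn
    rw [exp_neg] at this
    refine wh ?_ this
    rw [one_div]; exact inv_anti₀ (xz 1) ag.le
  have cl : ∀ a b : ℝ, 0 ≤ a → a ≤ 1 → 0 ≤ b → b ≤ 1 → log (1+a*(exp x-1)) - log (1+b*(exp x-1)) ≤ 6*X*|a-b| := fun a b h aa h' bz => by
    rw [← log_div (pos a x h aa).ne' (pos b x h' bz).ne']
    refine (vl (uj (pos a x h aa) (pos b x h' bz))).trans ?_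
    have p := pos b x h' bz
    rw [sub_le_iff_le_add, qc p]
    have q : 1/3 ≤ 1+b*(exp x-1) := by nlinarith
    have r : (a-b)*(exp x-1) ≤ (|a-b|)*(2*X) := (le_abs_self _).trans (by rw [abs_mul]; gcongr)
    have ly : 0 ≤ X := (zr _).trans hx
    have : 6*X*(|a-b|)*(1/3) ≤ 6*X*(|a-b|)*(1+b*(exp x-1)) := qq q qp
    linarith
  have bp := bn ω' x x' h' bz
  have bh := bn ω' x' x h' bz
  have ef := cl ω ω' h aa h' bz
  have ej := cl ω' ω h' bz h aa
  rw [abs_sub_comm] at bh ej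
  rw [zq]; constructor <;> linarith
theorem Je {θ θh V : ℝ → ℝ} {Y y : ℕ → ℝ} {n m : ℕ} (S : HtS θ θh B Y y n m) (H : HtN θh V ax v) (hY : 2 ≤ Y m) (hv : v/ax ≤ 1/4) (hs : 2*(θh 0)² ≤ m²)
    (hi : IntervalIntegrable (fun t => θ t*Ac 1 t) volume 0 B) :
    |∑ j ∈ rg n, Ac 1 (y j) - (∫ t in oo..B, θ t*Ac 1 t) - (log (cosh (π*θh 0)) - π*θh 0)| ≤ 28*(v/ax) + 2*(θh 0)²/m² + 3*(2/(Y m)²) := by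
  obtain ⟨A, F, bf, bk, dc, cw, dw, dx⟩ := Ct H 0
  have ax := H.p
  have ap : ∀ t, 0 < A t := fun t => ax.trans_le (cw t)
  set a := θh 0 with ha
  have dz : 0 < a := ax.trans_le (H.mb 0)
  have Aa : A 0 = a := by
    have d : HasDerivAt (fun y => ∫ t in oo..y, θh t) a 0 := intervalIntegral.integral_hasDerivAt_right (H.c.intervalIntegrable _ _) (H.c.stronglyMeasurableAtFilter _ _) H.c.continuousAt
    have bp := d.tendsto_slope
    have bh : Tendsto A (𝓝[≠] 0) (𝓝 (A 0)) := (dx.tendsto 0).mono_left xu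
    refine tendsto_nhds_unique bh (bp.congr' ?_)
    filter_upwards [self_mem_nhdsWithin] with t ht
    have : t ≠ 0 := ht
    rw [slope_def_field, intervalIntegral.integral_same, dc]; field_simp; ring
  have dp := fun t => (zq).1 (bk t)
  set η := v/_ with hη
  set x : ℝ → ℝ := fun t => 2*(log a-log (A t)) with hx
  have ex : ∀ t, exp (x t) = a²/(A t)² := fun t => by
    show exp (2*(log a-log (A t))) = _
    rw [← log_div dz.ne' (ap t).ne', ← div_pow, show 2*log (a/A t) = log ((a/A t)²) by rw [log_pow]; norm_num, xn (by have := ap t; positivity)]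
  have xb : ∀ t, 0 < t → |x t| ≤ 4*η := fun t ht => by
    rw [hx, ← Aa]; have := dw 0 t ht.le
    simp only; rw [abs_mul, abs_two]; linarith [(dp 0).1, (dp t).2]
  have af : 0 ≤ η := (zr _).trans (bk 0)
  have cp : 0 < cosh (π*a) := cosh_pos _
  have ce : Complex.cos (π*(a*jj)) = xc (cosh (π*a)) := by
    rw [← wx, Complex.cos_mul_I, ← Complex.ofReal_mul, Complex.ofReal_cosh]
  have key := Fp S H (g := Ac 1) (Q := fun t => -log (1+1/(1+t²)*(exp (x t)-1))) (W := fun t => 2*F t+24*η*(1-1/(1+(max t 0)²))) (σ := a²) (y0 := -1) (G := 2/(Y m)²) (κ := -1) (w := a*jj) (z := a)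
    (by push_cast; rw [xj, wl]; ring) (by rw [ce]; exact_mod_cast cp.ne') (by simpa using dz.le) (by push_cast; ring) (by rwa [abs_of_nonneg (zd a)]) (fun t ht hne => ?_)
    (fun j hj h => by have := (S.t j (hj.trans_le S.mn)).2; linarith) (fun b c h => ?_) (fun b c hb h => ?_) ?_ hi (by simp) (fun b c hb hYb h => ?_) (fun t ht => ?_) ql
  · rw [ce, qu, qd cp.le, zs, abs_of_nonneg (zd a)] at key
    refine key.trans ?_
    have : 24*η*(1-1/(1+(max (Y m) 0)²)) ≤ 24*η := by
      have : 0 ≤ 1/(1+(max (Y m) 0)²) := qp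
      nlinarith
    simp only [max_self]
    linarith [(dp 0).1, (dp (Y m)).2]
  · have := ap t
    rw [dc, ze, Ac, Ac, ex, qt qp, qt qp, show 1+1/(1+t²)*(a²/A t²-1) = (t²+a²/A t²)/(1+t²) by field_simp; ring, ← log_inv, ← ws qp qp]
    congr 1; field_simp; ring
  · have aa := bf h
    have : 1/(1+(max c 0)²) ≤ 1/(1+(max b 0)²) := by gcongr
    nlinarith
  · have bc : 0 < c := hb.trans_le h
    have q : ∀ t : ℝ, 0 ≤ 1/(1+t²) ∧ 1/(1+t²) ≤ 1 := fun t => ⟨qp, (xl qp).2 (by nlinarith)⟩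
    have := Jd (q c).1 (q c).2 (q b).1 (q b).2 (x' := x b) (xb c bc) ql
    rw [show -log (1+1/(1+b²)*(exp (x b)-1)) - -log (1+1/(1+c²)*(exp (x c)-1)) = log (1+1/(1+c²)*(exp (x c)-1))-log (1+1/(1+b²)*(exp (x b)-1)) by ring]
    refine this.trans ?_
    have ad : |x c-x b| ≤ 2*(F c-F b) := by
      have := dw b c h
      rw [hx, show 2*(log a-log (A c))-2*(log a-log (A b)) = 2*(log (A b)-log (A c)) by ring, abs_mul, abs_two]; linarith
    have ag : 1/(1+c²) ≤ 1/(1+b²) := by gcongr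
    rw [abs_of_nonpos (by linarith : 1/(1+c²)-1/(1+b²) ≤ 0), max_eq_left bc.le, max_eq_left hb.le]
    linarith
  · have bu := dx.log fun t => (ap t).ne'
    have : Continuous x := by rw [hx]; fun_prop
    refine (Continuous.log (continuous_const.add ((continuous_const.div qf fun t => qp).mul qf)) fun t => ?_).neg.continuousOn
    have q : 0 < 1/(1+t²) ∧ 1/(1+t²) ≤ 1 := ⟨qp, (xl qp).2 (by nlinarith)⟩
    exact (by linarith [mul_pos q.1 (xz (x t))] : 0 < 1+1/(1+t²)*(exp (x t)-1)).ne'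
  · have : Ac 1 c ≤ Ac 1 b := by
      rw [Ac, Ac, qt qp, qt qp]
      gcongr
    rw [abs_of_nonneg ql]; linarith
  · have bh : Y m ≤ t := ht
    have al : 0 < t := ql
    have := Fq al (s := 1) (by rw [abs_one]; nlinarith)
    rw [abs_one, zb] at this
    refine this.trans ?_
    gcongr
theorem Cu (hβ : xx < β) (hδ : 0 < δ) (K : ℕ) (hB : 1 < B) {g : ℝ → ℝ} (hg : IntegrableOn (fun y => Ae β B y*g y) (Ioo 0 B)) (hs : IntegrableOn (fun y => Ag δ K y*g y) (Ioi 0)) :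
    IntervalIntegrable (fun t => Al β δ K B t*g t) volume 0 B ∧ ∫ t in oo..B, Al β δ K B t*g t = (∫ y in Ioo 0 B, Ae β B y*g y) - ∫ y in Ioc 0 (√B), Ag δ K y*g y := by
  have ai : 0 < B := ql
  have sB : √B < B := by rw [sqrt_lt' ai]; nlinarith
  have av : IntegrableOn ((Iic (√B)).indicator fun y => Ag δ K y*g y) (Ioo 0 B) := Integrable.indicator (hs.mono_set fun x hx => hx.1) measurableSet_Iic
  have e : (fun t => Al β δ K B t*g t) = fun t => Ae β B t*g t - (Iic (√B)).indicator (fun y => Ag δ K y*g y) t := by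
    funext t; by_cases h : t ≤ √B
    · rw [indicator_of_mem (by exact h), Al, if_pos h]; ring
    · rw [indicator_of_notMem (by exact h), Al, if_neg h]; ring
  rw [e, qm ai.le, qw ai.le, qj]
  refine ⟨Dn hg av, ?_⟩
  rw [we hg av, xv measurableSet_Iic]
  congr 2
  have : Ioo 0 B ∩ Iic (√B) = Ioc 0 (√B) := by
    ext x; simp only [mem_inter_iff, mem_Ioo, mem_Iic, mem_Ioc]; constructor
    · rintro ⟨⟨a, b⟩, c⟩; exact ⟨a, c⟩
    · rintro ⟨a, c⟩; exact ⟨⟨a, ql⟩, c⟩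
  rw [this]
theorem Cj (hδ : 0 < δ) (K : ℕ) : IntegrableOn (Ag δ K) (Ioi 0) := by
  have c : ∀ c : ℝ, 0 < c → IntegrableOn (fun y : ℝ => c/(c²+y²)) (Ioi 0) := fun c hc => by
    have h := (integrable_inv_one_add_sq.comp_div hc.ne').const_mul c⁻¹
    refine h.integrableOn.congr_fun (fun y _ => ?_) qh
    have : 0 < c²+y² := qp
    simp only; field_simp
  exact ((((c δ hδ).const_mul xx).add (c 1 one_pos)).add ((c _ (inv_pos.2 hδ)).const_mul (K:ℝ))).const_mul (1/π)
theorem Jf (hβ : xx < β) (hδ : 0 < δ) (K : ℕ) (hη : 0 < η) : ∀ᶠ B in atTop, ∃ (Y y : ℕ → ℝ) (n m : ℕ) (V : ℝ → ℝ) (v : ℝ),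
    HtS (Al β δ K B) (fun t => Al β δ K B (min |t| (√B))) B Y y n m ∧ HtN (fun t => Al β δ K B (min |t| (√B))) V (Ad β B/(2*π)) v ∧ v/(Ad β B/(2*π)) ≤ η ∧
    (∀ t, Al β δ K B (min |t| (√B)) ≤ 2*Ad β B/π) ∧ √B/2 ≤ Y m ∧ Y m ≤ √B ∧ Ad β B*√B/(4*π) ≤ m ∧ (n:ℝ) ≤ Af β*B^xk β/(4*β) := by
  have mt : Tendsto (fun B => Ad β B*√B) atTop atTop := (Bf hβ).atTop_mul_atTop₀ tendsto_sqrt_atTop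
  filter_upwards [Jb hβ hδ K hη, mt.eventually_ge_atTop (8*π), qr 1] with B ⟨⟨V, v, H, hv⟩, hM⟩ hL hB
  have ai : 0 < B := ql
  have br := Av hβ ai
  have sB : √B < B := by rw [sqrt_lt' ai]; nlinarith
  have ao : 0 < √B := sqrt_pos.2 ai
  set θ := Al β δ K B with hθ
  have eq : ∀ t ∈ Icc 0 (√B), θ t = θ (min |t| (√B)) := fun t ht => by rw [abs_of_nonneg ht.1, min_eq_left ht.2]
  have p : ∀ t ∈ Ioo 0 B, 0 ≤ θ t := fun t ht => by
    by_cases h : t ≤ √B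
    · rw [eq t ⟨ht.1.le, h⟩]; exact H.p.le.trans (H.mb t)
    · rw [hθ, Al, if_neg h, ze]; exact (Bs hβ ai ⟨ht.1.le, ht.2⟩).1
  obtain ⟨i, hN⟩ := Cu hβ hδ K hB (g := fun _ => 1) (by simpa using (Bd hβ ai).1) (by simpa using Cj hδ K)
  simp only [zb, ← hθ, (Bd hβ ai).2] at i hN
  have ii : ∀ a b, 0 ≤ a → a ≤ B → 0 ≤ b → b ≤ B → IntervalIntegrable θ volume a b := fun a b aa ad ag ar => i.mono_set (by
    rw [uIcc_of_le ai.le]; exact uIcc_subset_Icc ⟨aa, ad⟩ ⟨ag, ar⟩)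
  set T : ℝ → ℝ := fun y => ∫ t in oo..y, θ t with hT
  have hTc : ContinuousOn T (Icc 0 B) := by
    have := intervalIntegral.continuousOn_primitive_interval' i (by simp : oo ∈ uIcc 0 B)
    rwa [uIcc_of_le ai.le] at this
  have df : ∀ a b, 0 ≤ a → a ≤ b → b ≤ B → T b - T a = ∫ t in a..b, θ t := fun a b aa ad ag =>
    wy (ii _ _ zu ai.le (aa.trans ad) ag) (ii _ _ zu ai.le aa (ad.trans ag))
  have hTm : MonotoneOn T (Icc 0 B) := fun a ha b hb h => by
    have := df a b ha.1 h hb.2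
    have ad : 0 ≤ ∫ t in a..b, θ t := by
      rw [qw h, qj]
      exact setIntegral_nonneg qz fun t ht => p t ⟨xq ha.1 ht.1, ht.2.trans_le hb.2⟩
    linarith
  have low : ∀ a b, 0 ≤ a → a ≤ b → b ≤ √B → Ad β B/(2*π)*(b-a) ≤ T b-T a := fun a b aa ad ag => by
    rw [df a b aa ad (ag.trans sB.le)]
    have := ug ad (by simp : IntervalIntegrable (fun _ : ℝ => Ad β B/(2*π)) volume a b) (ii a b aa ql ql ql) fun t ht => by
      rw [eq t ⟨aa.trans ht.1, ht.2.trans ag⟩]; exact H.mb t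
    rw [intervalIntegral.integral_const, qo] at this; linarith
  have ck : T 0 = 0 := by simp [hT]
  obtain ⟨Y, y, eo, go, fp, io, ku⟩ := Hw ai.le hTc hTm ck
  have TB : 0 ≤ T B := by rw [← ck]; exact hTm ⟨zu, ai.le⟩ ⟨ai.le, zu⟩ ai.le
  have Ts : T (√B) ≤ T B := hTm ⟨ao.le, sB.le⟩ ⟨ai.le, zu⟩ sB.le
  have bu := low 0 (√B) zu ao.le zu
  have bq : Ad β B/(2*π)*√B = 2*(Ad β B*√B/(4*π)) := by field_simp; ring
  have bw : 2 ≤ Ad β B*√B/(4*π) := by rw [zt qp]; linarith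
  rw [ck, ze, ze, bq] at bu
  set c := ⌈T (√B)⌉₊ with hc
  have az : T (√B) ≤ c := Nat.le_ceil _
  have ay : (c:ℝ) < T (√B)+1 := Nat.ceil_lt_add_one ql
  have cd : 1 ≤ c := by
    have : (1:ℝ) ≤ c := ql
    exact_mod_cast this
  have cm : ((c-1:ℕ):ℝ) = c-1 := by push_cast [Nat.cast_sub cd]; ring
  have Tm : T (Y (c-1)) = c-1 := by rw [io _ (by rw [cm]; linarith), cm]
  have ym : Y (c-1) ≤ √B := by
    by_contra! h
    have := hTm ⟨ao.le, sB.le⟩ (fp _) h.le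
    linarith
  have nf := Nat.floor_le TB
  refine ⟨Y, y, ⌊T B⌋₊, c-1, V, v, ⟨i, p, eo, go, fp, fun j hj => io j ?_, fun j hj => ku j ?_, (Nat.lt_floor_add_one _).le, ?_, ?_, fun t ht => eq t ⟨ht.1, ht.2.trans ym⟩⟩, H, hv, hM, ?_, ym, ?_, ?_⟩
  · exact wh (by exact_mod_cast hj) nf
  · have : ((j+1:ℕ):ℝ) ≤ (⌊T B⌋₊:ℝ) := by exact_mod_cast hj
    push_cast at this; linarith
  · exact Nat.le_floor (by rw [cm]; linarith)
  · have : (1:ℝ) ≤ (c-1:ℕ) := by rw [cm]; linarith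
    exact_mod_cast this
  · by_contra! h
    have da := low (Y (c-1)) (√B) (fp _).1 ym zu
    have jg : Ad β B/(2*π)*(√B/2) < Ad β B/(2*π)*(√B-Y (c-1)) := by
      have : 0 < Ad β B/(2*π) := qp
      exact mul_lt_mul_of_pos_left ql this
    linarith
  · rw [cm]; linarith
  · refine nf.trans (hN.le.trans (sub_le_self _ ?_))
    exact setIntegral_nonneg zm fun t _ => Bm hδ K t
theorem Jg (hh : 0 < h) (t : ℝ) : Integrable (fun y => Ac (h²) (y-t)) ∧ ∫ y, Ac (h²) (y-t) = 2*(π*h) := by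
  have e : ∫ y, Ac (h²) (y-t) = 2*(π*h) := by
    rw [integral_sub_right_eq_self (fun y => Ac (h²) y) t]
    have := (Di (v := (h:ℂ)) (by simpa using hh.le)).2
    rw [zs] at this
    rw [← this, ← integral_comp_abs]
    refine integral_congr_ae (qg fun y => ?_)
    simp only [← Complex.ofReal_pow, Br, Ac, sq_abs]
  refine ⟨?_, e⟩
  by_contra hn
  rw [integral_undef hn] at e
  have : 0 < 2*(π*h) := qp
  linarith
theorem Jh {θ θh : ℝ → ℝ} {Y y : ℕ → ℝ} {n m : ℕ} (S : HtS θ θh B Y y n m) (hM : ∀ s ∈ Ioo 0 B, θ s ≤ M) (ey : 0 < M) (hB : 0 < B) (hMB : 1 ≤ B*M) (ht : 0 < t)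
    (hi : IntervalIntegrable (fun s => θ s*Ac (-t²) s) volume 0 B) :
    ∏ j ∈ rg n, |1-t²/(y j)²| ≤ exp π*(B*M)^3*(1+4*M²*t²)²*exp (∫ s in oo..B, θ s*Ac (-t²) s) := by
  set E := 1+4*M²*t² with hE
  have fq : 1 ≤ E := by rw [hE]; nlinarith [zd (M*t)]
  set q := (B*M)⁻¹ with hq
  have dy : 0 < q := qp
  have dd : q ≤ 1 := inv_le_one_of_one_le₀ hMB
  set c := log (B*M) with hc
  have cd : 0 ≤ c := log_nonneg hMB
  have lq : log q = -c := by rw [hq, log_inv]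
  set k : ℝ → ℝ := fun y => max (min |1-t²/y²| E) q with hk
  have kq : ∀ y, q ≤ k y := fun y => le_max_right _ _
  have kp : ∀ y, 0 < k y := fun y => dy.trans_le (kq y)
  have kE : ∀ y, k y ≤ E := fun y => max_le (min_le_right _ _) (dd.trans fq)
  have gl : ∀ y, -c ≤ log (k y) := fun y => by rw [← lq]; exact zv dy (kq y)
  have gu : ∀ y, log (k y) ≤ log E := fun y => zv (kp y) (kE y)
  have ch : 0 ≤ log E := log_nonneg fq
  have kv : ∀ a b, 0 < a → a ≤ b → b ≤ t → log (k b) ≤ log (k a) := fun a b ha hab hb => by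
    refine zv (kp b) ?_
    have aa : t²/b² ≤ t²/a² := by gcongr
    have ad : 1 ≤ t²/b² := by rw [one_le_div (by have := ha.trans_le hab; positivity)]; gcongr; exact (ha.trans_le hab).le
    simp only [hk]; rw [abs_of_nonpos ql, abs_of_nonpos ql]; gcongr
  have kw : ∀ a b, t ≤ a → a ≤ b → log (k a) ≤ log (k b) := fun a b ha hab => by
    refine zv (kp a) ?_
    have dz : 0 < a := ht.trans_le ha
    have aa : t²/b² ≤ t²/a² := by gcongr
    have ad : t²/a² ≤ 1 := by rw [xl qp]; gcongr
    simp only [hk]; rw [abs_of_nonneg ql, abs_of_nonneg ql]; gcongr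
  have mg : Measurable fun y => log (k y) := by simp only [hk]; fun_prop
  have ig : IntervalIntegrable (fun y => θ y*log (k y)) volume 0 B := by
    have aa := S.i.norm.mul_const (log E+c)
    rw [xt hB.le] at aa ⊢
    have ad := S.i
    rw [xt hB.le] at ad
    refine Integrable.mono' aa (ad.aestronglyMeasurable.mul mg.aestronglyMeasurable) (qg fun y => ?_)
    rw [qk]
    refine qq ?_ (zk _)
    rw [qy, zq]; constructor <;> linarith [gl y, gu y]
  set U : ℝ → ℝ := fun y => if y ≤ 0 then -log E else if y ≤ t then -log (k y) else log (k y)+2*c with hU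
  have ei : ∀ y, 0 < y → y ≤ t → U y = -log (k y) := fun y h h' => by rw [hU]; simp only; rw [if_neg ql, if_pos h']
  have fs : ∀ y, t < y → U y = log (k y)+2*c := fun y h => by rw [hU]; simp only; rw [if_neg ql, if_neg ql]
  have ft : ∀ y, y ≤ 0 → U y = -log E := fun y h => by rw [hU]; simp only; rw [if_pos h]
  have dif : ∀ a b, 0 < a → a ≤ b → |log (k a)-log (k b)| ≤ U b-U a := fun a b ha hab => by
    rcases vw b t with h | h
    · rw [ei a ha (hab.trans h), ei b (ha.trans_le hab) h, abs_of_nonneg (by linarith [kv a b ha hab h])]; linarith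
    · rw [fs b h]
      rcases vw a t with h' | h'
      · rw [ei a ha h', zq]; constructor <;> linarith [gl a, gl b]
      · rw [fs a h', abs_of_nonpos (by linarith [kw a b h'.le hab])]; linarith
  have Ul : ∀ y, -log E ≤ U y ∧ U y ≤ log E+2*c := fun y => by
    rcases vw y 0 with h | h
    · rw [ft y h]; constructor <;> linarith
    rcases vw y t with h' | h'
    · rw [ei y h h']; constructor <;> linarith [gl y, gu y]
    · rw [fs y h']; constructor <;> linarith [gl y, gu y]
  have key := (Dv S (Nat.zero_le n) (g := fun y => log (k y)) (U := U) ig (G := c) (fun a ha b hb h => by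
      rcases vw a 0 with ah | ah
      · rw [ft a ah]; exact (Ul b).1
      · exact sub_nonneg.1 ((zr _).trans (dif a b ah h))) (fun a b h _ h' _ => dif a b h h') fun y _ => gl y).1
  rw [S.Y0, ft 0 zu, max_eq_left cd, Nat.sub_zero] at key
  simp only [vb] at key
  have ah : 0 < M⁻¹ := inv_pos.2 ey
  obtain ⟨bs, co⟩ := Jg ah t
  have ptw : ∀ y ∈ Ioo 0 B, θ y*log (k y) ≤ θ y*Ac (-t²) y + M*(xx*Ac ((M⁻¹)²) (y-t)) := fun y hy => by
    have kx := S.p y hy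
    have dv : 0 ≤ Ac ((M⁻¹)²) (y-t) := Bp (zd _) _
    have bu : log (k y) ≤ Ac (-t²) y + xx*Ac ((M⁻¹)²) (y-t) := by
      by_cases hyt : y = t
      · have : k t = q := by simp only [hk]; rw [div_self qp]; simp [dy.le]
        rw [hyt, this, lq, Ac, vm, div_self qp]; simp [Ac]; linarith
      have y0 := hy.1
      have d : y-t ≠ 0 := (xg).2 hyt
      have ea : 0 < |1-t²/y²| := by
        rw [abs_pos, show 1-t²/y² = (y-t)*(y+t)/y² by field_simp; ring]
        have : y+t ≠ 0 := qp
        positivity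
      rw [show Ac (-t²) y = log |1-t²/y²| by rw [Ac, vm, sub_eq_add_neg]]
      rcases le_total q |1-t²/y²| with h | h
      · have : log (k y) ≤ log |1-t²/y²| := zv (kp y) (max_le (min_le_left _ _) h)
        linarith
      · have : k y = q := by simp only [hk]; rw [min_eq_left (h.trans (dd.trans fq)), max_eq_right h]
        rw [this, Ac, qt (by positivity : 0 < 1+(M⁻¹)²/(y-t)²)]
        have bw : log ((M⁻¹/(|y-t|))²) ≤ log (1+(M⁻¹)²/(y-t)²) := zv qp (by rw [div_pow, sq_abs]; linarith)
        rw [log_pow] at bw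
        have da : log q ≤ log ((|1-t²/y²|)*(M⁻¹/(|y-t|))) := zv dy (by
          rw [show 1-t²/y² = (y-t)*((y+t)/y²) by field_simp; ring, abs_mul, qt (by positivity : 0 < (y+t)/y²), hq, mul_inv,
            show (|y-t|)*((y+t)/y²)*(M⁻¹/(|y-t|)) = (y+t)/y²*M⁻¹ by have := abs_pos.2 d; field_simp]
          refine qb ?_ ah.le
          rw [inv_le_comm₀ hB qp, inv_div, qc qp]
          nlinarith [hy.2])
        rw [ws ea.ne' qp] at da
        push_cast at bw; linarith
    have := qq bu kx
    have := qb (hM y hy) (by linarith : 0 ≤ xx*Ac ((M⁻¹)²) (y-t))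
    linarith
  have ik : IntervalIntegrable (fun y => M*(xx*Ac ((M⁻¹)²) (y-t))) volume 0 B := ((bs.const_mul xx).const_mul M).intervalIntegrable
  have I := xy hB.le ig (hi.add ik) ptw
  rw [xr hi ik, zj, zj] at I
  have ky : ∫ y in oo..B, Ac ((M⁻¹)²) (y-t) ≤ 2*(π*M⁻¹) := by
    rw [← co, qw hB.le]
    exact setIntegral_le_integral bs (qg fun y => Bp (zd _) _)
  have lz : M*(xx*∫ y in oo..B, Ac ((M⁻¹)²) (y-t)) ≤ π := by
    have := qq ky ey.le
    have e : M*(2*(π*M⁻¹)) = 2*π := by field_simp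
    linarith
  have kj : ∀ j ∈ rg n, |1-t²/(y j)²| ≤ k (y j) := fun j hj => by
    obtain ⟨aa, ad⟩ := S.t j ((wf).1 hj)
    have yB : y j ≤ B := (S.Yy j).2.trans (S.YB _).2
    have := xy ad.le (S.i.mono_set (by rw [uIcc_of_le ad.le, uIcc_of_le hB.le]; exact Icc_subset_Icc_right yB)) (by simp : IntervalIntegrable (fun _ : ℝ => M) volume 0 (y j)) fun s hs => hM s ⟨hs.1, hs.2.trans_le yB⟩
    rw [aa, intervalIntegral.integral_const, qo, ze] at this
    have gz : oo ≤ j := Nat.cast_nonneg j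
    refine wh (le_min zu ?_) (le_max_left _ _)
    have : t²/(y j)² ≤ 4*M²*t² := by
      rw [qc qp]
      have : 1 ≤ (2*(y j*M))² := by nlinarith
      nlinarith [zd t]
    have : 0 ≤ t²/(y j)² := qp
    rw [zq]; constructor <;> linarith
  calc _ ≤ ∏ j ∈ rg n, k (y j) := Finset.prod_le_prod (fun _ _ => zr _) kj
    _ = exp (∑ j ∈ rg n, log (k (y j))) := by rw [exp_sum]; exact Finset.prod_congr rfl fun j _ => (xn (kp _)).symm
    _ ≤ exp (π+(c+c+c)+(log E+log E)+∫ s in oo..B, θ s*Ac (-t²) s) := (wp).2 (by linarith [(Ul B).2])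
    _ = _ := by
      rw [zn, zn, zn, zn, zn, zn, hc, xn ql, xn ql]; ring
theorem Ji (hδ : 0 < δ) (K : ℕ) : ∀ᶠ B in atTop, ∀ t > 0, -∫ y in Ioc 0 (√B), Ag δ K y*Ac (-t²) y ≤ -Ap δ K (t*jj) + if t ≤ √B then 0 else log (1+t²) := by
  have lim := intervalIntegral_tendsto_integral_Ioi 0 (Cj hδ K) tendsto_sqrt_atTop
  filter_upwards [lim.eventually (lt_mem_nhds (sub_one_lt _)), qr 1] with B hl hB t ht
  have bn : 1 < √B := by rw [lt_sqrt xp]; linarith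
  have ao : 0 < √B := ql
  obtain ⟨bf, bk⟩ := Ds hδ K (v := t*jj) (by simp)
  have e : ((t:ℂ)*jj)² = xc (-t²) := by rw [xj, wl]; push_cast; ring
  simp only [e, Br] at bf bk
  have sp : ∀ f : ℝ → ℝ, IntegrableOn f (Ioi 0) → ∫ y in Ioi 0, f y = (∫ y in Ioc 0 (√B), f y) + ∫ y in Ioi (√B), f y := fun f hf => by
    rw [← Ioc_union_Ioi_eq_Ioi ao.le, setIntegral_union (Ioc_disjoint_Ioi zu) qh (hf.mono_set Ioc_subset_Ioi_self) (hf.mono_set (Ioi_subset_Ioi ao.le))]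
  rw [← bk, sp _ bf]
  have hsub : Ioi (√B) ⊆ Ioi 0 := Ioi_subset_Ioi ao.le
  split_ifs with h
  · have : ∫ y in Ioi (√B), Ag δ K y*Ac (-t²) y ≤ 0 := setIntegral_nonpos qh fun y hy => by
      have yt : t < y := xq h hy
      have y0 : 0 < y := ht.trans yt
      refine mul_nonpos_of_nonneg_of_nonpos (Bm hδ K y) ?_
      have : t²/y² < 1 := by rw [uw qp]; nlinarith
      have : 0 < t²/y² := qp
      rw [Ac, vm]; exact log_nonpos (zr _) (by rw [qt ql]; linarith)
    linarith
  · have aa := wv (bf.mono_set hsub) (((Cj hδ K).mono_set hsub).mul_const (log (1+t²))) qh fun y hy => by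
      refine qq ?_ (Bm hδ K y)
      have eo : 1 < y := bn.trans hy
      rcases eq_or_ne (1 + -t²/y²) 0 with h | h
      · rw [Ac, h, abs_zero, log_zero]; exact log_nonneg (by nlinarith)
      · refine zv (abs_pos.2 h) ?_
        have : t²/y² ≤ t² := div_le_self qp (by nlinarith)
        have : 0 ≤ t²/y² := qp
        rw [vm, zq]; constructor <;> linarith
    rw [integral_mul_const] at aa
    have ad := sp _ (Cj hδ K)
    rw [qw ao.le] at hl
    have ag : (∫ y in Ioi (√B), Ag δ K y)*log (1+t²) ≤ 1*log (1+t²) := qb ql (log_nonneg (by nlinarith))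
    linarith
theorem Jj {p : ℕ} (hB : 1 ≤ B) (hb : Λ = γ*B^b/b) (hγ : 0 < γ) (cy : 0 < b) (hp : b ≤ p) (hq : 1 ≤ q) (hc : c = q*(γ/b+1)) (ht : 0 < t) (htB : B ≤ t^4) (hk : k = Λ*q) :
    exp π*(B*k)^3*(1+4*k²*t²)²*(1+t²) ≤ exp π*(50*c^7)*t^(28*p+18) := by
  have bp : 1 ≤ t := by
    by_contra h
    have : t^4 < 1 := pow_lt_one₀ ht.le (not_le.1 h) qn
    linarith
  have ai : 0 < B := ql
  have aj : B^b ≤ t^(4*p) := by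
    calc B^b ≤ B^(p:ℝ) := rpow_le_rpow_of_exponent_le hB hp
      _ = B^p := vd _ _
      _ ≤ (t^4)^p := by gcongr
      _ = t^(4*p) := by rw [← pow_mul]
  have d : 0 < γ/b := qp
  have az : 1 ≤ c := by rw [hc]; nlinarith
  have dn : 0 < k := by rw [hk, hb]; positivity
  have kc : k ≤ c*t^(4*p) := by
    rw [hk, hb, hc]
    calc γ*B^b/b*q = q*(γ/b)*B^b := by ring
      _ ≤ q*(γ/b+1)*t^(4*p) := by gcongr; linarith
  have kz : 1 ≤ t^(4*p) := one_le_pow₀ bp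
  have bh : 1 ≤ t² := one_le_pow₀ bp
  calc exp π*(B*k)^3*(1+4*k²*t²)²*(1+t²) ≤ exp π*(t^4*(c*t^(4*p)))^3*(5*(c*t^(4*p))²*t²)²*(2*t²) := by
        gcongr
        · have : 1 ≤ (c*t^(4*p))²*t² := zi (one_le_pow₀ (zi az kz)) bh
          have : k²*t² ≤ (c*t^(4*p))²*t² := by gcongr
          linarith
        · linarith
    _ = exp π*(50*c^7)*t^(28*p+18) := by
        rw [show 28*p+18 = 4*p*7+18 by ring, pow_add, pow_mul]; ring
structure HtP (β δ : ℝ) (K : ℕ) (D : ℝ) (κ : ℕ) (ε B : ℝ) (n : ℕ) (y : ℕ → ℝ) : Prop where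
  d : (n:ℝ) ≤ Af β*B^xk β/(4*β)
  p : ∀ j < n, 0 < y j
  a : ∀ t > 0, t^4 ≤ B → ∏ j ∈ rg n, |1-t²/(y j)²| ≤ (1+ε)*(exp (t^xk β/2)*exp (-Ap δ K (t*jj)))*|cos (π*∫ s in oo..t, Al β δ K B s)|
  b : (1-ε)/2*exp (Af β*Az xk β B-Ap δ K 1) ≤ ∏ j ∈ rg n, (1+1/(y j)²)
  c : ∑ j ∈ rg n, Am (y j) ≤ (1+ε)*Ad β B/4
  e : ∀ t > 0, B ≤ t^4 → ∏ j ∈ rg n, |1-t²/(y j)²| ≤ D*t^κ*(exp (t^xk β/2)*exp (-Ap δ K (t*jj)))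
set_option maxHeartbeats 2000000 in
theorem Jk (hβ : xx < β) : ∃ D : ℝ, ∃ κ : ℕ, ∀ δ > 0, ∀ K : ℕ, ∀ ε > 0, ∀ᶠ B in atTop, ∃ n y, HtP β δ K D κ ε B n y := by
  have cy : 0 < 2*β-1 := ql
  obtain ⟨p, hp⟩ := exists_nat_ge xm β
  set q := xm β/π*Ci β+1 with hq
  have dd : 1 ≤ q := by
    have h := Bs hβ one_pos (y := 0) ⟨zu, one_pos⟩
    have := h.1.trans h.2
    rw [wx] at this
    have := nonneg_of_mul_nonneg_right this (Av hβ one_pos)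
    linarith
  refine ⟨exp π*(50*(q*(Af β/xm β+1))^7), 28*p+18, fun δ hδ K ε hε => ?_⟩
  have κ0 : 0 < log (1+ε) := log_pos ql
  set κ := log (1+ε) with hκ
  have ao : Tendsto (fun B : ℝ => √B) atTop atTop := tendsto_sqrt_atTop
  have db := Fh hβ Cs.1
  rw [Cs.2, show 1/π*(π/4) = 1/4 by field_simp] at db
  filter_upwards [Jf hβ hδ K (η := min (κ/56) (1/4)) qp, Ji hδ K, ao.eventually_ge_atTop 1000, (ao.atTop_mul_const κ0).eventually_ge_atTop 1000, qr 1,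
    db.eventually (vv (by linarith : 1/4 < 1/4+ε/8)), (Bf hβ).eventually_ge_atTop 1, ((Bf hβ).atTop_mul_const hε).eventually_ge_atTop 8] with B ⟨Y, y, n, m, V, v, S, H, hv, hb, hY, ma, hm, hd⟩ hsL hs hsκ dq hdb la mc
  have ai : 0 < B := ql
  have sq := sq_sqrt ai.le
  set r := √B with hr
  set Λ := Ad β B with hΛ
  have P := zp
  have au : 0 < r := ql
  have sB : r < B := by nlinarith only [sq, hs]
  have mf := hv.trans (min_le_left _ _)
  have lb := hv.trans (min_le_right _ _)
  have ax : oo < m := zl qp hm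
  have um : ∀ u t : ℝ, 0 ≤ u → u ≤ 2*Λ/π*t → 0 < t → t² ≤ r → u²/m² ≤ 64/r := fun u t ah aa al ad => by
    have a : u ≤ 8*t/r*m := by
      refine aa.trans ?_
      calc 2*Λ/π*t = 8*t/r*(Λ*r/(4*π)) := by field_simp; norm_num
        _ ≤ _ := by gcongr
    rw [qc qp]
    calc u² ≤ (8*t/r*m)² := by gcongr
      _ = 64*(t²)/r²*m² := by ring
      _ ≤ 64*r/r²*m² := by gcongr
      _ = _ := by field_simp
  have er : 64/r ≤ κ*(64/1000) := by rw [qc au]; linarith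
  have lc : 64/r ≤ 64/1000 := by gcongr
  have hum : ∀ x : ℝ, x²/m² ≤ 64/r → 2*x² ≤ m² := fun x w => by
    rw [qc qp] at w
    linarith [qb lc (zd (m:ℝ)), zd (m:ℝ)]
  have eY : ∀ t : ℝ, t² ≤ r → t²/(Y m)² ≤ 4/r := fun t h => by
    calc t²/(Y m)² ≤ r/xh r² := by gcongr
      _ = 4/r := by field_simp; norm_num
  have bq : 4/r ≤ κ*(4/1000) := by rw [qc au]; linarith
  have ah : ∀ t > 0, IntervalIntegrable (fun s => Al β δ K B s*Ac (-t²) s) volume 0 B ∧ ∫ s in oo..B, Al β δ K B s*Ac (-t²) s ≤ t^xk β/2+(-Ap δ K (t*jj) + if t ≤ r then 0 else log (1+t²)) := fun t ht => by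
    have aa := (Ds hδ K (v := t*jj) (by simp)).1
    rw [show ((t:ℂ)*jj)² = xc (-t²) by rw [xj, wl]; push_cast; ring] at aa
    simp only [Br] at aa
    obtain ⟨a, b, -⟩ := Es (B := B) hβ ht
    obtain ⟨i, j⟩ := Cu hβ hδ K dq a aa
    refine ⟨i, ?_⟩
    rw [j]; linarith [hsL t ht]
  refine ⟨n, y, hd, fun j hj => (S.t j hj).2, fun t al ej => ?_, ?_, ?_, fun t al ej => ?_⟩
  · obtain ⟨i, j⟩ := ah t al
    have bh : t² ≤ r := by
      rw [hr]; refine le_sqrt_of_sq_le (by rw [← pow_mul]; exact ej)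
    have tr : 4*t ≤ r := by nlinarith only [bh, hs, al]
    rw [if_pos ql, vu] at j
    set u := ∫ s in oo..t, Al β δ K B s with hu
    have hu' : ∫ s in oo..t, Al β δ K B (min |s| r) = u := uq fun s hs => by
      rw [uIcc_of_le al.le] at hs
      simp only [abs_of_nonneg hs.1, min_eq_left (by linarith [hs.2] : s ≤ r)]
    by_cases hz : ∃ j < n, y j = t
    · obtain ⟨j, hj, rfl⟩ := hz
      rw [Finset.prod_eq_zero ((wf).2 hj) (by rw [div_self qp]; simp)]; positivity
    push Not at hz
    have ii : ∀ a b, IntervalIntegrable (fun s => Al β δ K B (min |s| r)) volume a b := fun a b => H.c.intervalIntegrable a b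
    have ib : 0 ≤ u := by rw [← hu']; exact intervalIntegral.integral_nonneg al.le fun s _ => H.p.le.trans (H.mb s)
    have ld : u ≤ 2*Λ/π*t := by
      rw [← hu']
      refine (ug al.le (ii _ _) intervalIntegrable_const fun s _ => hb s).trans ?_
      rw [intervalIntegral.integral_const, qo]; linarith
    have w := um u t ib ld al bh
    obtain ⟨cd, az⟩ := Jc S H al ql (fun j hj => hz j (hj.trans_le S.mn)) hu' (hum u w) i
    have ay := ((zq).1 az).2
    have aj := eY t bh
    have pz : ∀ j ∈ rg n, |1-t²/(y j)²| ≠ 0 := fun j hj => by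
      have hj := (wf).1 hj
      have yp := (S.t j hj).2
      rw [abs_ne_zero]; intro h
      have : (y j-t)*(y j+t) = 0 := by field_simp at h; linarith
      rcases mul_eq_zero.1 this with h | h
      · exact hz j hj ql
      · linarith
    have hlog : log (∏ j ∈ rg n, |1-t²/(y j)²|) ≤ κ+(t^xk β/2+(-Ap δ K (t*jj)))+log (|cos (π*u)|) := by
      rw [log_prod pz]
      have : ∑ j ∈ rg n, log (|1-t²/(y j)²|) = ∑ j ∈ rg n, Ac (-t²) (y j) := zy rfl fun j _ => by rw [Ac, vm, sub_eq_add_neg]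
      rw [this]
      have ak : 2*u²/m² = 2*(u²/m²) := by ring
      have be : 2*t²/(Y m)² = 2*(t²/(Y m)²) := by ring
      rw [ak, be] at ay
      linarith
    have pp : 0 < ∏ j ∈ rg n, |1-t²/(y j)²| := Finset.prod_pos fun j hj => (zr _).lt_of_ne' (pz j hj)
    rw [log_le_iff_le_exp pp, zn, zn, zn, xn ql, xn (abs_pos.2 cd)] at hlog
    exact hlog
  · obtain ⟨bf, -⟩ := Cc (B := B) hβ one_pos
    rw [one_pow] at bf
    have bk := En hβ ai
    obtain ⟨bg, bo⟩ := Ds hδ K (v := 1) (by simp)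
    rw [one_pow, ← Complex.ofReal_one] at bg bo
    simp only [Br] at bg bo
    obtain ⟨i, j⟩ := Cu hβ hδ K dq bf bg
    have fm : ∫ y in Ioc 0 r, Ag δ K y*Ac 1 y ≤ Ap δ K 1 := by
      rw [Complex.ofReal_one] at bo
      rw [← bo]
      exact setIntegral_mono_set bg (qg fun y => zo (Bm hδ K y) (Bp xp _)) (qg fun y hy => hy.1)
    have tb : 0 ≤ Al β δ K B (min |oo| r) := H.p.le.trans (H.mb 0)
    have w := um _ 1 tb (by linarith [hb 0]) one_pos ql
    have c := Je S H ql lb (hum _ w) i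
    beta_reduce at c
    set a := Al β δ K B (min |oo| r) with ha
    have ay := ((zq).1 c).1
    have aj := eY 1 ql
    have pp : 0 < ∏ j ∈ rg n, (1+1/(y j)²) := Finset.prod_pos fun j hj => qp
    have hc : π*a-log 2 ≤ log (cosh (π*a)) := by
      rw [le_log_iff_exp_le (cosh_pos _), exp_sub, xn two_pos, cosh_eq]; linarith [xz (-(π*a))]
    have ak : 2*a²/m² = 2*(a²/m²) := by ring
    have be : 2/(Y m)² = 2*(1²/(Y m)²) := by ring
    rw [ak, be] at ay
    have hlog : -κ-log 2+(Af β*Az xk β B-Ap δ K 1) ≤ log (∏ j ∈ rg n, (1+1/(y j)²)) := by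
      rw [log_prod fun j hj => qp]
      have : ∑ j ∈ rg n, log (1+1/(y j)²) = ∑ j ∈ rg n, Ac 1 (y j) := zy rfl fun j _ => by rw [Ac, qt qp]
      rw [this]; linarith
    rw [le_log_iff_exp_le pp, zn, exp_sub, xn two_pos, exp_neg, xn ql] at hlog
    refine wh ?_ hlog
    have : 1-ε ≤ (1+ε)⁻¹ := by rw [← one_div, zt ql]; nlinarith only [hε]
    gcongr
  · have mb : Measurable Am := by unfold Am; fun_prop
    have bb : ∀ y, ‖Am y‖ ≤ 1/4 := fun y => by rw [qy, abs_of_nonneg (Bl y).1]; exact (Bl y).2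
    obtain ⟨i, j⟩ := Cu hβ hδ K dq ((Bd hβ ai).1.mul_bdd mb.aestronglyMeasurable (qg bb)) ((Cj hδ K).mul_bdd mb.aestronglyMeasurable (qg bb))
    have mo : ∀ a b : ℝ, 0 ≤ a → a ≤ b → -(1/(1+a²)) ≤ -(1/(1+b²)) := fun a b h h' => by
      rw [neg_le_neg_iff]; gcongr
    have c := (Dv S (Nat.zero_le n) (g := Am) (U := fun y => -(1/(1+y²))) (G := 0) i (fun a ha b hb h => mo a b ((S.YB 0).1.trans ha.1) h) (fun a b ha _ h _ => by
      have e : ∀ y : ℝ, Am y = 1/(1+y²)-(1/(1+y²))² := fun y => by unfold Am; field_simp; ring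
      have := mo a b ha.le h
      have w : ∀ y : ℝ, 0 < 1/(1+y²) ∧ 1/(1+y²) ≤ 1 := fun y => ⟨qp, by rw [xl qp]; linarith [zd y]⟩
      have wa := w a
      have wb := w b
      rw [e, e, zq]
      generalize 1/(1+a²) = x at *
      generalize 1/(1+b²) = z at *
      constructor <;> nlinarith only [this, wa.1, wa.2, wb.1, wb.2]) fun t _ => by simpa using (Bl t).1).1
    simp only [S.Y0, Nat.sub_zero, vb, max_self] at c
    rw [j] at c
    have az : 0 ≤ ∫ y in Ioc 0 r, Ag δ K y*Am y := integral_nonneg fun y => zo (Bm hδ K y) (Bl y).1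
    have ay : 0 < 1/(1+B²) := qp
    rw [div_lt_iff₀ ql] at hdb
    norm_num at c
    rw [one_div] at ay
    linarith
  · obtain ⟨i, j⟩ := ah t al
    have ey : 0 < Λ*q := qp
    have c := Jh S (M := Λ*q) (fun s hs => by
      have aa := (Bs hβ ai (y := s) ⟨hs.1.le, hs.2⟩).2
      have ad : Al β δ K B s ≤ Ae β B s := by
        unfold Al; split_ifs
        · linarith [Bm hδ K s]
        · linarith
      rw [hq, mul_add, ← wx]; linarith) ey ai (zi dq.le (zi la dd)) al i
    have fu : 0 ≤ log (1+t²) := log_nonneg (by linarith [zd t])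
    have hj : exp (∫ s in oo..B, Al β δ K B s*Ac (-t²) s) ≤ (1+t²)*(exp (t^xk β/2)*exp (-Ap δ K (t*jj))) := by
      rw [← zn]
      nth_rewrite 1 [← xn (by positivity : 0 < 1+t²)]
      rw [← zn]; refine (wp).2 (j.trans ?_)
      split_ifs <;> linarith
    refine c.trans ((qq hj qp).trans ?_)
    rw [← wx]
    exact qb (Jj dq.le rfl (Bo hβ) cy hp dd rfl al ej rfl) qp
theorem Fr (hδ : 0 < δ) (K : ℕ) : Continuous (fun t : ℝ => exp (-Ap δ K (t*jj))²) ∧ ∀ t : ℝ, t > 0 → t*exp (-Ap δ K (t*jj))² ≤ δ*(1+t²)⁻¹ ∧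
    t^(2*K)*(t*exp (-Ap δ K (t*jj))²) ≤ δ/δ^(2*K)*(1+t²)⁻¹ := by
  have re : ∀ t c : ℝ, (1+(t:ℂ)*jj/(c:ℂ)).re = 1 ∧ (1+(t:ℂ)*jj/(c:ℂ)).im = t/c := fun t c => by
    rw [show 1+(t:ℂ)*jj/(c:ℂ) = xc (1)+xc (t/c)*jj by push_cast; ring]; simp
  have p : ∀ t c : ℝ, 1 ≤ ‖1+(t:ℂ)*jj/(c:ℂ)‖ := fun t c => (re t c).1.symm.trans_le (zw _)
  have cn : ∀ c : ℝ, Continuous fun t : ℝ => log ‖1+(t:ℂ)*jj/(c:ℂ)‖ := fun c => Continuous.log qf fun t => by linarith [p t c]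
  refine ⟨?_, fun t ht => ?_⟩
  · have az := cn δ
    have ay := cn 1
    have ca := cn δ⁻¹
    unfold Ap
    exact (((az.const_mul _).add ay).add (ca.const_mul _)).neg.rexp.pow 2
  have bf : t/δ ≤ ‖1+(t:ℂ)*jj/(δ:ℂ)‖ := (re t δ).2.symm.trans_le (Complex.im_le_norm _)
  have bg : ‖1+(t:ℂ)*jj/xc (1)‖² = 1+t² := by
    rw [wm, Complex.normSq_apply, (re t 1).1, (re t 1).2]; ring
  have az : t*δ ≤ ‖1+(t:ℂ)*jj/xc (δ⁻¹)‖ := by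
    have := (re t δ⁻¹).2.symm.trans_le (Complex.im_le_norm _); rwa [div_inv_eq_mul] at this
  have pa := p t δ
  have pb := p t 1
  have pc := p t δ⁻¹
  unfold Ap
  set a := ‖1+(t:ℂ)*jj/(δ:ℂ)‖
  set b := ‖1+(t:ℂ)*jj/xc (1)‖
  set c := ‖1+(t:ℂ)*jj/xc (δ⁻¹)‖
  have e : exp (-(xx*log a+log b+K*log c))² = a⁻¹*(1+t²)⁻¹*(c^(2*K))⁻¹ := by
    rw [← uz, show ((2:ℕ):ℝ)*(-(xx*log a+log b+K*log c)) = -log a + -log (b²) + -log (c^(2*K)) by rw [log_pow, log_pow]; push_cast; ring,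
      zn, zn, exp_neg, exp_neg, exp_neg, xn qp, xn qp, xn qp, bg]
  have ta : t*a⁻¹ ≤ δ := by
    rw [← wd, qc qp]; rw [qc hδ] at bf; linarith
  have cd : 0 < t² := qp
  rw [e]
  constructor
  · calc t*(a⁻¹*(1+t²)⁻¹*(c^(2*K))⁻¹) = (t*a⁻¹)*(1+t²)⁻¹*(c^(2*K))⁻¹ := by ring
      _ ≤ δ*(1+t²)⁻¹*1 := by gcongr; exact inv_le_one_of_one_le₀ (one_le_pow₀ pc)
      _ = _ := zb _
  · have : (c^(2*K))⁻¹ ≤ ((t*δ)^(2*K))⁻¹ := by gcongr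
    calc t^(2*K)*(t*(a⁻¹*(1+t²)⁻¹*(c^(2*K))⁻¹)) = t^(2*K)*(t*a⁻¹)*(1+t²)⁻¹*(c^(2*K))⁻¹ := by ring
      _ ≤ t^(2*K)*δ*(1+t²)⁻¹*((t*δ)^(2*K))⁻¹ := by gcongr
      _ = _ := by rw [xj]; field_simp
theorem Jl (hβ : xx < β) (hδ : 0 < δ) (K : ℕ) (ht : 0 ≤ t) (htB : t ≤ √B) (hB : 1 ≤ B) : ∫ s in oo..t, Al β δ K B s = Au β B t - ∫ s in oo..t, Ag δ K s := by
  have ai : 0 < B := ql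
  have sB : √B ≤ B := by rw [sqrt_le_left ai.le]; nlinarith
  have i : IntervalIntegrable (Ae β B) volume 0 t := by
    rw [qm ht]
    exact (Bd hβ ai).1.mono_set (Ioo_subset_Ioo_right (htB.trans sB))
  rw [Au, ← qj, ← qw ht, ← vo i ((Dt hδ K).intervalIntegrable _ _)]
  refine uq fun s hs => ?_
  rw [uIcc_of_le ht] at hs
  simp only [Al, if_pos (hs.2.trans htB)]
theorem Jm (hβ : xx < β) (hδ : 0 < δ) (K : ℕ) {Bn : ℕ → ℝ} (hB : Tendsto Bn atTop atTop) (bl : ∀ i, 0 < Bn i) : ∃ A e : ℕ → ℝ → ℂ,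
    (∀ i, IntegrableOn (fun t => A i t*e i t) (Ioi 0)) ∧ Tt (fun i => ∫ t in Ioi 0, A i t*e i t) 0 ∧ (∀ i t, Bn i < t^4 → A i t = 0) ∧
    ∀ i t, 1 ≤ Bn i → 0 < t → t^4 ≤ Bn i → (A i t*e i t).re = t*exp (-Ap δ K (t*jj))²*cos (2*(π*∫ s in oo..t, Al β δ K (Bn i) s)) := by
  obtain ⟨wc, wb⟩ := Fr hδ K
  have ig : IntegrableOn (fun t : ℝ => δ*(1+t²)⁻¹) (Ioi 0) := (un δ).integrableOn
  set e : ℕ → ℝ → ℂ := fun i t => qe ((2*π*(Au β (Bn i) (Bn i*sin (arcsin (t/Bn i))) - ∫ s in oo..t, Ag δ K s):ℝ)*jj) with he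
  have cs : Continuous fun t => ∫ s in oo..t, Ag δ K s := intervalIntegral.continuous_primitive (fun a b => (Dt hδ K).intervalIntegrable a b) 0
  set A : ℕ → ℝ → ℂ := fun i => {t : ℝ | t^4 ≤ Bn i}.indicator fun t => xc (t*exp (-Ap δ K (t*jj))²) with hA
  have mA : ∀ i, Measurable (A i) := fun i => Measurable.indicator (Complex.continuous_ofReal.comp (continuous_id.mul wc)).measurable (measurableSet_le qf measurable_const)
  have me : ∀ i, Measurable (e i) := fun i => by
    have h := (Dp hβ (bl i)).comp (show Measurable fun t => 2*arcsin (t/Bn i) by fun_prop)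
    have h' : Measurable fun t => Au β (Bn i) (Bn i*sin (arcsin (t/Bn i))) := by
      convert h using 2 with t; simp only [Function.comp]; congr 3; ring
    have := cs.measurable
    simp only [he]; fun_prop
  have bA : ∀ i, ∀ t > 0, ‖A i t‖ ≤ δ*(1+t²)⁻¹ := fun i t ht => by
    refine (norm_indicator_le_norm_self _ _).trans ?_
    rw [qu, qd qp]; exact (wb t ht).1
  have ne : ∀ i t, ‖e i t‖ = 1 := fun i t => vq _
  have sn : ∀ i t, 0 ≤ t → t ≤ Bn i → Bn i*sin (arcsin (t/Bn i)) = t := fun i t ah h => by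
    have b := bl i
    rw [sin_arcsin (by have : 0 ≤ t/Bn i := qp; linarith) ((xl b).2 h)]; field_simp
  refine ⟨A, e, fun i => ?_, ?_, fun i t h => indicator_of_notMem (by simpa using h) _, fun i t aa ht h => ?_⟩
  · refine ig.mono' ((mA i).mul (me i)).aestronglyMeasurable ?_
    filter_upwards [qx qh] with t ht
    rw [qk, ne, zb]; exact bA i t ht
  · have cz : Tt (fun i => π/2/Ad β (Bn i)) 0 := xw ((Bf hβ).comp hB)
    refine Eu (am := fun t => xc (t*exp (-Ap δ K (t*jj))²)) (g := fun t => δ*(1+t²)⁻¹) (h := fun i => π/2/Ad β (Bn i)) (fun t ht => ?_) mA (qg bA) ig (fun a ha b hb h => ?_)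
      (Complex.continuous_ofReal.comp (continuous_id.mul wc)).continuousOn me (fun i t => (ne i t).le) (fun i => uj qp (Av hβ (bl i))) cz (fun t ht => ?_)
    · refine xa (?_ : ∀ᶠ i in atTop, _ = A i t)
      filter_upwards [hB.eventually_ge_atTop (t^4)] with i hi
      simp only [hA]; rw [indicator_of_mem (by exact hi)]
    · have : oo < a := ha
      simp only; gcongr
    · have al : 0 < t := ht
      have ev : ∀ᶠ i in atTop, π/2/Ad β (Bn i) < 1 ∧ (t+1)² < Bn i := (cz.eventually (vv one_pos)).and (hB.eventually_gt_atTop _)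
      have hp : ∀ i, 0 < π/2/Ad β (Bn i) := fun i => uj qp (Av hβ (bl i))
      apply Fl
      have aa := Fk hβ hB (a := fun i => t) (b := fun i => t+π/2/Ad β (Bn i)) (by
        filter_upwards [ev] with i ⟨aq, av⟩
        exact ⟨al.le, by linarith [hp i], le_sqrt_of_sq_le (by nlinarith [hp i])⟩) (by
        refine tendsto_const_nhds.congr fun i => ?_
        have := (Av hβ (bl i)).ne'
        field_simp; ring)
      have ad : Tt (fun i => (∫ s in oo..(t+π/2/Ad β (Bn i)), Ag δ K s) - ∫ s in oo..t, Ag δ K s) 0 := by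
        have := ((cs.tendsto (t+0)).comp (cz.const_add t)).sub_const (∫ s in oo..t, Ag δ K s)
        simpa [Function.comp_def] using this
      have ag := aa.sub ad
      rw [ze] at ag
      refine ag.congr' ?_
      filter_upwards [ev] with i ⟨aq, av⟩
      rw [sn i t al.le (by nlinarith), sn i _ (by linarith [hp i]) (by nlinarith [hp i])]; ring
  · have hs : t ≤ √(Bn i) := by
      refine le_sqrt_of_sq_le ?_
      by_contra hc
      nlinarith [zd t]
    have sB : √(Bn i) ≤ Bn i := by rw [sqrt_le_left (bl i).le]; nlinarith
    have q : A i t = xc (t*exp (-Ap δ K (t*jj))²) := indicator_of_mem (by exact h) _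
    rw [q, uu, he]
    simp only
    rw [zg, sn i t ht.le (hs.trans sB), Jl hβ hδ K ht.le hs aa]
    congr 2; ring
theorem Jn {κ : ℕ} (hβ : xx < β) (hδ : 0 < δ) (hε : 0 < ε) {Bn : ℕ → ℝ} (hB : Tendsto Bn atTop atTop) (bl : ∀ i, 0 < Bn i) :
    ∀ᶠ i in atTop, ∀ n y, HtP β δ κ D κ ε (Bn i) n y → ∫ x in Ioi 0, (∏ j ∈ rg n, (1-x/(y j)²))²*exp (-(x^β)) ≤ (1+ε)^3*(δ*π/2) := by
  obtain ⟨A, e, ie, le, am, dk⟩ := Jm hβ hδ κ hB bl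
  obtain ⟨wc, wb⟩ := Fr hδ κ
  have ii : IntegrableOn (fun t : ℝ => (1+t²)⁻¹) (Ioi 0) := integrable_inv_one_add_sq.integrableOn
  have is : ∀ i, MeasurableSet {t : ℝ | Bn i < t^4} := fun i => measurableSet_lt measurable_const qf
  have tl : Tt (fun i => ∫ t in Ioi 0, {t : ℝ | Bn i < t^4}.indicator (fun t => (1+t²)⁻¹) t) (∫ t in Ioi oo, oo) := by
    refine tendsto_integral_of_dominated_convergence (fun t => (1+t²)⁻¹) (fun i => (ii.indicator (is i)).aestronglyMeasurable) ii (fun i => qg fun t => ?_) (qg fun t => ?_)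
    · refine (norm_indicator_le_norm_self _ _).trans ?_
      rw [qd qp]
    · refine xa ?_
      filter_upwards [hB.eventually_ge_atTop (t^4)] with i hi
      rw [indicator_of_notMem (by simpa using hi)]
  rw [integral_zero] at tl
  have iw : IntegrableOn (fun t : ℝ => t*exp (-Ap δ κ (t*jj))²) (Ioi 0) := by
    refine (ii.const_mul δ).mono' (continuous_id.mul wc).aestronglyMeasurable ?_
    filter_upwards [qx qh] with t ht
    have : 0 < t := ht
    rw [qd qp]; exact (wb t ht).1
  have wi : ∫ t : ℝ in Ioi 0, t*exp (-Ap δ κ (t*jj))² ≤ δ*xh π := by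
    have := wv iw (ii.const_mul δ) qh fun t ht => (wb t ht).1
    rwa [qv, integral_Ioi_inv_one_add_sq, arctan_zero, ze] at this
  have ip := tl.const_mul (2*D²*(δ/δ^(2*κ)))
  have iq := (Complex.continuous_re.tendsto _).comp le
  rw [xo] at ip
  rw [Complex.zero_re] at iq
  have P := zp
  have fv : 0 < ε*(δ*π/2)/2 := qp
  filter_upwards [ip.eventually (vv fv), iq.eventually (vv fv), hB.eventually_ge_atTop 1] with i aa ad dq n y H
  simp only [Function.comp] at ad
  have sub := integral_comp_rpow_Ioi_of_pos (g := fun x => (∏ j ∈ rg n, (1-x/(y j)²))²*exp (-(x^β))) (p := 2) two_pos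
  rw [← sub]
  have ir : IntegrableOn (fun t => (A i t*e i t).re) (Ioi 0) := (ie i).re
  have iG := ((iw.fun_add ir).const_mul ((1+ε)²)).fun_add ((ii.indicator (is i)).const_mul (2*D²*(δ/δ^(2*κ))))
  have mh : 0 ≤ δ/δ^(2*κ) := qp
  have main := integral_mono_of_nonneg (μ := volume.restrict (Ioi oo)) (f := fun t => (2*t^((2:ℝ)-1)) • ((∏ j ∈ rg n, (1-t^(2:ℝ)/(y j)²))²*exp (-((t^(2:ℝ))^β)))) (by
    filter_upwards [qx qh] with t ht
    have : 0 < t := ht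
    simp only [Pi.zero_apply, qo]; positivity) iG (by
    filter_upwards [qx qh] with t ht
    have al : 0 < t := ht
    simp only [qo]
    rw [show (2:ℝ)-1 = 1 by norm_num, rpow_one, ← vf al.le, rpow_two]
    have Ee : exp (t^xk β/2)²*exp (-t^xk β) = 1 := by rw [← uz, ← zn, ← exp_zero]; congr 1; push_cast; ring
    have wt := (wb t al).2
    have Ha := H.a t al
    have He := H.e t al
    have dk := dk i t dq al
    rw [← Finset.abs_prod] at Ha He
    set E := exp (t^xk β/2)
    set w := exp (-Ap δ κ (t*jj))
    set q := ∏ j ∈ rg n, (1-t²/(y j)²)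
    have eg : 0 ≤ t*w² := qp
    rcases vw (t^4) (Bn i) with h | h
    · rw [indicator_of_notMem (by simpa using h), dk h, cos_two_mul, xo, vu]
      set c := cos (π*∫ s in oo..t, Al β δ κ (Bn i) s)
      have ag : q² ≤ ((1+ε)*(E*w)*|c|)² := by
        rw [← sq_abs q]; exact pow_le_pow_left₀ (zr _) (Ha h) 2
      calc 2*t*(q²*exp (-t^xk β)) ≤ 2*t*(((1+ε)*(E*w)*|c|)²*exp (-t^xk β)) := by gcongr
        _ = 2*t*(1+ε)²*w²*|c|²*(E²*exp (-t^xk β)) := by ring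
        _ = _ := by rw [Ee, sq_abs]; ring
    · rw [indicator_of_mem (by exact h), am i t h, zero_mul, Complex.zero_re, vu]
      have ag : q² ≤ (D*t^κ*(E*w))² := by
        rw [← sq_abs q]; exact pow_le_pow_left₀ (zr _) (He h.le) 2
      calc 2*t*(q²*exp (-t^xk β)) ≤ 2*t*((D*t^κ*(E*w))²*exp (-t^xk β)) := by gcongr
        _ = 2*D²*(t^(2*κ)*(t*w²))*(E²*exp (-t^xk β)) := by ring
        _ = 2*D²*(t^(2*κ)*(t*w²)) := by rw [Ee, zb]
        _ ≤ 2*D²*(δ/δ^(2*κ)*(1+t²)⁻¹) := by gcongr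
        _ ≤ _ := by
          have : 0 ≤ (1+ε)²*(t*w²) := qp
          linarith)
  refine main.trans ?_
  have ire : ∫ t in Ioi 0, (A i t*e i t).re = (∫ t in Ioi 0, A i t*e i t).re := integral_re (ie i)
  rw [wo ((iw.fun_add ir).const_mul ((1+ε)²)) ((ii.indicator (is i)).const_mul (2*D²*(δ/δ^(2*κ)))), qv, qv, wo iw ir, ire]
  have : (1+ε)²*((∫ t : ℝ in Ioi 0, t*exp (-Ap δ κ (t*jj))²)+(∫ t in Ioi 0, A i t*e i t).re) ≤ (1+ε)²*(δ*xh π+ε*(δ*π/2)/2) := by gcongr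
  have : ε*(δ*π/2)/2 ≤ (1+ε)²*(ε*(δ*π/2)/2) := le_mul_of_one_le_left fv.le (one_le_pow₀ ql)
  linarith
theorem Jo (hr : 0 < r) (hε : 0 < ε) : ∀ᶠ a in atTop, (1-ε)*√(π/a) ≤ ∫ ϑ in (-r)..r, exp (-(a*ϑ²)) := by
  have aa : Tendsto (fun a : ℝ => √a*r) atTop atTop := tendsto_sqrt_atTop.atTop_mul_const hr
  have h := intervalIntegral_tendsto_integral (ub one_pos) (tendsto_neg_atTop_atBot.comp aa) aa
  rw [integral_gaussian, div_one] at h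
  have ao : 0 < √π := sqrt_pos.2 zp
  filter_upwards [h.eventually (lt_mem_nhds (by nlinarith : (1-ε)*√π < √π)), qr 0] with a ha dz
  have sa : 0 < √a := sqrt_pos.2 dz
  have e : ∀ ϑ : ℝ, exp (-(a*ϑ²)) = exp (-1*(√a*ϑ)²) := fun ϑ => by rw [xj, sq_sqrt dz.le]; congr 1; ring
  simp_rw [e]
  rw [intervalIntegral.integral_comp_mul_left (fun u => exp (-1*u²)) sa.ne', qo, sqrt_div zx, mul_neg, inv_mul_eq_div, ← wu]
  simp only [Function.comp] at ha
  gcongr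
theorem Jp {K κ : ℕ} (hβ : xx < β) (hε : 0 < ε) (fw : ε < 1) : ∀ᶠ B in atTop, ∀ n y, HtP β δ K D κ ε B n y → ∀ c N, (∀ z, An c N z = ∏ j ∈ rg n, (1-z/(y j:ℂ)²)) →
    (1-ε)/(1+ε)*√(π/Ad β B)*(∏ j ∈ rg n, (1+1/(y j)²))² ≤ π*∑ k ∈ rg (N+1), c k² := by
  set r := √xh ε with hr
  have au : 0 < r := qp
  have fc : r² = ε/2 := sq_sqrt qp
  have P := vz
  have di : r < 1 := by nlinarith
  have at' : Tendsto (fun B => (1+ε)²*Ad β B) atTop atTop := (Bf hβ).const_mul_atTop qp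
  filter_upwards [at'.eventually (Jo au hε), qr 0] with B hg ai n y H c N hc
  have br := Av hβ ai
  rw [← Fn]
  set S := ∏ j ∈ rg n, (1+1/(y j)²)
  have e : ∀ ϑ : ℝ, ‖An c N (-cis ϑ²)‖² = S²*∏ j ∈ rg n, (1-4*sin ϑ²*Am (y j)) := fun ϑ => by
    rw [hc, norm_prod, ← Finset.prod_pow, ← Finset.prod_pow, ← Finset.prod_mul_distrib]
    refine Finset.prod_congr rfl fun j hj => ?_
    rw [vm, sub_neg_eq_add, Fi (H.p j ((wf).1 hj))]
  have ct : Continuous fun ϑ : ℝ => ‖An c N (-cis ϑ²)‖² := by unfold An; fun_prop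
  have m1 : ∫ ϑ in (-r)..r, ‖An c N (-cis ϑ²)‖² ≤ ∫ ϑ in (-xh π)..π/2, ‖An c N (-cis ϑ²)‖² := by
    refine intervalIntegral.integral_mono_interval ql ql ql (qg fun _ => qp) (ct.intervalIntegrable _ _)
  refine wh ?_ m1
  have dt : ∫ ϑ in (-r)..r, S²*exp (-((1+ε)²*Ad β B*ϑ²)) ≤ ∫ ϑ in (-r)..r, ‖An c N (-cis ϑ²)‖² := by
    refine ug ql (by apply Continuous.intervalIntegrable; fun_prop) (ct.intervalIntegrable _ _) fun ϑ hϑ => ?_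
    rw [e]
    have bh : ϑ² ≤ ε/2 := by rw [← fc]; exact sq_le_sq' hϑ.1 hϑ.2
    have cl : sin ϑ² ≤ ϑ² := sq_le_sq.2 abs_sin_le_abs
    refine qq ?_ (zd S)
    have f : ∀ j ∈ rg n, exp (-(4*ϑ²*(1+ε)*Am (y j))) ≤ 1-4*sin ϑ²*Am (y j) := fun j _ => by
      obtain ⟨cy, bg⟩ := Bl (y j)
      set x := 4*ϑ²*Am (y j) with hx
      have lf : 0 ≤ x := qp
      have gv : x ≤ ε/2 := by nlinarith [zd ϑ]
      have es : 4*sin ϑ²*Am (y j) ≤ x := by rw [hx]; gcongr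
      have aa : 1+x*(1+ε) ≤ exp (x*(1+ε)) := by linarith [add_one_le_exp (x*(1+ε))]
      have ad : 1 ≤ (1-x)*(1+x*(1+ε)) := by nlinarith [zo lf hε.le]
      rw [show -(4*ϑ²*(1+ε)*Am (y j)) = -(x*(1+ε)) by rw [hx]; ring, exp_neg, inv_le_iff_one_le_mul₀ (xz _)]
      have ag := xf (by linarith : 1-x ≤ 1-4*sin ϑ²*Am (y j)) aa qp ql
      linarith
    refine wh ?_ (Finset.prod_le_prod (fun j _ => (xz _).le) f)
    rw [← exp_sum, wp, Finset.sum_neg_distrib, ← vg, neg_le_neg_iff]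
    have := qq H.c (by positivity : 0 ≤ 4*ϑ²*(1+ε))
    linarith
  refine wh ?_ dt
  rw [zj, uf]
  refine qq (wh (vi ?_) hg) (zd S)
  rw [show π/((1+ε)²*Ad β B) = π/Ad β B/(1+ε)² by field_simp, sqrt_div (by positivity : 0 ≤ π/Ad β B), sqrt_sq qp]; ring
theorem Jq (hδ : 0 < δ) (K : ℕ) : exp (-Ap δ K 1)² = δ/(1+δ)^(2*K+1)/4 := by
  have n : ∀ x : ℝ, 0 < x → ‖1+(1:ℂ)/(x:ℂ)‖ = 1+1/x := fun x hx => by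
    rw [show 1+(1:ℂ)/(x:ℂ) = xc (1+1/x) by push_cast; ring, qu, qd qp]
  have e : exp (-Ap δ K 1)² = (1+1/δ)⁻¹*(2²)⁻¹*((1+δ)^(2*K))⁻¹ := by
    rw [Ap, n δ hδ, n 1 one_pos, n δ⁻¹ (inv_pos.2 hδ), one_div_one, one_add_one_eq_two, one_div δ⁻¹, inv_inv, ← uz,
      show ((2:ℕ):ℝ)*(-(xx*log (1+1/δ)+log 2+K*log (1+δ))) = -log (1+1/δ) + -log (2²) + -log ((1+δ)^(2*K)) by rw [log_pow, log_pow]; push_cast; ring,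
      zn, zn, exp_neg, exp_neg, exp_neg, xn qp, xn qp, xn qp]
  rw [e, pow_succ]; field_simp; ring
theorem Jr (n N : ℕ) (h : n ≤ N) (y : ℕ → ℝ) : ∃ c : ℕ → ℝ, (∀ x, As c N x = ∏ j ∈ rg n, (1-x/(y j)²)) ∧ (∀ z, An c N z = ∏ j ∈ rg n, (1-z/(y j:ℂ)²)) := by
  set p : ℝ[X] := ∏ j ∈ rg n, (1-C (1/(y j)²)*X) with hp
  have d : p.natDegree < N+1 := by
    have aa := natDegree_prod_le (rg n) (fun j => (1-C (1/(y j)²)*X : ℝ[X]))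
    have ad : ∑ j ∈ rg n, (1-C (1/(y j)²)*X : ℝ[X]).natDegree ≤ ∑ j ∈ rg n, 1 := Finset.sum_le_sum fun j _ => by compute_degree
    simp only [Finset.sum_const, Finset.card_range, qo, zb] at ad
    exact Nat.lt_succ_of_le ((aa.trans ad).trans h)
  refine ⟨p.coeff, fun x => ?_, fun z => ?_⟩
  · rw [As, ← eval_eq_sum_range' d, hp, eval_prod]
    refine Finset.prod_congr rfl fun j _ => ?_
    simp; ring
  · have := aeval_eq_sum_range' d z
    simp only [Algebra.smul_def, Complex.coe_algebraMap] at this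
    rw [An, ← this, hp, map_prod]
    refine Finset.prod_congr rfl fun j _ => ?_
    simp; ring
theorem Js (hβ : xx < β) (ah : 0 < ρ) (aa : ρ < 1) : ∀ᶠ N : ℕ in atTop, ∃ c : ℕ → ℝ, 0 < ∑ k ∈ rg (N+1), c k² ∧
    ρ*(exp (2*(Af β*Az xk β (Ak β N)))/(4*√(π*Ad β (Ak β N))))*(∫ x in Ioi 0, As c N x²*exp (-(x^β))) ≤ 2*π*∑ k ∈ rg (N+1), c k² := by
  obtain ⟨D, κ, hD⟩ := Jk hβ
  have ct : Tendsto (fun ε : ℝ => (1-ε)^3-ρ*(1+ε)^3*(1+ε)^(2*κ+2)) (𝓝[>] 0) (𝓝 (1-ρ)) := by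
    have : Continuous (fun ε : ℝ => (1-ε)^3-ρ*(1+ε)^3*(1+ε)^(2*κ+2)) := qf
    have := this.tendsto 0
    simp only [ze, vu, one_pow, zb] at this
    exact this.mono_left xu
  obtain ⟨ε, hc, hε, fw⟩ := ((ct.eventually (lt_mem_nhds (sub_pos.2 aa))).and (Ioo_mem_nhdsGT (one_pos : oo<1))).exists
  have Bt : Tendsto (fun N : ℕ => Ak β (N+1)) atTop atTop := (ww 1).2 (Ck hβ)
  have ai : ∀ N : ℕ, 0 < Ak β (N+1) := fun N => Bv hβ N.succ_pos
  rw [← map_add_atTop_eq_nat 1, eventually_map]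
  filter_upwards [Bt.eventually (hD ε hε κ ε hε), Jn (D := D) (κ := κ) hβ hε hε Bt ai, Bt.eventually (Jp (δ := ε) (K := κ) (D := D) (κ := κ) hβ hε fw)] with N ⟨n, y, H⟩ hn hci
  have br := Av hβ (ai N)
  have nN : n ≤ N+1 := by
    have := H.d
    rw [Cx hβ N.succ_pos, mul_div_cancel_left₀ _ qp] at this
    exact_mod_cast this
  obtain ⟨c, az, ay⟩ := Jr n (N+1) nN y
  have I := hn n y H
  have J := hci n y H c (N+1) ay
  have Hb := H.b
  set L := Ad β (Ak β (N+1))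
  set S := ∏ j ∈ rg n, (1+1/(y j)²)
  set E := exp (Af β*Az xk β (Ak β (N+1))) with hE
  have ch : 0 < E := xz _
  have q : √(π/L) = π/√(π*L) := by
    rw [eq_div_iff qp, ← sqrt_mul qp, show π/L*(π*L) = π² by field_simp, sqrt_sq zx]
  have eg : 0 < √(π/L) := qp
  have lh : ((1-ε)/2)²*E²*(ε/(1+ε)^(2*κ+1)/4) ≤ S² := by
    rw [← Jq hε κ, ← xj, ← xj, wx, hE, ← zn, ← sub_eq_add_neg]
    exact pow_le_pow_left₀ (zo ql (xz _).le) Hb 2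
  have it : (1-ε)/(1+ε)*√(π/L)*(((1-ε)/2)²*E²*(ε/(1+ε)^(2*κ+1)/4)) ≤ π*∑ k ∈ rg (N+1+1), c k² :=
    wh (qq lh (zo (ux ql ql) eg.le)) J
  have aj : 0 < 1-ε := ql
  refine ⟨c, ?_, ?_⟩
  · exact pos_of_mul_pos_right (zl qp it) zx
  · simp_rw [az]
    rw [show exp (2*(Af β*Az xk β (Ak β (N+1)))) = E² by rw [hE, ← uz]; norm_num]
    refine (qq I qp).trans ?_
    rw [show ρ*(E²/(4*√(π*L)))*((1+ε)^3*(ε*π/2)) = ρ*(1+ε)^3*(E²*ε/8*√(π/L)) by rw [q]; field_simp; ring]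
    rw [wx 2]
    refine wh ?_ (qq it two_pos.le)
    rw [show 2*((1-ε)/(1+ε)*√(π/L)*(((1-ε)/2)²*E²*(ε/(1+ε)^(2*κ+1)/4))) = (1-ε)^3/(1+ε)^(2*κ+2)*(E²*ε/8*√(π/L)) by field_simp; ring]
    refine qb ?_ qp
    rw [zt qp]; linarith
theorem Jt {n : ℕ} {A : Matrix (Fin n) (Fin n) ℝ} (hA : A.IsHermitian) (hl : ∀ x, Module.End.HasEigenvalue (Matrix.toLin' A) x → l ≤ x) (v : Fin n → ℝ) :
    l*∑ i, v i² ≤ v ⬝ᵥ (A.mulVec v) := by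
  have hB : (A-l•(1 : Matrix (Fin n) (Fin n) ℝ)).IsHermitian := hA.sub (by simp [Matrix.IsHermitian])
  have P : (A-l•(1 : Matrix (Fin n) (Fin n) ℝ)).PosSemidef := by
    rw [hB.posSemidef_iff_eigenvalues_nonneg]
    intro i
    have h := hB.mulVec_eigenvectorBasis i
    have ah := hB.eigenvectorBasis.orthonormal.ne_zero i
    rw [Matrix.sub_mulVec, Matrix.smul_mulVec, Matrix.one_mulVec, sub_eq_iff_eq_add, ← add_smul] at h
    have := hl (hB.eigenvalues i+l) (Module.End.hasEigenvalue_of_hasEigenvector (x := (hB.eigenvectorBasis i).ofLp) ⟨by rw [Module.End.mem_eigenspace_iff, Matrix.toLin'_apply, h], fun e => ah (by ext j; simpa using congrFun e j)⟩)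
    simpa using this
  have := P.dotProduct_mulVec_nonneg v
  rw [Matrix.sub_mulVec, Matrix.smul_mulVec, Matrix.one_mulVec, dotProduct_sub, dotProduct_smul, sub_nonneg] at this
  refine wh (vi ?_) this
  simp [dotProduct, sq]
theorem Fs (hβ : xx < β) {μ : ℕ → ℝ} (hμ : ∀ k, μ k = ∫ x in Ioi oo, x ^ k * exp (-(x ^ β))) (c : ℕ → ℝ) (N : ℕ)
    {H : Matrix (Fin (N + 1)) (Fin (N + 1)) ℝ} (hH : ∀ j k : Fin (N + 1), H j k = μ ((j : ℕ) + (k : ℕ))) :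
    ∫ x in Ioi 0, As c N x²*exp (-(x^β)) = (fun i : Fin (N+1) => c i) ⬝ᵥ (H.mulVec fun i : Fin (N+1) => c i) := by
  have e : ∀ x, As c N x² * exp (-(x^β)) = ∑ j : Fin (N+1), ∑ k : Fin (N+1), c j*c k*(x^((j:ℕ)+(k:ℕ))*exp (-(x^β))) := fun x => by
    rw [As, sq, Finset.sum_range, Finset.sum_mul_sum, Finset.sum_mul]
    refine zy rfl fun j _ => ?_
    rw [Finset.sum_mul]
    refine zy rfl fun k _ => by ring
  have i : ∀ j k : Fin (N+1), IntegrableOn (fun x : ℝ => c j*c k*(x^((j:ℕ)+(k:ℕ))*exp (-(x^β)))) (Ioi 0) := fun j k => by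
    refine Integrable.const_mul ?_ _
    have := integrableOn_rpow_mul_exp_neg_rpow (p := β) (s := ((j+k:ℕ):ℝ)) (by have : oo ≤ ((j+k:ℕ):ℝ) := qp; linarith) ql
    refine this.congr_fun (fun x _ => by simp only [vd]) qh
  simp_rw [e]
  rw [integral_finsetSum _ fun j _ => integrable_finsetSum _ fun k _ => i j k]
  refine zy rfl fun j _ => ?_
  rw [integral_finsetSum _ fun k _ => i j k, Matrix.mulVec, dotProduct, vg]
  refine zy rfl fun k _ => ?_
  rw [qv, ← hμ, hH]; ring
theorem Ju (β : ℝ) (hβ : xx < β)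
    (μ : ℕ → ℝ) (hμ : ∀ k, μ k = ∫ x in Ioi oo, x ^ k * exp (-(x ^ β)))
    (H : (N : ℕ) → Matrix (Fin (N + 1)) (Fin (N + 1)) ℝ)
    (hH : ∀ N, ∀ j k : Fin (N + 1), H N j k = μ ((j : ℕ) + (k : ℕ)))
    (hpd : ∀ N, (H N).PosDef)
    (lam : ℕ → ℝ)
    (hlam : ∀ N, IsLeast {x : ℝ | Module.End.HasEigenvalue (Matrix.toLin' (H N)) x} (lam N)) :
    Tt (fun N : ℕ => (2*π/lam N)/(exp (2*(Af β*Az xk β (Ak β N)))/(4*√(π*Ad β (Ak β N))))) 1 := by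
  have ev : ∀ N, ∃ c : ℕ → ℝ, ∑ k ∈ rg (N+1), c k² = 1 ∧ ∫ x in Ioi 0, As c N x²*exp (-(x^β)) = lam N := fun N => by
    obtain ⟨v, hv⟩ := Module.End.HasEigenvalue.exists_hasEigenvector (hlam N).1
    have he := hv.apply_eq_smul
    rw [Matrix.toLin'_apply] at he
    set s := ∑ i, v i² with hs
    have ao : 0 < s := by
      obtain ⟨i, hi⟩ := Function.ne_iff.1 hv.2
      exact Finset.sum_pos' (fun _ _ => zd _) ⟨i, Finset.mem_univ _, by have : v i ≠ 0 := hi; positivity⟩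
    set c : ℕ → ℝ := fun k => if h : k < N+1 then v ⟨k,h⟩/√s else 0 with hc
    have ci : ∀ i : Fin (N+1), c i = v i/√s := fun i => dif_pos i.isLt
    have cv : (fun i : Fin (N+1) => c i) = (√s)⁻¹ • v := by ext i; simp [ci, div_eq_inv_mul]
    refine ⟨c, ?_, ?_⟩
    · rw [Finset.sum_range]
      have : ∀ i : Fin (N+1), c i² = v i²/s := fun i => by simp [ci, div_pow, sq_sqrt ao.le]
      simp_rw [this]
      rw [← Finset.sum_div, div_self ao.ne']
    · rw [Fs hβ hμ c N (hH N), cv, Matrix.mulVec_smul, he, smul_dotProduct, dotProduct_smul, dotProduct_smul]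
      have vs : v ⬝ᵥ v = s := by simp [dotProduct, hs, sq]
      have ss : √s*√s = s := mul_self_sqrt ao.le
      have := sqrt_pos.2 ao
      rw [vs]; simp only [qo]; nth_rewrite 3 [← ss]; field_simp
  choose c az ay using ev
  have fu : ∀ N, 0 < lam N := fun N => by
    obtain ⟨v, hv⟩ := Module.End.HasEigenvalue.exists_hasEigenvector (hlam N).1
    have he := hv.apply_eq_smul
    rw [Matrix.toLin'_apply] at he
    have := (hpd N).dotProduct_mulVec_pos hv.2
    rw [he, dotProduct_smul, qo] at this
    exact pos_of_mul_pos_left this (dotProduct_star_self_nonneg v)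
  have ck : ∀ N : ℕ, 0 < N → 0 < exp (2*(Af β*Az xk β (Ak β N)))/(4*√(π*Ad β (Ak β N))) := fun N hN => by
    have := Av hβ (Bv hβ hN)
    positivity
  set T := fun N : ℕ => exp (2*(Af β*Az xk β (Ak β N)))/(4*√(π*Ad β (Ak β N)))
  rw [tendsto_order]
  constructor
  · intro a ha
    set ρ := max ((a+1)/2) xx
    have au : 0 < ρ := lt_max_of_lt_right qn
    have di : ρ < 1 := max_lt ql qn
    have ra : a < ρ := lt_max_of_lt_left ql
    filter_upwards [Js hβ au di, qr 0] with N ⟨d, ec, hd⟩ hN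
    refine zl ra ?_
    have h := Jt (hpd N).isHermitian (fun x hx => (hlam N).2 hx) (fun i => d i)
    rw [← Fs hβ hμ d N (hH N), ← Finset.sum_range (fun k => d k²)] at h
    rw [zt (ck N hN), zt (fu N)]
    have := (qq h (mul_pos au (ck N hN)).le).trans hd
    rw [← wx] at this
    exact le_of_mul_le_mul_right this ec
  · intro a ha
    have ct : Tendsto (fun ε : ℝ => a*(2*π-ε)-2*π*(1+ε)) (𝓝[>] 0) (𝓝 (a*(2*π)-2*π)) := by
      have : Continuous (fun ε : ℝ => a*(2*π-ε)-2*π*(1+ε)) := qf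
      have := this.tendsto 0
      simp only [ze, vu, zb] at this
      exact this.mono_left xu
    obtain ⟨ε, hc, hε, fw⟩ := ((ct.eventually (lt_mem_nhds (by nlinarith [zp] : 0 < a*(2*π)-2*π))).and (Ioo_mem_nhdsGT (one_pos : oo<1))).exists
    filter_upwards [Ht hβ c az hε, qr 0] with N h hN
    rw [ay] at h
    rw [div_lt_iff₀ (ck N hN), div_lt_iff₀ (fu N)]
    have h' : 2*π-ε ≤ (1+ε)*T N*lam N := h
    have := qq h' (by linarith : 0 ≤ a)
    have ag : (1+ε)*(2*π) < (1+ε)*(a*T N*lam N) := ql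
    exact lt_of_mul_lt_mul_left ag ql
theorem smallest_eigenvalue_asymptotics_nonhalfinteger
    (β : ℝ) (hβ : 1/2 < β) (hβ' : ∀ n : ℕ, 1 ≤ n → β ≠ (n : ℝ) + 1/2)
    (μ : ℕ → ℝ) (hμ : ∀ k, μ k = ∫ x in Set.Ioi (0:ℝ), x ^ k * Real.exp (-(x ^ β)))
    (H : (N : ℕ) → Matrix (Fin (N + 1)) (Fin (N + 1)) ℝ)
    (hH : ∀ N, ∀ j k : Fin (N + 1), H N j k = μ ((j : ℕ) + (k : ℕ)))
    (hpd : ∀ N, (H N).PosDef)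
    (lam : ℕ → ℝ)
    (hlam : ∀ N, IsLeast
      {x : ℝ | Module.End.HasEigenvalue (Matrix.toLin' (H N)) x} (lam N)) :
    Tendsto (fun N : ℕ =>
      (2 * π / lam N) /
        ((1/4) * π ^ (-(1/4) : ℝ) * Ccoef β ^ ((1/4) : ℝ) *
          ACoef β 0 ^ (-(1/2) : ℝ) * Real.exp (1 / Real.cos (π * β)) *
          (N : ℝ) ^ (-(1/2) + 1 / (4 * β)) *
          Real.exp ((2 * (N : ℝ) ^ (1 - 1 / (2 * β)) / Real.sqrt (π * Ccoef β)) *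
            ∑ r ∈ Finset.range (Nat.floor (β - 1/2) + 1),
              (-1 : ℝ) ^ r * (ACoef β r / Ccoef β ^ r) * (N : ℝ) ^ (-(r : ℝ) / β))))
      atTop (nhds 1) := by
  have hne : ∀ n : ℕ, β ≠ n+xx := fun n => by
    rcases Nat.eq_zero_or_pos n with rfl | hn
    · rw [Nat.cast_zero]; linarith
    · exact hβ' n hn
  have h := (Ju β hβ μ hμ H hH hpd lam hlam).mul (Gh hβ hne)
  rw [mul_one] at h
  refine h.congr' ?_
  filter_upwards [eventually_gt_atTop 0] with N hN
  have := Av hβ (Bv hβ hN)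
  exact div_mul_div_cancel₀ qp
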